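/- Theorem 1.2 (upper bound on the truncated two-point function): There exist constants c, C ∈ (0,∞) such that for all a ∈ ℝ and all x, y ∈ G: τ_a^tr(x,y) ≤ C τ_0^tr(x,y) · exp{−c|a|² d(x,y) / (log(|a|² d(x,y)) ∨ 1)} if ν = 1; τ_a^tr(x,y) ≤ C τ_0^tr(x,y) · exp{−c|a|^{2/ν} d(x,y)} if 1 < ν < α/2; and τ_a^tr(x,y) ≤ C τ_0^tr(x,y) · exp{−c|a|^{2/ν} d(x,y)/(log(|a|^{−1}) ∨ 1)} if ν = α/2. -/

import Mathlib

open MeasureTheory ProbabilityTheory Real Filter Topology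
open scoped ENNReal NNReal BigOperators Classical

noncomputable section

/-! ## Generic exponents and corrections -/

/-- The exponent `b₁`: equal to `1` if `ν = 1` and `0` otherwise. -/
def bOne (ν : ℝ) : ℝ := if ν = 1 then 1 else 0

/-- The exponent `b₂`: equal to `1` if `α = 2ν` and `0` otherwise. -/
def bTwo (ν α : ℝ) : ℝ := if α = 2 * ν then 1 else 0

/-- The polylogarithmic correction `q(r)` from Theorem 1.1. -/
def qArm (ν α r : ℝ) : ℝ :=
  if ν = 1 then Real.log (Real.log r)
  else if ν < α / 2 then Real.log r ^ ((ν - 1) / 2) * Real.log (Real.log r) ^ ν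
  else Real.log r ^ ν * Real.log (Real.log r) ^ ν

/-- `exp(-t)` for an extended nonnegative real `t`. -/
def expNegE (t : ℝ≥0∞) : ℝ≥0∞ := if t = ⊤ then 0 else ENNReal.ofReal (Real.exp (-t.toReal))

/-! ## Transient weighted graphs

A weighted graph `𝒢 = (G, λ)`, connected and locally finite, with controlled weights,
equipped with a metric `d`, a distinguished base point `o`, and exponents `α` (volume
growth) and `ν` (Green's function decay). -/

structure WGraph where
  (V : Type) (countableV : Countable V) (o : V)
  (lam : V → V → ℝ)
  (lam_nonneg : ∀ x y, 0 ≤ lam x y)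
  (lam_symm : ∀ x y, lam x y = lam y x)
  (locFin : ∀ x, (Function.support (lam x)).Finite)
  (connectedG : ∀ x y, Relation.ReflTransGen (fun u v => 0 < lam u v) x y)
  -- controlled weights: `λ_{x,y}/λ_x ≥ c₀` for all neighbours `x ∼ y`
  (ctrl : ∃ c₀ > (0:ℝ), ∀ x y, 0 < lam x y → c₀ * (∑ᶠ z, lam x z) ≤ lam x y)
  (d : V → V → ℝ)
  (d_symm : ∀ x y, d x y = d y x)
  (d_self : ∀ x, d x x = 0)
  (d_pos : ∀ x y, x ≠ y → 0 < d x y)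
  (d_triangle : ∀ x y z, d x z ≤ d x y + d y z)
  (α : ℝ) (ν : ℝ)

namespace WGraph

variable (M : WGraph)

/-- Total weight `λ_x = Σ_{y} λ_{x,y}` at a vertex. -/
def lamTot (x : M.V) : ℝ := ∑ᶠ y, M.lam x y

/-- The (closed) ball `B(x,r)` for the metric `d`. -/
def ball (x : M.V) (r : ℝ) : Set M.V := {y | M.d x y ≤ r}

/-- One-step transition probability of the random walk on `(G,λ)`. -/
def p (x y : M.V) : ℝ := M.lam x y / M.lamTot x

/-- `n`-step transition probability of the random walk. -/
def pstep : ℕ → M.V → M.V → ℝ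
  | 0, x, y => if x = y then 1 else 0
  | n + 1, x, y => ∑ᶠ z, M.p x z * pstep n z y

/-- The Green's function `g(x,y) = λ_y^{-1} Σ_{n ≥ 0} P_x[Z_n = y]` of the walk. -/
def green (x y : M.V) : ℝ := (∑' n, M.pstep n x y) / M.lamTot y

/-- Transience of the random walk on `𝒢`. -/
def Transient : Prop := ∀ x, Summable fun n => M.pstep n x x

/-- The volume growth condition `(V_α)`. -/
def VolGrowth : Prop :=
  ∃ c > (0:ℝ), ∃ C > (0:ℝ), ∀ (x : M.V) (r : ℝ), 1 ≤ r →
    c * r ^ M.α ≤ (∑ᶠ y ∈ M.ball x r, M.lamTot y) ∧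
      (∑ᶠ y ∈ M.ball x r, M.lamTot y) ≤ C * r ^ M.α

/-- The Green's function decay condition `(G_ν)`. -/
def GreenDecay : Prop :=
  ∃ c > (0:ℝ), ∃ C > (0:ℝ),
    (∀ x : M.V, c ≤ M.green x x ∧ M.green x x ≤ C) ∧
    ∀ x y : M.V, x ≠ y →
      c * M.d x y ^ (-M.ν) ≤ M.green x y ∧ M.green x y ≤ C * M.d x y ^ (-M.ν)

/-- The standing assumptions on the graph: transience, `(V_α)` and `(G_ν)`. -/
def Standing : Prop := M.Transient ∧ M.VolGrowth ∧ M.GreenDecay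

/-- The graph distance `d_gr` on `𝒢`. -/
def graphDist (x y : M.V) : ℝ :=
  sInf {r : ℝ | ∃ n : ℕ, r = n ∧ ∃ γ : Fin (n + 1) → M.V, γ 0 = x ∧ γ (Fin.last n) = y ∧
    ∀ i : Fin n, 0 < M.lam (γ i.castSucc) (γ i.succ)}

/-- Capacity of a finite set of vertices, via the variational characterization
`cap(K) = (inf_μ Σ_{x,y} μ(x) g(x,y) μ(y))⁻¹`, the infimum being over probability
measures supported on `K`. -/
def capFinset (K : Finset M.V) : ℝ :=
  (sInf {E : ℝ | ∃ μ : M.V → ℝ, (∀ x, 0 ≤ μ x) ∧ (∀ x, x ∉ K → μ x = 0) ∧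
    (∑ x ∈ K, μ x) = 1 ∧ E = ∑ x ∈ K, ∑ y ∈ K, μ x * M.green x y * μ y})⁻¹

/-- Capacity of an arbitrary set of vertices. -/
def cap (S : Set M.V) : ℝ := ⨆ K : {K : Finset M.V // ↑K ⊆ S}, M.capFinset K.1

/-- Weight `∏_{i<n} p(x_i, x_{i+1})` of a finite random walk trajectory. -/
def pathWt {n : ℕ} (γ : Fin (n + 1) → M.V) : ℝ := ∏ i : Fin n, M.p (γ i.castSucc) (γ i.succ)

/-- `P_z[H_x < H_O]`: the probability that the random walk started at `z` hits `x`
strictly before hitting the set `O`, expressed through a first-passage path decomposition. -/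
def hitBefore (z x : M.V) (O : Set M.V) : ℝ :=
  ∑' n : ℕ, ∑' γ : Fin (n + 1) → M.V,
    if γ 0 = z ∧ γ (Fin.last n) = x ∧ x ∉ O ∧
        (∀ i : Fin (n + 1), i ≠ Fin.last n → γ i ∉ O ∧ γ i ≠ x)
      then M.pathWt γ else 0

/-- Distance from a point to a set. -/
def dSet (x : M.V) (S : Set M.V) : ℝ := sInf (M.d x '' S)

/-! ### Discrete (rooted) loops

A rooted discrete loop visiting `m + 2` vertices (`m ≥ 0`), i.e. making at least two
jumps, encoded by its skeleton `Z_0, …, Z_{n-1}` (with `Z_n = Z_0`, indices mod `n`). -/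

/-- The type of rooted discrete loops on `G` making `n = m + 2 ≥ 2` jumps. -/
abbrev DLoop : Type := Σ m : ℕ, Fin (m + 2) → M.V

/-- The mass `(1/n) ∏_{0 ≤ i < n} λ_{x_i,x_{i+1}}/λ_{x_i}` that the loop measure `μ`
assigns to a given rooted discrete loop (its discrete skeleton intensity). -/
def dloopWt (γ : M.DLoop) : ℝ≥0∞ :=
  ENNReal.ofReal ((1 / ((γ.1 : ℝ) + 2)) * ∏ i : Fin (γ.1 + 2), M.p (γ.2 i) (γ.2 (i + 1)))

/-- The set of vertices visited by a discrete loop (`range(γ) ∩ G` for the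
corresponding continuous loop). -/
def dloopRange (γ : M.DLoop) : Set M.V := Set.range γ.2

/-- The loop measure `μ` evaluated on a set of (skeletons of) loops: since the events of
interest only depend on the vertices visited by a loop, the measure under `μ` of such an
event coincides with the total mass of the corresponding discrete skeletons. -/
def loopMeas (S : Set M.DLoop) : ℝ≥0∞ := ∑' γ : S, M.dloopWt γ

end WGraph

/-! ## Graphs equipped with an approximate renormalized lattice `Λ(L)` -/

structure LGraph extends WGraph where
  (Lat : ℝ → Set V)
  (Lat_base : ∀ L : ℝ, 1 ≤ L → o ∈ Lat L)
  (Lat_cover : ∀ L : ℝ, 1 ≤ L → ∀ x, ∃ y ∈ Lat L, d y x ≤ L)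
  (Lat_disj : ∀ L : ℝ, 1 ≤ L → ∀ y ∈ Lat L, ∀ z ∈ Lat L, y ≠ z →
    ∀ w, d y w ≤ L / 2 → ¬ d z w ≤ L / 2)
  (Lat_card : ∃ CΛ > (0:ℝ), ∀ L : ℝ, 1 ≤ L → ∀ (x : V) (N : ℕ), 1 ≤ N →
    {y | y ∈ Lat L ∧ d x y ≤ L * N}.Finite ∧
      ({y | y ∈ Lat L ∧ d x y ≤ L * N}.ncard : ℝ) ≤ CΛ * (N : ℝ) ^ α)

namespace LGraph

variable (M : LGraph)

/-- A path `π = (x_i)_{1 ≤ i ≤ M}` in `Λ(L)` from the base point `0` to `A ⊆ G`. -/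
def IsLatPath (L : ℝ) (A : Set M.V) {m : ℕ} (pa : Fin (m + 1) → M.V) : Prop :=
  pa 0 = M.o ∧ pa (Fin.last m) ∈ A ∧ (∀ i, pa i ∈ M.Lat L) ∧
    ∀ i : Fin m, ∃ x y, M.d (pa i.castSucc) x ≤ L ∧ M.d (pa i.succ) y ≤ L ∧ 0 < M.lam x y

/-- `𝒪 ⊆ G` is an `(L,R,n,κ)`-good obstacle: every path in `Λ(L)` from `0` to `B_R^c`
contains at least `n` points `y` (within `B_R`) with `cap(𝒪 ∩ B(y,L)) ≥ κ`. -/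
def GoodObstacle (O : Set M.V) (L R : ℝ) (n : ℝ) (κ : ℝ) : Prop :=
  ∀ (m : ℕ) (pa : Fin (m + 1) → M.V), M.IsLatPath L {y | R < M.d M.o y} pa →
    ∃ A : Finset M.V, (∀ y ∈ A, (∃ i, pa i = y) ∧ M.d M.o y ≤ R) ∧ n ≤ (A.card : ℝ) ∧
      ∀ y ∈ A, κ ≤ M.toWGraph.cap (O ∩ {z | M.d y z ≤ L})

/-- The layer `𝒜_k ⊆ Λ(L)` of lattice points whose `L`-ball meets the interior
boundary `∂B(0, C₁ k L)`. -/
def layer (C₁ L : ℝ) (k : ℕ) : Set M.V :=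
  {x | x ∈ M.Lat L ∧ ∃ y, M.d x y ≤ L ∧ M.d M.o y ≤ C₁ * k * L ∧
    ∃ z, 0 < M.lam y z ∧ C₁ * k * L < M.d M.o z}

/-- The annulus `𝔸_k = ∪_{x ∈ 𝒜_k} B(x,L)`. -/
def annulus (C₁ L : ℝ) (k : ℕ) : Set M.V := {v | ∃ x ∈ M.layer C₁ L k, M.d x v ≤ L}

end LGraph

/-! ## The Gaussian free field and its associated bond percolation `E^{≥a}` -/

/-- A transient weighted graph together with a Gaussian free field `φ` (law `ℙ`) and,
conditionally on `φ`, independent bond percolation configurations: each edge `{x,y}` is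
retained in `E^{≥a}` (i.e. `opn a`) independently with probability
`1 - exp(-2 λ_{x,y} (φ_x - a)_+ (φ_y - a)_+)`. -/
structure Model extends WGraph where
  (Ω : Type) [mΩ : MeasurableSpace Ω] (P : Measure Ω) (Pprob : IsProbabilityMeasure P)
  (φ : Ω → V → ℝ)
  (φ_meas : ∀ x, Measurable fun ω => φ ω x)
  -- `φ` is the centered Gaussian field with covariance the Green's function `g`
  (φ_gauss : ∀ (s : Finset V) (c : V → ℝ),
    Measure.map (fun ω => ∑ x ∈ s, c x * φ ω x) P =
      gaussianReal 0 (Real.toNNReal (∑ x ∈ s, ∑ y ∈ s, c x * c y * toWGraph.green x y)))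
  (opn : ℝ → Ω → V → V → Prop)
  (opn_symm : ∀ a ω x y, opn a ω x y → opn a ω y x)
  (opn_edge : ∀ a ω x y, opn a ω x y → 0 < lam x y)
  (opn_meas : ∀ a x y, MeasurableSet {ω | opn a ω x y})
  -- conditionally on `φ`, edges are open independently with the prescribed probabilities
  (opn_law : ∀ (a : ℝ) (s t : Finset (V × V)), Disjoint s t →
    (∀ e ∈ s ∪ t, ∀ f ∈ s ∪ t, e ≠ f → e ≠ Prod.swap f) →
    ∀ B : Set (V → ℝ), MeasurableSet B →
      P ({ω | φ ω ∈ B} ∩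
          {ω | (∀ e ∈ s, opn a ω e.1 e.2) ∧ (∀ e ∈ t, ¬ opn a ω e.1 e.2)}) =
      ∫⁻ ω in {ω | φ ω ∈ B},
        ENNReal.ofReal
          ((∏ e ∈ s,
            (1 - Real.exp (-(2 * lam e.1 e.2 * max (φ ω e.1 - a) 0 * max (φ ω e.2 - a) 0)))) *
           ∏ e ∈ t,
            Real.exp (-(2 * lam e.1 e.2 * max (φ ω e.1 - a) 0 * max (φ ω e.2 - a) 0))) ∂P)

attribute [instance] Model.mΩ

namespace Model

variable (M : Model)

/-- `x` and `y` are connected by a path of open edges of `E^{≥a}`. -/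
def conn (a : ℝ) (ω : M.Ω) (x y : M.V) : Prop :=
  Relation.ReflTransGen (fun u v => M.opn a ω u v) x y

/-- The open cluster `𝒦^a` of `x` in `E^{≥a}`. -/
def cluster (a : ℝ) (ω : M.Ω) (x : M.V) : Set M.V := {y | M.conn a ω x y}

/-- The probability of an event. -/
def prob (s : Set M.Ω) : ℝ := (M.P s).toReal

/-- The one-arm event `{x ↔ B(x,R)^c}` in `E^{≥0}`. -/
def armEvent (x : M.V) (R : ℝ) : Set M.Ω := {ω | ∃ y, R < M.d x y ∧ M.conn 0 ω x y}

/-- The truncated two-point function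
`τ_a^tr(x,y) = ℙ(x ↔ y in E^{≥a}, x ↮ ∞ in E^{≥a})`. -/
def tau (a : ℝ) (x y : M.V) : ℝ :=
  M.prob {ω | M.conn a ω x y ∧ (M.cluster a ω x).Finite}

/-- The truncated expected cluster volume `𝔼[|𝒦^a| 1_{|𝒦^a| < ∞}]`. -/
def clusterVol (a : ℝ) (x : M.V) : ℝ≥0∞ :=
  ∫⁻ ω, (if (M.cluster a ω x).Finite then ((M.cluster a ω x).ncard : ℝ≥0∞) else 0) ∂M.P

end Model

/-! ## The concrete case `G = ℤ³` with unit weights and the Euclidean distance -/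

/-- The vertex set `ℤ³`. -/
abbrev Z3 : Type := Fin 3 → ℤ

/-- Euclidean distance on `ℤ³`. -/
def dZ (x y : Z3) : ℝ := Real.sqrt (∑ i, ((x i : ℝ) - (y i : ℝ)) ^ 2)

/-- Unit weights: `λ_{x,y} = 1_{|x-y| = 1}`. -/
def lamZ (x y : Z3) : ℝ := if dZ x y = 1 then 1 else 0

/-- Transition probabilities of simple random walk on `ℤ³`. -/
def pZ (x y : Z3) : ℝ := lamZ x y / 6

/-- `n`-step transition probabilities of simple random walk on `ℤ³`. -/
def pstepZ : ℕ → Z3 → Z3 → ℝ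
  | 0, x, y => if x = y then 1 else 0
  | n + 1, x, y => ∑ᶠ z, pZ x z * pstepZ n z y

/-- The Green's function of simple random walk on `ℤ³` (with the normalization
`g(x,y) = λ_y^{-1} Σ_n P_x[Z_n = y]`, `λ_y = 6`). -/
def greenZ (x y : Z3) : ℝ := (∑' n, pstepZ n x y) / 6

/-- Euclidean distance between a point of `ℝ³` and a point of `ℤ³`. -/
def dMix (u : Fin 3 → ℝ) (z : Z3) : ℝ := Real.sqrt (∑ i, (u i - (z i : ℝ)) ^ 2)

/-- The Gaussian free field on `ℤ³` together with the associated bond percolation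
configurations `E^{≥a}`. -/
structure PercZ3 where
  (Ω : Type) [mΩ : MeasurableSpace Ω] (P : Measure Ω) (Pprob : IsProbabilityMeasure P)
  (φ : Ω → Z3 → ℝ)
  (φ_meas : ∀ x, Measurable fun ω => φ ω x)
  (φ_gauss : ∀ (s : Finset Z3) (c : Z3 → ℝ),
    Measure.map (fun ω => ∑ x ∈ s, c x * φ ω x) P =
      gaussianReal 0 (Real.toNNReal (∑ x ∈ s, ∑ y ∈ s, c x * c y * greenZ x y)))
  (opn : ℝ → Ω → Z3 → Z3 → Prop)
  (opn_symm : ∀ a ω x y, opn a ω x y → opn a ω y x)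
  (opn_edge : ∀ a ω x y, opn a ω x y → 0 < lamZ x y)
  (opn_meas : ∀ a x y, MeasurableSet {ω | opn a ω x y})
  (opn_law : ∀ (a : ℝ) (s t : Finset (Z3 × Z3)), Disjoint s t →
    (∀ e ∈ s ∪ t, ∀ f ∈ s ∪ t, e ≠ f → e ≠ Prod.swap f) →
    ∀ B : Set (Z3 → ℝ), MeasurableSet B →
      P ({ω | φ ω ∈ B} ∩
          {ω | (∀ e ∈ s, opn a ω e.1 e.2) ∧ (∀ e ∈ t, ¬ opn a ω e.1 e.2)}) =
      ∫⁻ ω in {ω | φ ω ∈ B},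
        ENNReal.ofReal
          ((∏ e ∈ s,
            (1 - Real.exp (-(2 * lamZ e.1 e.2 * max (φ ω e.1 - a) 0 * max (φ ω e.2 - a) 0)))) *
           ∏ e ∈ t,
            Real.exp (-(2 * lamZ e.1 e.2 * max (φ ω e.1 - a) 0 * max (φ ω e.2 - a) 0))) ∂P)

attribute [instance] PercZ3.mΩ

namespace PercZ3

variable (M : PercZ3)

/-- Connectivity by open edges in `E^{≥a}`. -/
def conn (a : ℝ) (ω : M.Ω) (x y : Z3) : Prop :=
  Relation.ReflTransGen (fun u v => M.opn a ω u v) x y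

/-- The open cluster of `x` in `E^{≥a}`. -/
def cluster (a : ℝ) (ω : M.Ω) (x : Z3) : Set Z3 := {y | M.conn a ω x y}

/-- The truncated two-point function on `ℤ³`. -/
def tau (a : ℝ) (x y : Z3) : ℝ :=
  ((M.P {ω | M.conn a ω x y ∧ (M.cluster a ω x).Finite}).toReal)

end PercZ3

/-! ## The metric graph (cable system) `𝔾̃`, killed Green's functions and killed GFFs -/

/-- The cable system `𝔾̃` over a graph `𝒢` (with renormalized lattice), together with the
killed Green's functions `g_U` and the laws `ℙ_U` of the Gaussian free field on open sets
`U ⊆ 𝔾̃` (the field killed outside `U`). -/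
structure CableG extends LGraph where
  (Gt : Type) [topGt : TopologicalSpace Gt] [msGt : MeasurableSpace Gt]
  (ι : V → Gt) (ι_inj : Function.Injective ι)
  (gU : Set Gt → Gt → Gt → ℝ)
  (gU_symm : ∀ U x y, gU U x y = gU U y x)
  (gU_zero : ∀ U x y, x ∉ U → gU U x y = 0)
  -- the Green's function of the full cable system restricts to `g` on `G`
  (gU_univ : ∀ x y : V, gU Set.univ (ι x) (ι y) = toWGraph.green x y)
  (PU : Set Gt → Measure (Gt → ℝ))
  (PU_prob : ∀ U, IsProbabilityMeasure (PU U))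
  -- `ℙ_U` is the law of the centered Gaussian field with covariance `g_U`
  (PU_gauss : ∀ (U : Set Gt) (s : Finset Gt) (c : Gt → ℝ),
    Measure.map (fun h => ∑ q ∈ s, c q * h q) (PU U) =
      gaussianReal 0 (Real.toNNReal (∑ q ∈ s, ∑ q' ∈ s, c q * c q' * gU U q q')))

attribute [instance] CableG.topGt CableG.msGt

/-- A probability space. -/
structure ProbSpace where
  (Ω : Type) [mΩ : MeasurableSpace Ω] (P : Measure Ω) (Pprob : IsProbabilityMeasure P)

attribute [instance] ProbSpace.mΩ

/-- A cable system as above, together with the laws of the vacant sets `Ṽ^u` of random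
interlacements at level `u > 0` on `𝔾̃`, axiomatized through their characterizing
properties: `Ṽ^u` is open and `ℙ(F ⊆ Ṽ^u) = exp(-u cap(F))` for finite `F ⊆ G`. -/
structure CableRI extends CableG where
  [msSetGt : MeasurableSpace (Set Gt)]
  (RIVacant : ℝ → Measure (Set Gt))
  (RIVacant_prob : ∀ u : ℝ, 0 < u → IsProbabilityMeasure (RIVacant u))
  (RIVacant_open : ∀ u : ℝ, 0 < u → ∀ᵐ S ∂(RIVacant u), @IsOpen Gt topGt S)
  (RIVacant_cap : ∀ u : ℝ, 0 < u → ∀ F : Finset V,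
    (RIVacant u {S | ∀ x ∈ F, ι x ∈ S}).toReal =
      Real.exp (-(u * toWGraph.capFinset F)))

attribute [instance] CableRI.msSetGt

/-! ## The Markovian loop soup at intensity `1/2` on the cable system -/

/-- The Poisson loop soup `ℒ` of intensity `(1/2)μ` on the cable system `𝔾̃` of a graph
`𝒢` (with renormalized lattice), under the law `Q`.  Continuous loops are axiomatized
through their ranges in `𝔾̃` and their discrete skeletons; the intensity measure `μ` is
pinned down via its (concrete) discrete skeleton intensity, and the law of the soup via
its void probabilities `Q(ℒ ∩ S = ∅) = exp(-μ(S)/2)`. -/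
structure LoopSoup extends LGraph where
  -- the cable system
  (Gt : Type) [topGt : TopologicalSpace Gt]
  (ι : V → Gt) (ι_inj : Function.Injective ι)
  (cable : V → V → Set Gt)
  (cable_symm : ∀ x y, cable x y = cable y x)
  (cable_ends : ∀ x y, 0 < lam x y → ι x ∈ cable x y ∧ ι y ∈ cable x y)
  (cable_vertices : ∀ x y, 0 < lam x y → ∀ v : V, ι v ∈ cable x y → v = x ∨ v = y)
  (cable_cover : ∀ q : Gt, (∃ v, q = ι v) ∨ ∃ x y, 0 < lam x y ∧ q ∈ cable x y)
  -- continuous loops on the cable system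
  (CLoop : Type) [msLoop : MeasurableSpace CLoop]
  (crange : CLoop → Set Gt)
  (traceG : CLoop → Set V)
  (trace_spec : ∀ γ, traceG γ = {v | ι v ∈ crange γ})
  -- the loop measure `μ` and its discrete skeleton
  (μC : Measure CLoop)
  (skel : CLoop → Option (Σ m : ℕ, Fin (m + 2) → V))
  (skel_spec : ∀ γ dγ, skel γ = some dγ → traceG γ = Set.range dγ.2)
  (skel_trivial : ∀ γ, skel γ = none → (traceG γ).Subsingleton)
  (μC_skel : ∀ S : Set (Σ m : ℕ, Fin (m + 2) → V),
    μC {γ | ∃ dγ ∈ S, skel γ = some dγ} = toWGraph.loopMeas S)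
  -- the loop soup and its law
  (Ωq : Type) [mΩq : MeasurableSpace Ωq] (Q : Measure Ωq) (Qprob : IsProbabilityMeasure Q)
  (soup : Ωq → Set CLoop)
  (soup_void : ∀ S : Set CLoop, MeasurableSet S →
    Q {ω | ∀ γ ∈ soup ω, γ ∉ S} = expNegE (μC S / 2))

attribute [instance] LoopSoup.topGt LoopSoup.msLoop LoopSoup.mΩq

namespace LoopSoup

variable (M : LoopSoup)

/-- Two loops of the soup are linked if they can be joined by a finite chain of loops of
the soup whose ranges successively intersect. -/
def linked (ω : M.Ωq) (γ γ' : M.CLoop) : Prop :=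
  Relation.ReflTransGen
    (fun g g' => g ∈ M.soup ω ∧ g' ∈ M.soup ω ∧ (M.crange g ∩ M.crange g').Nonempty) γ γ'

/-- The trace `𝒞` on `𝔾̃` of the cluster of loops of `ℒ` containing the base point `0`. -/
def C0 (ω : M.Ωq) : Set M.Gt :=
  {q | ∃ γ ∈ M.soup ω, q ∈ M.crange γ ∧
    ∃ γ₀ ∈ M.soup ω, M.ι M.o ∈ M.crange γ₀ ∧ M.linked ω γ γ₀}

/-- A loop is big (for the parameters `δ, L`) if `cap(range(γ) ∩ G) ≥ δ L^ν (log L)^{-b₂}`. -/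
def isBig (δ L : ℝ) (γ : M.CLoop) : Prop :=
  δ * L ^ M.ν * Real.log L ^ (-(bTwo M.ν M.α)) ≤ M.toWGraph.cap (M.traceG γ)

/-- The box `B̃(x,L) ⊆ 𝔾̃`: the ball `B(x,L)` together with all cables joining
neighbouring vertices of `B(x,L)`. -/
def Btilde (x : M.V) (L : ℝ) : Set M.Gt :=
  (M.ι '' {y | M.d x y ≤ L}) ∪
    ⋃ (u : M.V) (v : M.V) (_ : 0 < M.lam u v ∧ M.d x u ≤ L ∧ M.d x v ≤ L), M.cable u v

/-- A loop belongs to (the support of) `ℒ_k^b`: it is big and its range is contained in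
`B̃(x,L)` for some `x ∈ 𝒜_k`. -/
def inLayerBig (C₁ δ L : ℝ) (k : ℕ) (γ : M.CLoop) : Prop :=
  M.isBig δ L γ ∧ ∃ x ∈ M.toLGraph.layer C₁ L k, M.crange γ ⊆ M.Btilde x L

/-- The event `𝐁_k`: the cluster `𝒞` of `0` reaches `B_R^c` but contains no big loop of
`ℒ_k^b`. -/
def Bk (C₁ δ L R : ℝ) (k : ℕ) : Set M.Ωq :=
  {ω | (∃ y : M.V, R < M.d M.o y ∧ M.ι y ∈ M.C0 ω) ∧
    ∀ γ ∈ M.soup ω, M.inLayerBig C₁ δ L k γ → ¬ M.crange γ ⊆ M.C0 ω}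

/-- The number `N` of bad annuli among `k ∈ {1, …, ℓ}`. -/
def Nbad (C₁ δ L R : ℝ) (ℓ : ℕ) (ω : M.Ωq) : ℕ :=
  ((Finset.Icc 1 ℓ).filter fun k => ω ∈ M.Bk C₁ δ L R k).card

/-- The obstacle set `𝒪 = G ∩ 𝐼̃_D^b`: all vertices visited by a big loop of the soup
contained in a box `B̃(x,L)` with `x ∈ 𝒜_k` for some `k ∈ D`. -/
def obstacleD (C₁ δ L : ℝ) (D : Finset ℕ) (ω : M.Ωq) : Set M.V :=
  {v | ∃ γ ∈ M.soup ω, (∃ k ∈ D, M.inLayerBig C₁ δ L k γ) ∧ M.ι v ∈ M.crange γ}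

end LoopSoup

set_option linter.unusedSectionVars false

/-! ## Bernoulli percolation on a finite edge set -/

namespace Perc

section Bern

variable {β : Type*} [DecidableEq β]

/-- The weight of the configuration `S ⊆ E` under independent edges with parameters `p`. -/
def bern (E : Finset β) (p : β → ℝ) (S : Finset β) : ℝ :=
  (∏ e ∈ S, p e) * ∏ e ∈ E \ S, (1 - p e)

lemma bern_nonneg {E : Finset β} {p : β → ℝ} (hp : ∀ e ∈ E, 0 ≤ p e ∧ p e ≤ 1) {S : Finset β}
    (hS : S ⊆ E) : 0 ≤ bern E p S :=
  mul_nonneg (Finset.prod_nonneg fun e he => (hp e (hS he)).1)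
    (Finset.prod_nonneg fun e he => by
      have := (hp e (Finset.mem_sdiff.1 he).1).2; linarith)

lemma bern_congr {E : Finset β} {p q : β → ℝ} (h : ∀ e ∈ E, p e = q e) {S : Finset β}
    (hS : S ⊆ E) : bern E p S = bern E q S := by
  unfold bern
  congr 1
  · exact Finset.prod_congr rfl fun e he => h e (hS he)
  · exact Finset.prod_congr rfl fun e he => by rw [h e (Finset.mem_sdiff.1 he).1]

lemma bern_insert {E : Finset β} {e : β} (he : e ∉ E) (p : β → ℝ) {S : Finset β} (hS : S ⊆ E) :
    bern (insert e E) p S = (1 - p e) * bern E p S ∧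
      bern (insert e E) p (insert e S) = p e * bern E p S := by
  have heS : e ∉ S := fun h => he (hS h)
  constructor
  · unfold bern
    rw [Finset.insert_sdiff_of_notMem _ heS, Finset.prod_insert (by simp [he])]; ring
  · unfold bern
    rw [Finset.insert_sdiff_insert, Finset.sdiff_insert_of_notMem he, Finset.prod_insert heS]
    ring

lemma sum_bern_insert {E : Finset β} {e : β} (he : e ∉ E) (p : β → ℝ) (f : Finset β → ℝ) :
    ∑ S ∈ (insert e E).powerset, bern (insert e E) p S * f S =
      ∑ S ∈ E.powerset, bern E p S * ((1 - p e) * f S + p e * f (insert e S)) := by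
  rw [Finset.sum_powerset_insert he, ← Finset.sum_add_distrib]
  refine Finset.sum_congr rfl fun S hS => ?_
  obtain ⟨h1, h2⟩ := bern_insert he p (Finset.mem_powerset.1 hS)
  rw [h1, h2]; ring

lemma sum_bern (E : Finset β) (p : β → ℝ) : ∑ S ∈ E.powerset, bern E p S = 1 := by
  induction E using Finset.induction_on with
  | empty => simp [bern]
  | insert e E he ih =>
    have := sum_bern_insert he p (fun _ => 1)
    simp only [mul_one, sub_add_cancel] at this
    rw [this, ih]

lemma sum_bern_antitone {E : Finset β} {p q : β → ℝ}
    (h : ∀ e ∈ E, 0 ≤ p e ∧ p e ≤ q e ∧ q e ≤ 1) {f : Finset β → ℝ} (hf : Antitone f) :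
    ∑ S ∈ E.powerset, bern E q S * f S ≤ ∑ S ∈ E.powerset, bern E p S * f S := by
  induction E using Finset.induction_on generalizing f with
  | empty => simp [bern]
  | insert e E he ih =>
    rw [sum_bern_insert he, sum_bern_insert he]
    have h' : ∀ e ∈ E, 0 ≤ p e ∧ p e ≤ q e ∧ q e ≤ 1 :=
      fun x hx => h x (Finset.mem_insert_of_mem hx)
    obtain ⟨h0, h1, h2⟩ := h e (Finset.mem_insert_self _ _)
    refine le_trans (Finset.sum_le_sum fun S hS => ?_)
      (ih h' (f := fun S => (1 - p e) * f S + p e * f (insert e S)) ?_)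
    · refine mul_le_mul_of_nonneg_left ?_ (bern_nonneg (fun x hx => ?_) (Finset.mem_powerset.1 hS))
      · have := hf (Finset.subset_insert e S)
        nlinarith
      · have := h' x hx; constructor <;> linarith
    · intro S T hST
      have a1 := hf hST
      have a2 := hf (Finset.insert_subset_insert e hST)
      simp only
      have : 0 ≤ 1 - p e := by linarith
      gcongr

lemma sum_bern_union {E D : Finset β} (hED : Disjoint E D) (p : β → ℝ) (f : Finset β → ℝ) :
    ∑ S ∈ (E ∪ D).powerset, bern (E ∪ D) p S * f S =
      ∑ S ∈ E.powerset, bern E p S * ∑ T ∈ D.powerset, bern D p T * f (S ∪ T) := by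
  induction D using Finset.induction_on generalizing f with
  | empty => simp [bern]
  | insert e D he ih =>
    have hE : e ∉ E := fun h => (Finset.disjoint_left.1 hED h) (Finset.mem_insert_self _ _)
    have hd : Disjoint E D := hED.mono_right (Finset.subset_insert _ _)
    rw [Finset.union_insert, sum_bern_insert (by simp [he, hE]), ih hd]
    refine Finset.sum_congr rfl fun S _ => ?_
    rw [sum_bern_insert he]
    simp [Finset.union_insert]

end Bern

section Cluster

variable {ι : Type*} [Fintype ι]

/-- The vertices reachable from `y` through edges of `S`. -/
def cl (S : Finset (Sym2 ι)) (y : ι) : Finset ι :=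
  Finset.univ.filter fun z => Relation.ReflTransGen (fun u v => s(u, v) ∈ S) y z

lemma mem_cl {S : Finset (Sym2 ι)} {y z : ι} :
    z ∈ cl S y ↔ Relation.ReflTransGen (fun u v => s(u, v) ∈ S) y z := by simp [cl]

lemma self_mem_cl (S : Finset (Sym2 ι)) (y : ι) : y ∈ cl S y := mem_cl.2 .refl

lemma cl_mono (y : ι) : Monotone fun S : Finset (Sym2 ι) => cl S y := fun _ _ h _ hz =>
  mem_cl.2 (Relation.ReflTransGen.mono (fun _ _ h' => h h') _ _ (mem_cl.1 hz))

/-- The edges inside `K`. -/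
def inE (K : Finset ι) : Finset (Sym2 ι) :=
  Finset.univ.filter fun e => ¬ e.IsDiag ∧ ∀ u ∈ e, u ∈ K

/-- The edges between `K` and its complement. -/
def bdE (K : Finset ι) : Finset (Sym2 ι) :=
  Finset.univ.filter fun e => (∃ u ∈ e, u ∈ K) ∧ ∃ u ∈ e, u ∉ K

/-- The edges outside `K`. -/
def outE (K : Finset ι) : Finset (Sym2 ι) :=
  Finset.univ.filter fun e => ¬ e.IsDiag ∧ ∀ u ∈ e, u ∉ K

variable (ι) in
/-- All edges. -/
def allE : Finset (Sym2 ι) := Finset.univ.filter fun e => ¬ e.IsDiag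

lemma allE_eq (K : Finset ι) : allE ι = inE K ∪ (bdE K ∪ outE K) := by
  ext e
  induction e with | _ u v => ?_
  simp only [allE, inE, bdE, outE, Finset.mem_filter, Finset.mem_univ, true_and, Finset.mem_union,
    Sym2.mk_isDiag_iff, Sym2.mem_iff]
  by_cases hu : u ∈ K <;> by_cases hv : v ∈ K <;> simp [hu, hv] <;> rintro rfl <;> contradiction

lemma disj_in (K : Finset ι) : Disjoint (inE K) (bdE K ∪ outE K) := by
  rw [Finset.disjoint_left]
  intro e
  induction e with | _ u v => ?_
  simp only [inE, bdE, outE, Finset.mem_filter, Finset.mem_univ, true_and, Finset.mem_union,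
    Sym2.mk_isDiag_iff, Sym2.mem_iff]
  by_cases hu : u ∈ K <;> by_cases hv : v ∈ K <;> simp [hu, hv]

lemma disj_bd (K : Finset ι) : Disjoint (bdE K) (outE K) := by
  rw [Finset.disjoint_left]
  intro e
  induction e with | _ u v => ?_
  simp only [bdE, outE, Finset.mem_filter, Finset.mem_univ, true_and,
    Sym2.mk_isDiag_iff, Sym2.mem_iff]
  by_cases hu : u ∈ K <;> by_cases hv : v ∈ K <;> simp [hu, hv]

lemma cl_eq_iff {K : Finset ι} {S T U : Finset (Sym2 ι)} {y : ι}
    (hT : T ⊆ bdE K) (hU : U ⊆ outE K) :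
    cl (S ∪ (T ∪ U)) y = K ∧ S ⊆ inE K ↔ (cl S y = K ∧ S ⊆ inE K) ∧ T = ∅ := by
  constructor
  · rintro ⟨h, hS⟩
    have hTe : T = ∅ := by
      rw [Finset.eq_empty_iff_forall_notMem]
      intro e he
      have h1 := hT he
      have key : ∀ u v, s(u, v) ∈ T → u ∈ K → v ∈ K := by
        intro u v huv hu
        rw [← h] at hu ⊢
        exact mem_cl.2 ((mem_cl.1 hu).tail (by simp [huv]))
      induction e with | _ u v => ?_
      have k1 := key u v he
      have k2 := key v u (by rwa [Sym2.eq_swap])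
      simp only [bdE, Finset.mem_filter, Finset.mem_univ, true_and, Sym2.mem_iff] at h1
      by_cases hu : u ∈ K <;> by_cases hv : v ∈ K <;> simp_all
    refine ⟨⟨?_, hS⟩, hTe⟩
    subst hTe
    refine le_antisymm ?_ ?_
    · rw [← h]; exact cl_mono y Finset.subset_union_left
    · intro z hz
      rw [← h] at hz
      have hz' := mem_cl.1 hz
      rw [mem_cl]
      induction hz' with
      | refl => exact .refl
      | @tail b c hb hbc ih =>
        have hbm : b ∈ cl (S ∪ (∅ ∪ U)) y := mem_cl.2 hb
        refine (ih hbm).tail ?_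
        simp only [Finset.empty_union, Finset.mem_union] at hbc
        refine hbc.resolve_right fun h2 => ?_
        have := hU h2
        simp only [outE, Finset.mem_filter, Finset.mem_univ, true_and] at this
        rw [h] at hbm
        exact this.2 b (by simp) hbm
  · rintro ⟨⟨h, hS⟩, rfl⟩
    refine ⟨?_, hS⟩
    refine le_antisymm ?_ ?_
    · intro z hz
      have hz' := mem_cl.1 hz
      induction hz' with
      | refl => rw [← h]; exact self_mem_cl _ _
      | @tail b c hb hbc ih =>
        have hbK := ih (mem_cl.2 hb)
        simp only [Finset.empty_union, Finset.mem_union] at hbc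
        rcases hbc with h2 | h2
        · have := hS h2
          simp only [inE, Finset.mem_filter, Finset.mem_univ, true_and] at this
          exact this.2 c (by simp)
        · have := hU h2
          simp only [outE, Finset.mem_filter, Finset.mem_univ, true_and] at this
          exact absurd hbK (this.2 b (by simp))
    · nth_rewrite 1 [← h]; exact cl_mono y Finset.subset_union_left

/-- Probability that the cluster of `y` is `K`. -/
def wK (p : Sym2 ι → ℝ) (y : ι) (K : Finset ι) : ℝ :=
  ∑ S ∈ (allE ι).powerset, bern (allE ι) p S * if cl S y = K then 1 else 0

/-- Probability that `K` is connected (from `y`) by its inner edges. -/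
def innK (p : Sym2 ι → ℝ) (y : ι) (K : Finset ι) : ℝ :=
  ∑ S ∈ (inE K).powerset, bern (inE K) p S * if cl S y = K then 1 else 0

lemma sum_bern_empty {β : Type*} [DecidableEq β] (E : Finset β) (p : β → ℝ) :
    ∑ S ∈ E.powerset, bern E p S * (if S = ∅ then (1 : ℝ) else 0) = ∏ e ∈ E, (1 - p e) := by
  rw [Finset.sum_eq_single ∅]
  · simp [bern]
  · intro b _ hb; simp [hb]
  · simp

lemma wK_eq (p : Sym2 ι → ℝ) (y : ι) (K : Finset ι) :
    wK p y K = innK p y K * ∏ e ∈ bdE K, (1 - p e) := by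
  unfold wK innK
  rw [allE_eq K, sum_bern_union (disj_in K), Finset.sum_mul]
  refine Finset.sum_congr rfl fun S hS => ?_
  rw [mul_assoc]
  congr 1
  rw [sum_bern_union (disj_bd K), ← sum_bern_empty, Finset.mul_sum]
  refine Finset.sum_congr rfl fun T hT => ?_
  have : ∀ U ∈ (outE K).powerset, bern (outE K) p U * (if cl (S ∪ (T ∪ U)) y = K then (1:ℝ) else 0)
      = bern (outE K) p U * ((if cl S y = K then 1 else 0) * if T = ∅ then 1 else 0) := by
    intro U hU
    have h := cl_eq_iff (S := S) (y := y) (Finset.mem_powerset.1 hT) (Finset.mem_powerset.1 hU)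
    have hS' := Finset.mem_powerset.1 hS
    simp only [hS', and_true] at h
    rw [if_congr h rfl rfl]
    by_cases h1 : cl S y = K <;> by_cases h2 : T = ∅ <;> simp [h1, h2]
  rw [Finset.sum_congr rfl this, ← Finset.sum_mul, sum_bern]
  ring

lemma wK_nonneg {p : Sym2 ι → ℝ} (hp : ∀ e, 0 ≤ p e ∧ p e ≤ 1) (y : ι) (K : Finset ι) :
    0 ≤ wK p y K :=
  Finset.sum_nonneg fun S hS => mul_nonneg
    (bern_nonneg (fun e _ => hp e) (Finset.mem_powerset.1 hS)) (by split_ifs <;> norm_num)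

lemma innK_nonneg {p : Sym2 ι → ℝ} (hp : ∀ e, 0 ≤ p e ∧ p e ≤ 1) (y : ι) (K : Finset ι) :
    0 ≤ innK p y K :=
  Finset.sum_nonneg fun S hS => mul_nonneg
    (bern_nonneg (fun e _ => hp e) (Finset.mem_powerset.1 hS)) (by split_ifs <;> norm_num)

lemma innK_congr {p q : Sym2 ι → ℝ} (y : ι) (K : Finset ι) (h : ∀ e ∈ inE K, p e = q e) :
    innK p y K = innK q y K :=
  Finset.sum_congr rfl fun S hS => by rw [bern_congr h (Finset.mem_powerset.1 hS)]

lemma sum_mul_wK (p : Sym2 ι → ℝ) (y : ι) (F : Finset ι → ℝ) :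
    ∑ K, F K * wK p y K = ∑ S ∈ (allE ι).powerset, bern (allE ι) p S * F (cl S y) := by
  simp_rw [wK, Finset.mul_sum]
  rw [Finset.sum_comm]
  refine Finset.sum_congr rfl fun S _ => ?_
  rw [Finset.sum_eq_single (cl S y)]
  · simp [mul_comm]
  · intro b _ hb; simp [Ne.symm hb]
  · simp

lemma sum_wK (p : Sym2 ι → ℝ) (y : ι) : ∑ K, wK p y K = 1 := by
  have := sum_mul_wK p y (fun _ => 1)
  simpa [sum_bern] using this

lemma sum_mul_wK_antitone {p q : Sym2 ι → ℝ} (h : ∀ e, 0 ≤ p e ∧ p e ≤ q e ∧ q e ≤ 1) (y : ι)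
    {F : Finset ι → ℝ} (hF : Antitone F) : ∑ K, F K * wK q y K ≤ ∑ K, F K * wK p y K := by
  rw [sum_mul_wK, sum_mul_wK]
  exact sum_bern_antitone (fun e _ => h e) fun S T hST => hF (cl_mono y hST)

lemma wK_le_one {p : Sym2 ι → ℝ} (hp : ∀ e, 0 ≤ p e ∧ p e ≤ 1) (y : ι) (K : Finset ι) :
    wK p y K ≤ 1 := by
  rw [← sum_wK p y]
  exact Finset.single_le_sum (fun K _ => wK_nonneg hp y K) (Finset.mem_univ K)

lemma wK_of_notMem (p : Sym2 ι → ℝ) {y : ι} {K : Finset ι} (hy : y ∉ K) : wK p y K = 0 := by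
  refine Finset.sum_eq_zero fun S _ => ?_
  have : cl S y ≠ K := fun h => hy (h ▸ self_mem_cl S y)
  simp [this]

/-- A cluster which is not a singleton has no isolated vertex. -/
lemma innK_eq_zero {p : Sym2 ι → ℝ} {y u : ι} {K : Finset ι} (hu : u ∈ K) (hK : K ≠ {y})
    (hp : ∀ v, v ≠ u → p s(u, v) = 0) : innK p y K = 0 := by
  refine Finset.sum_eq_zero fun S hS => ?_
  by_cases h : cl S y = K
  swap; · simp [h]
  have hS' := Finset.mem_powerset.1 hS
  obtain ⟨v, hv⟩ : ∃ v, s(u, v) ∈ S := by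
    by_cases huy : u = y
    · subst huy
      obtain ⟨z, hz, hzy⟩ : ∃ z ∈ K, z ≠ u := by
        by_contra! hcon
        exact hK (Finset.eq_singleton_iff_unique_mem.2 ⟨hu, hcon⟩)
      rw [← h, mem_cl] at hz
      rcases Relation.ReflTransGen.cases_head hz with h1 | ⟨c, h1, _⟩
      · exact absurd h1.symm hzy
      · exact ⟨c, h1⟩
    · rw [← h, mem_cl] at hu
      rcases Relation.ReflTransGen.cases_tail hu with h1 | ⟨c, _, h1⟩
      · exact absurd h1 huy
      · exact ⟨c, by rwa [Sym2.eq_swap]⟩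
  have h1 := hS' hv
  simp only [inE, Finset.mem_filter, Finset.mem_univ, true_and, Sym2.mk_isDiag_iff] at h1
  have : bern (inE K) p S = 0 := by
    unfold bern
    rw [Finset.prod_eq_zero hv (hp v (Ne.symm h1.1)), zero_mul]
  simp [this]

end Cluster

end Perc

namespace Perc

/-! ### Gaussian densities -/

section Invariance

variable {E : Type*} [NormedAddCommGroup E] [NormedSpace ℝ E] [MeasurableSpace E] [BorelSpace E]
  [FiniteDimensional ℝ E]

lemma involutive_measurePreserving (μ : Measure E) [μ.IsAddHaarMeasure] (A : E →ₗ[ℝ] E)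
    (hA : ∀ x, A (A x) = x) : MeasurePreserving A μ μ := by
  have h1 : A * A = 1 := LinearMap.ext hA
  have h2 : LinearMap.det A * LinearMap.det A = 1 := by
    rw [← map_mul, h1, map_one]
  have h3 : LinearMap.det A ≠ 0 := by intro h; rw [h] at h2; norm_num at h2
  have h4 : |LinearMap.det A| = 1 := by
    rcases mul_self_eq_one_iff.1 h2 with h | h <;> simp [h]
  refine ⟨A.continuous_of_finiteDimensional.measurable, ?_⟩
  rw [Measure.map_linearMap_addHaar_eq_smul_addHaar μ h3, abs_inv, h4]
  simp

lemma measurePreserving_withDensity {X : Type*} [MeasurableSpace X] {μ : Measure X} {A : X → X}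
    (hA : MeasurePreserving A μ μ) {ρ : X → ℝ≥0∞} (hρ : Measurable ρ) (h : ∀ x, ρ (A x) = ρ x) :
    MeasurePreserving A (μ.withDensity ρ) (μ.withDensity ρ) := by
  refine ⟨hA.measurable, ?_⟩
  ext s hs
  rw [Measure.map_apply hA.measurable hs, withDensity_apply _ hs,
    withDensity_apply _ (hA.measurable hs), ← hA.setLIntegral_comp_preimage hs hρ]
  simp [h]

end Invariance

section Density

variable {ι : Type*} [Fintype ι]

/-- The quadratic form of a matrix. -/
def qf (Q : Matrix ι ι ℝ) (x : ι → ℝ) : ℝ := x ⬝ᵥ Q.mulVec x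

/-- The bilinear form of a matrix. -/
def bf (Q : Matrix ι ι ℝ) (x y : ι → ℝ) : ℝ := x ⬝ᵥ Q.mulVec y

lemma bf_symm {Q : Matrix ι ι ℝ} (hQ : Q.IsSymm) (x y : ι → ℝ) : bf Q x y = bf Q y x := by
  unfold bf
  rw [Matrix.dotProduct_mulVec, dotProduct_comm, ← Matrix.mulVec_transpose, hQ]

lemma bf_add_left (Q : Matrix ι ι ℝ) (x y z : ι → ℝ) : bf Q (x + y) z = bf Q x z + bf Q y z := by
  simp [bf, add_dotProduct]

lemma bf_add_right (Q : Matrix ι ι ℝ) (x y z : ι → ℝ) : bf Q x (y + z) = bf Q x y + bf Q x z := by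
  simp [bf, Matrix.mulVec_add, dotProduct_add]

lemma bf_smul_left (Q : Matrix ι ι ℝ) (c : ℝ) (x z : ι → ℝ) : bf Q (c • x) z = c * bf Q x z := by
  simp [bf]

lemma bf_smul_right (Q : Matrix ι ι ℝ) (c : ℝ) (x z : ι → ℝ) : bf Q x (c • z) = c * bf Q x z := by
  simp [bf, Matrix.mulVec_smul]

lemma qf_eq_bf (Q : Matrix ι ι ℝ) (x : ι → ℝ) : qf Q x = bf Q x x := rfl

lemma qf_add {Q : Matrix ι ι ℝ} (hQ : Q.IsSymm) (x y : ι → ℝ) :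
    qf Q (x + y) = qf Q x + 2 * bf Q x y + qf Q y := by
  simp only [qf_eq_bf, bf_add_left, bf_add_right, bf_symm hQ y x]; ring

lemma qf_smul (Q : Matrix ι ι ℝ) (c : ℝ) (x : ι → ℝ) : qf Q (c • x) = c ^ 2 * qf Q x := by
  simp only [qf_eq_bf, bf_smul_left, bf_smul_right]; ring

lemma bf_eq_sum (Q : Matrix ι ι ℝ) (x y : ι → ℝ) : bf Q x y = ∑ i, ∑ j, Q i j * x i * y j := by
  simp only [bf, dotProduct, Matrix.mulVec, Finset.mul_sum]
  exact Finset.sum_congr rfl fun i _ => Finset.sum_congr rfl fun j _ => by ring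

lemma qf_continuous (Q : Matrix ι ι ℝ) : Continuous (qf Q) := by
  have : qf Q = fun x => ∑ i, ∑ j, Q i j * x i * x j := by
    funext x; rw [qf_eq_bf, bf_eq_sum]
  rw [this]; fun_prop

lemma posDef_isSymm {Q : Matrix ι ι ℝ} (hQ : Q.PosDef) : Q.IsSymm := by
  have := hQ.isHermitian
  rwa [Matrix.IsHermitian, Matrix.conjTranspose_eq_transpose_of_trivial] at this

lemma qf_nonneg {Q : Matrix ι ι ℝ} (hQ : Q.PosDef) (x : ι → ℝ) : 0 ≤ qf Q x := by
  simpa [qf] using hQ.posSemidef.dotProduct_mulVec_nonneg x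

/-- The unnormalised Gaussian measure with precision matrix `Q`. -/
def gm (Q : Matrix ι ι ℝ) : Measure (ι → ℝ) :=
  volume.withDensity fun x => ENNReal.ofReal (Real.exp (-(qf Q x / 2)))

lemma gm_density_measurable (Q : Matrix ι ι ℝ) :
    Measurable fun x => ENNReal.ofReal (Real.exp (-(qf Q x / 2))) := by
  have := (qf_continuous Q).measurable
  fun_prop

lemma lintegral_gm (Q : Matrix ι ι ℝ) {f : (ι → ℝ) → ℝ≥0∞} (hf : Measurable f) :
    ∫⁻ x, f x ∂(gm Q) = ∫⁻ x, ENNReal.ofReal (Real.exp (-(qf Q x / 2))) * f x := by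
  rw [gm, lintegral_withDensity_eq_lintegral_mul _ (gm_density_measurable Q) hf]; rfl

lemma gm_involutive (Q : Matrix ι ι ℝ) (A : (ι → ℝ) →ₗ[ℝ] (ι → ℝ)) (hA : ∀ x, A (A x) = x)
    (hq : ∀ x, qf Q (A x) = qf Q x) : MeasurePreserving A (gm Q) (gm Q) :=
  measurePreserving_withDensity (involutive_measurePreserving _ A hA) (gm_density_measurable Q)
    fun x => by simp only [hq]

/-- Independent standard Gaussians have the expected joint density. -/
lemma pi_gaussian_eq : ∃ κ : ℝ≥0∞, κ ≠ 0 ∧ κ ≠ ⊤ ∧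
    Measure.pi (fun _ : ι => gaussianReal 0 1) =
      κ • volume.withDensity fun x : ι → ℝ => ENNReal.ofReal (Real.exp (-((∑ i, x i ^ 2) / 2))) := by
  set k : ℝ := ∏ _i : ι, (√(2 * π * ((1 : ℝ≥0) : ℝ)))⁻¹ with hk
  have hk0 : 0 < k := Finset.prod_pos fun _ _ => by positivity
  refine ⟨ENNReal.ofReal k, by simpa using hk0, ENNReal.ofReal_ne_top, ?_⟩
  refine (Measure.pi_eq fun s hs => ?_)
  have hmeas : Measurable fun x : ι → ℝ => ENNReal.ofReal (Real.exp (-((∑ i, x i ^ 2) / 2))) := by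
    fun_prop
  rw [Measure.smul_apply, withDensity_apply _ (MeasurableSet.univ_pi hs), smul_eq_mul,
    ← lintegral_const_mul _ hmeas]
  have h1 : ∀ x : ι → ℝ, ENNReal.ofReal k * ENNReal.ofReal (Real.exp (-((∑ i, x i ^ 2) / 2))) =
      ENNReal.ofReal (∏ i, gaussianPDFReal 0 1 (x i)) := by
    intro x
    rw [← ENNReal.ofReal_mul hk0.le]
    congr 1
    simp only [gaussianPDFReal, Finset.prod_mul_distrib, ← Real.exp_sum, hk]
    congr 2
    rw [Finset.sum_div, ← Finset.sum_neg_distrib]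
    exact Finset.sum_congr rfl fun i _ => by simp; ring
  simp_rw [h1]
  rw [← ofReal_integral_eq_lintegral_ofReal]
  · have h2 : ∫ x in Set.univ.pi s, ∏ i, gaussianPDFReal 0 1 (x i) =
        ∏ i, ∫ t in s i, gaussianPDFReal 0 1 t := by
      rw [← integral_indicator (MeasurableSet.univ_pi hs)]
      simp_rw [← integral_indicator (hs _)]
      rw [← integral_fintype_prod_volume_eq_prod]
      congr 1
      funext x
      by_cases hx : x ∈ Set.univ.pi s
      · rw [Set.indicator_of_mem hx]
        exact Finset.prod_congr rfl fun i _ => by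
          rw [Set.indicator_of_mem (hx i (Set.mem_univ i))]
      · rw [Set.indicator_of_notMem hx]
        simp only [Set.mem_pi, Set.mem_univ, true_implies, not_forall] at hx
        obtain ⟨i, hi⟩ := hx
        rw [Finset.prod_eq_zero (Finset.mem_univ i)]
        rw [Set.indicator_of_notMem hi]
    rw [h2, ENNReal.ofReal_prod_of_nonneg
      fun i _ => integral_nonneg fun t => gaussianPDFReal_nonneg _ _ _]
    refine Finset.prod_congr rfl fun i _ => ?_
    rw [gaussianReal_apply_eq_integral _ one_ne_zero]
  · exact (Integrable.fintype_prod fun i => integrable_gaussianPDFReal 0 1).integrableOn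
  · exact Eventually.of_forall fun x => Finset.prod_nonneg fun i _ => gaussianPDFReal_nonneg _ _ _

end Density

end Perc
namespace Perc

section Law

variable {ι : Type*} [Fintype ι]

lemma exists_factor {Q : Matrix ι ι ℝ} (hQ : Q.PosDef) :
    ∃ A : Matrix ι ι ℝ, A.det ≠ 0 ∧ Q = A.transpose * A := by
  open scoped MatrixOrder in
  obtain ⟨A, hA⟩ := CStarAlgebra.nonneg_iff_eq_star_mul_self.1 hQ.posSemidef.nonneg
  refine ⟨A, fun h => ?_, ?_⟩
  · have h1 := hQ.det_pos
    rw [hA, Matrix.det_mul, h, mul_zero] at h1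
    exact lt_irrefl _ h1
  · rw [hA, Matrix.star_eq_conjTranspose, Matrix.conjTranspose_eq_transpose_of_trivial]

lemma pi_gaussian_charFunDual (L : StrongDual ℝ (ι → ℝ)) :
    charFunDual (Measure.pi (fun _ : ι => gaussianReal 0 1)) L =
      Complex.exp (-((∑ i, L (Pi.single i 1) ^ 2 : ℝ) : ℂ) / 2) := by
  rw [charFunDual_pi]
  have : ∀ i : ι, charFunDual (gaussianReal 0 1)
      (L ∘SL ContinuousLinearMap.single ℝ (fun _ : ι => ℝ) i) =
      Complex.exp (-((L (Pi.single i 1) ^ 2 : ℝ) : ℂ) / 2) := by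
    intro i
    rw [charFunDual_eq_charFun_map_one]
    have h : (L ∘SL ContinuousLinearMap.single ℝ (fun _ : ι => ℝ) i : ℝ → ℝ) =
        fun t => L (Pi.single i 1) * t := by
      funext t
      simp only [ContinuousLinearMap.coe_comp, Function.comp_apply,
        ContinuousLinearMap.single_apply]
      have : (Pi.single i t : ι → ℝ) = t • Pi.single i 1 := by
        rw [← Pi.single_smul]; simp
      rw [this, map_smul, smul_eq_mul, mul_comm]
    rw [h, gaussianReal_map_const_mul, charFun_gaussianReal]
    congr 1
    simp [neg_div]
  simp_rw [this]
  rw [← Complex.exp_sum]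
  congr 1
  push_cast
  rw [← Finset.sum_div, Finset.sum_neg_distrib]

lemma exists_gm_eq {Q : Matrix ι ι ℝ} (hQ : Q.PosDef) :
    ∃ κ : ℝ≥0∞, κ ≠ 0 ∧ κ ≠ ⊤ ∧ ∃ A : Matrix ι ι ℝ, A.det ≠ 0 ∧ Q = A.transpose * A ∧
      κ • gm Q = (Measure.pi (fun _ : ι => gaussianReal 0 1)).map (Matrix.toLin' A⁻¹) := by
  obtain ⟨A, hdet, hA⟩ := exists_factor hQ
  obtain ⟨k, hk0, hkt, hk⟩ := pi_gaussian_eq (ι := ι)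
  have hunit : IsUnit A.det := isUnit_iff_ne_zero.2 hdet
  have hdet' : LinearMap.det (Matrix.toLin' A⁻¹) ≠ 0 := by
    rw [LinearMap.det_toLin', Matrix.det_nonsing_inv, Ring.inverse_eq_inv']
    exact inv_ne_zero hdet
  have hmeas : Measurable (Matrix.toLin' A⁻¹) :=
    (LinearMap.continuous_of_finiteDimensional _).measurable
  have hmap := Measure.map_linearMap_addHaar_eq_smul_addHaar (volume : Measure (ι → ℝ)) hdet'
  set r : ℝ≥0∞ := ENNReal.ofReal |(LinearMap.det (Matrix.toLin' A⁻¹))⁻¹| with hr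
  have hr0 : r ≠ 0 := by
    rw [hr, Ne, ENNReal.ofReal_eq_zero, not_le]
    exact abs_pos.2 (inv_ne_zero hdet')
  refine ⟨k * r, mul_ne_zero hk0 hr0, ENNReal.mul_ne_top hkt ENNReal.ofReal_ne_top,
    A, hdet, hA, ?_⟩
  have hq : ∀ x, qf Q (Matrix.toLin' A⁻¹ x) = ∑ i, x i ^ 2 := by
    intro x
    rw [qf, Matrix.toLin'_apply, hA, ← Matrix.mulVec_mulVec, Matrix.mulVec_mulVec _ A,
      Matrix.mul_nonsing_inv _ hunit, Matrix.one_mulVec, Matrix.dotProduct_mulVec,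
      ← Matrix.mulVec_transpose, Matrix.transpose_transpose, Matrix.mulVec_mulVec,
      Matrix.mul_nonsing_inv _ hunit, Matrix.one_mulVec]
    simp [dotProduct, pow_two]
  rw [hk, Measure.map_smul, mul_smul]
  congr 1
  ext s hs
  rw [Measure.smul_apply, Measure.map_apply hmeas hs, gm, withDensity_apply _ hs,
    withDensity_apply _ (hmeas hs), smul_eq_mul]
  simp_rw [← hq]
  rw [← setLIntegral_map hs (gm_density_measurable Q) hmeas, hmap, Measure.restrict_smul,
    lintegral_smul_measure, smul_eq_mul]

lemma sum_pi_single (L : StrongDual ℝ (ι → ℝ)) (x : ι → ℝ) :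
    L x = ∑ i, L (Pi.single i 1) * x i := by
  conv_lhs => rw [pi_eq_sum_univ' x]
  rw [map_sum]
  refine Finset.sum_congr rfl fun i _ => ?_
  rw [map_smul, smul_eq_mul, mul_comm]

/-- A vector all of whose linear forms are Gaussian has the Gaussian density. -/
lemma gaussian_law {Ω : Type*} [MeasurableSpace Ω] {P : Measure Ω} [IsProbabilityMeasure P]
    {Q : Matrix ι ι ℝ} (hQ : Q.PosDef) {X : Ω → ι → ℝ} (hX : Measurable X)
    (hlaw : ∀ c : ι → ℝ, P.map (fun ω => ∑ i, c i * X ω i) =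
      gaussianReal 0 (Real.toNNReal (qf Q⁻¹ c))) :
    ∃ κ : ℝ≥0∞, κ ≠ 0 ∧ κ ≠ ⊤ ∧ P.map X = κ • gm Q := by
  obtain ⟨κ, h0, ht, A, hdet, hA, hκ⟩ := exists_gm_eq hQ
  refine ⟨κ, h0, ht, ?_⟩
  have hunit : IsUnit A.det := isUnit_iff_ne_zero.2 hdet
  have hmeas : Measurable (Matrix.toLin' A⁻¹) :=
    (LinearMap.continuous_of_finiteDimensional _).measurable
  rw [hκ]
  have : IsProbabilityMeasure (P.map X) := Measure.isProbabilityMeasure_map hX.aemeasurable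
  have : IsProbabilityMeasure ((Measure.pi fun _ : ι => gaussianReal 0 1).map
    (Matrix.toLin' A⁻¹)) := Measure.isProbabilityMeasure_map hmeas.aemeasurable
  refine Measure.ext_of_charFunDual ?_
  funext L
  set c : ι → ℝ := fun i => L (Pi.single i 1) with hc
  have e1 : charFunDual (P.map X) L = Complex.exp (-((qf Q⁻¹ c : ℝ) : ℂ) / 2) := by
    rw [charFunDual_eq_charFun_map_one, Measure.map_map L.continuous.measurable hX]
    have : (L ∘ X) = fun ω => ∑ i, c i * X ω i := by
      funext ω; exact sum_pi_single L (X ω)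
    rw [this, hlaw, charFun_gaussianReal]
    congr 1
    simp [Real.coe_toNNReal _ (qf_nonneg hQ.inv c), neg_div]
  have e2 : charFunDual ((Measure.pi fun _ : ι => gaussianReal 0 1).map (Matrix.toLin' A⁻¹)) L =
      Complex.exp (-((qf Q⁻¹ c : ℝ) : ℂ) / 2) := by
    set L' : StrongDual ℝ (ι → ℝ) :=
      L ∘SL (LinearMap.toContinuousLinearMap (Matrix.toLin' A⁻¹)) with hL'
    have : charFunDual ((Measure.pi fun _ : ι => gaussianReal 0 1).map (Matrix.toLin' A⁻¹)) L =
        charFunDual (Measure.pi fun _ : ι => gaussianReal 0 1) L' := by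
      rw [charFunDual_apply, charFunDual_apply, integral_map hmeas.aemeasurable]
      · rfl
      · exact Continuous.aestronglyMeasurable (by fun_prop)
    rw [this, pi_gaussian_charFunDual]
    congr 4
    have h1 : ∀ i, L' (Pi.single i 1) = (Matrix.vecMul c A⁻¹) i := by
      intro i
      change L (Matrix.toLin' A⁻¹ (Pi.single i 1)) = _
      rw [sum_pi_single, Matrix.vecMul, dotProduct]
      refine Finset.sum_congr rfl fun j _ => ?_
      simp [hc]
    simp_rw [h1]
    have h2 : qf Q⁻¹ c = Matrix.vecMul c A⁻¹ ⬝ᵥ Matrix.vecMul c A⁻¹ := by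
      rw [qf, hA, Matrix.mul_inv_rev, ← Matrix.mulVec_mulVec, Matrix.dotProduct_mulVec]
      congr 1
      rw [← Matrix.transpose_nonsing_inv, Matrix.mulVec_transpose]
    rw [h2, dotProduct]
    exact Finset.sum_congr rfl fun i _ => by ring
  rw [e1, e2]

lemma gm_univ {Q : Matrix ι ι ℝ} (hQ : Q.PosDef) : gm Q Set.univ ≠ 0 ∧ gm Q Set.univ ≠ ⊤ := by
  obtain ⟨κ, h0, ht, A, hdet, hA, hκ⟩ := exists_gm_eq hQ
  have hmeas : Measurable (Matrix.toLin' A⁻¹) :=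
    (LinearMap.continuous_of_finiteDimensional _).measurable
  have h1 : (κ • gm Q) Set.univ = 1 := by
    rw [hκ, Measure.map_apply hmeas MeasurableSet.univ]; simp
  rw [Measure.smul_apply, smul_eq_mul] at h1
  constructor
  · intro h; rw [h, mul_zero] at h1; exact zero_ne_one h1
  · intro h; rw [h, ENNReal.mul_top h0] at h1; exact ENNReal.top_ne_one h1

end Law

end Perc
namespace Perc

section Star

lemma integral_half_exp {c : ℝ} (hc : 0 < c) (t : ℝ) :
    (Integrable fun s : ℝ => (if 0 < s then Real.exp (-(c * s)) else 0) *
      (if 0 < s + t then Real.exp (-(c * (s + t))) else 0)) ∧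
    ∫ s : ℝ, (if 0 < s then Real.exp (-(c * s)) else 0) *
      (if 0 < s + t then Real.exp (-(c * (s + t))) else 0) = Real.exp (-(c * |t|)) / (2 * c) := by
  have h : (fun s : ℝ => (if 0 < s then Real.exp (-(c * s)) else 0) *
      (if 0 < s + t then Real.exp (-(c * (s + t))) else 0)) =
      (Set.Ioi (max 0 (-t))).indicator fun s => Real.exp (-(c * t)) * Real.exp (-(2 * c) * s) := by
    funext s
    by_cases h1 : 0 < s <;> by_cases h2 : 0 < s + t
    · rw [if_pos h1, if_pos h2, Set.indicator_of_mem, ← Real.exp_add, ← Real.exp_add]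
      · congr 1; ring
      · exact max_lt h1 (by linarith)
    all_goals
      rw [Set.indicator_of_notMem]
      · simp [h1, h2]
      · simp only [Set.mem_Ioi, max_lt_iff, not_and_or]
        first
        | exact Or.inl h1
        | exact Or.inr fun h => h2 (by linarith)
  rw [h, integrable_indicator_iff measurableSet_Ioi, integral_indicator measurableSet_Ioi]
  refine ⟨(integrableOn_exp_mul_Ioi (by linarith) _).const_mul _, ?_⟩
  rw [integral_const_mul, integral_exp_mul_Ioi (by linarith)]
  rcases le_total 0 t with ht | ht
  · rw [max_eq_left (by linarith), abs_of_nonneg ht]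
    simp; ring
  · rw [max_eq_right (by linarith), abs_of_nonpos ht]
    have : Real.exp (-(c * t)) * Real.exp (-(2 * c) * -t) = Real.exp (-(c * -t)) := by
      rw [← Real.exp_add]; congr 1; ring
    rw [neg_div_neg_eq, ← mul_div_assoc, this]

variable {T : Type*} [Fintype T]

/-- A product of one-sided exponentials. -/
def halfExp (c s : T → ℝ) : ℝ≥0∞ :=
  ENNReal.ofReal (∏ v, if 0 < s v then Real.exp (-(c v * s v)) else 0)

lemma halfExp_measurable (c : T → ℝ) : Measurable (halfExp c) := by
  unfold halfExp
  refine ENNReal.measurable_ofReal.comp (Finset.measurable_prod _ fun v _ => ?_)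
  refine Measurable.ite ?_ (by fun_prop) measurable_const
  exact measurableSet_lt measurable_const (measurable_pi_apply v)

lemma lintegral_halfExp {c : T → ℝ} (hc : ∀ v, 0 < c v) (t : T → ℝ) :
    ENNReal.ofReal (∏ v, 2 * c v) * ∫⁻ s, halfExp c s * halfExp c (s + t) =
      ENNReal.ofReal (Real.exp (-∑ v, c v * |t v|)) := by
  have h0 : ∀ s v, 0 ≤ (if 0 < s then Real.exp (-(c v * s)) else (0 : ℝ)) := by
    intro s v; split_ifs <;> positivity
  have h1 : ∀ s, halfExp c s * halfExp c (s + t) =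
      ENNReal.ofReal (∏ v, (if 0 < s v then Real.exp (-(c v * s v)) else 0) *
        (if 0 < s v + t v then Real.exp (-(c v * (s v + t v))) else 0)) := by
    intro s
    rw [Finset.prod_mul_distrib, ENNReal.ofReal_mul (Finset.prod_nonneg fun v _ => h0 _ v)]
    rfl
  simp_rw [h1]
  have hI : Integrable (fun s : T → ℝ => ∏ v, (if 0 < s v then Real.exp (-(c v * s v)) else 0) *
      (if 0 < s v + t v then Real.exp (-(c v * (s v + t v))) else 0)) volume :=
    Integrable.fintype_prod (f := fun v s => (if 0 < s then Real.exp (-(c v * s)) else 0) *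
      (if 0 < s + t v then Real.exp (-(c v * (s + t v))) else 0))
      fun v => (integral_half_exp (hc v) (t v)).1
  rw [← ofReal_integral_eq_lintegral_ofReal hI
    (Eventually.of_forall fun s => Finset.prod_nonneg fun v _ => mul_nonneg (h0 _ v) (h0 _ v)),
    ← ENNReal.ofReal_mul (Finset.prod_nonneg fun v _ => by have := hc v; positivity),
    integral_fintype_prod_volume_eq_prod (fun v s => (if 0 < s then Real.exp (-(c v * s)) else 0) *
        (if 0 < s + t v then Real.exp (-(c v * (s + t v))) else 0)),
    ← Finset.prod_mul_distrib, ← Finset.sum_neg_distrib, Real.exp_sum]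
  congr 1
  refine Finset.prod_congr rfl fun v _ => ?_
  rw [(integral_half_exp (hc v) (t v)).2]
  have := hc v
  field_simp

lemma two_mul_le_sq_ennreal (x y : ℝ≥0∞) : 2 * (x * y) ≤ x * x + y * y := by
  induction x with
  | top => simp
  | coe x =>
    induction y with
    | top => simp
    | coe y =>
      have := two_mul_le_add_sq x y
      rw [pow_two, pow_two, mul_assoc] at this
      exact_mod_cast this

lemma correlation_le (A : (T → ℝ) → ℝ≥0∞) (hA : Measurable A) (m : T → ℝ) :
    ∫⁻ u, A u * A (u + m) ≤ ∫⁻ u, A u * A u := by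
  have h1 : 2 * ∫⁻ u, A u * A (u + m) ≤ 2 * ∫⁻ u, A u * A u := by
    rw [← lintegral_const_mul _ (by fun_prop)]
    calc ∫⁻ u, 2 * (A u * A (u + m)) ≤ ∫⁻ u, (A u * A u + A (u + m) * A (u + m)) :=
          lintegral_mono fun u => two_mul_le_sq_ennreal _ _
      _ = _ := by
          rw [lintegral_add_left (by fun_prop),
            lintegral_add_right_eq_self (fun u => A u * A u) m, two_mul]
  exact (ENNReal.mul_le_mul_iff_right (by norm_num) (by norm_num)).1 h1

lemma gauss_parallelogram {B : Matrix T T ℝ} (hB : B.PosDef) (s t : T → ℝ) :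
    ∫⁻ u, ENNReal.ofReal (Real.exp (-qf B (s - u))) * ENNReal.ofReal (Real.exp (-qf B (t - u))) =
      ENNReal.ofReal (Real.exp (-(qf B (t - s) / 2))) * gm ((4 : ℝ) • B) Set.univ := by
  have hs := posDef_isSymm hB
  have hq := (qf_continuous B).measurable
  have h4 : ∀ x, qf ((4 : ℝ) • B) x = 4 * qf B x := by
    intro x; simp [qf, Matrix.smul_mulVec]
  have h1 : gm ((4 : ℝ) • B) Set.univ = ∫⁻ u, ENNReal.ofReal (Real.exp (-(2 * qf B u))) := by
    rw [gm, withDensity_apply _ MeasurableSet.univ, Measure.restrict_univ]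
    refine lintegral_congr fun u => ?_
    rw [h4]; congr 3; ring
  rw [h1, ← lintegral_const_mul _ (by fun_prop),
    ← lintegral_add_right_eq_self _ ((2⁻¹ : ℝ) • (s + t))]
  refine lintegral_congr fun u => ?_
  rw [← ENNReal.ofReal_mul (Real.exp_nonneg _), ← ENNReal.ofReal_mul (Real.exp_nonneg _),
    ← Real.exp_add, ← Real.exp_add]
  congr 2
  have e1 : s - (u + (2⁻¹ : ℝ) • (s + t)) = (2⁻¹ : ℝ) • (s - t) + (-1 : ℝ) • u := by
    ext i; simp; ring
  have e2 : t - (u + (2⁻¹ : ℝ) • (s + t)) = (-2⁻¹ : ℝ) • (s - t) + (-1 : ℝ) • u := by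
    ext i; simp; ring
  have e3 : t - s = (-1 : ℝ) • (s - t) := by ext i; simp
  rw [e1, e2, e3]
  simp only [qf_eq_bf, bf_add_left, bf_add_right, bf_smul_left, bf_smul_right, bf_symm hs u]
  ring

lemma star_pos {B : Matrix T T ℝ} (hB : B.PosDef) {c : T → ℝ} (hc : ∀ v, 0 < c v) (m : T → ℝ) :
    ∫⁻ t, ENNReal.ofReal (Real.exp (-(qf B t / 2))) *
        ENNReal.ofReal (Real.exp (-∑ v, c v * |t v + m v|)) ≤
      ∫⁻ t, ENNReal.ofReal (Real.exp (-(qf B t / 2))) *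
        ENNReal.ofReal (Real.exp (-∑ v, c v * |t v|)) := by
  have hq := (qf_continuous B).measurable
  have hG := halfExp_measurable c
  have h4 : ((4 : ℝ) • B).PosDef := hB.smul (by norm_num)
  set Z := gm ((4 : ℝ) • B) Set.univ
  obtain ⟨hZ0, hZt⟩ : Z ≠ 0 ∧ Z ≠ ⊤ := gm_univ h4
  set E : (T → ℝ) → ℝ≥0∞ := fun t => ENNReal.ofReal (Real.exp (-(qf B t / 2))) with hE
  set D : (T → ℝ) → ℝ≥0∞ := fun t => ENNReal.ofReal (Real.exp (-qf B t)) with hD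
  have hEm : Measurable E := by fun_prop
  have hDm : Measurable D := by fun_prop
  set A : (T → ℝ) → ℝ≥0∞ := fun u => ∫⁻ s, halfExp c s * D (s - u) with hA
  have hAm : Measurable A := by
    refine Measurable.lintegral_prod_right' (f := fun p : (T → ℝ) × (T → ℝ) =>
      halfExp c p.2 * D (p.2 - p.1)) ?_
    fun_prop
  set K := ENNReal.ofReal (∏ v, 2 * c v)
  have key : ∀ m : T → ℝ, Z * ∫⁻ t, E t *
        ENNReal.ofReal (Real.exp (-∑ v, c v * |t v + m v|)) = K * ∫⁻ u, A u * A (u + m) := by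
    intro m
    have hAs : ∀ u, A (u + m) = ∫⁻ t, halfExp c (t + m) * D (t - u) := by
      intro u
      change ∫⁻ s, halfExp c s * D (s - (u + m)) = _
      rw [← lintegral_add_right_eq_self (fun s => halfExp c s * D (s - (u + m))) m]
      refine lintegral_congr fun t => ?_
      congr 2; abel
    calc Z * ∫⁻ t, E t * ENNReal.ofReal (Real.exp (-∑ v, c v * |t v + m v|))
        = Z * ∫⁻ t, E t * (K * ∫⁻ s, halfExp c s * halfExp c (s + (t + m))) := by
          congr 1
          refine lintegral_congr fun t => ?_
          rw [lintegral_halfExp hc]; rfl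
      _ = K * ∫⁻ t, ∫⁻ s, Z * (E t * (halfExp c s * halfExp c (s + (t + m)))) := by
          rw [← lintegral_const_mul' _ _ hZt, ← lintegral_const_mul' _ _ ENNReal.ofReal_ne_top]
          refine lintegral_congr fun t => ?_
          rw [lintegral_const_mul _ (by fun_prop), lintegral_const_mul _ (by fun_prop)]
          ring
      _ = K * ∫⁻ s, ∫⁻ t, Z * (E t * (halfExp c s * halfExp c (s + (t + m)))) := by
          congr 1
          rw [lintegral_lintegral_swap]
          fun_prop
      _ = K * ∫⁻ s, ∫⁻ t, Z * (E (t - s) * (halfExp c s * halfExp c (t + m))) := by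
          congr 1
          refine lintegral_congr fun s => ?_
          rw [← lintegral_sub_right_eq_self
            (fun t => Z * (E t * (halfExp c s * halfExp c (s + (t + m))))) s]
          refine lintegral_congr fun t => ?_
          congr 4; abel
      _ = K * ∫⁻ s, ∫⁻ t, ∫⁻ u, (halfExp c s * D (s - u)) * (halfExp c (t + m) * D (t - u)) := by
          congr 1
          refine lintegral_congr fun s => lintegral_congr fun t => ?_
          have := gauss_parallelogram hB s t
          calc _ = (halfExp c s * halfExp c (t + m)) * (E (t - s) * Z) := by ring
            _ = (halfExp c s * halfExp c (t + m)) * ∫⁻ u, D (s - u) * D (t - u) := by rw [this]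
            _ = _ := by
              rw [← lintegral_const_mul _ (by fun_prop)]
              refine lintegral_congr fun u => ?_
              ring
      _ = K * ∫⁻ u, ∫⁻ s, ∫⁻ t, (halfExp c s * D (s - u)) * (halfExp c (t + m) * D (t - u)) := by
          congr 1
          have : ∀ s, ∫⁻ t, ∫⁻ u, (halfExp c s * D (s - u)) * (halfExp c (t + m) * D (t - u)) =
              ∫⁻ u, ∫⁻ t, (halfExp c s * D (s - u)) * (halfExp c (t + m) * D (t - u)) := by
            intro s
            rw [lintegral_lintegral_swap]
            fun_prop
          simp_rw [this]
          rw [lintegral_lintegral_swap]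
          refine Measurable.aemeasurable ?_
          refine Measurable.lintegral_prod_right' (f := fun p : ((T → ℝ) × (T → ℝ)) × (T → ℝ) =>
            (halfExp c p.1.1 * D (p.1.1 - p.1.2)) * (halfExp c (p.2 + m) * D (p.2 - p.1.2))) ?_
          fun_prop
      _ = K * ∫⁻ u, A u * A (u + m) := by
          congr 1
          refine lintegral_congr fun u => ?_
          rw [hAs, hA, ← lintegral_mul_const _ (by fun_prop)]
          refine lintegral_congr fun s => ?_
          rw [lintegral_const_mul _ (by fun_prop)]
  have k0 := key 0
  simp only [Pi.zero_apply, add_zero] at k0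
  refine (ENNReal.mul_le_mul_iff_right hZ0 hZt).1 ?_
  rw [key m, k0]
  exact mul_le_mul le_rfl (correlation_le A hAm m) zero_le zero_le

lemma star_nonneg {B : Matrix T T ℝ} (hB : B.PosDef) {c : T → ℝ} (hc : ∀ v, 0 ≤ c v) (m : T → ℝ) :
    ∫⁻ t, ENNReal.ofReal (Real.exp (-(qf B t / 2))) *
        ENNReal.ofReal (Real.exp (-∑ v, c v * |t v + m v|)) ≤
      ∫⁻ t, ENNReal.ofReal (Real.exp (-(qf B t / 2))) *
        ENNReal.ofReal (Real.exp (-∑ v, c v * |t v|)) := by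
  have hq := (qf_continuous B).measurable
  have hpos : ∀ n : ℕ, 0 < 1 / ((n : ℝ) + 1) := fun n => by positivity
  have hlim : Tendsto (fun n : ℕ => ∫⁻ t, ENNReal.ofReal (Real.exp (-(qf B t / 2))) *
        ENNReal.ofReal (Real.exp (-∑ v, (c v + 1 / ((n : ℝ) + 1)) * |t v + m v|))) atTop
      (𝓝 (∫⁻ t, ENNReal.ofReal (Real.exp (-(qf B t / 2))) *
        ENNReal.ofReal (Real.exp (-∑ v, c v * |t v + m v|)))) := by
    refine lintegral_tendsto_of_tendsto_of_monotone (fun n => by fun_prop) ?_ ?_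
    · refine Eventually.of_forall fun t i j hij => ?_
      dsimp only
      gcongr
    · refine Eventually.of_forall fun t => ?_
      refine ENNReal.Tendsto.const_mul ?_ (Or.inr ENNReal.ofReal_ne_top)
      refine ENNReal.tendsto_ofReal ((Real.continuous_exp.tendsto _).comp ?_)
      refine (tendsto_finsetSum _ fun v _ => ?_).neg
      refine Tendsto.mul_const _ ?_
      simpa using tendsto_one_div_add_atTop_nhds_zero_nat.const_add (c v)
  refine le_of_tendsto' hlim fun n => ?_
  refine (star_pos hB (fun v => add_pos_of_nonneg_of_pos (hc v) (hpos n)) m).trans ?_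
  refine lintegral_mono fun t => ?_
  dsimp only
  gcongr
  have := (hpos n).le
  linarith

end Star

end Perc
namespace Perc

section Shift

variable {ι : Type*} [Fintype ι]

/-- Extension by zero. -/
def ext0 (s : Finset ι) (t : s → ℝ) : ι → ℝ := Function.updateFinset 0 s t

lemma sum_ext0 (s : Finset ι) (t : s → ℝ) (F : ι → ℝ → ℝ) (hF : ∀ i, F i 0 = 0) :
    ∑ i, F i (ext0 s t i) = ∑ v : s, F v (t v) := by
  have h1 : ∑ i, F i (ext0 s t i) = ∑ i ∈ s, F i (ext0 s t i) := by
    symm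
    refine Finset.sum_subset (Finset.subset_univ _) fun i _ hi => ?_
    simp [ext0, Function.updateFinset, hi, hF]
  rw [h1, ← Finset.sum_coe_sort s]
  refine Finset.sum_congr rfl fun v _ => ?_
  simp [ext0, Function.updateFinset]

/-- Comparison of the shifted Gaussian weight of a positive cluster with the unshifted one. -/
lemma shift_cluster_le {Q : Matrix ι ι ℝ} (hQ : Q.PosDef) (hoff : ∀ u v, u ≠ v → Q u v ≤ 0)
    (K : Finset ι) (a c : ℝ) (h1 : ∀ u ∈ K, 0 ≤ a * Q.mulVec 1 u) {f : (ι → ℝ) → ℝ≥0∞}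
    (hf : Measurable f) (hfK : ∀ x y : ι → ℝ, (∀ u ∈ K, x u = y u) → f x = f y)
    (hf0 : ∀ x : ι → ℝ, (∃ u ∈ K, x u ≤ 0) → f x = 0)
    (hc : ∀ h : ι → ℝ, (∀ u ∈ K, h u = 1) → c ≤ qf Q h) :
    ∫⁻ x, ENNReal.ofReal (Real.exp (-(qf Q (x + a • 1) / 2))) *
        (f x * ENNReal.ofReal (Real.exp (∑ u ∈ K, ∑ v ∈ Kᶜ, 2 * Q u v * x u * max (x v) 0))) ≤
      ENNReal.ofReal (Real.exp (-(a ^ 2 * c / 2))) *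
        ∫⁻ x, ENNReal.ofReal (Real.exp (-(qf Q x / 2))) *
        (f x * ENNReal.ofReal (Real.exp (∑ u ∈ K, ∑ v ∈ Kᶜ, 2 * Q u v * x u * max (x v) 0))) := by
  have hsym := posDef_isSymm hQ
  have hqm := (qf_continuous Q).measurable
  set D : (ι → ℝ) → ℝ := fun x => ∑ u ∈ K, ∑ v ∈ Kᶜ, 2 * Q u v * x u * max (x v) 0 with hD
  have hDm : Measurable D := by
    rw [hD]; fun_prop
  rw [← lintegral_const_mul _ (by fun_prop)]
  refine lintegral_le_of_lmarginal_le (μ := fun _ : ι => (volume : Measure ℝ)) Kᶜ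
    (by fun_prop) (by fun_prop) fun x => ?_
  unfold lmarginal
  have hagree : ∀ t : (Kᶜ : Finset ι) → ℝ, ∀ u ∈ K, Function.updateFinset x Kᶜ t u = x u := by
    intro t u hu
    simp [Function.updateFinset, hu]
  have hfx : ∀ t, f (Function.updateFinset x Kᶜ t) = f x := fun t => hfK _ _ (hagree t)
  simp only [hfx]
  by_cases hx : ∃ u ∈ K, x u ≤ 0
  · simp [hf0 x hx]
  push Not at hx
  set k : ι → ℝ := fun i => if i ∈ K then x i else 0 with hk
  have hdec : ∀ t, Function.updateFinset x Kᶜ t = k + ext0 Kᶜ t := by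
    intro t; funext i
    by_cases hi : i ∈ K <;> simp [Function.updateFinset, ext0, hk, hi]
  set B : Matrix (Kᶜ : Finset ι) (Kᶜ : Finset ι) ℝ := Q.submatrix Subtype.val Subtype.val with hBdef
  have hB : B.PosDef := hQ.submatrix Subtype.val_injective
  have hqB := (qf_continuous B).measurable
  set b : (Kᶜ : Finset ι) → ℝ := fun v => Q.mulVec 1 v with hb
  set w : (Kᶜ : Finset ι) → ℝ := fun v => -∑ u ∈ K, Q u v * x u with hw
  have hw0 : ∀ v, 0 ≤ w v := by
    intro v
    rw [hw]
    refine neg_nonneg.2 (Finset.sum_nonpos fun u hu => ?_)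
    refine mul_nonpos_of_nonpos_of_nonneg (hoff u v ?_) (hx u hu).le
    rintro rfl
    exact (Finset.mem_compl.1 v.2) hu
  have hqe : ∀ t, qf Q (ext0 Kᶜ t) = qf B t := by
    intro t
    rw [qf_eq_bf, bf_eq_sum, qf_eq_bf, bf_eq_sum]
    rw [sum_ext0 Kᶜ t (fun i r => ∑ j, Q i j * r * ext0 Kᶜ t j) (by simp)]
    refine Finset.sum_congr rfl fun u _ => ?_
    rw [sum_ext0 Kᶜ t (fun j r => Q u j * t u * r) (by simp)]
    rfl
  have hb1 : ∀ t, bf Q 1 (ext0 Kᶜ t) = ∑ v, b v * t v := by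
    intro t
    rw [bf_symm hsym, bf, dotProduct]
    rw [← sum_ext0 Kᶜ t (fun i r => Q.mulVec 1 i * r) (by simp)]
    exact Finset.sum_congr rfl fun i _ => mul_comm _ _
  have hbk : ∀ t, bf Q k (ext0 Kᶜ t) = -∑ v, w v * t v := by
    intro t
    rw [bf_eq_sum, Finset.sum_comm,
      sum_ext0 Kᶜ t (fun j r => ∑ i, Q i j * k i * r) (by simp), ← Finset.sum_neg_distrib]
    refine Finset.sum_congr rfl fun v _ => ?_
    rw [hw, ← Finset.sum_mul]
    have : ∑ i, Q i v * k i = ∑ u ∈ K, Q u v * x u := by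
      rw [hk, ← Finset.sum_subset (Finset.subset_univ K)]
      · exact Finset.sum_congr rfl fun u hu => by simp [hu]
      · intro u _ hu; simp [hu]
    rw [this]; ring
  have hDe : ∀ t, D (Function.updateFinset x Kᶜ t) = -∑ v, 2 * (w v * max (t v) 0) := by
    intro t
    rw [hD]
    dsimp only
    rw [Finset.sum_comm, ← Finset.sum_coe_sort Kᶜ, ← Finset.sum_neg_distrib]
    refine Finset.sum_congr rfl fun v _ => ?_
    have hv : Function.updateFinset x Kᶜ t v = t v := by simp [Function.updateFinset]
    rw [hw]
    dsimp only
    rw [neg_mul, mul_neg, neg_neg, Finset.sum_mul, Finset.mul_sum]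
    refine Finset.sum_congr rfl fun u hu => ?_
    rw [hagree t u hu, hv]; ring
  obtain ⟨m, hm⟩ : ∃ m, B.mulVec m = b :=
    ⟨B⁻¹.mulVec b, by
      rw [Matrix.mulVec_mulVec, Matrix.mul_nonsing_inv _ ((Matrix.isUnit_iff_isUnit_det _).1 hB.isUnit),
        Matrix.one_mulVec]⟩
  have hBs := posDef_isSymm hB
  have hbt : ∀ t, bf B t m = ∑ v, b v * t v := by
    intro t; rw [bf, hm, dotProduct]; exact Finset.sum_congr rfl fun v _ => mul_comm _ _
  have hcm : c ≤ qf Q 1 - qf B m := by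
    have := hc (1 + (-1 : ℝ) • ext0 Kᶜ m) (fun u hu => by
      simp [ext0, Function.updateFinset, hu])
    rw [qf_add hsym, qf_smul, bf_smul_right, hqe, hb1, ← hbt] at this
    rw [qf_eq_bf B] at this ⊢
    linarith
  have hk1 : 0 ≤ a * bf Q 1 k := by
    rw [bf_symm hsym, bf, dotProduct, Finset.mul_sum]
    refine Finset.sum_nonneg fun i _ => ?_
    by_cases hi : i ∈ K
    · have := mul_nonneg (hx i hi).le (h1 i hi)
      simp only [hk, hi, if_true]; linarith
    · simp [hk, hi]
  have habs : ∀ t : (Kᶜ : Finset ι) → ℝ, ∑ v, w v * |t v| =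
      -(∑ v, w v * t v) + ∑ v, 2 * (w v * max (t v) 0) := by
    intro t
    rw [← Finset.sum_neg_distrib, ← Finset.sum_add_distrib]
    refine Finset.sum_congr rfl fun v _ => ?_
    rcases le_total 0 (t v) with h | h
    · rw [abs_of_nonneg h, max_eq_left h]; ring
    · rw [abs_of_nonpos h, max_eq_right h]; ring
  have hexp : ∀ (a : ℝ) t, -(qf Q (Function.updateFinset x Kᶜ t + a • 1) / 2) +
      D (Function.updateFinset x Kᶜ t) =
      (-(qf Q k / 2) - a * bf Q 1 k - a ^ 2 * (qf Q 1 - qf B m) / 2) +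
        (-(qf B (t + a • m) / 2) + -∑ v, w v * |t v|) := by
    intro a t
    rw [hDe, habs, hdec, qf_add hsym, qf_add hsym, qf_smul, hqe, bf_smul_right, bf_add_left, hbk,
      bf_symm hsym _ 1, bf_symm hsym _ 1, hb1, qf_add hBs, qf_smul, bf_smul_right, hbt]
    ring
  have hterm : ∀ (a : ℝ) t, ENNReal.ofReal (Real.exp
      (-(qf Q (Function.updateFinset x Kᶜ t + a • 1) / 2))) *
      (f x * ENNReal.ofReal (Real.exp (D (Function.updateFinset x Kᶜ t)))) =
      (f x * ENNReal.ofReal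
        (Real.exp (-(qf Q k / 2) - a * bf Q 1 k - a ^ 2 * (qf Q 1 - qf B m) / 2))) *
      (ENNReal.ofReal (Real.exp (-(qf B (t + a • m) / 2))) *
        ENNReal.ofReal (Real.exp (-∑ v, w v * |t v|))) := by
    intro a t
    rw [mul_left_comm, mul_assoc, ← ENNReal.ofReal_mul (Real.exp_nonneg _),
      ← ENNReal.ofReal_mul (Real.exp_nonneg _), ← ENNReal.ofReal_mul (Real.exp_nonneg _),
      ← Real.exp_add, ← Real.exp_add, ← Real.exp_add, hexp]
  have hterm0 := hterm 0
  simp only [zero_smul, add_zero] at hterm0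
  simp only [hD] at hterm hterm0
  simp only [hterm, hterm0]
  have hpi : (Measure.pi fun _ : (Kᶜ : Finset ι) => (volume : Measure ℝ)) = volume := rfl
  rw [hpi, lintegral_const_mul _ (by fun_prop), lintegral_const_mul _ (by fun_prop),
    lintegral_const_mul _ (by fun_prop), ← mul_assoc (ENNReal.ofReal _)]
  refine mul_le_mul ?_ ?_ zero_le zero_le
  · rw [mul_left_comm, ← ENNReal.ofReal_mul (Real.exp_nonneg _), ← Real.exp_add]
    gcongr
    nlinarith [sq_nonneg a]
  · rw [← lintegral_sub_right_eq_self _ (a • m)]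
    have := star_nonneg hB hw0 (-(a • m))
    simpa [sub_eq_add_neg] using this

end Shift

end Perc

namespace Perc

section Weights

variable {ι : Type*} [Fintype ι]

/-- The conductance of the off-diagonal entry. -/
def cond (Q : Matrix ι ι ℝ) (u v : ι) : ℝ := max (-(Q u v + Q v u)) 0

/-- Edge probabilities given the field. -/
def pe (Q : Matrix ι ι ℝ) (x : ι → ℝ) : Sym2 ι → ℝ :=
  Sym2.lift ⟨fun u v => 1 - Real.exp (-(cond Q u v * (max (x u) 0 * max (x v) 0))), fun u v => by
    dsimp only
    rw [cond, cond, add_comm (Q u v), mul_comm (max (x u) 0)]⟩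

lemma pe_mk (Q : Matrix ι ι ℝ) (x : ι → ℝ) (u v : ι) :
    pe Q x s(u, v) = 1 - Real.exp (-(cond Q u v * (max (x u) 0 * max (x v) 0))) := rfl

lemma cond_nonneg (Q : Matrix ι ι ℝ) (u v : ι) : 0 ≤ cond Q u v := le_max_right _ _

lemma cond_eq {Q : Matrix ι ι ℝ} (hs : Q.IsSymm) (hoff : ∀ u v, u ≠ v → Q u v ≤ 0) {u v : ι}
    (h : u ≠ v) : cond Q u v = -(2 * Q u v) := by
  have h1 : Q v u = Q u v := hs.apply u v
  rw [cond, h1, max_eq_left (by linarith [hoff u v h])]; ring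

lemma pe_mem (Q : Matrix ι ι ℝ) (x : ι → ℝ) (e : Sym2 ι) : 0 ≤ pe Q x e ∧ pe Q x e ≤ 1 := by
  induction e with | _ u v => ?_
  rw [pe_mk]
  have h : 0 ≤ cond Q u v * (max (x u) 0 * max (x v) 0) :=
    mul_nonneg (cond_nonneg Q u v) (mul_nonneg (le_max_right _ _) (le_max_right _ _))
  have h1 : Real.exp (-(cond Q u v * (max (x u) 0 * max (x v) 0))) ≤ 1 :=
    Real.exp_le_one_iff.2 (by linarith)
  have h2 := Real.exp_nonneg (-(cond Q u v * (max (x u) 0 * max (x v) 0)))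
  constructor <;> linarith

lemma pe_mono (Q : Matrix ι ι ℝ) {x x' : ι → ℝ} (h : x ≤ x') (e : Sym2 ι) :
    pe Q x e ≤ pe Q x' e := by
  induction e with | _ u v => ?_
  rw [pe_mk, pe_mk]
  have h0 := cond_nonneg Q u v
  have hu := h u
  have hv := h v
  have : max (x u) 0 * max (x v) 0 ≤ max (x' u) 0 * max (x' v) 0 := by gcongr
  gcongr

lemma pe_zero (Q : Matrix ι ι ℝ) {x : ι → ℝ} {u : ι} (h : x u ≤ 0) (v : ι) :
    pe Q x s(u, v) = 0 := by
  rw [pe_mk, max_eq_right h]; simp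

lemma pe_congr (Q : Matrix ι ι ℝ) {x x' : ι → ℝ} {e : Sym2 ι} (h : ∀ u ∈ e, x u = x' u) :
    pe Q x e = pe Q x' e := by
  induction e with | _ u v => ?_
  rw [pe_mk, pe_mk, h u (by simp), h v (by simp)]

lemma pe_measurable (Q : Matrix ι ι ℝ) (e : Sym2 ι) : Measurable fun x => pe Q x e := by
  induction e with | _ u v => ?_
  simp only [pe_mk]
  fun_prop

lemma bern_measurable {E S : Finset (Sym2 ι)} (Q : Matrix ι ι ℝ) :
    Measurable fun x => bern E (pe Q x) S := by
  unfold bern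
  have := pe_measurable Q
  fun_prop

lemma wK_measurable (Q : Matrix ι ι ℝ) (y : ι) (K : Finset ι) :
    Measurable fun x => wK (pe Q x) y K := by
  unfold wK
  have := fun S => bern_measurable (E := allE ι) (S := S) Q
  fun_prop

lemma innK_measurable (Q : Matrix ι ι ℝ) (y : ι) (K : Finset ι) :
    Measurable fun x => innK (pe Q x) y K := by
  unfold innK
  have := fun S => bern_measurable (E := inE K) (S := S) Q
  fun_prop

lemma prod_bdE {Q : Matrix ι ι ℝ} (hs : Q.IsSymm) (hoff : ∀ u v, u ≠ v → Q u v ≤ 0)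
    (K : Finset ι) (x : ι → ℝ) :
    ∏ e ∈ bdE K, (1 - pe Q x e) =
      Real.exp (∑ u ∈ K, ∑ v ∈ Kᶜ, 2 * Q u v * max (x u) 0 * max (x v) 0) := by
  rw [← Finset.sum_product', Real.exp_sum]
  symm
  refine Finset.prod_bij (fun p _ => s(p.1, p.2)) ?_ ?_ ?_ ?_
  · rintro ⟨u, v⟩ h
    simp only [Finset.mem_product, Finset.mem_compl] at h
    simp only [bdE, Finset.mem_filter, Finset.mem_univ, true_and, Sym2.mem_iff]
    exact ⟨⟨u, Or.inl rfl, h.1⟩, ⟨v, Or.inr rfl, h.2⟩⟩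
  · rintro ⟨u, v⟩ h ⟨u', v'⟩ h' he
    simp only [Finset.mem_product, Finset.mem_compl] at h h'
    simp only [Sym2.eq_iff] at he
    rcases he with ⟨rfl, rfl⟩ | ⟨rfl, rfl⟩
    · rfl
    · exact absurd h.1 h'.2
  · intro e he
    induction e with | _ u v => ?_
    simp only [bdE, Finset.mem_filter, Finset.mem_univ, true_and, Sym2.mem_iff] at he
    obtain ⟨⟨a, ha, haK⟩, b, hb, hbK⟩ := he
    by_cases hu : u ∈ K
    · have hv : v ∉ K := by rcases hb with rfl | rfl; exacts [absurd hu hbK, hbK]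
      exact ⟨(u, v), by simp [hu, hv], rfl⟩
    · have hv : v ∈ K := by rcases ha with rfl | rfl; exacts [absurd haK hu, haK]
      exact ⟨(v, u), by simp [hu, hv], Sym2.eq_swap⟩
  · rintro ⟨u, v⟩ h
    simp only [Finset.mem_product, Finset.mem_compl] at h
    have : u ≠ v := by rintro rfl; exact h.2 h.1
    rw [pe_mk, cond_eq hs hoff this]
    simp only [sub_sub_cancel]
    congr 1; ring

/-- Weight of the cluster of `y` being `K`, on the event that the field at `y` is positive. -/
def nK (Q : Matrix ι ι ℝ) (y : ι) (K : Finset ι) (x : ι → ℝ) : ℝ :=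
  if 0 < x y then wK (pe Q x) y K else 0

lemma nK_measurable (Q : Matrix ι ι ℝ) (y : ι) (K : Finset ι) : Measurable (nK Q y K) :=
  Measurable.ite (measurableSet_lt measurable_const (measurable_pi_apply y)) (wK_measurable Q y K)
    measurable_const

lemma nK_nonneg (Q : Matrix ι ι ℝ) (y : ι) (K : Finset ι) (x : ι → ℝ) : 0 ≤ nK Q y K x := by
  unfold nK; split_ifs
  exacts [wK_nonneg (pe_mem Q x) y K, le_rfl]

lemma nK_le_one (Q : Matrix ι ι ℝ) (y : ι) (K : Finset ι) (x : ι → ℝ) : nK Q y K x ≤ 1 := by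
  unfold nK; split_ifs
  exacts [wK_le_one (pe_mem Q x) y K, zero_le_one]

lemma nK_ne_zero {Q : Matrix ι ι ℝ} {y : ι} {K : Finset ι} {x : ι → ℝ} (h : nK Q y K x ≠ 0) :
    y ∈ K ∧ ∀ u ∈ K, 0 < x u := by
  unfold nK at h
  split_ifs at h with hy
  swap; · exact absurd rfl h
  refine ⟨by_contra fun hyK => h (wK_of_notMem _ hyK), fun u hu => ?_⟩
  by_contra hxu
  push Not at hxu
  refine h ?_
  rw [wK_eq, innK_eq_zero hu (fun hK => ?_) (fun v _ => pe_zero Q hxu v), zero_mul]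
  rw [hK, Finset.mem_singleton] at hu
  rw [hu] at hxu
  linarith

/-- The inner part of the weight. -/
def iK (Q : Matrix ι ι ℝ) (y : ι) (K : Finset ι) (x : ι → ℝ) : ℝ :=
  if y ∈ K ∧ ∀ u ∈ K, 0 < x u then innK (pe Q x) y K else 0

lemma iK_nonneg (Q : Matrix ι ι ℝ) (y : ι) (K : Finset ι) (x : ι → ℝ) : 0 ≤ iK Q y K x := by
  unfold iK; split_ifs
  exacts [innK_nonneg (pe_mem Q x) y K, le_rfl]

lemma iK_measurable (Q : Matrix ι ι ℝ) (y : ι) (K : Finset ι) : Measurable (iK Q y K) := by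
  refine Measurable.ite ?_ (innK_measurable Q y K) measurable_const
  by_cases hy : y ∈ K
  · simp only [hy, true_and]
    have : {x : ι → ℝ | ∀ u ∈ K, 0 < x u} = ⋂ u ∈ K, {x | 0 < x u} := by ext; simp
    rw [this]
    exact Finset.measurableSet_biInter K fun u _ =>
      measurableSet_lt measurable_const (measurable_pi_apply u)
  · simp [hy]

lemma iK_congr (Q : Matrix ι ι ℝ) (y : ι) (K : Finset ι) {x x' : ι → ℝ}
    (h : ∀ u ∈ K, x u = x' u) : iK Q y K x = iK Q y K x' := by
  unfold iK
  have h1 : (∀ u ∈ K, 0 < x u) ↔ ∀ u ∈ K, 0 < x' u :=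
    forall₂_congr fun u hu => by rw [h u hu]
  have h2 : innK (pe Q x) y K = innK (pe Q x') y K := innK_congr y K fun e he =>
    pe_congr Q fun u hu => h u ((Finset.mem_filter.1 he).2.2 u hu)
  rw [h2]
  simp only [h1]

lemma nK_eq {Q : Matrix ι ι ℝ} (hs : Q.IsSymm) (hoff : ∀ u v, u ≠ v → Q u v ≤ 0)
    (y : ι) (K : Finset ι) (x : ι → ℝ) :
    nK Q y K x = iK Q y K x *
      Real.exp (∑ u ∈ K, ∑ v ∈ Kᶜ, 2 * Q u v * x u * max (x v) 0) := by
  by_cases h : y ∈ K ∧ ∀ u ∈ K, 0 < x u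
  · rw [nK, if_pos (h.2 y h.1), wK_eq, prod_bdE hs hoff, iK, if_pos h]
    congr 2
    refine Finset.sum_congr rfl fun u hu => Finset.sum_congr rfl fun v _ => ?_
    rw [max_eq_left (h.2 u hu).le]
  · rw [iK, if_neg h, zero_mul]
    by_contra hn
    exact h (nK_ne_zero hn)

/-- Change of sign of the coordinates outside `K`. -/
def flipK (K : Finset ι) : (ι → ℝ) →ₗ[ℝ] (ι → ℝ) where
  toFun x := fun i => if i ∈ K then x i else -x i
  map_add' x y := by funext i; by_cases h : i ∈ K <;> simp [h]; ring
  map_smul' c x := by funext i; by_cases h : i ∈ K <;> simp [h]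

lemma flipK_apply (K : Finset ι) (x : ι → ℝ) (i : ι) :
    flipK K x i = if i ∈ K then x i else -x i := rfl

lemma flipK_flipK (K : Finset ι) (x : ι → ℝ) : flipK K (flipK K x) = x := by
  funext i; by_cases h : i ∈ K <;> simp [flipK_apply, h]

lemma qf_flipK {Q : Matrix ι ι ℝ} (hs : Q.IsSymm) (K : Finset ι) (x : ι → ℝ) :
    qf Q (flipK K x) = qf Q x - 4 * ∑ u ∈ K, ∑ v ∈ Kᶜ, Q u v * x u * x v := by
  have hsplit : ∀ F : ι → ι → ℝ, ∑ i, ∑ j, F i j =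
      (∑ i ∈ K, ∑ j ∈ K, F i j + ∑ i ∈ K, ∑ j ∈ Kᶜ, F i j) +
      (∑ i ∈ Kᶜ, ∑ j ∈ K, F i j + ∑ i ∈ Kᶜ, ∑ j ∈ Kᶜ, F i j) := by
    intro F
    simp_rw [← Finset.sum_add_distrib, Finset.sum_add_sum_compl]
  have hsw : ∑ i ∈ Kᶜ, ∑ j ∈ K, Q i j * x i * x j = ∑ u ∈ K, ∑ v ∈ Kᶜ, Q u v * x u * x v := by
    rw [Finset.sum_comm]
    refine Finset.sum_congr rfl fun u _ => Finset.sum_congr rfl fun v _ => ?_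
    rw [hs.apply u v]; ring
  rw [qf_eq_bf, bf_eq_sum, qf_eq_bf, bf_eq_sum, hsplit, hsplit (fun i j => Q i j * x i * x j)]
  have a1 : ∑ i ∈ K, ∑ j ∈ K, Q i j * flipK K x i * flipK K x j =
      ∑ i ∈ K, ∑ j ∈ K, Q i j * x i * x j :=
    Finset.sum_congr rfl fun i hi => Finset.sum_congr rfl fun j hj => by
      simp [flipK_apply, hi, hj]
  have a2 : ∑ i ∈ K, ∑ j ∈ Kᶜ, Q i j * flipK K x i * flipK K x j =
      -∑ i ∈ K, ∑ j ∈ Kᶜ, Q i j * x i * x j := by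
    simp_rw [← Finset.sum_neg_distrib]
    exact Finset.sum_congr rfl fun i hi => Finset.sum_congr rfl fun j hj => by
      simp [flipK_apply, hi, Finset.mem_compl.1 hj]
  have a3 : ∑ i ∈ Kᶜ, ∑ j ∈ K, Q i j * flipK K x i * flipK K x j =
      -∑ i ∈ Kᶜ, ∑ j ∈ K, Q i j * x i * x j := by
    simp_rw [← Finset.sum_neg_distrib]
    exact Finset.sum_congr rfl fun i hi => Finset.sum_congr rfl fun j hj => by
      simp [flipK_apply, hj, Finset.mem_compl.1 hi]
  have a4 : ∑ i ∈ Kᶜ, ∑ j ∈ Kᶜ, Q i j * flipK K x i * flipK K x j =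
      ∑ i ∈ Kᶜ, ∑ j ∈ Kᶜ, Q i j * x i * x j :=
    Finset.sum_congr rfl fun i hi => Finset.sum_congr rfl fun j hj => by
      simp [flipK_apply, Finset.mem_compl.1 hi, Finset.mem_compl.1 hj]
  rw [a1, a2, a3, a4, hsw]; ring

lemma dens_nK_flip {Q : Matrix ι ι ℝ} (hs : Q.IsSymm) (hoff : ∀ u v, u ≠ v → Q u v ≤ 0)
    (y : ι) (K : Finset ι) (x : ι → ℝ) :
    Real.exp (-(qf Q (flipK K x) / 2)) * nK Q y K (flipK K x) =
      Real.exp (-(qf Q x / 2)) * nK Q y K x := by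
  rw [nK_eq hs hoff, nK_eq hs hoff,
    iK_congr Q y K (x := flipK K x) (x' := x) (fun u hu => by simp [flipK_apply, hu]),
    mul_left_comm, mul_left_comm (Real.exp _), ← Real.exp_add, ← Real.exp_add, qf_flipK hs]
  congr 2
  rw [neg_div', neg_sub, sub_div, mul_comm (4 : ℝ), mul_div_assoc, Finset.sum_mul]
  rw [← sub_eq_zero]
  have : ∀ a b c d : ℝ, a - b + c - (-(b * 2 / 2) + d) = a + c - d := by intros; ring
  have e : ∑ u ∈ K, (∑ v ∈ Kᶜ, Q u v * x u * x v) * (4 / 2) +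
      ∑ u ∈ K, ∑ v ∈ Kᶜ, 2 * Q u v * flipK K x u * max (flipK K x v) 0 -
      ∑ u ∈ K, ∑ v ∈ Kᶜ, 2 * Q u v * x u * max (x v) 0 = 0 := by
    rw [← Finset.sum_add_distrib, ← Finset.sum_sub_distrib]
    refine Finset.sum_eq_zero fun u hu => ?_
    rw [Finset.sum_mul, ← Finset.sum_add_distrib, ← Finset.sum_sub_distrib]
    refine Finset.sum_eq_zero fun v hv => ?_
    simp only [flipK_apply, hu, Finset.mem_compl.1 hv, if_true, if_false]
    rcases le_total 0 (x v) with h | h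
    · rw [max_eq_right (by linarith), max_eq_left h]; ring
    · rw [max_eq_left (by linarith), max_eq_right h]; ring
  linarith

end Weights

end Perc

namespace Perc

section Involution

variable {E : Type*} [MeasurableSpace E]

lemma integral_comp_involution {μ : Measure E} {f : E → E} (hf : MeasurePreserving f μ μ)
    (hi : Function.Involutive f) (h : E → ℝ) : ∫ x, h (f x) ∂μ = ∫ x, h x ∂μ :=
  hf.integral_comp (MeasurableEquiv.measurableEmbedding
    ⟨hi.toPerm f, hf.measurable, hf.measurable⟩) h

lemma integrable_comp_preserving {μ : Measure E} {f : E → E} (hf : MeasurePreserving f μ μ)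
    {h : E → ℝ} (hh : Integrable h μ) : Integrable (fun x => h (f x)) μ :=
  hf.integrable_comp_of_integrable hh

end Involution

/-- A finite centred Gaussian vector with an M-matrix as precision matrix. -/
structure FG (ι : Type*) [Fintype ι] where
  Q : Matrix ι ι ℝ
  pd : Q.PosDef
  off : ∀ u v, u ≠ v → Q u v ≤ 0
  κ : ℝ≥0∞
  κ_ne_zero : κ ≠ 0
  κ_ne_top : κ ≠ ⊤
  prob : IsProbabilityMeasure (κ • gm Q)
  int : ∀ i, Integrable (fun x : ι → ℝ => x i) (κ • gm Q)

namespace FG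

variable {ι : Type*} [Fintype ι] (S : FG ι)

/-- The law of the Gaussian vector. -/
def μ : Measure (ι → ℝ) := S.κ • gm S.Q

instance : IsProbabilityMeasure S.μ := S.prob

lemma symm : S.Q.IsSymm := posDef_isSymm S.pd

lemma integrable_coord (i : ι) : Integrable (fun x : ι → ℝ => x i) S.μ := S.int i

lemma integral_eq (h : (ι → ℝ) → ℝ) :
    ∫ x, h x ∂S.μ = S.κ.toReal * ∫ x, Real.exp (-(qf S.Q x / 2)) * h x := by
  rw [μ, integral_smul_measure, gm,
    integral_withDensity_eq_integral_toReal_smul (gm_density_measurable S.Q)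
      (by simp)]
  simp only [smul_eq_mul, ENNReal.toReal_ofReal (Real.exp_nonneg _)]

lemma integral_flip (y : ι) (K : Finset ι) (h : (ι → ℝ) → ℝ) :
    ∫ x, h (flipK K x) * nK S.Q y K x ∂S.μ = ∫ x, h x * nK S.Q y K x ∂S.μ := by
  rw [S.integral_eq, S.integral_eq]
  congr 1
  rw [← integral_comp_involution
    (involutive_measurePreserving volume (flipK K) (flipK_flipK K)) (flipK_flipK K)]
  refine integral_congr_ae (Eventually.of_forall fun x => ?_)
  dsimp only
  have := dens_nK_flip S.symm S.off y K x
  rw [flipK_flipK]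
  linear_combination (h x) * this

lemma nK_integrable (y : ι) (K : Finset ι) : Integrable (nK S.Q y K) S.μ :=
  Integrable.of_bound (nK_measurable S.Q y K).aestronglyMeasurable 1
    (Eventually.of_forall fun x => by
      rw [Real.norm_of_nonneg (nK_nonneg _ _ _ _)]; exact nK_le_one _ _ _ _)

lemma mul_nK_integrable (y : ι) (K : Finset ι) {h : (ι → ℝ) → ℝ} (hh : Integrable h S.μ) :
    Integrable (fun x => h x * nK S.Q y K x) S.μ :=
  hh.mul_bdd (c := 1) (nK_measurable S.Q y K).aestronglyMeasurable
    (Eventually.of_forall fun x => by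
      rw [Real.norm_of_nonneg (nK_nonneg _ _ _ _)]; exact nK_le_one _ _ _ _)

/-- Probability that the cluster of `y` is `K` and the field at `y` is positive. -/
def D (y : ι) (K : Finset ι) : ℝ := ∫ x, nK S.Q y K x ∂S.μ

/-- Mean of the field at `z` on the event that the cluster of `y` is `K`. -/
def T (y : ι) (K : Finset ι) (z : ι) : ℝ := ∫ x, x z * nK S.Q y K x ∂S.μ

lemma D_nonneg (y : ι) (K : Finset ι) : 0 ≤ S.D y K :=
  integral_nonneg fun _ => nK_nonneg _ _ _ _

lemma T_of_notMem {y : ι} {K : Finset ι} {z : ι} (h : z ∉ K) : S.T y K z = 0 := by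
  have := S.integral_flip y K (fun x => x z)
  simp only [flipK_apply, if_neg h, neg_mul, integral_neg] at this
  unfold T
  linarith

lemma T_nonneg (y : ι) (K : Finset ι) (z : ι) : 0 ≤ S.T y K z := by
  by_cases h : z ∈ K
  · refine integral_nonneg fun x => ?_
    by_cases h' : nK S.Q y K x = 0
    · simp [h']
    · exact mul_nonneg ((nK_ne_zero h').2 z h).le (nK_nonneg _ _ _ _)
  · rw [S.T_of_notMem h]

/-- Weighted mean of the field at `z`. -/
def R (y : ι) (F : Finset ι → ℝ) (z : ι) : ℝ := ∑ K, F K * S.T y K z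

/-- The weight of the cluster of `y`. -/
def G (y : ι) (F : Finset ι → ℝ) (x : ι → ℝ) : ℝ := ∑ K, F K * nK S.Q y K x

lemma G_measurable (y : ι) (F : Finset ι → ℝ) : Measurable (S.G y F) := by
  unfold G
  have := nK_measurable S.Q y
  fun_prop

lemma G_antitone {y : ι} {F : Finset ι → ℝ} (hF : Antitone F) {x x' : ι → ℝ} (h : x ≤ x')
    (hy : x y = x' y) : S.G y F x' ≤ S.G y F x := by
  unfold G nK
  rw [hy]
  split_ifs
  · exact sum_mul_wK_antitone (fun e => ⟨(pe_mem _ _ e).1, pe_mono _ h e, (pe_mem _ _ e).2⟩) y hF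
  · simp

lemma mul_G_integrable (y : ι) (F : Finset ι → ℝ) {h : (ι → ℝ) → ℝ} (hh : Integrable h S.μ) :
    Integrable (fun x => h x * S.G y F x) S.μ := by
  unfold G
  simp only [Finset.mul_sum, mul_left_comm (h _)]
  exact integrable_finsetSum _ fun K _ => (S.mul_nK_integrable y K hh).const_mul _

lemma integral_mul_G (y : ι) (F : Finset ι → ℝ) {h : (ι → ℝ) → ℝ} (hh : Integrable h S.μ) :
    ∫ x, h x * S.G y F x ∂S.μ = ∑ K, F K * ∫ x, h x * nK S.Q y K x ∂S.μ := by
  unfold G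
  simp only [Finset.mul_sum, mul_left_comm (h _)]
  rw [integral_finsetSum _ fun K _ => (S.mul_nK_integrable y K hh).const_mul _]
  simp only [integral_const_mul]

lemma R_eq (y : ι) (F : Finset ι → ℝ) (z : ι) : S.R y F z = ∫ x, x z * S.G y F x ∂S.μ :=
  (S.integral_mul_G y F (S.integrable_coord z)).symm

/-- The (normalised) conditional residual of the field at `z`. -/
def res (z : ι) (x : ι → ℝ) : ℝ := S.Q.mulVec x z / S.Q z z

lemma diag_pos (z : ι) : 0 < S.Q z z := S.pd.diag_pos

lemma qf_add_single (z : ι) (x : ι → ℝ) (t : ℝ) :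
    qf S.Q (x + t • Pi.single z 1) = qf S.Q x + S.Q z z * (2 * t * S.res z x + t ^ 2) := by
  have h0 := (S.diag_pos z).ne'
  rw [qf_add S.symm, qf_smul]
  have h1 : bf S.Q (t • Pi.single z 1) x = t * S.Q.mulVec x z := by
    rw [bf_smul_left]; simp [bf]
  have h2 : qf S.Q (Pi.single z (1:ℝ)) = S.Q z z := by simp [qf]
  rw [bf_symm S.symm, h1, h2, res]
  field_simp
  ring

lemma res_add_single (z : ι) (x : ι → ℝ) (t : ℝ) :
    S.res z (x + t • Pi.single z 1) = S.res z x + t := by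
  have h0 := (S.diag_pos z).ne'
  rw [res, res, Matrix.mulVec_add, Matrix.mulVec_smul]
  simp
  field_simp

lemma res_smul (z : ι) (x : ι → ℝ) (t : ℝ) : S.res z (t • x) = t * S.res z x := by
  rw [res, res, Matrix.mulVec_smul]; simp; ring

lemma res_add (z : ι) (x x' : ι → ℝ) : S.res z (x + x') = S.res z x + S.res z x' := by
  rw [res, res, res, Matrix.mulVec_add]; simp; ring

lemma res_eq_sum (z : ι) (x : ι → ℝ) : S.res z x = ∑ v, S.Q z v / S.Q z z * x v := by
  rw [res, Matrix.mulVec, dotProduct, Finset.sum_div]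
  exact Finset.sum_congr rfl fun v _ => by ring

lemma res_integrable (z : ι) : Integrable (S.res z) S.μ := by
  have : S.res z = fun x => ∑ v, S.Q z v / S.Q z z * x v := funext fun x => S.res_eq_sum z x
  rw [this]
  exact integrable_finsetSum _ fun v _ => (S.integrable_coord v).const_mul _

/-- Reflection of the residual at `z`. -/
def refl (z : ι) : (ι → ℝ) →ₗ[ℝ] (ι → ℝ) where
  toFun x := x + (-2 * S.res z x) • Pi.single z 1
  map_add' x x' := by rw [res_add]; module
  map_smul' t x := by rw [res_smul]; simp only [RingHom.id_apply]; module

lemma refl_apply (z : ι) (x : ι → ℝ) :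
    S.refl z x = x + (-2 * S.res z x) • Pi.single z 1 := rfl

lemma res_refl (z : ι) (x : ι → ℝ) : S.res z (S.refl z x) = -S.res z x := by
  rw [refl_apply, res_add_single]; ring

lemma refl_refl (z : ι) (x : ι → ℝ) : S.refl z (S.refl z x) = x := by
  rw [S.refl_apply z (S.refl z x), res_refl, refl_apply]; module

lemma refl_measurePreserving (z : ι) : MeasurePreserving (S.refl z) S.μ S.μ := by
  have := gm_involutive S.Q (S.refl z) (S.refl_refl z) fun x => by
    rw [refl_apply, qf_add_single]; ring
  exact this.smul_measure S.κ

lemma add_single_apply_ne {y z : ι} (h : z ≠ y) (x : ι → ℝ) (t : ℝ) :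
    (x + t • Pi.single z (1:ℝ) : ι → ℝ) y = x y := by
  simp [Pi.single_eq_of_ne h.symm]

lemma add_single_mono (z : ι) (x : ι → ℝ) {t t' : ℝ} (h : t ≤ t') :
    x + t • Pi.single z (1:ℝ) ≤ x + t' • Pi.single z (1:ℝ) := by
  intro i
  by_cases hi : i = z
  · subst hi; simp [h]
  · simp [Pi.single_eq_of_ne hi]

lemma G_add_single {y z : ι} (hzy : z ≠ y) {F : Finset ι → ℝ} (hF : Antitone F) (x : ι → ℝ)
    {t t' : ℝ} (h : t ≤ t') :
    S.G y F (x + t' • Pi.single z 1) ≤ S.G y F (x + t • Pi.single z 1) :=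
  S.G_antitone hF (add_single_mono z x h)
    (by rw [add_single_apply_ne hzy, add_single_apply_ne hzy])

lemma res_mul_G_refl {y z : ι} (hzy : z ≠ y) {F : Finset ι → ℝ} (hF : Antitone F) (x : ι → ℝ) :
    S.res z x * S.G y F x ≤ S.res z x * S.G y F (S.refl z x) := by
  have e1 : S.G y F x = S.G y F (x + (0:ℝ) • Pi.single z 1) := by rw [zero_smul, add_zero]
  rw [e1, refl_apply]
  rcases le_total 0 (S.res z x) with h | h
  · exact mul_le_mul_of_nonneg_left (S.G_add_single hzy hF x (by linarith)) h
  · exact mul_le_mul_of_nonpos_left (S.G_add_single hzy hF x (by linarith)) h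

lemma R_superharmonic_aux (y z : ι) (F : Finset ι → ℝ) :
    ∑ v, S.Q z v * S.R y F v = S.Q z z * ∫ x, S.res z x * S.G y F x ∂S.μ := by
  simp only [R_eq]
  have : ∀ x, S.res z x * S.G y F x = ∑ v, S.Q z v / S.Q z z * (x v * S.G y F x) := fun x => by
    rw [res_eq_sum, Finset.sum_mul]; exact Finset.sum_congr rfl fun v _ => by ring
  simp only [this]
  rw [integral_finsetSum _ fun v _ =>
    (S.mul_G_integrable y F (S.integrable_coord v)).const_mul _, Finset.mul_sum]
  refine Finset.sum_congr rfl fun v _ => ?_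
  rw [integral_const_mul]
  have := (S.diag_pos z).ne'
  field_simp

lemma R_superharmonic {y z : ι} (hzy : z ≠ y) {F : Finset ι → ℝ} (hF : Antitone F) :
    ∑ v, S.Q z v * S.R y F v ≤ 0 := by
  rw [R_superharmonic_aux]
  refine mul_nonpos_of_nonneg_of_nonpos (S.diag_pos z).le ?_
  set h : (ι → ℝ) → ℝ := fun x => S.res z x * S.G y F x with hh
  have hi : Integrable h S.μ := S.mul_G_integrable y F (S.res_integrable z)
  have h2 : ∫ x, h (S.refl z x) ∂S.μ = ∫ x, h x ∂S.μ :=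
    integral_comp_involution (S.refl_measurePreserving z) (S.refl_refl z) h
  have hi2 : Integrable (fun x => h (S.refl z x)) S.μ :=
    integrable_comp_preserving (S.refl_measurePreserving z) hi
  have h3 : ∫ x, h x + h (S.refl z x) ∂S.μ = _ := integral_add hi hi2
  have h4 : ∫ x, h x + h (S.refl z x) ∂S.μ ≤ 0 := by
    refine integral_nonpos fun x => ?_
    have h5 := S.res_mul_G_refl hzy hF x
    simp only [Pi.zero_apply, hh, res_refl]
    linarith
  linarith

end FG

end Perc

namespace Perc

section Sign

/-- Real-valued sign. -/
def sg (t : ℝ) : ℝ := (if 0 < t then 1 else 0) - (if t < 0 then 1 else 0)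

lemma sg_neg (t : ℝ) : sg (-t) = -sg t := by
  simp only [sg, Left.neg_pos_iff, Left.neg_neg_iff]; ring

lemma sg_of_pos {t : ℝ} (h : 0 < t) : sg t = 1 := by simp [sg, h, h.le]

lemma sg_of_neg {t : ℝ} (h : t < 0) : sg t = -1 := by simp [sg, h, h.le]

lemma sg_mem (t : ℝ) : -1 ≤ sg t ∧ sg t ≤ 1 := by
  rcases lt_trichotomy t 0 with h | h | h
  · rw [sg_of_neg h]; norm_num
  · simp [sg, h]
  · rw [sg_of_pos h]; norm_num

lemma abs_sg_le (t : ℝ) : |sg t| ≤ 1 := abs_le.2 (sg_mem t)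

lemma sg_mono : Monotone sg := by
  intro s t h
  rcases lt_trichotomy s 0 with hs | hs | hs
  · rw [sg_of_neg hs]; exact (sg_mem t).1
  · rcases h.eq_or_lt with h | h
    · rw [h]
    · rw [sg_of_pos (hs.symm.trans_lt h)]; exact (sg_mem s).2
  · rw [sg_of_pos (hs.trans_le h)]; exact (sg_mem s).2

lemma sg_measurable : Measurable sg := sg_mono.measurable

variable (v : ℝ≥0)

/-- Mean sign of a Gaussian with mean `m`. -/
def theta (m : ℝ) : ℝ := ∫ t, sg (m + t) ∂(gaussianReal 0 v)

lemma sg_integrable (m : ℝ) : Integrable (fun t => sg (m + t)) (gaussianReal 0 v) :=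
  Integrable.of_bound (sg_measurable.comp (measurable_const_add m)).aestronglyMeasurable 1
    (Eventually.of_forall fun _ => abs_sg_le _)

lemma theta_neg (m : ℝ) : theta v (-m) = -theta v m := by
  have h : (gaussianReal 0 v).map (fun t => -t) = gaussianReal 0 v := by
    rw [gaussianReal_map_neg, neg_zero]
  rw [theta, theta, ← integral_neg]
  conv_lhs => rw [← h]
  have h2 := sg_measurable
  have h3 : Measurable fun t => sg (-m + t) := by fun_prop
  rw [integral_map measurable_neg.aemeasurable h3.aestronglyMeasurable]
  refine integral_congr_ae (Eventually.of_forall fun t => ?_)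
  dsimp only
  rw [← sg_neg]; congr 1; ring

lemma theta_mono : Monotone (theta v) := fun m m' h =>
  integral_mono (sg_integrable v m) (sg_integrable v m') fun t => sg_mono (by linarith)

lemma abs_theta_le (m : ℝ) : |theta v m| ≤ 1 := by
  have := norm_integral_le_of_norm_le_const (μ := gaussianReal 0 v) (f := fun t => sg (m + t))
    (C := 1) (Eventually.of_forall fun t => abs_sg_le _)
  simpa [theta] using this

variable {v}

lemma theta_sub_le (hv : v ≠ 0) {m m' : ℝ} (h : m ≤ m') :
    theta v m' - theta v m ≤ 2 * (√(2 * π * v))⁻¹ * (m' - m) := by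
  rw [theta, theta, ← integral_sub (sg_integrable v m') (sg_integrable v m)]
  have h1 : ∫ t, (sg (m' + t) - sg (m + t)) ∂gaussianReal 0 v ≤
      ∫ t, (Set.Icc (-m') (-m)).indicator (fun _ => (2:ℝ)) t ∂gaussianReal 0 v := by
    refine integral_mono ((sg_integrable v m').sub (sg_integrable v m))
      ((integrable_const 2).indicator measurableSet_Icc) fun t => ?_
    dsimp only
    by_cases ht : t ∈ Set.Icc (-m') (-m)
    · rw [Set.indicator_of_mem ht]
      linarith [(sg_mem (m' + t)).2, (sg_mem (m + t)).1]
    · rw [Set.indicator_of_notMem ht]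
      rw [Set.mem_Icc, not_and_or, not_le, not_le] at ht
      rcases ht with ht | ht
      · rw [sg_of_neg (by linarith : m' + t < 0), sg_of_neg (by linarith : m + t < 0)]; norm_num
      · rw [sg_of_pos (by linarith : 0 < m' + t), sg_of_pos (by linarith : 0 < m + t)]; norm_num
  refine h1.trans ?_
  rw [integral_indicator measurableSet_Icc, setIntegral_const, smul_eq_mul, mul_comm,
    mul_assoc]
  refine mul_le_mul_of_nonneg_left ?_ zero_le_two
  have hc : 0 ≤ (√(2 * π * v))⁻¹ := by positivity
  rw [measureReal_def, gaussianReal_apply 0 hv]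
  refine ENNReal.toReal_le_of_le_ofReal (mul_nonneg hc (by linarith)) ?_
  calc ∫⁻ t in Set.Icc (-m') (-m), gaussianPDF 0 v t
      ≤ ∫⁻ _ in Set.Icc (-m') (-m), ENNReal.ofReal (√(2 * π * v))⁻¹ := by
        refine lintegral_mono fun t => ENNReal.ofReal_le_ofReal ?_
        rw [gaussianPDFReal]
        refine mul_le_of_le_one_right hc (Real.exp_le_one_iff.2 ?_)
        exact div_nonpos_of_nonpos_of_nonneg (by nlinarith [sq_nonneg (t - 0)]) (by positivity)
    _ = _ := by
        rw [setLIntegral_const, Real.volume_Icc, ENNReal.ofReal_mul hc]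
        congr 2; ring

end Sign

namespace FG

variable {ι : Type*} [Fintype ι] (S : FG ι)

/-- Exchange of the residual at `z` with an independent copy. -/
def swapRes (z : ι) : ((ι → ℝ) × ℝ) →ₗ[ℝ] ((ι → ℝ) × ℝ) where
  toFun p := (p.1 + (p.2 - S.res z p.1) • Pi.single z 1, S.res z p.1)
  map_add' p q := by
    simp only [Prod.fst_add, Prod.snd_add, res_add, Prod.mk_add_mk, Prod.mk.injEq, and_true]
    module
  map_smul' t p := by
    simp only [Prod.smul_fst, Prod.smul_snd, res_smul, RingHom.id_apply, Prod.smul_mk,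
      Prod.mk.injEq, smul_eq_mul, and_true]
    module

lemma swapRes_apply (z : ι) (p : (ι → ℝ) × ℝ) :
    S.swapRes z p = (p.1 + (p.2 - S.res z p.1) • Pi.single z 1, S.res z p.1) := rfl

lemma swapRes_swapRes (z : ι) (p : (ι → ℝ) × ℝ) : S.swapRes z (S.swapRes z p) = p := by
  rw [S.swapRes_apply z (S.swapRes z p), swapRes_apply]
  dsimp only
  rw [res_add_single]
  refine Prod.ext ?_ ?_
  · dsimp only; module
  · dsimp only; ring

/-- Variance of the residual. -/
def var (z : ι) : ℝ≥0 := Real.toNNReal (S.Q z z)⁻¹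

lemma coe_var (z : ι) : (S.var z : ℝ) = (S.Q z z)⁻¹ :=
  Real.coe_toNNReal _ (inv_nonneg.2 (S.diag_pos z).le)

lemma var_ne_zero (z : ι) : S.var z ≠ 0 := by
  have := inv_pos.2 (S.diag_pos z)
  rw [← S.coe_var z] at this
  exact_mod_cast this.ne'

lemma swapRes_measurePreserving (z : ι) :
    MeasurePreserving (S.swapRes z) (S.μ.prod (gaussianReal 0 (S.var z)))
      (S.μ.prod (gaussianReal 0 (S.var z))) := by
  have hm : Measurable fun x : ι → ℝ => ENNReal.ofReal (Real.exp (-(qf S.Q x / 2))) :=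
    gm_density_measurable S.Q
  rw [μ, Measure.prod_smul_left, gm, gaussianReal_of_var_ne_zero _ (S.var_ne_zero z),
    prod_withDensity hm (measurable_gaussianPDF _ _)]
  refine MeasurePreserving.smul_measure ?_ S.κ
  refine measurePreserving_withDensity
    (involutive_measurePreserving _ (S.swapRes z) (S.swapRes_swapRes z)) ?_ ?_
  · exact (hm.comp measurable_fst).mul ((measurable_gaussianPDF _ _).comp measurable_snd)
  · rintro ⟨x, t⟩
    have h0 := (S.diag_pos z).ne'
    rw [swapRes_apply]
    dsimp only
    simp only [gaussianPDF, gaussianPDFReal, qf_add_single, coe_var]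
    rw [← ENNReal.ofReal_mul (Real.exp_nonneg _), ← ENNReal.ofReal_mul (Real.exp_nonneg _),
      mul_left_comm, ← Real.exp_add, mul_left_comm, ← Real.exp_add]
    congr 3
    field_simp
    ring

lemma G_bounded (y : ι) (F : Finset ι → ℝ) : ∃ C, ∀ x, |S.G y F x| ≤ C := by
  refine ⟨∑ K, |F K|, fun x => (Finset.abs_sum_le_sum_abs _ _).trans
    (Finset.sum_le_sum fun K _ => ?_)⟩
  rw [abs_mul, abs_of_nonneg (nK_nonneg S.Q y K x)]
  exact mul_le_of_le_one_right (abs_nonneg _) (nK_le_one _ _ _ _)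

/-- The conditional mean of the field at `z`. -/
def cm (z : ι) (x : ι → ℝ) : ℝ := x z - S.res z x

lemma cm_integrable (z : ι) : Integrable (S.cm z) S.μ :=
  (S.integrable_coord z).sub (S.res_integrable z)

lemma res_measurable (z : ι) : Measurable (S.res z) := by
  have : S.res z = fun x => ∑ v, S.Q z v / S.Q z z * x v := funext fun x => S.res_eq_sum z x
  rw [this]; fun_prop

lemma cm_measurable (z : ι) : Measurable (S.cm z) :=
  (measurable_pi_apply z).sub (S.res_measurable z)

lemma sg_correlation (z : ι) {y : ι} (hzy : z ≠ y) {F : Finset ι → ℝ} (hF : Antitone F) :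
    ∫ x, sg (x z) * S.G y F x ∂S.μ ≤ ∫ x, theta (S.var z) (S.cm z x) * S.G y F x ∂S.μ := by
  set γ := gaussianReal 0 (S.var z)
  obtain ⟨C, hC⟩ := S.G_bounded y F
  have hG := S.G_measurable y F
  have hsg := sg_measurable
  have hcm := S.cm_measurable z
  have hz : Measurable fun x : ι → ℝ => x z := measurable_pi_apply z
  set A : (ι → ℝ) × ℝ → ℝ := fun p => sg (p.1 z) * S.G y F p.1 with hA
  set B : (ι → ℝ) × ℝ → ℝ := fun p => sg (S.cm z p.1 + p.2) * S.G y F p.1 with hB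
  have bound : ∀ (s : ℝ) (x : ι → ℝ), ‖sg s * S.G y F x‖ ≤ C := fun s x => by
    rw [norm_mul]
    have := abs_sg_le s
    have h2 := hC x
    have h3 := abs_nonneg (S.G y F x)
    rw [Real.norm_eq_abs, Real.norm_eq_abs]
    nlinarith
  have hAi : Integrable A (S.μ.prod γ) := Integrable.of_bound
    (by fun_prop : Measurable A).aestronglyMeasurable C
    (Eventually.of_forall fun p => bound _ _)
  have hBi : Integrable B (S.μ.prod γ) := Integrable.of_bound
    (by fun_prop : Measurable B).aestronglyMeasurable C
    (Eventually.of_forall fun p => bound _ _)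
  have hmp : MeasurePreserving (S.swapRes z) (S.μ.prod γ) (S.μ.prod γ) :=
    S.swapRes_measurePreserving z
  have eA : ∫ p, A p ∂(S.μ.prod γ) = ∫ x, sg (x z) * S.G y F x ∂S.μ := by
    rw [integral_prod _ hAi]
    simp [hA]
  have eB : ∫ p, B p ∂(S.μ.prod γ) = ∫ x, theta (S.var z) (S.cm z x) * S.G y F x ∂S.μ := by
    rw [integral_prod _ hBi]
    simp only [hB, integral_mul_const, theta, γ]
  have sA : ∫ p, A (S.swapRes z p) ∂(S.μ.prod γ) = ∫ p, A p ∂(S.μ.prod γ) :=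
    integral_comp_involution hmp (S.swapRes_swapRes z) A
  have sB : ∫ p, B (S.swapRes z p) ∂(S.μ.prod γ) = ∫ p, B p ∂(S.μ.prod γ) :=
    integral_comp_involution hmp (S.swapRes_swapRes z) B
  have iA : Integrable (fun p => A (S.swapRes z p)) (S.μ.prod γ) :=
    integrable_comp_preserving hmp hAi
  have iB : Integrable (fun p => B (S.swapRes z p)) (S.μ.prod γ) :=
    integrable_comp_preserving hmp hBi
  have key : ∫ p, A p + A (S.swapRes z p) ∂(S.μ.prod γ) ≤
      ∫ p, B p + B (S.swapRes z p) ∂(S.μ.prod γ) := by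
    refine integral_mono (hAi.add iA) (hBi.add iB) ?_
    rintro ⟨x, t⟩
    simp only [hA, hB, swapRes_apply, cm, res_add_single]
    have e1 : (x + (t - S.res z x) • Pi.single z (1:ℝ) : ι → ℝ) z = x z + (t - S.res z x) := by
      simp
    rw [e1]
    have e2 : x z + (t - S.res z x) - (S.res z x + (t - S.res z x)) + S.res z x = x z := by ring
    have e3 : x z - S.res z x + t = x z + (t - S.res z x) := by ring
    rw [e2, e3]
    have e4 : S.G y F x = S.G y F (x + (0:ℝ) • Pi.single z 1) := by rw [zero_smul, add_zero]
    rcases le_total 0 (t - S.res z x) with h | h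
    · have h1 := S.G_add_single hzy hF x h
      rw [← e4] at h1
      have h2 : sg (x z) ≤ sg (x z + (t - S.res z x)) := sg_mono (by linarith)
      nlinarith
    · have h1 := S.G_add_single hzy hF x h
      rw [← e4] at h1
      have h2 : sg (x z + (t - S.res z x)) ≤ sg (x z) := sg_mono (by linarith)
      nlinarith
  rw [integral_add hAi iA, integral_add hBi iB, sA, sB, eA, eB] at key
  linarith

lemma cm_eq_sum (z : ι) (x : ι → ℝ) :
    S.cm z x = ∑ v ∈ Finset.univ.erase z, -S.Q z v / S.Q z z * x v := by
  have h0 := (S.diag_pos z).ne'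
  rw [cm, res_eq_sum, ← Finset.add_sum_erase _ _ (Finset.mem_univ z), div_self h0]
  simp only [neg_div, neg_mul, Finset.sum_neg_distrib]
  ring

lemma cm_add_flip_nonneg (z : ι) {K : Finset ι} {x : ι → ℝ} (h : ∀ u ∈ K, 0 < x u) :
    0 ≤ S.cm z x + S.cm z (flipK K x) := by
  rw [cm_eq_sum, cm_eq_sum, ← Finset.sum_add_distrib]
  refine Finset.sum_nonneg fun v hv => ?_
  rw [← mul_add]
  refine mul_nonneg (div_nonneg ?_ (S.diag_pos z).le) ?_
  · linarith [S.off z v (Finset.ne_of_mem_erase hv).symm]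
  · rw [flipK_apply]
    split_ifs with hK
    · linarith [h v hK]
    · linarith

lemma theta_le_linear (z y : ι) (K : Finset ι) :
    ∫ x, theta (S.var z) (S.cm z x) * nK S.Q y K x ∂S.μ ≤
      2 * (√(2 * π * S.var z))⁻¹ * ∫ x, S.cm z x * nK S.Q y K x ∂S.μ := by
  set c := 2 * (√(2 * π * S.var z))⁻¹ with hc
  have ht : Integrable (fun x => theta (S.var z) (S.cm z x)) S.μ := Integrable.of_bound
    ((theta_mono _).measurable.comp (S.cm_measurable z)).aestronglyMeasurable 1
    (Eventually.of_forall fun x => abs_theta_le _ _)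
  set r : (ι → ℝ) → ℝ := fun x => c * S.cm z x - theta (S.var z) (S.cm z x) with hr
  have hri : Integrable r S.μ := ((S.cm_integrable z).const_mul c).sub ht
  have h1 : ∫ x, r x * nK S.Q y K x ∂S.μ = c * ∫ x, S.cm z x * nK S.Q y K x ∂S.μ -
      ∫ x, theta (S.var z) (S.cm z x) * nK S.Q y K x ∂S.μ := by
    rw [← integral_const_mul, ← integral_sub
      ((S.mul_nK_integrable y K (S.cm_integrable z)).const_mul c) (S.mul_nK_integrable y K ht)]
    refine integral_congr_ae (Eventually.of_forall fun x => ?_)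
    simp only [hr]; ring
  have h2 := S.integral_flip y K r
  have hcf : Integrable (fun x => S.cm z (flipK K x)) S.μ := by
    simp only [cm_eq_sum, flipK_apply]
    refine integrable_finsetSum _ fun v _ => ?_
    split_ifs
    · exact (S.integrable_coord v).const_mul _
    · exact (S.integrable_coord v).neg.const_mul _
  have htf : Integrable (fun x => theta (S.var z) (S.cm z (flipK K x))) S.μ :=
    Integrable.of_bound (((theta_mono _).measurable.comp_aemeasurable hcf.aemeasurable)
      |>.aestronglyMeasurable) 1 (Eventually.of_forall fun x => abs_theta_le _ _)
  have hrf : Integrable (fun x => r (flipK K x)) S.μ := (hcf.const_mul c).sub htf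
  have h3 : 0 ≤ ∫ x, (r x * nK S.Q y K x + r (flipK K x) * nK S.Q y K x) ∂S.μ := by
    refine integral_nonneg fun x => ?_
    by_cases h : nK S.Q y K x = 0
    · simp [h]
    · have hm := S.cm_add_flip_nonneg z (nK_ne_zero h).2
      have hn := nK_nonneg S.Q y K x
      have h5 := theta_sub_le (S.var_ne_zero z) (by linarith : -S.cm z x ≤ S.cm z (flipK K x))
      rw [theta_neg, ← hc] at h5
      have h6 : 0 ≤ r x + r (flipK K x) := by simp only [hr]; linarith
      simp only [Pi.zero_apply]
      nlinarith
  rw [integral_add (S.mul_nK_integrable y K hri) (S.mul_nK_integrable y K hrf), h2] at h3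
  linarith

lemma cm_mul_G (y z : ι) (F : Finset ι → ℝ) :
    ∑ K, F K * ∫ x, S.cm z x * nK S.Q y K x ∂S.μ =
      ∑ v ∈ Finset.univ.erase z, -S.Q z v / S.Q z z * S.R y F v := by
  rw [← S.integral_mul_G y F (S.cm_integrable z)]
  simp only [R_eq, cm_eq_sum, Finset.sum_mul, mul_assoc]
  rw [integral_finsetSum _ fun v _ =>
    (S.mul_G_integrable y F (S.integrable_coord v)).const_mul _]
  simp only [integral_const_mul]

lemma sg_mul_nK (y z : ι) (K : Finset ι) :
    ∫ x, sg (x z) * nK S.Q y K x ∂S.μ = if z ∈ K then S.D y K else 0 := by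
  split_ifs with h
  · refine integral_congr_ae (Eventually.of_forall fun x => ?_)
    dsimp only
    by_cases h' : nK S.Q y K x = 0
    · simp [h']
    · rw [sg_of_pos ((nK_ne_zero h').2 z h), one_mul]
  · have := S.integral_flip y K (fun x => sg (x z))
    simp only [flipK_apply, if_neg h, sg_neg, neg_mul, integral_neg] at this
    linarith

/-- The hitting weight is controlled by the weighted field around the target. -/
lemma sum_D_le {y z : ι} (hzy : z ≠ y) {F : Finset ι → ℝ} (hF : Antitone F) (h0 : ∀ K, 0 ≤ F K) :
    ∑ K, F K * (if z ∈ K then S.D y K else 0) ≤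
      2 * √(S.Q z z) * ∑ v ∈ Finset.univ.erase z, -S.Q z v / S.Q z z * S.R y F v := by
  have hsgi : Integrable (fun x : ι → ℝ => sg (x z)) S.μ := Integrable.of_bound
    (sg_measurable.comp (measurable_pi_apply z)).aestronglyMeasurable 1
    (Eventually.of_forall fun x => abs_sg_le _)
  have hti : Integrable (fun x => theta (S.var z) (S.cm z x)) S.μ := Integrable.of_bound
    ((theta_mono _).measurable.comp (S.cm_measurable z)).aestronglyMeasurable 1
    (Eventually.of_forall fun x => abs_theta_le _ _)
  have h1 := S.sg_correlation z hzy hF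
  rw [S.integral_mul_G y F hsgi, S.integral_mul_G y F hti] at h1
  simp only [sg_mul_nK] at h1
  refine h1.trans ?_
  set c := 2 * (√(2 * π * S.var z))⁻¹ with hc
  have h2 : ∑ K, F K * ∫ x, theta (S.var z) (S.cm z x) * nK S.Q y K x ∂S.μ ≤
      c * ∑ v ∈ Finset.univ.erase z, -S.Q z v / S.Q z z * S.R y F v := by
    rw [← cm_mul_G, Finset.mul_sum]
    refine Finset.sum_le_sum fun K _ => ?_
    rw [mul_left_comm]
    exact mul_le_mul_of_nonneg_left (S.theta_le_linear z y K) (h0 K)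
  refine h2.trans (mul_le_mul_of_nonneg_right ?_ (Finset.sum_nonneg fun v hv =>
    mul_nonneg (div_nonneg ?_ (S.diag_pos z).le)
      (Finset.sum_nonneg fun K _ => mul_nonneg (h0 K) (S.T_nonneg y K v))))
  · rw [hc, ← Real.sqrt_inv, coe_var, mul_inv, inv_inv]
    refine mul_le_mul_of_nonneg_left (Real.sqrt_le_sqrt ?_) zero_le_two
    refine mul_le_of_le_one_left (S.diag_pos z).le (inv_le_one_of_one_le₀ ?_)
    linarith [Real.pi_gt_three]
  · linarith [S.off z v (Finset.ne_of_mem_erase hv).symm]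

lemma R_nonneg {y : ι} {F : Finset ι → ℝ} (h0 : ∀ K, 0 ≤ F K) (z : ι) : 0 ≤ S.R y F z :=
  Finset.sum_nonneg fun K _ => mul_nonneg (h0 K) (S.T_nonneg y K z)

lemma R_mono {y : ι} {F F' : Finset ι → ℝ} (z : ι) (h : ∀ K, z ∈ K → F K ≤ F' K) :
    S.R y F z ≤ S.R y F' z := by
  refine Finset.sum_le_sum fun K _ => ?_
  by_cases hz : z ∈ K
  · exact mul_le_mul_of_nonneg_right (h K hz) (S.T_nonneg y K z)
  · rw [S.T_of_notMem hz, mul_zero, mul_zero]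

lemma R_congr {y : ι} {F F' : Finset ι → ℝ} (z : ι) (h : ∀ K, z ∈ K → F K = F' K) :
    S.R y F z = S.R y F' z :=
  le_antisymm (S.R_mono z fun K hK => (h K hK).le) (S.R_mono z fun K hK => (h K hK).ge)

lemma G_one (y : ι) (x : ι → ℝ) : S.G y (fun _ => 1) x = if 0 < x y then 1 else 0 := by
  simp only [G, nK, one_mul]
  split_ifs
  · exact sum_wK _ y
  · simp

lemma R_le {y : ι} {F : Finset ι → ℝ} {c : ℝ} (h : ∀ K, y ∈ K → F K ≤ c)
    (hc : 0 ≤ c) : S.R y F y ≤ c * ∫ x, |x y| ∂S.μ := by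
  have h1 : S.R y F y ≤ S.R y (fun _ => c) y := S.R_mono y h
  refine h1.trans ?_
  have h2 : S.R y (fun _ => c) y = c * S.R y (fun _ => 1) y := by
    simp [R, Finset.mul_sum]
  rw [h2]
  refine mul_le_mul_of_nonneg_left ?_ hc
  rw [R_eq]
  refine integral_mono (S.mul_G_integrable y _ (S.integrable_coord y)) (S.integrable_coord y).abs
    fun x => ?_
  dsimp only
  rw [G_one]
  split_ifs
  · rw [mul_one]; exact le_abs_self _
  · rw [mul_zero]; exact abs_nonneg _

lemma sum_D (y : ι) : ∑ K, S.D y K = S.μ.real {x | 0 < x y} := by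
  have h := S.integral_mul_G y (fun _ => 1) (h := fun _ => 1) (integrable_const 1)
  simp only [one_mul, G_one] at h
  have hm : MeasurableSet {x : ι → ℝ | 0 < x y} :=
    measurableSet_lt measurable_const (measurable_pi_apply y)
  have h2 : (fun x : ι → ℝ => if 0 < x y then (1:ℝ) else 0) =
      {x : ι → ℝ | 0 < x y}.indicator (fun _ => 1) := by
    funext x; simp [Set.indicator]
  rw [h2, integral_indicator hm] at h
  simp only [integral_const, smul_eq_mul, mul_one] at h
  rw [← show S.μ.real {x | 0 < x y} = ∑ K, S.D y K from by simpa [D] using h]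

/-- Cost of shifting the field on a cluster. -/
lemma shift_D_le (y : ι) (K : Finset ι) (a c : ℝ) (h1 : ∀ u ∈ K, 0 ≤ a * S.Q.mulVec 1 u)
    (hc : ∀ h : ι → ℝ, (∀ u ∈ K, h u = 1) → c ≤ qf S.Q h) :
    ∫ x, nK S.Q y K (x - a • 1) ∂S.μ ≤ Real.exp (-(a ^ 2 * c / 2)) * S.D y K := by
  have h := shift_cluster_le S.pd S.off K a c h1 (f := fun x => ENNReal.ofReal (iK S.Q y K x))
    (iK_measurable S.Q y K).ennreal_ofReal
    (fun x x' hx => by rw [iK_congr S.Q y K hx])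
    (fun x hx => by
      obtain ⟨u, hu, hxu⟩ := hx
      rw [iK, if_neg (fun h => absurd (h.2 u hu) (not_lt.2 hxu)), ENNReal.ofReal_zero]) hc
  have hn : ∀ x, ENNReal.ofReal (iK S.Q y K x) * ENNReal.ofReal
      (Real.exp (∑ u ∈ K, ∑ v ∈ Kᶜ, 2 * S.Q u v * x u * max (x v) 0)) =
      ENNReal.ofReal (nK S.Q y K x) := fun x => by
    rw [← ENNReal.ofReal_mul (iK_nonneg _ _ _ _), nK_eq S.symm S.off]
  simp only [hn] at h
  have hme := gm_density_measurable S.Q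
  have hmn := nK_measurable S.Q y K
  have hsh : ∫⁻ x, ENNReal.ofReal (Real.exp (-(qf S.Q (x + a • 1) / 2))) *
      ENNReal.ofReal (nK S.Q y K x) =
      ∫⁻ x, ENNReal.ofReal (Real.exp (-(qf S.Q x / 2))) *
        ENNReal.ofReal (nK S.Q y K (x - a • 1)) := by
    rw [← lintegral_sub_right_eq_self _ (a • (1 : ι → ℝ))]
    simp only [sub_add_cancel]
  rw [hsh] at h
  have e1 : ∀ f : (ι → ℝ) → ℝ, Measurable f → (∀ x, 0 ≤ f x) → ∫ x, f x ∂S.μ =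
      (S.κ * ∫⁻ x, ENNReal.ofReal (Real.exp (-(qf S.Q x / 2))) * ENNReal.ofReal (f x)).toReal := by
    intro f hf h0
    rw [integral_eq_lintegral_of_nonneg_ae (Eventually.of_forall h0) hf.aestronglyMeasurable, μ,
      lintegral_smul_measure, lintegral_gm _ hf.ennreal_ofReal, smul_eq_mul]
  have hms : Measurable fun x : ι → ℝ => nK S.Q y K (x - a • 1) := by fun_prop
  rw [D, e1 _ hms (fun x => nK_nonneg _ _ _ _), e1 _ hmn (fun x => nK_nonneg _ _ _ _)]
  have hfin : S.κ * ∫⁻ x, ENNReal.ofReal (Real.exp (-(qf S.Q x / 2))) *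
      ENNReal.ofReal (nK S.Q y K x) ≠ ⊤ := by
    have hi := (S.nK_integrable y K).lintegral_lt_top
    rw [μ, lintegral_smul_measure, lintegral_gm _ hmn.ennreal_ofReal, smul_eq_mul] at hi
    exact hi.ne
  rw [← ENNReal.toReal_ofReal (Real.exp_nonneg (-(a ^ 2 * c / 2))), ← ENNReal.toReal_mul]
  refine ENNReal.toReal_mono (ENNReal.mul_ne_top ENNReal.ofReal_ne_top hfin) ?_
  rw [mul_left_comm]
  exact mul_le_mul_right h _

end FG

end Perc

namespace Perc

section Walk

variable (M : WGraph)

/-- Neighbours, including the vertex itself in case of a self-loop. -/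
def nbs (x : M.V) : Finset M.V := (M.locFin x).toFinset

lemma mem_nbs {x y : M.V} : y ∈ nbs M x ↔ 0 < M.lam x y := by
  rw [nbs, Set.Finite.mem_toFinset, Function.mem_support]
  exact ⟨fun h => lt_of_le_of_ne (M.lam_nonneg x y) h.symm, fun h => h.ne'⟩

lemma mem_nbs_comm {x y : M.V} : y ∈ nbs M x ↔ x ∈ nbs M y := by
  rw [mem_nbs, mem_nbs, M.lam_symm]

lemma lam_eq_zero {x y : M.V} (h : y ∉ nbs M x) : M.lam x y = 0 := by
  rw [mem_nbs, not_lt] at h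
  exact le_antisymm h (M.lam_nonneg x y)

lemma lamTot_eq (x : M.V) : M.lamTot x = ∑ y ∈ nbs M x, M.lam x y :=
  finsum_eq_sum_of_support_subset _ (by simp [nbs])

lemma lamTot_nonneg (x : M.V) : 0 ≤ M.lamTot x := by
  rw [lamTot_eq]; exact Finset.sum_nonneg fun y _ => M.lam_nonneg x y

lemma p_eq_zero {x y : M.V} (h : y ∉ nbs M x) : M.p x y = 0 := by
  rw [WGraph.p, lam_eq_zero M h, zero_div]

lemma p_nonneg (x y : M.V) : 0 ≤ M.p x y := div_nonneg (M.lam_nonneg x y) (lamTot_nonneg M x)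

lemma pstep_succ (n : ℕ) (x y : M.V) :
    M.pstep (n + 1) x y = ∑ z ∈ nbs M x, M.p x z * M.pstep n z y := by
  rw [WGraph.pstep]
  refine finsum_eq_sum_of_support_subset _ fun z hz => ?_
  by_contra h
  exact hz (by simp [p_eq_zero M h])

lemma pstep_nonneg (n : ℕ) (x y : M.V) : 0 ≤ M.pstep n x y := by
  induction n generalizing x with
  | zero => rw [WGraph.pstep]; split_ifs <;> norm_num
  | succ n ih =>
    rw [pstep_succ]
    exact Finset.sum_nonneg fun z _ => mul_nonneg (p_nonneg M x z) (ih z)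

lemma pstep_succ' (n : ℕ) (x y : M.V) :
    M.pstep (n + 1) x y = ∑ z ∈ nbs M y, M.pstep n x z * M.p z y := by
  induction n generalizing x with
  | zero =>
    rw [pstep_succ]
    simp only [WGraph.pstep, mul_ite, mul_one, mul_zero, ite_mul, one_mul, zero_mul,
      Finset.sum_ite_eq', Finset.sum_ite_eq]
    by_cases h : y ∈ nbs M x
    · rw [if_pos h, if_pos ((mem_nbs_comm M).1 h)]
    · rw [if_neg h, if_neg fun h' => h ((mem_nbs_comm M).2 h')]
  | succ n ih =>
    rw [pstep_succ]
    simp only [ih, Finset.mul_sum]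
    rw [Finset.sum_comm]
    refine Finset.sum_congr rfl fun z _ => ?_
    rw [pstep_succ, Finset.sum_mul]
    exact Finset.sum_congr rfl fun u _ => by ring

lemma lamTot_mul_p {x : M.V} (h : M.lamTot x ≠ 0) (y : M.V) :
    M.lamTot x * M.p x y = M.lam x y := by rw [WGraph.p]; field_simp

lemma pstep_reversible (h : ∀ x, M.lamTot x ≠ 0) (n : ℕ) (x y : M.V) :
    M.lamTot x * M.pstep n x y = M.lamTot y * M.pstep n y x := by
  induction n generalizing x with
  | zero =>
    simp only [WGraph.pstep, eq_comm (a := y) (b := x)]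
    split_ifs with hxy
    · rw [hxy]
    · simp
  | succ n ih =>
    rw [pstep_succ, pstep_succ', Finset.mul_sum, Finset.mul_sum]
    refine Finset.sum_congr rfl fun z _ => ?_
    rw [← mul_assoc, lamTot_mul_p M (h x), ← mul_assoc, ← ih z]
    rw [mul_right_comm, lamTot_mul_p M (h z), M.lam_symm]

lemma p_pos (h : ∀ x, M.lamTot x ≠ 0) {x y : M.V} (hxy : 0 < M.lam x y) : 0 < M.p x y :=
  div_pos hxy (lt_of_le_of_ne (lamTot_nonneg M x) (h x).symm)

lemma pstep_summable (hT : M.Transient) (h : ∀ x, M.lamTot x ≠ 0) (x y : M.V) :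
    Summable fun n => M.pstep n x y := by
  induction M.connectedG y x with
  | refl => exact hT y
  | @tail u v _ huv ih =>
    have hp := p_pos M h huv
    refine Summable.of_nonneg_of_le (fun n => pstep_nonneg M n v y) (fun n => ?_)
      (((summable_nat_add_iff 1).2 ih).mul_left (M.p u v)⁻¹)
    rw [pstep_succ, inv_mul_eq_div, le_div_iff₀ hp, mul_comm]
    exact Finset.single_le_sum (f := fun z => M.p u z * M.pstep n z y)
      (fun z _ => mul_nonneg (p_nonneg M u z) (pstep_nonneg M n z y)) ((mem_nbs M).2 huv)

lemma green_nonneg (x y : M.V) : 0 ≤ M.green x y :=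
  div_nonneg (tsum_nonneg fun n => pstep_nonneg M n x y) (lamTot_nonneg M y)

lemma green_symm (h : ∀ x, M.lamTot x ≠ 0) (x y : M.V) : M.green x y = M.green y x := by
  have h1 : M.lamTot x * ∑' n, M.pstep n x y = M.lamTot y * ∑' n, M.pstep n y x := by
    rw [← tsum_mul_left, ← tsum_mul_left]
    exact tsum_congr fun n => pstep_reversible M h n x y
  have hx := h x
  have hy := h y
  rw [WGraph.green, WGraph.green]
  field_simp
  linarith

lemma green_harmonic (hT : M.Transient) (h : ∀ x, M.lamTot x ≠ 0) (x y : M.V) :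
    M.lamTot x * M.green x y = (if x = y then 1 else 0) +
      ∑ z ∈ nbs M x, M.lam x z * M.green z y := by
  have h1 : ∑' n, M.pstep n x y = (if x = y then 1 else 0) +
      ∑ z ∈ nbs M x, M.p x z * ∑' n, M.pstep n z y := by
    rw [(pstep_summable M hT h x y).tsum_eq_zero_add]
    congr 1
    simp only [pstep_succ]
    rw [Summable.tsum_finsetSum fun z _ => (pstep_summable M hT h z y).mul_left _]
    simp only [tsum_mul_left]
  have hx := h x
  have hy := h y
  rw [WGraph.green, h1, add_div, mul_add, Finset.sum_div, Finset.mul_sum]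
  congr 1
  · split_ifs with hxy
    · rw [hxy, mul_one_div_cancel hy]
    · simp
  · refine Finset.sum_congr rfl fun z _ => ?_
    rw [WGraph.green, ← lamTot_mul_p M hx z]
    ring

end Walk

section Positivity

variable (M : Model)

lemma phi_memLp (x : M.V) : MemLp (fun ω => M.φ ω x) 2 M.P := by
  have h := M.φ_gauss {x} (fun _ => 1)
  simp only [Finset.sum_singleton, one_mul] at h
  have hm : MemLp (id : ℝ → ℝ) 2 (M.P.map fun ω => M.φ ω x) := by
    rw [h]; exact memLp_id_gaussianReal 2
  exact (memLp_map_measure_iff aestronglyMeasurable_id (M.φ_meas x).aemeasurable).1 hm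

lemma phi_comb_sq (s : Finset M.V) (c : M.V → ℝ) :
    ∫ ω, (∑ x ∈ s, c x * M.φ ω x) ^ 2 ∂M.P =
      max (∑ x ∈ s, ∑ y ∈ s, c x * c y * M.green x y) 0 := by
  have hφ := M.φ_meas
  have hm : Measurable fun ω => ∑ x ∈ s, c x * M.φ ω x := by fun_prop
  have h2 : ∫ t, t ^ 2 ∂(M.P.map fun ω => ∑ x ∈ s, c x * M.φ ω x) =
      ∫ ω, (∑ x ∈ s, c x * M.φ ω x) ^ 2 ∂M.P := integral_map hm.aemeasurable (by fun_prop)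
  rw [← h2, M.φ_gauss]
  have h3 := variance_id_gaussianReal (μ := 0)
    (v := Real.toNNReal (∑ x ∈ s, ∑ y ∈ s, c x * c y * M.green x y))
  rw [variance_of_integral_eq_zero (by fun_prop) (by simp)] at h3
  simp only [id] at h3
  rw [h3]; rfl

lemma green_psd (hpos : ∀ x, 0 < M.green x x) (s : Finset M.V) (c : M.V → ℝ) :
    0 ≤ ∑ x ∈ s, ∑ y ∈ s, c x * c y * M.green x y := by
  by_contra hneg
  push Not at hneg
  rcases s.eq_empty_or_nonempty with rfl | ⟨o, ho⟩
  · simp at hneg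
  set b : (M.V → ℝ) → (M.V → ℝ) → ℝ := fun c c' => ∑ x ∈ s, ∑ y ∈ s, c x * c' y * M.green x y
    with hb
  have hi : ∀ c : M.V → ℝ, MemLp (fun ω => ∑ x ∈ s, c x * M.φ ω x) 2 M.P := fun c =>
    memLp_finsetSum s fun x _ => (phi_memLp M x).const_mul (c x)
  set e : M.V → ℝ := fun x => if x = o then 1 else 0 with he
  have hee : b e e = M.green o o := by
    simp [hb, he, ho]
  have h0 : (fun ω => (∑ x ∈ s, c x * M.φ ω x) ^ 2) =ᵐ[M.P] 0 := by
    refine (integral_eq_zero_iff_of_nonneg (fun ω => sq_nonneg _) (hi c).integrable_sq).1 ?_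
    rw [phi_comb_sq, max_eq_right hneg.le]
  have h1 : ∀ t : ℝ, max (b (e + t • c) (e + t • c)) 0 = max (b e e) 0 := by
    intro t
    rw [← phi_comb_sq, ← phi_comb_sq]
    refine integral_congr_ae ?_
    filter_upwards [h0] with ω hω
    have : ∑ x ∈ s, c x * M.φ ω x = 0 := by simpa using hω
    simp only [Pi.add_apply, Pi.smul_apply, smul_eq_mul, add_mul, mul_assoc, Finset.sum_add_distrib,
      ← Finset.mul_sum, this]
    ring
  have h2 : ∀ t : ℝ, b (e + t • c) (e + t • c) = b e e + t * (b e c + b c e) + t ^ 2 * b c c := by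
    intro t
    simp only [hb, Finset.mul_sum, ← Finset.sum_add_distrib]
    refine Finset.sum_congr rfl fun x _ => Finset.sum_congr rfl fun y _ => ?_
    simp only [Pi.add_apply, Pi.smul_apply, smul_eq_mul]
    ring
  have hp : 0 < b e e := by rw [hee]; exact hpos o
  have h3 : ∀ t : ℝ, t * (b e c + b c e) + t ^ 2 * b c c = 0 := by
    intro t
    have := h1 t
    rw [max_eq_left hp.le] at this
    rcases max_choice (b (e + t • c) (e + t • c)) 0 with h | h
    · rw [h, h2] at this; linarith
    · rw [h] at this; linarith
  have h4 := h3 1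
  have h5 := h3 (-1)
  have : b c c = 0 := by linarith
  exact hneg.ne this

end Positivity

end Perc

namespace Perc

/-- Truncated distance profile. -/
def rho (t : ℝ) : ℝ := max t 1

lemma one_le_rho (t : ℝ) : 1 ≤ rho t := le_max_right _ _

lemma rho_pos (t : ℝ) : 0 < rho t := zero_lt_one.trans_le (one_le_rho t)

lemma le_rho (t : ℝ) : t ≤ rho t := le_max_left _ _

/-- A transient network with polynomial volume growth and Green's function decay, with uniform
constants. -/
structure Net (V : Type) where
  w : V → V → ℝ
  w_nonneg : ∀ x y, 0 ≤ w x y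
  w_symm : ∀ x y, w x y = w y x
  w_self : ∀ x, w x x = 0
  nb : V → Finset V
  mem_nb : ∀ x y, y ∈ nb x ↔ 0 < w x y
  W : V → ℝ
  W_eq : ∀ x, W x = ∑ z ∈ nb x, w x z
  g : V → V → ℝ
  g_symm : ∀ x y, g x y = g y x
  d : V → V → ℝ
  d_symm : ∀ x y, d x y = d y x
  d_self : ∀ x, d x x = 0
  d_nonneg : ∀ x y, 0 ≤ d x y
  d_triangle : ∀ x y z, d x z ≤ d x y + d y z
  α : ℝ
  ν : ℝ
  one_le_ν : 1 ≤ ν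
  two_ν_le : 2 * ν ≤ α
  A : ℝ
  one_le_A : 1 ≤ A
  W_ge : ∀ x, 1 ≤ A * W x
  W_le : ∀ x, W x ≤ A
  g_le : ∀ x y, g x y ≤ A * rho (d x y) ^ (-ν)
  g_ge : ∀ x y, rho (d x y) ^ (-ν) ≤ A * g x y
  Lg : ∀ x y, W x * g x y = (if x = y then 1 else 0) + ∑ z ∈ nb x, w x z * g z y
  w_d : ∀ x y, 0 < w x y → d x y ≤ A
  bal : V → ℝ → Finset V
  mem_bal : ∀ x r y, y ∈ bal x r ↔ d x y ≤ r
  card_le : ∀ x r, 1 ≤ r → ((bal x r).card : ℝ) ≤ A * r ^ α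
  card_ge : ∀ x r, 1 ≤ r → r ^ α ≤ A * (bal x r).card
  conn : ∀ x y, Relation.ReflTransGen (fun u v => 0 < w u v) x y
  psd : ∀ (s : Finset V) (c : V → ℝ), 0 ≤ ∑ x ∈ s, ∑ y ∈ s, c x * c y * g x y

/-- Weight without self-loops. -/
def wOff (M : WGraph) (x y : M.V) : ℝ := if x = y then 0 else M.lam x y

lemma wOff_of_ne (M : WGraph) {x y : M.V} (h : x ≠ y) : wOff M x y = M.lam x y := if_neg h

lemma exists_net (M : Model) (hS : M.toWGraph.Standing) (hν1 : 1 ≤ M.ν) (hνα : M.ν ≤ M.α / 2) :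
    ∃ N : Net M.V, N.w = wOff M.toWGraph ∧ N.g = M.green ∧ N.d = M.d ∧ N.α = M.α ∧ N.ν = M.ν := by
  obtain ⟨hT, ⟨cv, hcv, Cv, hCv, hV⟩, cg, hcg, Cg, hCg, hg, hgd⟩ := hS
  obtain ⟨c0, hc0, hctrl⟩ := M.ctrl
  have hν0 : 0 < M.ν := by linarith
  have hα0 : 0 < M.α := by linarith
  have h0 : ∀ x, M.lamTot x ≠ 0 := fun x h => by
    have := (hg x).1
    rw [WGraph.green, h, div_zero] at this
    linarith
  have hl0 : ∀ x, 0 < M.lamTot x := fun x =>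
    lt_of_le_of_ne (lamTot_nonneg _ x) (h0 x).symm
  have dn : ∀ x y, 0 ≤ M.d x y := fun x y => by
    by_cases h : x = y
    · rw [h, M.d_self]
    · exact (M.d_pos x y h).le
  have bfin1 : ∀ x (r : ℝ), 1 ≤ r → (M.ball x r).Finite := fun x r hr => by
    have h1 : 0 < ∑ᶠ y ∈ M.ball x r, M.lamTot y :=
      lt_of_lt_of_le (mul_pos hcv (Real.rpow_pos_of_pos (by linarith) _)) (hV x r hr).1
    have h2 := not_imp_comm.1 (finsum_mem_eq_zero_of_infinite (f := M.lamTot)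
      (s := M.ball x r)) h1.ne'
    refine h2.subset fun y hy => ⟨hy, h0 y⟩
  have bfin : ∀ x (r : ℝ), (M.ball x r).Finite := fun x r =>
    (bfin1 x (max r 1) (le_max_right _ _)).subset fun y hy =>
      (le_trans (show M.d x y ≤ r from hy) (le_max_left _ _) : M.d x y ≤ max r 1)
  have hsum : ∀ x (r : ℝ), ∑ᶠ y ∈ M.ball x r, M.lamTot y = ∑ y ∈ (bfin x r).toFinset, M.lamTot y :=
    fun x r => finsum_mem_eq_finite_toFinset_sum _ _
  have hlu : ∀ x, M.lamTot x ≤ Cv := fun x => by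
    have h1 := (hV x 1 le_rfl).2
    rw [hsum, Real.one_rpow, mul_one] at h1
    refine le_trans ?_ h1
    exact Finset.single_le_sum (f := M.lamTot) (fun y _ => (hl0 y).le)
      ((bfin x 1).mem_toFinset.2 (by simp [WGraph.ball, M.d_self]))
  have gs := green_symm M.toWGraph h0
  have psd := green_psd M fun x => hcg.trans_le (hg x).1
  have gle : ∀ x y, M.green x y ≤ Cg := fun x y => by
    by_cases hxy : x = y
    · rw [hxy]; exact (hg y).2
    · have h := psd {x, y} (fun z => if z = x then 1 else -1)
      simp only [Finset.sum_pair hxy, if_true, if_neg (Ne.symm hxy)] at h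
      have := (hg x).2
      have := (hg y).2
      have := gs x y
      linarith
  have Lg : ∀ x y, (M.lamTot x - M.lam x x) * M.green x y = (if x = y then 1 else 0) +
      ∑ z ∈ (nbs M.toWGraph x).erase x, wOff M.toWGraph x z * M.green z y := fun x y => by
    have h1 := green_harmonic M.toWGraph hT h0 x y
    have h2 : ∑ z ∈ nbs M.toWGraph x, M.lam x z * M.green z y = M.lam x x * M.green x y +
        ∑ z ∈ (nbs M.toWGraph x).erase x, wOff M.toWGraph x z * M.green z y := by
      by_cases hx : x ∈ nbs M.toWGraph x
      · rw [← Finset.add_sum_erase _ _ hx]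
        congr 1
        exact Finset.sum_congr rfl fun z hz => by
          rw [wOff_of_ne _ (Finset.ne_of_mem_erase hz).symm]
      · rw [lam_eq_zero _ hx, Finset.erase_eq_of_notMem hx, zero_mul, zero_add]
        exact Finset.sum_congr rfl fun z hz => by
          rw [wOff_of_ne _ (by rintro rfl; exact hx hz)]
    rw [h2] at h1
    rw [sub_mul, h1]
    ring
  have wn : ∀ x y, 0 ≤ wOff M.toWGraph x y := fun x y => by
    unfold wOff; split_ifs; exacts [le_rfl, M.lam_nonneg x y]
  have gn := green_nonneg M.toWGraph
  have Wlow : ∀ x, 1 ≤ Cg * (M.lamTot x - M.lam x x) := fun x => by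
    have h1 := Lg x x
    rw [if_pos rfl] at h1
    have h2 : 0 ≤ ∑ z ∈ (nbs M.toWGraph x).erase x, wOff M.toWGraph x z * M.green z x :=
      Finset.sum_nonneg fun z _ => mul_nonneg (wn x z) (gn z x)
    have h3 := (hg x).2
    have h4 : 0 < M.green x x := hcg.trans_le (hg x).1
    have h5 : 0 < M.lamTot x - M.lam x x := by
      by_contra h
      push Not at h
      nlinarith
    nlinarith
  have wd : ∀ x y, x ≠ y → 0 < M.lam x y → M.d x y ≤ max (Cg / (c0 * cg)) 1 := fun x y hxy h => by
    have h1 := Lg x y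
    have h2 : wOff M.toWGraph x y * M.green y y ≤
        ∑ z ∈ (nbs M.toWGraph x).erase x, wOff M.toWGraph x z * M.green z y :=
      Finset.single_le_sum (f := fun z => wOff M.toWGraph x z * M.green z y)
        (fun z _ => mul_nonneg (wn x z) (gn z y))
        (Finset.mem_erase.2 ⟨hxy.symm, (mem_nbs _).2 h⟩)
    rw [if_neg hxy, zero_add] at h1
    rw [wOff_of_ne _ hxy] at h2
    have h3 : c0 * M.lamTot x ≤ M.lam x y := hctrl x y h
    have h4 := (hg y).1
    have h5 := M.lam_nonneg x x
    have h6 := (hgd x y hxy).2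
    have h7 : c0 * cg * M.lamTot x ≤ M.lamTot x * M.green x y := by
      have := gn x y
      nlinarith [mul_le_mul h3 h4 hcg.le (M.lam_nonneg x y)]
    have h8 : c0 * cg ≤ M.green x y := by
      have := hl0 x
      by_contra hh
      push Not at hh
      nlinarith
    rw [le_max_iff, or_iff_not_imp_right, not_le]
    intro hd
    have h9 : M.d x y ^ (-M.ν) ≤ (M.d x y)⁻¹ := by
      rw [← Real.rpow_neg_one]
      exact Real.rpow_le_rpow_of_exponent_le hd.le (by linarith)
    have h10 : c0 * cg ≤ Cg * (M.d x y)⁻¹ := by nlinarith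
    rw [le_div_iff₀ (by positivity)]
    rw [← div_eq_mul_inv, le_div_iff₀ (by linarith)] at h10
    linarith
  set A : ℝ := 1 + Cg + Cv + cg⁻¹ + Cg * Cv + Cg / (c0 * cg) + Cv / cv with hA
  have hp1 : 0 < cg⁻¹ := inv_pos.2 hcg
  have hp2 : 0 < Cg * Cv := mul_pos hCg hCv
  have hp3 : 0 < Cg / (c0 * cg) := by positivity
  have hp4 : 0 < Cv / cv := by positivity
  have hA1 : 1 ≤ A := by rw [hA]; linarith
  have rn : ∀ t, 0 ≤ rho t ^ (-M.ν) := fun t => Real.rpow_nonneg (rho_pos t).le _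
  have r1 : ∀ t, rho t ^ (-M.ν) ≤ 1 := fun t =>
    Real.rpow_le_one_of_one_le_of_nonpos (one_le_rho t) (by linarith)
  have nbspec : ∀ x y, y ∈ (nbs M.toWGraph x).erase x ↔ 0 < wOff M.toWGraph x y := fun x y => by
    rw [Finset.mem_erase, mem_nbs, wOff]
    by_cases hxy : x = y
    · simp [hxy]
    · simp [hxy, Ne.symm hxy]
  have lamlow : ∀ x, 1 ≤ Cg * M.lamTot x := fun x => by
    have := Wlow x
    have := M.lam_nonneg x x
    nlinarith
  refine ⟨{ w := wOff M.toWGraph, w_nonneg := wn, w_symm := fun x y => ?_, w_self := fun x => if_pos rfl,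
            nb := fun x => (nbs M.toWGraph x).erase x, mem_nb := nbspec,
            W := fun x => M.lamTot x - M.lam x x, W_eq := fun x => ?_,
            g := M.green, g_symm := gs, d := M.d, d_symm := M.d_symm, d_self := M.d_self,
            d_nonneg := dn, d_triangle := M.d_triangle, α := M.α, ν := M.ν, one_le_ν := hν1,
            two_ν_le := by linarith, A := A, one_le_A := hA1, W_ge := fun x => ?_,
            W_le := fun x => ?_, g_le := fun x y => ?_, g_ge := fun x y => ?_, Lg := Lg,
            w_d := fun x y h => ?_, bal := fun x r => (bfin x r).toFinset,
            mem_bal := fun x r y => ?_, card_le := fun x r hr => ?_, card_ge := fun x r hr => ?_,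
            conn := fun x y => ?_, psd := psd }, rfl, rfl, rfl, rfl, rfl⟩
  · simp only [wOff, eq_comm (a := x), M.lam_symm x y]
  · rw [lamTot_eq]
    have : ∑ z ∈ (nbs M.toWGraph x).erase x, wOff M.toWGraph x z =
        ∑ z ∈ (nbs M.toWGraph x).erase x, M.lam x z :=
      Finset.sum_congr rfl fun z hz => wOff_of_ne _ (Finset.ne_of_mem_erase hz).symm
    rw [this]
    by_cases hx : x ∈ nbs M.toWGraph x
    · rw [← Finset.add_sum_erase _ _ hx]; ring
    · rw [lam_eq_zero _ hx, Finset.erase_eq_of_notMem hx]; ring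
  · have h1 := Wlow x
    have h2 : Cg ≤ A := by rw [hA]; linarith
    have h3 : 0 < M.lamTot x - M.lam x x := by
      by_contra h
      push Not at h
      nlinarith
    nlinarith
  · have h1 := hlu x
    have h2 := M.lam_nonneg x x
    rw [hA]; linarith
  · have h2 : Cg ≤ A := by rw [hA]; linarith
    by_cases hxy : 1 ≤ M.d x y
    · have hne : x ≠ y := by rintro rfl; rw [M.d_self] at hxy; linarith
      rw [rho, max_eq_left hxy]
      exact (hgd x y hne).2.trans (mul_le_mul_of_nonneg_right h2
        (Real.rpow_nonneg (dn x y) _))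
    · rw [rho, max_eq_right (not_le.1 hxy).le, Real.one_rpow, mul_one]
      exact (gle x y).trans h2
  · have h2 : cg⁻¹ ≤ A := by rw [hA]; linarith
    have h3 : cg * rho (M.d x y) ^ (-M.ν) ≤ M.green x y := by
      by_cases hxy : x = y
      · rw [hxy]
        have := (hg y).1
        have := r1 (M.d y y)
        nlinarith
      · refine le_trans (mul_le_mul_of_nonneg_left ?_ hcg.le) (hgd x y hxy).1
        exact Real.rpow_le_rpow_of_nonpos (M.d_pos x y hxy) (le_rho _) (by linarith)
    calc rho (M.d x y) ^ (-M.ν) = cg⁻¹ * (cg * rho (M.d x y) ^ (-M.ν)) := by field_simp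
      _ ≤ cg⁻¹ * M.green x y := mul_le_mul_of_nonneg_left h3 hp1.le
      _ ≤ A * M.green x y := mul_le_mul_of_nonneg_right h2 (gn x y)
  · have h1 := (nbspec x y).2 h
    rw [Finset.mem_erase, mem_nbs] at h1
    refine (wd x y h1.1.symm h1.2).trans (max_le ?_ hA1)
    rw [hA]; linarith
  · rw [Set.Finite.mem_toFinset]; rfl
  · have h1 := (hV x r hr).2
    rw [hsum] at h1
    have h2 : ((bfin x r).toFinset.card : ℝ) ≤ Cg * ∑ y ∈ (bfin x r).toFinset, M.lamTot y := by
      rw [Finset.mul_sum, Finset.cast_card]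
      exact Finset.sum_le_sum fun y _ => lamlow y
    have h3 : 0 ≤ r ^ M.α := Real.rpow_nonneg (by linarith) _
    have h4 : Cg * Cv ≤ A := by rw [hA]; linarith
    calc ((bfin x r).toFinset.card : ℝ) ≤ Cg * (Cv * r ^ M.α) :=
          h2.trans (mul_le_mul_of_nonneg_left h1 hCg.le)
      _ = Cg * Cv * r ^ M.α := by ring
      _ ≤ A * r ^ M.α := mul_le_mul_of_nonneg_right h4 h3
  · have h1 := (hV x r hr).1
    rw [hsum] at h1
    have h2 : ∑ y ∈ (bfin x r).toFinset, M.lamTot y ≤ Cv * (bfin x r).toFinset.card := by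
      rw [Finset.cast_card, Finset.mul_sum]
      exact Finset.sum_le_sum fun y _ => by rw [mul_one]; exact hlu y
    have h4 : Cv / cv ≤ A := by rw [hA]; linarith
    calc r ^ M.α = (cv * r ^ M.α) / cv := by field_simp
      _ ≤ (Cv * (bfin x r).toFinset.card) / cv :=
          div_le_div_of_nonneg_right (h1.trans h2) hcv.le
      _ = Cv / cv * (bfin x r).toFinset.card := by ring
      _ ≤ A * (bfin x r).toFinset.card := mul_le_mul_of_nonneg_right h4 (Nat.cast_nonneg _)
  · induction M.connectedG x y with
    | refl => exact Relation.ReflTransGen.refl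
    | @tail u v _ huv ih =>
      by_cases h : u = v
      · rw [← h]; exact ih
      · exact ih.tail (by rw [wOff_of_ne _ h]; exact huv)

end Perc

namespace Perc

namespace Net

variable {V : Type} (N : Net V)

lemma A_pos : 0 < N.A := zero_lt_one.trans_le N.one_le_A

lemma W_pos (x : V) : 0 < N.W x := by
  have := N.W_ge x
  have := N.A_pos
  by_contra h
  push Not at h
  nlinarith

lemma rho_rpow_pos (t : ℝ) : 0 < rho t ^ (-N.ν) := Real.rpow_pos_of_pos (rho_pos t) _

lemma g_pos (x y : V) : 0 < N.g x y := by
  have h1 := N.g_ge x y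
  have h2 := N.rho_rpow_pos (N.d x y)
  have := N.A_pos
  by_contra h
  push Not at h
  nlinarith

lemma g_nonneg (x y : V) : 0 ≤ N.g x y := (N.g_pos x y).le

lemma w_eq_zero {x y : V} (h : y ∉ N.nb x) : N.w x y = 0 := by
  rw [N.mem_nb] at h
  exact le_antisymm (not_lt.1 h) (N.w_nonneg x y)

lemma g_le_A (x y : V) : N.g x y ≤ N.A :=
  (N.g_le x y).trans (mul_le_of_le_one_right N.A_pos.le
    (Real.rpow_le_one_of_one_le_of_nonpos (one_le_rho _) (by linarith [N.one_le_ν])))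

lemma g_le_div (x y : V) : N.g x y ≤ N.A / rho (N.d x y) := by
  refine (N.g_le x y).trans ?_
  rw [div_eq_mul_inv, ← Real.rpow_neg_one]
  exact mul_le_mul_of_nonneg_left (Real.rpow_le_rpow_of_exponent_le (one_le_rho _)
    (by linarith [N.one_le_ν])) N.A_pos.le

lemma g_lt_of_far {x y : V} {δ : ℝ} (hδ : 0 < δ) (h : N.A / δ < N.d x y) : N.g x y < δ := by
  refine (N.g_le_div x y).trans_lt ?_
  rw [div_lt_iff₀ (rho_pos _)]
  rw [div_lt_iff₀ hδ] at h
  nlinarith [le_rho (N.d x y)]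

/-- The graph Laplacian. -/
def lap (f : V → ℝ) (x : V) : ℝ := N.W x * f x - ∑ z ∈ N.nb x, N.w x z * f z

lemma lap_add (f h : V → ℝ) (x : V) : N.lap (fun z => f z + h z) x = N.lap f x + N.lap h x := by
  simp only [lap, mul_add, Finset.sum_add_distrib]; ring

lemma lap_smul (c : ℝ) (f : V → ℝ) (x : V) : N.lap (fun z => c * f z) x = c * N.lap f x := by
  simp only [lap, mul_sub, Finset.mul_sum]
  congr 1
  · ring
  · exact Finset.sum_congr rfl fun z _ => by ring

lemma lap_sub (f h : V → ℝ) (x : V) : N.lap (fun z => f z - h z) x = N.lap f x - N.lap h x := by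
  simp only [lap, mul_sub, Finset.sum_sub_distrib]; ring

lemma lap_const (c : ℝ) (x : V) : N.lap (fun _ => c) x = 0 := by
  rw [lap, ← Finset.sum_mul, ← N.W_eq, sub_self]

lemma lap_sum {κ : Type*} (s : Finset κ) (f : κ → V → ℝ) (x : V) :
    N.lap (fun z => ∑ i ∈ s, f i z) x = ∑ i ∈ s, N.lap (f i) x := by
  simp only [lap, Finset.sum_sub_distrib, Finset.mul_sum]
  rw [Finset.sum_comm]

lemma lap_g (y x : V) : N.lap (fun z => N.g z y) x = if x = y then 1 else 0 := by
  rw [lap, N.Lg]; ring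

lemma lap_eq_sum_sub (f : V → ℝ) (x : V) :
    N.lap f x = ∑ z ∈ N.nb x, N.w x z * (f x - f z) := by
  simp only [lap, mul_sub, Finset.sum_sub_distrib, ← Finset.sum_mul, ← N.W_eq]

/-- Maximum principle on a finite domain. -/
lemma max_principle (B : Finset V) (f : V → ℝ) (hB : ∀ z ∈ B, N.lap f z ≤ 0)
    (hout : ∀ z, z ∉ B → f z ≤ 0) (z : V) : f z ≤ 0 := by
  set s : V → ℝ := fun z => ∑ u ∈ B, N.g z u with hs
  have s0 : ∀ z, 0 ≤ s z := fun z => Finset.sum_nonneg fun u _ => N.g_nonneg z u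
  have sl : ∀ z ∈ B, N.lap s z = 1 := fun z hz => by
    rw [hs, lap_sum]
    simp only [lap_g]
    simp [hz]
  have key : ∀ ε : ℝ, 0 < ε → ∀ z, f z - ε * s z ≤ 0 := by
    intro ε hε
    have ho : ∀ z, z ∉ B → f z - ε * s z ≤ 0 := fun z hz => by
      have := hout z hz
      have := mul_nonneg hε.le (s0 z)
      linarith
    by_contra hcon
    push Not at hcon
    obtain ⟨z1, hz1⟩ := hcon
    have hz1B : z1 ∈ B := by
      by_contra h
      exact absurd (ho z1 h) (not_le.2 hz1)
    obtain ⟨z0, hz0, hmax⟩ := B.exists_max_image (fun z => f z - ε * s z) ⟨z1, hz1B⟩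
    have hp : 0 < f z0 - ε * s z0 := hz1.trans_le (hmax z1 hz1B)
    have hall : ∀ z, f z - ε * s z ≤ f z0 - ε * s z0 := fun z => by
      by_cases h : z ∈ B
      · exact hmax z h
      · exact (ho z h).trans hp.le
    have h1 : N.lap (fun z => f z - ε * s z) z0 < 0 := by
      rw [lap_sub, lap_smul, sl z0 hz0]
      linarith [hB z0 hz0]
    have h2 : 0 ≤ N.lap (fun z => f z - ε * s z) z0 := by
      rw [lap_eq_sum_sub]
      exact Finset.sum_nonneg fun z _ => mul_nonneg (N.w_nonneg _ _) (sub_nonneg.2 (hall z))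
    linarith
  by_contra h
  push Not at h
  have h1 := key (f z / (2 * (s z + 1))) (by have := s0 z; positivity) z
  have h2 : f z / (2 * (s z + 1)) * s z < f z := by
    rw [div_mul_eq_mul_div, div_lt_iff₀ (by have := s0 z; positivity)]
    nlinarith [s0 z]
  linarith

lemma comparison (B : Finset V) (f F : V → ℝ) (hB : ∀ z ∈ B, N.lap f z ≤ N.lap F z)
    (hout : ∀ z, z ∉ B → f z ≤ F z) (z : V) : f z ≤ F z := by
  have := N.max_principle B (fun z => f z - F z)
    (fun z hz => by rw [lap_sub]; linarith [hB z hz]) (fun z hz => by linarith [hout z hz]) z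
  linarith

/-- Potential of a charge on a finite set. -/
def pot (s : Finset V) (c : V → ℝ) (z : V) : ℝ := ∑ v ∈ s, c v * N.g z v

lemma lap_pot (s : Finset V) (c : V → ℝ) (x : V) :
    N.lap (N.pot s c) x = if x ∈ s then c x else 0 := by
  have : N.pot s c = fun z => ∑ v ∈ s, c v * N.g z v := rfl
  rw [this, lap_sum]
  simp only [lap_smul, lap_g]
  simp

lemma pot_small (s : Finset V) (c : V → ℝ) {δ : ℝ} (hδ : 0 < δ) :
    ∃ B : Finset V, ∀ z, z ∉ B → N.pot s c z ≤ δ := by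
  set T : ℝ := ∑ v ∈ s, |c v| + 1 with hT
  have hT0 : 0 < T := by
    have : 0 ≤ ∑ v ∈ s, |c v| := Finset.sum_nonneg fun _ _ => abs_nonneg _
    linarith
  refine ⟨s.biUnion fun v => N.bal v (N.A / (δ / T)), fun z hz => ?_⟩
  have h1 : ∀ v ∈ s, c v * N.g z v ≤ |c v| * (δ / T) := fun v hv => by
    have h2 : N.A / (δ / T) < N.d z v := by
      by_contra h
      refine hz (Finset.mem_biUnion.2 ⟨v, hv, (N.mem_bal _ _ _).2 ?_⟩)
      rw [N.d_symm]; exact not_lt.1 h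
    have h3 := N.g_lt_of_far (div_pos hδ hT0) h2
    exact mul_le_mul (le_abs_self _) h3.le (N.g_nonneg _ _) (abs_nonneg _)
  calc N.pot s c z ≤ ∑ v ∈ s, |c v| * (δ / T) := Finset.sum_le_sum h1
    _ = (T - 1) * (δ / T) := by rw [← Finset.sum_mul, hT]; ring
    _ ≤ δ := by
        rw [mul_div_assoc', div_le_iff₀ hT0]
        nlinarith

lemma pot_le (s : Finset V) (c : V → ℝ) {m : ℝ} (hm : 0 ≤ m) (h : ∀ z ∈ s, N.pot s c z ≤ m)
    (z : V) : N.pot s c z ≤ m := by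
  refine le_of_forall_pos_le_add fun ε hε => ?_
  obtain ⟨B, hB⟩ := N.pot_small s c hε
  have := N.comparison (B \ s) (N.pot s c) (fun _ => m + ε)
    (fun z hz => by
      rw [lap_pot, lap_const, if_neg (Finset.mem_sdiff.1 hz).2])
    (fun z hz => by
      by_cases hzs : z ∈ s
      · linarith [h z hzs]
      · have : z ∉ B := fun hb => hz (Finset.mem_sdiff.2 ⟨hb, hzs⟩)
        linarith [hB z this]) z
  exact this

lemma pot_nonneg (s : Finset V) (c : V → ℝ) (h : ∀ z ∈ s, 0 ≤ N.pot s c z)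
    (z : V) : 0 ≤ N.pot s c z := by
  have hneg : ∀ z, N.pot s (fun v => -c v) z = -N.pot s c z := fun z => by
    simp [pot]
  have := N.pot_le s (fun v => -c v) le_rfl (fun z hz => by rw [hneg]; linarith [h z hz]) z
  rw [hneg] at this
  linarith

/-- Green's matrix on a finite set. -/
def gmat (s : Finset V) : Matrix s s ℝ := fun u v => N.g u v

lemma gmat_mulVec (s : Finset V) (c : V → ℝ) (u : s) :
    (N.gmat s).mulVec (fun v => c v) u = N.pot s c u := by
  simp only [Matrix.mulVec, dotProduct, gmat, pot]
  rw [← Finset.sum_coe_sort s (fun v => c v * N.g u v)]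
  exact Finset.sum_congr rfl fun v _ => mul_comm _ _

/-- Extension by zero. -/
def ext0 {s : Finset V} (c : s → ℝ) (v : V) : ℝ := if h : v ∈ s then c ⟨v, h⟩ else 0

lemma ext0_coe {s : Finset V} (c : s → ℝ) (v : s) : ext0 c v = c v := by
  simp [ext0]

lemma gmat_mulVec' (s : Finset V) (c : s → ℝ) (u : s) :
    (N.gmat s).mulVec c u = N.pot s (ext0 c) u := by
  rw [← gmat_mulVec]
  congr 1
  ext v
  rw [ext0_coe]

lemma gmat_posDef (s : Finset V) : (N.gmat s).PosDef := by
  have hps : (N.gmat s).PosSemidef := by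
    refine Matrix.PosSemidef.of_dotProduct_mulVec_nonneg ?_ fun c => ?_
    · ext u v; exact N.g_symm v u
    · have h := N.psd s (ext0 c)
      have h2 : star c ⬝ᵥ (N.gmat s).mulVec c =
          ∑ x ∈ s, ∑ y ∈ s, ext0 c x * ext0 c y * N.g x y := by
        simp only [dotProduct, Pi.star_apply, star_trivial, gmat_mulVec', pot, Finset.mul_sum]
        rw [← Finset.sum_coe_sort s]
        exact Finset.sum_congr rfl fun u _ => Finset.sum_congr rfl fun v _ => by
          rw [ext0_coe]; ring
      rw [h2]; exact h
  rw [hps.posDef_iff_isUnit, ← Matrix.mulVec_injective_iff_isUnit]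
  rw [← Matrix.coe_mulVecLin, ← LinearMap.ker_eq_bot, LinearMap.ker_eq_bot']
  intro c hc
  have h0 : ∀ z ∈ s, N.pot s (ext0 c) z = 0 := fun z hz => by
    have := congrFun hc ⟨z, hz⟩
    rwa [Matrix.mulVecLin_apply, gmat_mulVec'] at this
  have h1 : ∀ z, N.pot s (ext0 c) z = 0 := fun z =>
    le_antisymm (N.pot_le s _ le_rfl (fun z hz => (h0 z hz).le) z)
      (N.pot_nonneg s _ (fun z hz => (h0 z hz).ge) z)
  ext u
  have h2 := N.lap_pot s (ext0 c) u
  rw [if_pos u.2, ext0_coe] at h2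
  rw [← h2, lap_eq_sum_sub]
  simp [h1]

/-- Precision matrix of the field on a finite set. -/
def prec (s : Finset V) : Matrix s s ℝ := (N.gmat s)⁻¹

lemma prec_posDef (s : Finset V) : (N.prec s).PosDef := (N.gmat_posDef s).inv

lemma gmat_mul_prec (s : Finset V) : N.gmat s * N.prec s = 1 :=
  Matrix.mul_nonsing_inv _ (N.gmat_posDef s).det_pos.ne'.isUnit

lemma prec_mul_gmat (s : Finset V) : N.prec s * N.gmat s = 1 :=
  Matrix.nonsing_inv_mul _ (N.gmat_posDef s).det_pos.ne'.isUnit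

lemma prec_inv (s : Finset V) : (N.prec s)⁻¹ = N.gmat s :=
  Matrix.nonsing_inv_nonsing_inv _ (N.gmat_posDef s).det_pos.ne'.isUnit

lemma prec_apply_of_interior (s : Finset V) (u : s) (hu : N.nb u ⊆ s) (v : s) :
    N.prec s u v = (if u = v then N.W u else 0) - N.w u v := by
  have h : (fun v : s => (if u = v then N.W u else 0) - N.w u v) =
      Matrix.vecMul (Pi.single u 1) (N.prec s) := by
    have h1 : Matrix.vecMul (fun v : s => (if u = v then N.W u else 0) - N.w u v) (N.gmat s) =
        Pi.single u 1 := by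
      ext y
      simp only [Matrix.vecMul, dotProduct, gmat, sub_mul, Finset.sum_sub_distrib, ite_mul,
        zero_mul, Finset.sum_ite_eq, Finset.mem_univ, if_true]
      rw [N.Lg, Finset.sum_coe_sort s (fun v => N.w u v * N.g v y),
        ← Finset.sum_subset hu (fun z _ hz => by rw [N.w_eq_zero hz, zero_mul])]
      simp only [Pi.single_apply, Subtype.ext_iff, eq_comm (a := (u : V)), add_sub_cancel_right]
    rw [← h1, Matrix.vecMul_vecMul, gmat_mul_prec, Matrix.vecMul_one]
  have := congrFun h v
  rw [Matrix.single_one_vecMul] at this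
  exact this.symm

lemma prec_mulVec_eq_lap (s : Finset V) (c : s → ℝ) (u : s) :
    (N.prec s).mulVec c u = N.lap (N.pot s (ext0 ((N.prec s).mulVec c))) u := by
  rw [lap_pot, if_pos u.2, ext0_coe]

lemma pot_prec (s : Finset V) (c : s → ℝ) (u : s) :
    N.pot s (ext0 ((N.prec s).mulVec c)) u = c u := by
  rw [← gmat_mulVec', Matrix.mulVec_mulVec, gmat_mul_prec, Matrix.one_mulVec]

lemma prec_mulVec_one_nonneg (s : Finset V) (u : s) : 0 ≤ (N.prec s).mulVec 1 u := by
  rw [prec_mulVec_eq_lap, lap_eq_sum_sub]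
  refine Finset.sum_nonneg fun z _ => mul_nonneg (N.w_nonneg _ _) (sub_nonneg.2 ?_)
  rw [pot_prec, Pi.one_apply]
  exact N.pot_le s _ zero_le_one (fun z hz => by rw [N.pot_prec s 1 ⟨z, hz⟩, Pi.one_apply]) z

lemma prec_off (s : Finset V) (u v : s) (h : u ≠ v) : N.prec s u v ≤ 0 := by
  have h1 : N.prec s u v = (N.prec s).mulVec (Pi.single v 1) u := by
    rw [Matrix.mulVec_single_one]; rfl
  rw [h1, prec_mulVec_eq_lap, lap_eq_sum_sub]
  refine Finset.sum_nonpos fun z _ => mul_nonpos_of_nonneg_of_nonpos (N.w_nonneg _ _)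
    (sub_nonpos.2 ?_)
  rw [pot_prec, Pi.single_eq_of_ne h]
  refine N.pot_nonneg s _ (fun z hz => ?_) z
  rw [N.pot_prec s _ ⟨z, hz⟩, Pi.single_apply]
  split_ifs <;> norm_num

lemma prec_mulVec_one_of_interior (s : Finset V) (u : s) (hu : N.nb u ⊆ s) :
    (N.prec s).mulVec 1 u = 0 := by
  simp only [Matrix.mulVec, dotProduct, Pi.one_apply, mul_one, N.prec_apply_of_interior s u hu,
    Finset.sum_sub_distrib, Finset.sum_ite_eq, Finset.mem_univ, if_true]
  rw [N.W_eq, Finset.sum_coe_sort s (fun v => N.w u v),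
    ← Finset.sum_subset hu (fun z _ hz => N.w_eq_zero hz), sub_self]

end Net

end Perc

namespace Perc

namespace Net

variable {V : Type} (N : Net V)

lemma α_ge : 2 ≤ N.α := by linarith [N.one_le_ν, N.two_ν_le]

lemma self_mem_bal (x : V) {r : ℝ} (hr : 0 ≤ r) : x ∈ N.bal x r :=
  (N.mem_bal _ _ _).2 (by rw [N.d_self]; exact hr)

/-- Sum of a power of the distance over a ball. -/
def dsum (p : ℝ) (u : V) (r : ℝ) : ℝ := ∑ v ∈ N.bal u r, rho (N.d u v) ^ (-p)

lemma dsum_le_card {p : ℝ} (hp : 0 ≤ p) (u : V) {r : ℝ} (hr : 1 ≤ r) :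
    N.dsum p u r ≤ N.A * r ^ N.α := by
  refine le_trans ?_ (N.card_le u r hr)
  rw [dsum, Finset.cast_card]
  exact Finset.sum_le_sum fun v _ =>
    Real.rpow_le_one_of_one_le_of_nonpos (one_le_rho _) (by linarith)

lemma dsum_halve {p : ℝ} (hp : 0 ≤ p) (u : V) {r : ℝ} (hr : 2 ≤ r) :
    N.dsum p u r ≤ N.dsum p u (r / 2) + N.A * 2 ^ p * r ^ (N.α - p) := by
  have hsub : N.bal u (r / 2) ⊆ N.bal u r := fun v hv => by
    rw [mem_bal] at hv ⊢; linarith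
  rw [dsum, ← Finset.sum_sdiff hsub, add_comm, ← dsum]
  gcongr
  have h1 : ∀ v ∈ N.bal u r \ N.bal u (r / 2), rho (N.d u v) ^ (-p) ≤ (r / 2) ^ (-p) := by
    intro v hv
    rw [Finset.mem_sdiff, mem_bal, mem_bal, not_le] at hv
    exact Real.rpow_le_rpow_of_nonpos (by linarith) (hv.2.le.trans (le_rho _)) (by linarith)
  calc ∑ v ∈ N.bal u r \ N.bal u (r / 2), rho (N.d u v) ^ (-p)
      ≤ ∑ v ∈ N.bal u r \ N.bal u (r / 2), (r / 2) ^ (-p) := Finset.sum_le_sum h1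
    _ ≤ ∑ v ∈ N.bal u r, (r / 2) ^ (-p) :=
        Finset.sum_le_sum_of_subset_of_nonneg Finset.sdiff_subset
          fun _ _ _ => Real.rpow_nonneg (by linarith) _
    _ = (N.bal u r).card * (r / 2) ^ (-p) := by rw [Finset.sum_const, nsmul_eq_mul]
    _ ≤ N.A * r ^ N.α * (r / 2) ^ (-p) :=
        mul_le_mul_of_nonneg_right (N.card_le u r (by linarith)) (Real.rpow_nonneg (by linarith) _)
    _ = N.A * 2 ^ p * r ^ (N.α - p) := by
        rw [Real.div_rpow (by linarith) (by norm_num), Real.rpow_neg (by norm_num : (0:ℝ) ≤ 2),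
          Real.rpow_sub (by linarith), Real.rpow_neg (by linarith)]
        have : r ^ p ≠ 0 := (Real.rpow_pos_of_pos (by linarith) _).ne'
        field_simp

lemma dsum_le_induct {p : ℝ} (hp : 0 ≤ p) (F : ℝ → ℝ)
    (h1 : ∀ r, 1 ≤ r → r ≤ 2 → N.A * r ^ N.α ≤ F r)
    (h2 : ∀ r, 2 ≤ r → F (r / 2) + N.A * 2 ^ p * r ^ (N.α - p) ≤ F r) (u : V) {r : ℝ}
    (hr : 1 ≤ r) : N.dsum p u r ≤ F r := by
  obtain ⟨n, hn⟩ := pow_unbounded_of_one_lt r (one_lt_two)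
  induction n generalizing r with
  | zero => rw [pow_zero] at hn; linarith
  | succ n ih =>
    by_cases h : r ≤ 2
    · exact (N.dsum_le_card hp u hr).trans (h1 r hr h)
    · push Not at h
      have h3 := ih (r := r / 2) (by linarith) (by rw [pow_succ] at hn; linarith)
      linarith [N.dsum_halve hp u h.le, h2 r h.le]

lemma dsum_le_of_lt {p : ℝ} (hp : 0 ≤ p) (hpα : p < N.α) :
    ∃ C : ℝ, 0 < C ∧ ∀ u r, 1 ≤ r → N.dsum p u r ≤ C * r ^ (N.α - p) := by
  have hq : (0:ℝ) < 1 - 2 ^ (-(N.α - p)) := by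
    have : (2:ℝ) ^ (-(N.α - p)) < 1 :=
      Real.rpow_lt_one_of_one_lt_of_neg one_lt_two (by linarith)
    linarith
  have hA := N.A_pos
  have h2p : (0:ℝ) < 2 ^ p := Real.rpow_pos_of_pos two_pos _
  have hC : 0 < N.A * 2 ^ p / (1 - 2 ^ (-(N.α - p))) := by positivity
  refine ⟨_, hC, fun u r hr => N.dsum_le_induct hp (fun r => _ * r ^ (N.α - p)) ?_ ?_ u hr⟩
  · intro r hr hr2
    have hr0 : 0 < r := by linarith
    have h3 : N.A * 2 ^ p ≤ N.A * 2 ^ p / (1 - 2 ^ (-(N.α - p))) := by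
      rw [le_div_iff₀ hq]
      have := Real.rpow_pos_of_pos two_pos (-(N.α - p))
      have := mul_pos hA h2p
      nlinarith
    have h4 : r ^ N.α = r ^ p * r ^ (N.α - p) := by rw [← Real.rpow_add hr0]; congr 1; ring
    have h5 : r ^ p ≤ 2 ^ p := Real.rpow_le_rpow hr0.le hr2 hp
    have h6 : 0 < r ^ (N.α - p) := Real.rpow_pos_of_pos hr0 _
    calc N.A * r ^ N.α = N.A * r ^ p * r ^ (N.α - p) := by rw [h4]; ring
      _ ≤ N.A * 2 ^ p * r ^ (N.α - p) := by gcongr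
      _ ≤ _ := by gcongr
  · intro r hr
    have hr0 : 0 < r := by linarith
    rw [Real.div_rpow hr0.le two_pos.le]
    have h6 : 0 < r ^ (N.α - p) := Real.rpow_pos_of_pos hr0 _
    have h7 : (2:ℝ) ^ (-(N.α - p)) = (2 ^ (N.α - p))⁻¹ := Real.rpow_neg two_pos.le _
    have h8 : (0:ℝ) < 2 ^ (N.α - p) := Real.rpow_pos_of_pos two_pos _
    set K := N.A * 2 ^ p / (1 - 2 ^ (-(N.α - p))) with hK
    have h9 : N.A * 2 ^ p = K * (1 - (2 ^ (N.α - p))⁻¹) := by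
      rw [hK, h7, div_mul_cancel₀]; rw [← h7]; exact hq.ne'
    rw [h9]
    apply le_of_eq
    field_simp
    ring

lemma dsum_le_log {p : ℝ} (hpα : p = N.α) :
    ∃ C : ℝ, 0 < C ∧ ∀ u r, 1 ≤ r → N.dsum p u r ≤ C * (1 + Real.log r) := by
  have hA := N.A_pos
  have hp : 0 ≤ p := by rw [hpα]; linarith [N.α_ge]
  have h2p : (0:ℝ) < 2 ^ p := Real.rpow_pos_of_pos two_pos _
  have hl : 0 < Real.log 2 := Real.log_pos one_lt_two
  have hl1 : Real.log 2 ≤ 1 := by linarith [Real.log_two_lt_d9]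
  have hC : 0 < N.A * 2 ^ p / Real.log 2 := by positivity
  refine ⟨_, hC, fun u r hr => N.dsum_le_induct hp (fun r => _ * (1 + Real.log r)) ?_ ?_ u hr⟩
  · intro r hr hr2
    have h3 : N.A * 2 ^ p ≤ N.A * 2 ^ p / Real.log 2 := by
      rw [le_div_iff₀ hl]
      have := mul_pos hA h2p
      nlinarith
    have h5 : r ^ p ≤ 2 ^ p := Real.rpow_le_rpow (by linarith) hr2 hp
    have h6 : 0 ≤ Real.log r := Real.log_nonneg hr
    calc N.A * r ^ N.α ≤ N.A * 2 ^ p := by rw [← hpα]; gcongr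
      _ ≤ N.A * 2 ^ p / Real.log 2 := h3
      _ ≤ _ := by nlinarith
  · intro r hr
    rw [hpα, sub_self, Real.rpow_zero, Real.log_div (by linarith) two_ne_zero]
    apply le_of_eq
    field_simp
    ring

lemma g_sum_le : ∃ C : ℝ, 0 < C ∧ ∀ u r, 1 ≤ r →
    ∑ v ∈ N.bal u r, N.g u v ≤ C * r ^ (N.α - N.ν) := by
  have := N.one_le_ν
  have := N.two_ν_le
  obtain ⟨C, hC, h⟩ := N.dsum_le_of_lt (p := N.ν) (by linarith) (by linarith)
  refine ⟨N.A * C, mul_pos N.A_pos hC, fun u r hr => ?_⟩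
  calc ∑ v ∈ N.bal u r, N.g u v ≤ ∑ v ∈ N.bal u r, N.A * rho (N.d u v) ^ (-N.ν) :=
        Finset.sum_le_sum fun v _ => N.g_le u v
    _ = N.A * N.dsum N.ν u r := by rw [dsum, Finset.mul_sum]
    _ ≤ N.A * (C * r ^ (N.α - N.ν)) := mul_le_mul_of_nonneg_left (h u r hr) N.A_pos.le
    _ = _ := by ring

/-- Logarithmic correction at the critical exponent. -/
def lgc (r : ℝ) : ℝ := if 2 * N.ν = N.α then 1 + Real.log r else 1

lemma one_le_lgc {r : ℝ} (hr : 1 ≤ r) : 1 ≤ N.lgc r := by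
  unfold lgc
  have := Real.log_nonneg hr
  split_ifs <;> linarith

lemma g_sq_sum_le : ∃ C : ℝ, 0 < C ∧ ∀ u r, 1 ≤ r →
    ∑ v ∈ N.bal u r, N.g u v ^ 2 ≤ C * r ^ (N.α - 2 * N.ν) * N.lgc r := by
  have h1 := N.one_le_ν
  have h2 := N.two_ν_le
  have key : ∃ C : ℝ, 0 < C ∧ ∀ u r, 1 ≤ r →
      N.dsum (2 * N.ν) u r ≤ C * r ^ (N.α - 2 * N.ν) * N.lgc r := by
    unfold lgc
    by_cases h : 2 * N.ν = N.α
    · obtain ⟨C, hC, hh⟩ := N.dsum_le_log h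
      refine ⟨C, hC, fun u r hr => ?_⟩
      rw [if_pos h, h, sub_self, Real.rpow_zero, mul_one, ← h]
      exact hh u r hr
    · obtain ⟨C, hC, hh⟩ := N.dsum_le_of_lt (p := 2 * N.ν) (by linarith) (lt_of_le_of_ne h2 h)
      refine ⟨C, hC, fun u r hr => ?_⟩
      rw [if_neg h, mul_one]
      exact hh u r hr
  obtain ⟨C, hC, h⟩ := key
  refine ⟨N.A ^ 2 * C, by have := N.A_pos; positivity, fun u r hr => ?_⟩
  calc ∑ v ∈ N.bal u r, N.g u v ^ 2
      ≤ ∑ v ∈ N.bal u r, N.A ^ 2 * rho (N.d u v) ^ (-(2 * N.ν)) :=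
        Finset.sum_le_sum fun v _ => by
          have h3 : rho (N.d u v) ^ (-(2 * N.ν)) = (rho (N.d u v) ^ (-N.ν)) ^ 2 := by
            rw [← Real.rpow_natCast, ← Real.rpow_mul (rho_pos _).le]
            congr 1; push_cast; ring
          rw [h3, ← mul_pow]
          exact pow_le_pow_left₀ (N.g_nonneg _ _) (N.g_le u v) 2
    _ = N.A ^ 2 * N.dsum (2 * N.ν) u r := by rw [dsum, Finset.mul_sum]
    _ ≤ N.A ^ 2 * (C * r ^ (N.α - 2 * N.ν) * N.lgc r) :=
        mul_le_mul_of_nonneg_left (h u r hr) (by have := N.A_pos; positivity)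
    _ = _ := by ring

/-- Bilinear Green energy. -/
def en (s : Finset V) (c e : V → ℝ) : ℝ := ∑ x ∈ s, ∑ y ∈ s, c x * e y * N.g x y

lemma en_self_nonneg (s : Finset V) (c : V → ℝ) : 0 ≤ N.en s c c := N.psd s c

lemma en_symm (s : Finset V) (c e : V → ℝ) : N.en s c e = N.en s e c := by
  rw [en, Finset.sum_comm, en]
  exact Finset.sum_congr rfl fun x _ => Finset.sum_congr rfl fun y _ => by
    rw [N.g_symm]; ring

lemma en_quad (s : Finset V) (c e : V → ℝ) (t : ℝ) :
    N.en s (fun x => c x + t * e x) (fun x => c x + t * e x) =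
      N.en s c c + 2 * t * N.en s c e + t ^ 2 * N.en s e e := by
  have h : N.en s (fun x => c x + t * e x) (fun x => c x + t * e x) =
      N.en s c c + t * N.en s c e + t * N.en s e c + t ^ 2 * N.en s e e := by
    simp only [en, Finset.mul_sum, ← Finset.sum_add_distrib]
    exact Finset.sum_congr rfl fun x _ => Finset.sum_congr rfl fun y _ => by ring
  rw [h, N.en_symm s e c]; ring

lemma en_cauchy (s : Finset V) (c e : V → ℝ) : N.en s c e ^ 2 ≤ N.en s c c * N.en s e e := by
  have h : ∀ t : ℝ, 0 ≤ N.en s e e * (t * t) + 2 * N.en s c e * t + N.en s c c := fun t => by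
    have := N.en_self_nonneg s (fun x => c x + t * e x)
    rw [en_quad] at this
    linarith
  have := discrim_le_zero h
  unfold discrim at this
  nlinarith

/-- A finitely supported function is the potential of its Laplacian. -/
lemma pot_lap (s : Finset V) (f : V → ℝ) (hf : ∀ z, z ∉ s → f z = 0 ∧ ∀ v ∈ N.nb z, f v = 0)
    (x : V) : ∑ y ∈ s, N.lap f y * N.g x y = f x := by
  have hlap : ∀ z, z ∉ s → N.lap f z = 0 := fun z hz => by
    rw [lap, (hf z hz).1, mul_zero, zero_sub, neg_eq_zero]
    exact Finset.sum_eq_zero fun v hv => by rw [(hf z hz).2 v hv, mul_zero]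
  have hx : ∀ z, N.pot s (N.lap f) z - f z = N.pot s (N.lap f) z + -1 * f z := fun z => by ring
  have l0 : ∀ z, N.lap (fun z => N.pot s (N.lap f) z - f z) z = 0 := fun z => by
    rw [lap_sub, lap_pot]
    split_ifs with h
    · ring
    · rw [hlap z h]; ring
  have small : ∀ ε > 0, ∀ z, |N.pot s (N.lap f) z - f z| ≤ ε := by
    intro ε hε z
    obtain ⟨B1, hB1⟩ := N.pot_small s (N.lap f) hε
    obtain ⟨B2, hB2⟩ := N.pot_small s (fun v => -N.lap f v) hε
    have hneg : ∀ z, N.pot s (fun v => -N.lap f v) z = -N.pot s (N.lap f) z := fun z => by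
      simp [pot]
    rw [abs_le]
    constructor
    · have := N.comparison (B2 ∪ s) (fun _ => -ε) (fun z => N.pot s (N.lap f) z - f z)
        (fun z _ => by rw [l0, lap_const]) (fun z hz => by
          rw [Finset.mem_union, not_or] at hz
          have := hB2 z hz.1
          rw [hneg] at this
          rw [(hf z hz.2).1]; linarith) z
      exact this
    · have := N.comparison (B1 ∪ s) (fun z => N.pot s (N.lap f) z - f z) (fun _ => ε)
        (fun z _ => by rw [l0, lap_const]) (fun z hz => by
          rw [Finset.mem_union, not_or] at hz
          have := hB1 z hz.1
          rw [(hf z hz.2).1]; linarith) z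
      exact this
  have h0 : |N.pot s (N.lap f) x - f x| ≤ 0 :=
    le_of_forall_pos_le_add fun ε hε => by rw [zero_add]; exact small ε hε x
  have := abs_nonpos_iff.1 h0
  rw [pot] at this
  linarith

end Net

end Perc

namespace Perc

namespace Net

variable {V : Type} (N : Net V)

/-- Tent function. -/
def tent (o : V) (R : ℝ) (z : V) : ℝ := max 0 (min 1 (2 - N.d o z / R))

lemma tent_lip (o : V) {R : ℝ} (hR : 0 < R) {x z : V} (h : 0 < N.w x z) :
    (N.tent o R x - N.tent o R z) ^ 2 ≤ (N.A / R) ^ 2 := by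
  have h1 := N.w_d x z h
  have h2 := N.d_triangle o x z
  have h3 := N.d_triangle o z x
  rw [N.d_symm z x] at h3
  have h4 : |N.tent o R x - N.tent o R z| ≤ N.A / R := by
    unfold tent
    refine (abs_max_sub_max_le_max _ _ _ _).trans (max_le (by simp; have := N.A_pos; positivity) ?_)
    refine (abs_min_sub_min_le_max _ _ _ _).trans (max_le (by simp; have := N.A_pos; positivity) ?_)
    rw [show 2 - N.d o x / R - (2 - N.d o z / R) = (N.d o z - N.d o x) / R by ring, abs_div,
      abs_of_pos hR]
    exact div_le_div_of_nonneg_right (abs_le.2 ⟨by linarith, by linarith⟩) hR.le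
  rw [← sq_abs]
  exact pow_le_pow_left₀ (abs_nonneg _) h4 2

lemma tent_eq_zero (o : V) {R : ℝ} (hR : 0 < R) {z : V} (h : 2 * R < N.d o z) :
    N.tent o R z = 0 := by
  have : 2 - N.d o z / R ≤ 0 := by
    rw [sub_nonpos, le_div_iff₀ hR]; exact h.le
  exact max_eq_left ((min_le_right _ _).trans this)

lemma tent_eq_one (o : V) {R : ℝ} (hR : 0 < R) {z : V} (h : N.d o z ≤ R) :
    N.tent o R z = 1 := by
  have : 1 ≤ 2 - N.d o z / R := by
    have : N.d o z / R ≤ 1 := by rw [div_le_one hR]; exact h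
    linarith
  rw [tent, min_eq_left this, max_eq_right zero_le_one]

lemma dirichlet_le (s : Finset V) (f : V → ℝ) (hf : ∀ x ∈ s, f x ≠ 0 → N.nb x ⊆ s) {b : ℝ}
    (hb0 : 0 ≤ b) (hb : ∀ x z, 0 < N.w x z → (f x - f z) ^ 2 ≤ b) :
    ∑ x ∈ s, f x * N.lap f x ≤ N.A * s.card * b := by
  have h1 : ∑ x ∈ s, f x * N.lap f x = ∑ x ∈ s, ∑ z ∈ s, N.w x z * (f x * (f x - f z)) := by
    refine Finset.sum_congr rfl fun x hx => ?_
    by_cases h : f x = 0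
    · simp [h]
    · rw [lap_eq_sum_sub, Finset.mul_sum,
        ← Finset.sum_subset (hf x hx h) (fun z _ hz => by rw [N.w_eq_zero hz, zero_mul])]
      exact Finset.sum_congr rfl fun z _ => by ring
  have h2 : ∑ x ∈ s, f x * N.lap f x = ∑ x ∈ s, ∑ z ∈ s, N.w x z * (f z * (f z - f x)) := by
    rw [h1, Finset.sum_comm]
    exact Finset.sum_congr rfl fun x _ => Finset.sum_congr rfl fun z _ => by rw [N.w_symm]
  have h3 : 2 * ∑ x ∈ s, f x * N.lap f x = ∑ x ∈ s, ∑ z ∈ s, N.w x z * (f x - f z) ^ 2 := by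
    rw [two_mul]
    nth_rewrite 1 [h1]
    rw [h2]
    simp only [← Finset.sum_add_distrib]
    exact Finset.sum_congr rfl fun x _ => Finset.sum_congr rfl fun z _ => by ring
  have h4 : ∀ x ∈ s, ∑ z ∈ s, N.w x z * (f x - f z) ^ 2 ≤ N.A * b := fun x _ => by
    have h5 : ∀ z, N.w x z * (f x - f z) ^ 2 ≤ N.w x z * b := fun z => by
      rcases (N.w_nonneg x z).eq_or_lt with h | h
      · rw [← h]; simp
      · exact mul_le_mul_of_nonneg_left (hb x z h) h.le
    have h6 : ∑ z ∈ s, N.w x z ≤ N.W x := by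
      rw [N.W_eq]
      calc ∑ z ∈ s, N.w x z ≤ ∑ z ∈ s ∪ N.nb x, N.w x z :=
            Finset.sum_le_sum_of_subset_of_nonneg Finset.subset_union_left
              fun _ _ _ => N.w_nonneg _ _
        _ = ∑ z ∈ N.nb x, N.w x z := (Finset.sum_subset Finset.subset_union_right
              fun z _ hz => N.w_eq_zero hz).symm
    calc ∑ z ∈ s, N.w x z * (f x - f z) ^ 2 ≤ ∑ z ∈ s, N.w x z * b :=
          Finset.sum_le_sum fun z _ => h5 z
      _ = (∑ z ∈ s, N.w x z) * b := by rw [Finset.sum_mul]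
      _ ≤ N.A * b := mul_le_mul_of_nonneg_right (h6.trans (N.W_le x)) hb0
  have h5 : 2 * ∑ x ∈ s, f x * N.lap f x ≤ ∑ x ∈ s, N.A * b := h3.trans_le (Finset.sum_le_sum h4)
  rw [Finset.sum_const, nsmul_eq_mul] at h5
  have : 0 ≤ (s.card : ℝ) * (N.A * b) := by have := N.A_pos; positivity
  nlinarith

lemma nu_add_two_le (o : V) : N.ν + 2 ≤ N.α := by
  obtain ⟨C, hC, hsum⟩ := N.g_sum_le
  have hA := N.A_pos
  have hα := N.α_ge
  have hν := N.one_le_ν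
  have hνα := N.two_ν_le
  have key : ∃ K : ℝ, 0 < K ∧ ∀ R : ℝ, 1 ≤ R → 1 ≤ K * R ^ (N.α - N.ν - 2) := by
    refine ⟨N.A ^ 2 * ((N.A * (C * 2 ^ (N.α - N.ν))) * (N.A * (N.A * (3 * N.A) ^ N.α) * N.A ^ 2)),
      by have := hA; positivity, fun R hR => ?_⟩
    have hR0 : 0 < R := by linarith
    have h1A := N.one_le_A
    set s := N.bal o (2 * R + N.A) with hs
    set f := N.tent o R with hf
    set e : V → ℝ := fun z => if z ∈ N.bal o R then 1 else 0 with he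
    have hsupp : ∀ z, z ∉ s → f z = 0 ∧ ∀ v ∈ N.nb z, f v = 0 := fun z hz => by
      rw [hs, mem_bal, not_le] at hz
      refine ⟨N.tent_eq_zero o hR0 (by linarith), fun v hv => N.tent_eq_zero o hR0 ?_⟩
      have h1 := N.w_d z v ((N.mem_nb _ _).1 hv)
      have h2 := N.d_triangle o v z
      rw [N.d_symm v z] at h2
      linarith
    have hInt : ∀ x ∈ s, f x ≠ 0 → N.nb x ⊆ s := fun x _ hx v hv => by
      rw [hs, mem_bal]
      have h1 := N.w_d x v ((N.mem_nb _ _).1 hv)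
      have h2 := N.d_triangle o x v
      have h3 : N.d o x ≤ 2 * R := by
        by_contra h
        exact hx (N.tent_eq_zero o hR0 (not_le.1 h))
      linarith
    have hpl := N.pot_lap s f hsupp
    have e1 : N.en s (N.lap f) (N.lap f) = ∑ x ∈ s, f x * N.lap f x := by
      rw [en]
      refine Finset.sum_congr rfl fun x _ => ?_
      rw [← hpl x, Finset.sum_mul]
      refine Finset.sum_congr rfl fun y _ => ?_
      rw [N.g_symm]; ring
    have hBs : N.bal o R ⊆ s := fun z hz => by
      rw [hs, mem_bal]; rw [mem_bal] at hz; linarith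
    have e2 : N.en s e (N.lap f) = (N.bal o R).card := by
      have : N.en s e (N.lap f) = ∑ x ∈ s, e x * f x := by
        rw [en]
        refine Finset.sum_congr rfl fun x _ => ?_
        rw [← hpl x, Finset.mul_sum]
        refine Finset.sum_congr rfl fun y _ => ?_
        rw [N.g_symm]; ring
      rw [this, Finset.cast_card, ← Finset.sum_subset hBs]
      · refine Finset.sum_congr rfl fun x hx => ?_
        rw [he]
        simp only [if_pos hx, one_mul]
        exact N.tent_eq_one o hR0 ((N.mem_bal _ _ _).1 hx)
      · intro x _ hx
        rw [he]; simp [hx]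
    have e3 : N.en s e e ≤ N.A * R ^ N.α * (C * (2 * R) ^ (N.α - N.ν)) := by
      have h1 : N.en s e e = ∑ x ∈ N.bal o R, ∑ y ∈ N.bal o R, N.g x y := by
        rw [en, ← Finset.sum_subset hBs]
        · refine Finset.sum_congr rfl fun x hx => ?_
          rw [← Finset.sum_subset hBs]
          · refine Finset.sum_congr rfl fun y hy => ?_
            simp [he, hx, hy]
          · intro y _ hy; simp [he, hy]
        · intro x _ hx; simp [he, hx]
      rw [h1]
      have h2 : ∀ x ∈ N.bal o R, ∑ y ∈ N.bal o R, N.g x y ≤ C * (2 * R) ^ (N.α - N.ν) := by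
        intro x hx
        refine le_trans (Finset.sum_le_sum_of_subset_of_nonneg (fun y hy => ?_)
          fun _ _ _ => N.g_nonneg _ _) (hsum x (2 * R) (by linarith))
        rw [mem_bal] at hx hy ⊢
        have := N.d_triangle x o y
        rw [N.d_symm x o] at this
        linarith
      calc _ ≤ ∑ x ∈ N.bal o R, C * (2 * R) ^ (N.α - N.ν) := Finset.sum_le_sum h2
        _ = (N.bal o R).card * (C * (2 * R) ^ (N.α - N.ν)) := by
            rw [Finset.sum_const, nsmul_eq_mul]
        _ ≤ _ := mul_le_mul_of_nonneg_right (N.card_le o R hR) (by positivity)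
    have e4 : N.en s (N.lap f) (N.lap f) ≤ N.A * (N.A * (3 * N.A * R) ^ N.α) * (N.A / R) ^ 2 := by
      rw [e1]
      refine (N.dirichlet_le s f hInt (sq_nonneg _) (fun x z h => N.tent_lip o hR0 h)).trans ?_
      have h1 : (s.card : ℝ) ≤ N.A * (2 * R + N.A) ^ N.α := N.card_le o _ (by linarith)
      have h2 : (2 * R + N.A) ^ N.α ≤ (3 * N.A * R) ^ N.α :=
        Real.rpow_le_rpow (by linarith) (by nlinarith) (by linarith)
      have h3 : N.A * (2 * R + N.A) ^ N.α ≤ N.A * (3 * N.A * R) ^ N.α :=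
        mul_le_mul_of_nonneg_left h2 hA.le
      gcongr
      exact h1.trans h3
    have hcs := N.en_cauchy s e (N.lap f)
    rw [e2] at hcs
    have h7 := N.card_ge o R hR
    have h8 : (R ^ N.α) ^ 2 ≤ N.A ^ 2 * (((N.bal o R).card : ℝ)) ^ 2 := by
      rw [← mul_pow]
      exact pow_le_pow_left₀ (Real.rpow_nonneg hR0.le _) h7 2
    have h9 : (R ^ N.α) ^ 2 ≤ N.A ^ 2 * ((N.A * R ^ N.α * (C * (2 * R) ^ (N.α - N.ν))) *
        (N.A * (N.A * (3 * N.A * R) ^ N.α) * (N.A / R) ^ 2)) := by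
      refine h8.trans (mul_le_mul_of_nonneg_left (hcs.trans ?_) (by positivity))
      exact mul_le_mul e3 e4 (N.en_self_nonneg _ _) (by positivity)
    have h10 : 0 < (R ^ N.α) ^ 2 := by positivity
    rw [Real.mul_rpow two_pos.le hR0.le, Real.mul_rpow (by positivity) hR0.le] at h9
    have h11 : R ^ (N.α - N.ν - 2) = R ^ (N.α - N.ν) / R ^ 2 := by
      rw [Real.rpow_sub hR0]; norm_num
    rw [h11]
    refine le_of_mul_le_mul_right ?_ h10
    rw [one_mul]
    refine h9.trans (le_of_eq ?_)
    field_simp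
  obtain ⟨K, hK, h⟩ := key
  by_contra hcon
  push Not at hcon
  have ht := (tendsto_rpow_neg_atTop (y := -(N.α - N.ν - 2)) (by linarith)).const_mul K
  rw [mul_zero, neg_neg] at ht
  obtain ⟨R, h1, h2⟩ := ((ht.eventually (gt_mem_nhds (zero_lt_one))).and
    (eventually_ge_atTop 1)).exists
  linarith [h R h2]

end Net

end Perc

namespace Perc

section Link

/-- A model together with its simplified network. -/
structure Linked (M : Model) (N : Net M.V) : Prop where
  w_eq : N.w = wOff M.toWGraph
  g_eq : N.g = M.green

variable {M : Model} {N : Net M.V}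

lemma Linked.lam_eq (hL : Linked M N) {x y : M.V} (h : x ≠ y) : M.lam x y = N.w x y := by
  rw [hL.w_eq, wOff_of_ne _ h]

/-- Restriction of the field to a finite set. -/
def restr (M : Model) (s : Finset M.V) (ω : M.Ω) : s → ℝ := fun u => M.φ ω u

lemma restr_measurable (s : Finset M.V) : Measurable (restr M s) :=
  measurable_pi_lambda _ fun u => M.φ_meas u

lemma exists_fg (hL : Linked M N) (s : Finset M.V) :
    ∃ S : FG s, S.Q = N.prec s ∧ S.μ = M.P.map (restr M s) := by
  have := M.Pprob
  obtain ⟨κ, h0, ht, hκ⟩ := gaussian_law (P := M.P) (N.prec_posDef s) (restr_measurable s)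
    (fun c => by
      have h := M.φ_gauss s (Net.ext0 c)
      have e1 : (fun ω => ∑ x ∈ s, Net.ext0 c x * M.φ ω x) =
          fun ω => ∑ i : s, c i * restr M s ω i := by
        funext ω
        rw [← Finset.sum_coe_sort s]
        exact Finset.sum_congr rfl fun i _ => by rw [Net.ext0_coe]; rfl
      have e2 : ∑ x ∈ s, ∑ y ∈ s, Net.ext0 c x * Net.ext0 c y * M.green x y =
          qf (N.gmat s) c := by
        rw [← Finset.sum_coe_sort s]
        simp only [qf, dotProduct, Matrix.mulVec, Finset.mul_sum]
        refine Finset.sum_congr rfl fun i _ => ?_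
        rw [← Finset.sum_coe_sort s]
        refine Finset.sum_congr rfl fun j _ => ?_
        rw [Net.ext0_coe, Net.ext0_coe, Net.gmat, hL.g_eq]; ring
      rw [e1, e2] at h
      convert h using 4
      convert N.prec_inv s)
  have hp : IsProbabilityMeasure (κ • gm (N.prec s)) := by
    rw [← hκ]; exact Measure.isProbabilityMeasure_map (restr_measurable s).aemeasurable
  refine ⟨⟨N.prec s, N.prec_posDef s, N.prec_off s, κ, h0, ht, hp, fun i => ?_⟩, rfl, hκ.symm⟩
  rw [← hκ, integrable_map_measure (measurable_pi_apply i).aestronglyMeasurable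
    (restr_measurable s).aemeasurable]
  exact (phi_memLp M i).integrable one_le_two

lemma conn_symm {a : ℝ} {ω : M.Ω} {x y : M.V} (h : M.conn a ω x y) : M.conn a ω y x := by
  induction h with
  | refl => exact .refl
  | tail _ h2 ih => exact Relation.ReflTransGen.head (M.opn_symm _ _ _ _ h2) ih

lemma cluster_eq {a : ℝ} {ω : M.Ω} {x y : M.V} (h : M.conn a ω x y) :
    M.cluster a ω x = M.cluster a ω y := by
  ext z
  exact ⟨fun hz => (conn_symm h).trans hz, fun hz => h.trans hz⟩

lemma opn_nb (hL : Linked M N) {a : ℝ} {ω : M.Ω} {u v : M.V} (h : M.opn a ω u v) (huv : u ≠ v) :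
    v ∈ N.nb u := by
  rw [N.mem_nb, ← hL.lam_eq huv]
  exact M.opn_edge a ω u v h

/-- Openness of an unordered pair. -/
def opE (M : Model) (s : Finset M.V) (a : ℝ) (ω : M.Ω) (e : Sym2 s) : Prop :=
  M.opn a ω (Quot.out e).1 (Quot.out e).2

lemma out_eq {s : Finset M.V} (e : Sym2 s) : s((Quot.out e).1, (Quot.out e).2) = e :=
  Quot.out_eq e

lemma opE_mk (s : Finset M.V) (a : ℝ) (ω : M.Ω) (u v : s) :
    opE M s a ω s(u, v) ↔ M.opn a ω u v := by
  have h := out_eq s(u, v)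
  rw [Sym2.eq_iff] at h
  unfold opE
  rcases h with ⟨h1, h2⟩ | ⟨h1, h2⟩
  · rw [h1, h2]
  · rw [h1, h2]
    exact ⟨M.opn_symm _ _ _ _, M.opn_symm _ _ _ _⟩

/-- A set of vertices of `s` as a set of vertices of the graph. -/
def up {V : Type} {s : Finset V} (K : Finset s) : Finset V := K.map (Function.Embedding.subtype _)

lemma mem_up {V : Type} {s : Finset V} {K : Finset s} {v : V} :
    v ∈ up K ↔ ∃ h : v ∈ s, (⟨v, h⟩ : s) ∈ K := by simp [up]

lemma coe_mem_up {V : Type} {s : Finset V} {K : Finset s} {v : s} : (v : V) ∈ up K ↔ v ∈ K := by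
  simp [up]

lemma up_mono {V : Type} {s : Finset V} {K K' : Finset s} (h : K ⊆ K') : up K ⊆ up K' :=
  Finset.map_subset_map.2 h

lemma up_injective {V : Type} {s : Finset V} : Function.Injective (up (s := s)) :=
  Finset.map_injective _

lemma exists_up {V : Type} {s A : Finset V} (h : A ⊆ s) : ∃ K : Finset s, up K = A :=
  ⟨s.attach.filter fun v => (v : V) ∈ A, by
    ext v
    rw [mem_up]
    constructor
    · rintro ⟨h1, h2⟩; simpa using h2
    · intro hv; exact ⟨h hv, by simpa using hv⟩⟩

lemma cluster_iff (hL : Linked M N) {s : Finset M.V} (a : ℝ) (ω : M.Ω) (y : s) (K : Finset s)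
    (hK : ∀ u ∈ K, N.nb u ⊆ s) (hy : y ∈ K) :
    M.cluster a ω y = ↑(up K) ↔
      cl ((inE K).filter (opE M s a ω)) y = K ∧ ∀ e ∈ bdE K, ¬ opE M s a ω e := by
  constructor
  · intro h
    have hc : ∀ z : s, M.conn a ω y z ↔ z ∈ K := fun z => by
      have : (z : M.V) ∈ M.cluster a ω y ↔ (z : M.V) ∈ (↑(up K) : Set M.V) := by rw [h]
      rw [Finset.mem_coe, coe_mem_up] at this
      exact this
    refine ⟨?_, ?_⟩
    · ext z
      rw [mem_cl]
      constructor
      · intro hz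
        rw [← hc]
        induction hz with
        | refl => exact .refl
        | tail _ h2 ih => exact ih.tail ((opE_mk s a ω _ _).1 (Finset.mem_filter.1 h2).2)
      · intro hz
        have : ∀ v, M.conn a ω y v → ∃ h : v ∈ s, Relation.ReflTransGen
            (fun u v => s(u, v) ∈ (inE K).filter (opE M s a ω)) y ⟨v, h⟩ := by
          intro v hv
          induction hv with
          | refl => exact ⟨y.2, .refl⟩
          | @tail u v h1 h2 ih =>
            obtain ⟨hu, ih⟩ := ih
            have hv : v ∈ (↑(up K) : Set M.V) := by
              rw [← h]; exact h1.tail h2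
            rw [Finset.mem_coe, mem_up] at hv
            obtain ⟨hvs, hvK⟩ := hv
            have huK : (⟨u, hu⟩ : s) ∈ K := (hc ⟨u, hu⟩).1 h1
            refine ⟨hvs, ?_⟩
            by_cases huv : u = v
            · subst huv; exact ih
            · refine ih.tail (Finset.mem_filter.2 ⟨?_, (opE_mk s a ω ⟨u, hu⟩ ⟨v, hvs⟩).2 h2⟩)
              simp only [inE, Finset.mem_filter, Finset.mem_univ, true_and, Sym2.mem_iff,
                Sym2.mk_isDiag_iff, Subtype.mk.injEq, huv, not_false_eq_true]
              rintro p (rfl | rfl)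
              exacts [huK, hvK]
        obtain ⟨_, h2⟩ := this z ((hc z).2 hz)
        exact h2
    · intro e he ho
      induction e with | _ u v => ?_
      rw [opE_mk] at ho
      simp only [bdE, Finset.mem_filter, Finset.mem_univ, true_and, Sym2.mem_iff] at he
      obtain ⟨⟨p, hp, hpK⟩, q, hq, hqK⟩ := he
      have h1 : M.opn a ω p q := by
        rcases hp with rfl | rfl <;> rcases hq with rfl | rfl
        · exact absurd hpK hqK
        · exact ho
        · exact M.opn_symm _ _ _ _ ho
        · exact absurd hpK hqK
      exact hqK ((hc q).1 (((hc p).2 hpK).tail h1))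
  · rintro ⟨h1, h2⟩
    have hc : ∀ v, M.conn a ω y v → v ∈ up K := by
      intro v hv
      induction hv with
      | refl => exact coe_mem_up.2 hy
      | @tail u v _ ho ih =>
        obtain ⟨hus, huK⟩ := mem_up.1 ih
        by_cases huv : u = v
        · rw [← huv]; exact ih
        · have hvs : v ∈ s := hK _ huK (opn_nb hL ho huv)
          by_contra hvK
          refine h2 s(⟨u, hus⟩, ⟨v, hvs⟩) ?_ ((opE_mk s a ω _ _).2 ho)
          have hvK' : (⟨v, hvs⟩ : s) ∉ K := fun h => hvK (mem_up.2 ⟨hvs, h⟩)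
          simp only [bdE, Finset.mem_filter, Finset.mem_univ, true_and, Sym2.mem_iff]
          exact ⟨⟨_, Or.inl rfl, huK⟩, ⟨_, Or.inr rfl, hvK'⟩⟩
    ext v
    refine ⟨fun hv => hc v hv, fun hv => ?_⟩
    obtain ⟨hvs, hvK⟩ := mem_up.1 hv
    rw [← h1, mem_cl] at hvK
    have : ∀ z : s, Relation.ReflTransGen
        (fun u v => s(u, v) ∈ (inE K).filter (opE M s a ω)) y z → M.conn a ω y z := by
      intro z hz
      induction hz with
      | refl => exact .refl
      | tail _ h2 ih => exact ih.tail ((opE_mk s a ω _ _).1 (Finset.mem_filter.1 h2).2)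
    exact this _ hvK

lemma pe_prec (hL : Linked M N) {s : Finset M.V} (x : s → ℝ) {u v : s} (huv : u ≠ v)
    (h : N.nb u ⊆ s ∨ N.nb v ⊆ s) :
    pe (N.prec s) x s(u, v) =
      1 - Real.exp (-(2 * M.lam u v * max (x u) 0 * max (x v) 0)) := by
  have hs : (N.prec s).IsSymm := posDef_isSymm (N.prec_posDef s)
  have h1 : N.prec s u v = -M.lam u v := by
    have huv' : (u : M.V) ≠ v := fun h => huv (Subtype.ext h)
    rcases h with h | h
    · rw [N.prec_apply_of_interior s u h, if_neg huv, hL.lam_eq huv']; ring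
    · have : N.prec s u v = N.prec s v u := hs.apply v u
      rw [this, N.prec_apply_of_interior s v h, if_neg huv.symm, hL.lam_eq huv', N.w_symm]; ring
  rw [pe_mk, cond_eq hs (N.prec_off s) huv, h1]
  congr 3; ring

lemma cluster_measurable_prob (hL : Linked M N) {s : Finset M.V} (a : ℝ) (y : s) (K : Finset s)
    (hK : ∀ u ∈ K, N.nb u ⊆ s) (hy : y ∈ K) :
    MeasurableSet {ω | M.cluster a ω y = ↑(up K)} ∧
    M.P {ω | M.cluster a ω y = ↑(up K)} =
      ∫⁻ ω, ENNReal.ofReal (wK (pe (N.prec s) (restr M s ω - a • 1)) y K) ∂M.P := by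
  set Good := (inE K).powerset.filter (fun S => cl S y = K) with hGood
  set Ev : Finset (Sym2 s) → Set M.Ω := fun S =>
    {ω | (inE K).filter (opE M s a ω) = S ∧ ∀ e ∈ bdE K, ¬ opE M s a ω e} with hEv
  have hset : {ω | M.cluster a ω y = ↑(up K)} = ⋃ S ∈ Good, Ev S := by
    ext ω
    simp only [Set.mem_iUnion, Set.mem_ofPred_eq, hGood, hEv, Finset.mem_filter,
      Finset.mem_powerset, exists_prop]
    rw [cluster_iff hL a ω y K hK hy]
    constructor
    · rintro ⟨h1, h2⟩
      exact ⟨_, ⟨Finset.filter_subset _ _, h1⟩, rfl, h2⟩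
    · rintro ⟨S, ⟨_, h1⟩, rfl, h2⟩
      exact ⟨h1, h2⟩
  have hom : ∀ e, MeasurableSet {ω | opE M s a ω e} := fun e => M.opn_meas a _ _
  set pr : Sym2 s → M.V × M.V := fun e => ((Quot.out e).1, (Quot.out e).2) with hpr
  have hprinj : Function.Injective pr := fun e f h => by
    rw [← out_eq e, ← out_eq f]
    simp only [hpr, Prod.mk.injEq] at h
    rw [Subtype.ext h.1, Subtype.ext h.2]
  have hEvS : ∀ S ⊆ inE K, Ev S = {ω | (∀ e ∈ S.image pr, M.opn a ω e.1 e.2) ∧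
      ∀ e ∈ ((inE K \ S) ∪ bdE K).image pr, ¬ M.opn a ω e.1 e.2} := by
    intro S hS
    ext ω
    simp only [hEv, Set.mem_ofPred_eq, Finset.forall_mem_image]
    constructor
    · rintro ⟨rfl, h2⟩
      refine ⟨fun e he => (Finset.mem_filter.1 he).2, fun e he ho => ?_⟩
      rcases Finset.mem_union.1 he with h | h
      · exact (Finset.mem_sdiff.1 h).2 (Finset.mem_filter.2 ⟨(Finset.mem_sdiff.1 h).1, ho⟩)
      · exact h2 e h ho
    · rintro ⟨h1, h2⟩
      refine ⟨?_, fun e he ho => h2 (Finset.mem_union_right _ he) ho⟩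
      ext e
      rw [Finset.mem_filter]
      constructor
      · rintro ⟨he, ho⟩
        by_contra hn
        exact h2 (Finset.mem_union_left _ (Finset.mem_sdiff.2 ⟨he, hn⟩)) ho
      · intro he; exact ⟨hS he, h1 he⟩
  have hEm : ∀ S ⊆ inE K, MeasurableSet (Ev S) := by
    intro S hS
    rw [hEvS S hS]
    have e1 : {ω | (∀ e ∈ S.image pr, M.opn a ω e.1 e.2) ∧
      ∀ e ∈ ((inE K \ S) ∪ bdE K).image pr, ¬ M.opn a ω e.1 e.2} =
      (⋂ e ∈ S.image pr, {ω | M.opn a ω e.1 e.2}) ∩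
        ⋂ e ∈ ((inE K \ S) ∪ bdE K).image pr, {ω | M.opn a ω e.1 e.2}ᶜ := by
      ext ω; simp only [Set.mem_ofPred_eq, Set.mem_inter_iff, Set.mem_iInter, Set.mem_compl_iff]
    rw [e1]
    exact (Finset.measurableSet_biInter _ fun e _ => M.opn_meas a _ _).inter
      (Finset.measurableSet_biInter _ fun e _ => (M.opn_meas a _ _).compl)
  have hGsub : ∀ S ∈ Good, S ⊆ inE K := fun S hS =>
    Finset.mem_powerset.1 (Finset.mem_filter.1 hS).1
  have hnd : ∀ e ∈ inE K ∪ bdE K, ¬ e.IsDiag ∧ ∃ u ∈ e, u ∈ K := by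
    intro e he
    induction e with | _ u v => ?_
    simp only [inE, bdE, Finset.mem_union, Finset.mem_filter, Finset.mem_univ, true_and,
      Sym2.mem_iff, Sym2.mk_isDiag_iff] at he ⊢
    rcases he with ⟨h1, h2⟩ | ⟨⟨p, hp, hpK⟩, q, hq, hqK⟩
    · exact ⟨h1, u, Or.inl rfl, h2 u (Or.inl rfl)⟩
    · refine ⟨?_, p, hp, hpK⟩
      rintro rfl
      have : p = q := by
        rcases hp with rfl | rfl <;> rcases hq with rfl | rfl <;> rfl
      exact hqK (this ▸ hpK)
  have hpe : ∀ ω, ∀ e ∈ inE K ∪ bdE K, pe (N.prec s) (restr M s ω - a • 1) e =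
      1 - Real.exp (-(2 * M.lam (pr e).1 (pr e).2 * max (M.φ ω (pr e).1 - a) 0 *
        max (M.φ ω (pr e).2 - a) 0)) := by
    intro ω e he
    obtain ⟨hd, p, hp, hpK⟩ := hnd e he
    have h0 := out_eq e
    conv_lhs => rw [← h0]
    have hne : (Quot.out e).1 ≠ (Quot.out e).2 := fun h => hd (by
      rw [← h0]; exact Sym2.mk_isDiag_iff.2 h)
    have hor : p = (Quot.out e).1 ∨ p = (Quot.out e).2 := by
      rw [← h0, Sym2.mem_iff] at hp; exact hp
    rw [pe_prec hL _ hne (by rcases hor with rfl | rfl; exacts [Or.inl (hK _ hpK), Or.inr (hK _ hpK)])]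
    simp [restr, hpr]
  have hEP : ∀ S ∈ Good, M.P (Ev S) = ∫⁻ ω, ENNReal.ofReal
      (bern (inE K) (pe (N.prec s) (restr M s ω - a • 1)) S *
        ∏ e ∈ bdE K, (1 - pe (N.prec s) (restr M s ω - a • 1) e)) ∂M.P := by
    intro S hSG
    have hS := hGsub S hSG
    have hdisj : Disjoint (inE K \ S) (bdE K) := by
      rw [Finset.disjoint_left]
      intro e h1 h2
      simp only [inE, bdE, Finset.mem_sdiff, Finset.mem_filter] at h1 h2
      obtain ⟨_, _, q, hq, hqK⟩ := h2
      exact hqK (h1.1.2.2 q hq)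
    have hdisj2 : Disjoint S ((inE K \ S) ∪ bdE K) := by
      rw [Finset.disjoint_left]
      intro e h1 h2
      rcases Finset.mem_union.1 h2 with h | h
      · exact (Finset.mem_sdiff.1 h).2 h1
      · have h3 := hS h1
        simp only [inE, bdE, Finset.mem_filter] at h3 h
        obtain ⟨_, _, q, hq, hqK⟩ := h
        exact hqK (h3.2.2 q hq)
    have hall : S ∪ ((inE K \ S) ∪ bdE K) ⊆ inE K ∪ bdE K := by
      intro e he
      simp only [Finset.mem_union, Finset.mem_sdiff] at he ⊢
      rcases he with h | h | h
      exacts [Or.inl (hS h), Or.inl h.1, Or.inr h]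
    have h := M.opn_law a (S.image pr) (((inE K \ S) ∪ bdE K).image pr)
      ((Finset.disjoint_image hprinj).2 hdisj2) (by
        intro e he f hf hef hswap
        rw [← Finset.image_union] at he hf
        obtain ⟨e', he', rfl⟩ := Finset.mem_image.1 he
        obtain ⟨f', hf', rfl⟩ := Finset.mem_image.1 hf
        refine hef ?_
        congr 1
        rw [← out_eq e', ← out_eq f']
        simp only [hpr, Prod.swap_prod_mk, Prod.mk.injEq] at hswap
        rw [Subtype.ext hswap.1, Subtype.ext hswap.2, Sym2.eq_swap]) Set.univ MeasurableSet.univ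
    simp only [Set.mem_univ, Set.ofPred_true, Set.univ_inter, Measure.restrict_univ] at h
    rw [hEvS S hS, h]
    refine lintegral_congr fun ω => ?_
    congr 1
    rw [Finset.prod_image (hprinj.injOn), Finset.prod_image (hprinj.injOn),
      Finset.prod_union hdisj, bern, mul_assoc]
    congr 1
    · exact Finset.prod_congr rfl fun e he => (hpe ω e (Finset.mem_union_left _ (hS he))).symm
    · congr 1
      · exact Finset.prod_congr rfl fun e he => by
          rw [hpe ω e (Finset.mem_union_left _ (Finset.mem_sdiff.1 he).1), sub_sub_cancel]
      · exact Finset.prod_congr rfl fun e he => by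
          rw [hpe ω e (Finset.mem_union_right _ he), sub_sub_cancel]
  have hpd : (Good : Set (Finset (Sym2 s))).PairwiseDisjoint Ev := by
    intro S _ S' _ hne
    rw [Function.onFun, Set.disjoint_left]
    rintro ω ⟨h1, _⟩ ⟨h2, _⟩
    exact hne (h1.symm.trans h2)
  refine ⟨?_, ?_⟩
  · rw [hset]
    exact Finset.measurableSet_biUnion _ fun S hS => hEm S (hGsub S hS)
  · have hmb : ∀ S, Measurable fun ω => ENNReal.ofReal
        (bern (inE K) (pe (N.prec s) (restr M s ω - a • 1)) S *
        ∏ e ∈ bdE K, (1 - pe (N.prec s) (restr M s ω - a • 1) e)) := fun S => by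
      have h1 : Measurable fun ω => restr M s ω - a • (1 : s → ℝ) :=
        (restr_measurable s).sub measurable_const
      have h2 : ∀ e, Measurable fun ω => pe (N.prec s) (restr M s ω - a • 1) e :=
        fun e => (pe_measurable _ e).comp h1
      unfold bern
      fun_prop
    have hnn : ∀ ω S, 0 ≤ bern (inE K) (pe (N.prec s) (restr M s ω - a • 1)) S *
        ∏ e ∈ bdE K, (1 - pe (N.prec s) (restr M s ω - a • 1) e) := fun ω S =>
      mul_nonneg (mul_nonneg (Finset.prod_nonneg fun e _ => (pe_mem _ _ e).1)
        (Finset.prod_nonneg fun e _ => by linarith [(pe_mem (N.prec s) (restr M s ω - a • 1) e).2]))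
        (Finset.prod_nonneg fun e _ => by linarith [(pe_mem (N.prec s) (restr M s ω - a • 1) e).2])
    rw [hset, measure_biUnion_finset hpd (fun S hS => hEm S (hGsub S hS)),
      Finset.sum_congr rfl hEP, ← lintegral_finsetSum _ (fun S _ => hmb S)]
    refine lintegral_congr fun ω => ?_
    rw [← ENNReal.ofReal_sum_of_nonneg (fun S _ => hnn ω S)]
    congr 1
    rw [wK_eq, innK, ← Finset.sum_mul, hGood, Finset.sum_filter]
    congr 1
    refine Finset.sum_congr rfl fun S _ => ?_
    split_ifs with h
    · simp only [mul_one]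
      congr!
    · simp

end Link

end Perc

namespace Perc

section Cross

variable {ι : Type*} [Fintype ι]

/-- A cluster leaving a set does so through an edge of positive probability. -/
lemma wK_cross {p : Sym2 ι → ℝ} {y : ι} {K : Finset ι} (h : wK p y K ≠ 0) (P : ι → Prop)
    (hy : P y) {v : ι} (hv : v ∈ K) (hPv : ¬ P v) :
    ∃ a ∈ K, ∃ b ∈ K, P a ∧ ¬ P b ∧ p s(a, b) ≠ 0 := by
  obtain ⟨S, _, hS⟩ := Finset.exists_ne_zero_of_sum_ne_zero h
  have hcl : cl S y = K := by
    by_contra hne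
    simp [hne] at hS
  have hp : ∀ e ∈ S, p e ≠ 0 := by
    intro e he h0
    refine hS ?_
    rw [bern, Finset.prod_eq_zero he h0, zero_mul, zero_mul]
  have key : ∀ z, Relation.ReflTransGen (fun u v => s(u, v) ∈ S) y z → ¬ P z →
      ∃ a ∈ K, ∃ b ∈ K, P a ∧ ¬ P b ∧ p s(a, b) ≠ 0 := by
    intro z hz
    induction hz with
    | refl => exact fun h => absurd hy h
    | @tail b c hb hbc ih =>
      intro hc
      by_cases hPb : P b
      · exact ⟨b, by rw [← hcl, mem_cl]; exact hb, c, by rw [← hcl, mem_cl]; exact hb.tail hbc,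
          hPb, hc, hp _ hbc⟩
      · exact ih hPb
  rw [← hcl, mem_cl] at hv
  exact key v hv hPv

lemma FG.D_cross (S : FG ι) {y : ι} {K : Finset ι} (h : S.D y K ≠ 0) (P : ι → Prop)
    (hy : P y) {v : ι} (hv : v ∈ K) (hPv : ¬ P v) :
    ∃ a ∈ K, ∃ b ∈ K, P a ∧ ¬ P b ∧ S.Q a b ≠ 0 := by
  have : ∃ x, nK S.Q y K x ≠ 0 := by
    by_contra! hcon
    exact h (by simp [FG.D, hcon])
  obtain ⟨x, hx⟩ := this
  have hw : wK (pe S.Q x) y K ≠ 0 := by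
    intro h0
    rw [nK, h0, ite_self] at hx
    exact hx rfl
  obtain ⟨a, ha, b, hb, hPa, hPb, hab⟩ := wK_cross hw P hy hv hPv
  refine ⟨a, ha, b, hb, hPa, hPb, fun h0 => hab ?_⟩
  have hne : a ≠ b := by rintro rfl; exact hPb hPa
  rw [pe_mk, cond_eq S.symm S.off hne, h0]
  simp

lemma FG.mem_of_D_ne_zero (S : FG ι) {y : ι} {K : Finset ι} (h : S.D y K ≠ 0) : y ∈ K := by
  have : ∃ x, nK S.Q y K x ≠ 0 := by
    by_contra! hcon
    exact h (by simp [FG.D, hcon])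
  obtain ⟨x, hx⟩ := this
  exact (nK_ne_zero hx).1

lemma wK_eq_nK (Q : Matrix ι ι ℝ) {y : ι} {K : Finset ι} (hK : K ≠ {y}) (x : ι → ℝ) :
    wK (pe Q x) y K = nK Q y K x := by
  rw [nK]
  split_ifs with h
  · rfl
  · by_cases hy : y ∈ K
    · rw [wK_eq, innK_eq_zero hy hK (fun v _ => pe_zero Q (not_lt.1 h) v), zero_mul]
    · exact wK_of_notMem _ hy

end Cross

namespace Net

variable {V : Type} (N : Net V)

/-- Exponential weight of the capacity of a finite set. -/
def capW (a : ℝ) (A : Finset V) : ℝ :=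
  ⨅ μ : V → ℝ, Real.exp (-(a ^ 2 / 2 * (2 * ∑ x ∈ A, μ x - N.en A μ μ)))

lemma capW_bdd (a : ℝ) (A : Finset V) : BddBelow (Set.range fun μ : V → ℝ =>
    Real.exp (-(a ^ 2 / 2 * (2 * ∑ x ∈ A, μ x - N.en A μ μ)))) :=
  ⟨0, by rintro _ ⟨μ, rfl⟩; exact Real.exp_nonneg _⟩

lemma capW_le (a : ℝ) (A : Finset V) (μ : V → ℝ) :
    N.capW a A ≤ Real.exp (-(a ^ 2 / 2 * (2 * ∑ x ∈ A, μ x - N.en A μ μ))) :=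
  ciInf_le (N.capW_bdd a A) μ

lemma capW_nonneg (a : ℝ) (A : Finset V) : 0 ≤ N.capW a A :=
  Real.iInf_nonneg fun _ => Real.exp_nonneg _

lemma en_restrict {A B : Finset V} (h : A ⊆ B) (μ : V → ℝ) :
    N.en B (fun x => if x ∈ A then μ x else 0) (fun x => if x ∈ A then μ x else 0) =
      N.en A μ μ := by
  unfold en
  rw [← Finset.sum_subset h]
  · refine Finset.sum_congr rfl fun x hx => ?_
    rw [← Finset.sum_subset h]
    · exact Finset.sum_congr rfl fun y hy => by simp only [if_pos hx, if_pos hy]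
    · intro y _ hy; simp [hy]
  · intro x _ hx; simp [hx]

lemma sum_restrict {A B : Finset V} (h : A ⊆ B) (μ : V → ℝ) :
    ∑ x ∈ B, (if x ∈ A then μ x else 0) = ∑ x ∈ A, μ x := by
  rw [← Finset.sum_subset h]
  · exact Finset.sum_congr rfl fun x hx => if_pos hx
  · intro x _ hx; simp [hx]

lemma capW_anti (a : ℝ) {A B : Finset V} (h : A ⊆ B) : N.capW a B ≤ N.capW a A := by
  refine le_ciInf fun μ => ?_
  have := N.capW_le a B (fun x => if x ∈ A then μ x else 0)
  rwa [N.en_restrict h, sum_restrict h] at this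

lemma capW_le_of_subset (a : ℝ) {A B : Finset V} (h : A ⊆ B) (μ : V → ℝ) :
    N.capW a B ≤ Real.exp (-(a ^ 2 / 2 * (2 * ∑ x ∈ A, μ x - N.en A μ μ))) :=
  (N.capW_anti a h).trans (N.capW_le a A μ)

lemma qf_prec_ge (s : Finset V) (K : Finset s) (h : s → ℝ) (hK : ∀ u ∈ K, h u = 1)
    (μ : V → ℝ) : 2 * ∑ x ∈ up K, μ x - N.en (up K) μ μ ≤ qf (N.prec s) h := by
  set m : s → ℝ := fun u => if u ∈ K then μ u else 0 with hm
  have h0 := qf_nonneg (N.prec_posDef s) (h + (-1 : ℝ) • (N.gmat s).mulVec m)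
  rw [qf_add (posDef_isSymm (N.prec_posDef s)), bf_smul_right, qf_smul] at h0
  have e1 : (N.prec s).mulVec ((N.gmat s).mulVec m) = m := by
    rw [Matrix.mulVec_mulVec, N.prec_mul_gmat, Matrix.one_mulVec]
  have e2 : bf (N.prec s) h ((N.gmat s).mulVec m) = ∑ x ∈ up K, μ x := by
    rw [bf, e1, up, Finset.sum_map]
    simp only [dotProduct, hm, mul_ite, mul_zero, Finset.sum_ite_mem, Finset.univ_inter]
    exact Finset.sum_congr rfl fun u hu => by rw [hK u hu, one_mul]; rfl
  have e3 : qf (N.prec s) ((N.gmat s).mulVec m) = N.en (up K) μ μ := by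
    rw [qf, e1, en, up, Finset.sum_map]
    simp only [dotProduct, hm, mul_ite, mul_zero, Finset.sum_ite_mem, Finset.univ_inter,
      Matrix.mulVec, Finset.sum_mul, Finset.sum_map]
    refine Finset.sum_congr rfl fun u hu => Finset.sum_congr rfl fun v hv => ?_
    simp only [gmat, Function.Embedding.subtype_apply]
    ring
  rw [e2, e3] at h0
  linarith

end Net

section Prob

variable {M : Model} {N : Net M.V}

/-- Probability that the cluster of `y` contains `x` and stays in `Λ`. -/
def PL (M : Model) (a : ℝ) (x y : M.V) (Λ : Finset M.V) : ℝ :=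
  M.prob {ω | x ∈ M.cluster a ω y ∧ M.cluster a ω y ⊆ ↑Λ}

lemma tau_set (a : ℝ) (x y : M.V) :
    {ω | M.conn a ω x y ∧ (M.cluster a ω x).Finite} =
      ⋃ Λ : Finset M.V, {ω | x ∈ M.cluster a ω y ∧ M.cluster a ω y ⊆ ↑Λ} := by
  ext ω
  simp only [Set.mem_iUnion, Set.mem_ofPred_eq]
  constructor
  · rintro ⟨h1, h2⟩
    rw [cluster_eq h1] at h2
    exact ⟨h2.toFinset, conn_symm h1, by simp⟩
  · rintro ⟨Λ, h1, h2⟩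
    have h1' : M.conn a ω x y := conn_symm h1
    refine ⟨h1', ?_⟩
    rw [cluster_eq h1']
    exact Λ.finite_toSet.subset h2

lemma PL_le_tau (a : ℝ) (x y : M.V) (Λ : Finset M.V) : PL M a x y Λ ≤ M.tau a x y := by
  have := M.Pprob
  unfold PL Model.tau Model.prob
  rw [tau_set]
  exact ENNReal.toReal_mono (measure_ne_top _ _)
    (measure_mono (Set.subset_iUnion (fun Λ : Finset M.V =>
      {ω | x ∈ M.cluster a ω y ∧ M.cluster a ω y ⊆ ↑Λ}) Λ))

lemma tau_le_of (a : ℝ) (x y : M.V) {c : ℝ} (h : ∀ Λ, PL M a x y Λ ≤ c) :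
    M.tau a x y ≤ c := by
  have := M.Pprob
  have := M.countableV
  have hc : 0 ≤ c := ENNReal.toReal_nonneg.trans (h ∅)
  unfold Model.tau Model.prob
  rw [tau_set, Directed.measure_iUnion]
  · refine ENNReal.toReal_le_of_le_ofReal hc (iSup_le fun Λ => ?_)
    rw [ENNReal.le_ofReal_iff_toReal_le (measure_ne_top _ _) hc]
    exact h Λ
  · intro Λ Λ'
    refine ⟨Λ ∪ Λ', fun ω hω => ⟨hω.1, hω.2.trans ?_⟩, fun ω hω => ⟨hω.1, hω.2.trans ?_⟩⟩ <;>
      simp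

lemma tau_nonneg (a : ℝ) (x y : M.V) : 0 ≤ M.tau a x y := ENNReal.toReal_nonneg

lemma prob_cluster (hL : Linked M N) {s : Finset M.V} {S : FG s} (hQ : S.Q = N.prec s)
    (hμ : S.μ = M.P.map (restr M s)) (a : ℝ) (y : s) (K : Finset s)
    (hK : ∀ u ∈ K, N.nb u ⊆ s) (hy : y ∈ K) :
    (M.P {ω | M.cluster a ω y = ↑(up K)}).toReal =
      ∫ x, wK (pe S.Q (x - a • 1)) y K ∂S.μ := by
  have hm : Measurable fun x : s → ℝ => wK (pe S.Q (x - a • 1)) y K :=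
    (wK_measurable S.Q y K).comp (measurable_id.sub_const _)
  rw [(cluster_measurable_prob hL a y K hK hy).2, hμ,
    integral_map (restr_measurable s).aemeasurable hm.aestronglyMeasurable,
    integral_eq_lintegral_of_nonneg_ae (ae_of_all _ fun ω => wK_nonneg (pe_mem _ _) y K)
      (hm.comp (restr_measurable s)).aestronglyMeasurable, hQ]

/-- A finite set containing `Λ` and its neighbours. -/
def hull (N : Net M.V) (Λ : Finset M.V) : Finset M.V := Λ ∪ Λ.biUnion N.nb

lemma subset_hull (Λ : Finset M.V) : Λ ⊆ hull N Λ := Finset.subset_union_left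

lemma nb_subset_hull {Λ : Finset M.V} {u : M.V} (h : u ∈ Λ) : N.nb u ⊆ hull N Λ :=
  (Finset.subset_biUnion_of_mem N.nb h).trans Finset.subset_union_right

lemma PL_eq (hL : Linked M N) {s Λ : Finset M.V} (hs : hull N Λ ⊆ s) {S : FG s}
    (hQ : S.Q = N.prec s) (hμ : S.μ = M.P.map (restr M s)) (a : ℝ) {x : M.V} (y : s)
    (hxy : x ≠ y) :
    PL M a x y Λ = ∑ K : Finset s, if x ∈ up K ∧ up K ⊆ Λ then
      ∫ z, nK S.Q y K (z - a • 1) ∂S.μ else 0 := by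
  have := M.Pprob
  set I : Finset (Finset s) := Finset.univ.filter fun K => (x ∈ up K ∧ up K ⊆ Λ) ∧ y ∈ K with hI
  have hInt : ∀ K ∈ I, ∀ u ∈ K, N.nb u ⊆ s := fun K hK u hu =>
    (nb_subset_hull ((Finset.mem_filter.1 hK).2.1.2 (coe_mem_up.2 hu))).trans hs
  have hset : {ω | x ∈ M.cluster a ω y ∧ M.cluster a ω y ⊆ ↑Λ} =
      ⋃ K ∈ I, {ω | M.cluster a ω y = ↑(up K)} := by
    ext ω
    simp only [Set.mem_iUnion, Set.mem_ofPred_eq, exists_prop]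
    constructor
    · rintro ⟨h1, h2⟩
      have hfin : (M.cluster a ω y).Finite := Λ.finite_toSet.subset h2
      have hsub : hfin.toFinset ⊆ Λ := by
        intro v hv; exact h2 (hfin.mem_toFinset.1 hv)
      obtain ⟨K, hK⟩ := exists_up (hsub.trans ((subset_hull Λ).trans hs))
      have hKc : M.cluster a ω y = ↑(up K) := by rw [hK]; simp
      refine ⟨K, Finset.mem_filter.2 ⟨Finset.mem_univ _, ⟨?_, ?_⟩, ?_⟩, hKc⟩
      · rw [hKc] at h1; exact h1
      · rw [hK]; exact hsub
      · rw [← coe_mem_up, ← Finset.mem_coe, ← hKc]; exact Relation.ReflTransGen.refl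
    · rintro ⟨K, hK, hKc⟩
      have hK' := (Finset.mem_filter.1 hK).2
      rw [hKc]
      exact ⟨hK'.1.1, Finset.coe_subset.2 hK'.1.2⟩
  unfold PL Model.prob
  rw [hset, measure_biUnion_finset]
  · rw [ENNReal.toReal_sum fun K _ => measure_ne_top _ _]
    rw [← Finset.sum_filter]
    have hsub : I ⊆ Finset.univ.filter fun K : Finset s => x ∈ up K ∧ up K ⊆ Λ := by
      intro K hK
      exact Finset.mem_filter.2 ⟨Finset.mem_univ _, (Finset.mem_filter.1 hK).2.1⟩
    rw [← Finset.sum_subset hsub]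
    · refine Finset.sum_congr rfl fun K hK => ?_
      have hK' := (Finset.mem_filter.1 hK).2
      rw [prob_cluster hL hQ hμ a y K (hInt K hK) hK'.2]
      refine integral_congr_ae (ae_of_all _ fun z => ?_)
      refine wK_eq_nK S.Q ?_ _
      rintro rfl
      obtain ⟨h1, h2⟩ := mem_up.1 hK'.1.1
      exact hxy (congrArg Subtype.val (Finset.mem_singleton.1 h2))
    · intro K hK hKI
      have hyK : y ∉ K := fun hy => hKI (Finset.mem_filter.2
        ⟨Finset.mem_univ _, (Finset.mem_filter.1 hK).2, hy⟩)
      have : ∀ z, nK S.Q y K z = 0 := fun z => by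
        by_contra h; exact hyK (nK_ne_zero h).1
      simp [this]
  · intro K _ K' _ hne
    rw [Function.onFun, Set.disjoint_left]
    intro ω h1 h2
    exact hne (up_injective (Finset.coe_injective (h1.symm.trans h2)))
  · intro K hK
    exact (cluster_measurable_prob hL a y K (hInt K hK) (Finset.mem_filter.1 hK).2.2).1

lemma shift_le_capW {s : Finset M.V} {S : FG s} (hQ : S.Q = N.prec s)
    (a : ℝ) (y : s) (K : Finset s) (hK : ∀ u ∈ K, N.nb u ⊆ s) :
    ∫ z, nK S.Q y K (z - a • 1) ∂S.μ ≤ N.capW a (up K) * S.D y K := by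
  have key : ∀ μ : M.V → ℝ, ∫ z, nK S.Q y K (z - a • 1) ∂S.μ ≤
      Real.exp (-(a ^ 2 / 2 * (2 * ∑ x ∈ up K, μ x - N.en (up K) μ μ))) * S.D y K := by
    intro μ
    have := S.shift_D_le y K a (2 * ∑ x ∈ up K, μ x - N.en (up K) μ μ)
      (fun u hu => by
        rw [hQ, N.prec_mulVec_one_of_interior s u (hK u hu), mul_zero])
      (fun h hh => by rw [hQ]; exact N.qf_prec_ge s K h hh μ)
    refine this.trans (le_of_eq ?_)
    congr 2; ring
  rcases (S.D_nonneg y K).eq_or_lt with h0 | h0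
  · have := key 0
    rw [← h0, mul_zero] at this ⊢
    exact this
  · rw [← div_le_iff₀ h0]
    refine le_ciInf fun μ => ?_
    rw [div_le_iff₀ h0]
    exact key μ

lemma PL_le (hL : Linked M N) {s Λ : Finset M.V} (hs : hull N Λ ⊆ s) {S : FG s}
    (hQ : S.Q = N.prec s) (hμ : S.μ = M.P.map (restr M s)) (a : ℝ) {x : M.V} (y : s)
    (hxy : x ≠ y) :
    PL M a x y Λ ≤ ∑ K : Finset s, if x ∈ up K ∧ up K ⊆ Λ then
      N.capW a (up K) * S.D y K else 0 := by
  rw [PL_eq hL hs hQ hμ a y hxy]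
  refine Finset.sum_le_sum fun K _ => ?_
  split_ifs with h
  · exact shift_le_capW hQ a y K fun u hu =>
      (nb_subset_hull (h.2 (coe_mem_up.2 hu))).trans hs
  · exact le_rfl

lemma PL_zero (hL : Linked M N) {s Λ : Finset M.V} (hs : hull N Λ ⊆ s) {S : FG s}
    (hQ : S.Q = N.prec s) (hμ : S.μ = M.P.map (restr M s)) {x : M.V} (y : s)
    (hxy : x ≠ y) :
    PL M 0 x y Λ = ∑ K : Finset s, if x ∈ up K ∧ up K ⊆ Λ then S.D y K else 0 := by
  rw [PL_eq hL hs hQ hμ 0 y hxy]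
  simp only [zero_smul, sub_zero, FG.D]

lemma PL_of_notMem (a : ℝ) (x : M.V) {y : M.V} {Λ : Finset M.V} (h : y ∉ Λ) :
    PL M a x y Λ = 0 := by
  have : {ω | x ∈ M.cluster a ω y ∧ M.cluster a ω y ⊆ ↑Λ} = ∅ := by
    ext ω
    simp only [Set.mem_ofPred_eq, Set.mem_empty_iff_false, iff_false, not_and]
    intro _ h2
    exact h (h2 (Relation.ReflTransGen.refl : M.conn a ω y y))
  rw [PL, this, Model.prob, measure_empty, ENNReal.toReal_zero]

/-- Comparison with the critical two-point function by a capacity bound. -/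
lemma tau_le_of_capW (hL : Linked M N) (a : ℝ) {x y : M.V} (hxy : x ≠ y) {f : ℝ}
    (h : ∀ K : Finset M.V, x ∈ K → y ∈ K →
      (∀ P : M.V → Prop, P y → ∀ v ∈ K, ¬ P v → ∃ u ∈ K, ∃ w ∈ K, P u ∧ ¬ P w ∧ 0 < N.w u w) →
      N.capW a K ≤ f) (hf : 0 ≤ f) :
    M.tau a x y ≤ f * M.tau 0 x y := by
  refine tau_le_of a x y fun Λ => ?_
  by_cases hy : y ∈ Λ
  swap
  · rw [PL_of_notMem a x hy]; exact mul_nonneg hf (tau_nonneg 0 x y)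
  obtain ⟨S, hQ, hμ⟩ := exists_fg hL (hull N Λ)
  refine le_trans ?_ (mul_le_mul_of_nonneg_left (PL_le_tau 0 x y Λ) hf)
  set y' : hull N Λ := ⟨y, subset_hull Λ hy⟩
  have h1 := PL_le hL (Finset.Subset.refl _) hQ hμ a y' hxy
  have h2 := PL_zero hL (Finset.Subset.refl _) hQ hμ y' hxy
  refine h1.trans ?_
  change _ ≤ f * PL M 0 x y' Λ
  rw [h2, Finset.mul_sum]
  refine Finset.sum_le_sum fun K _ => ?_
  split_ifs with hK
  swap; · simp
  by_cases hD : S.D y' K = 0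
  · simp [hD]
  refine mul_le_mul_of_nonneg_right (h _ hK.1 (coe_mem_up (v := y') |>.2 (S.mem_of_D_ne_zero hD))
    fun P hPy v hv hPv => ?_) (S.D_nonneg _ _)
  obtain ⟨hvs, hvK⟩ := mem_up.1 hv
  obtain ⟨u, hu, w, hw, hPu, hPw, huw⟩ := S.D_cross hD (fun z => P z) hPy hvK hPv
  refine ⟨u, coe_mem_up.2 hu, w, coe_mem_up.2 hw, hPu, hPw, ?_⟩
  have hne : u ≠ w := by rintro rfl; exact hPw hPu
  rw [hQ, N.prec_apply_of_interior _ u (nb_subset_hull (hK.2 (coe_mem_up.2 hu))), if_neg hne] at huw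
  exact lt_of_le_of_ne (N.w_nonneg _ _) (fun h => huw (by rw [← h]; ring))

lemma tau_le_tau_zero (hL : Linked M N) (a : ℝ) {x y : M.V} (hxy : x ≠ y) :
    M.tau a x y ≤ Real.exp (-(a ^ 2 / (2 * N.A))) * M.tau 0 x y := by
  refine tau_le_of_capW hL a hxy (fun K hx _ _ => ?_) (Real.exp_nonneg _)
  refine (N.capW_le_of_subset a (Finset.singleton_subset_iff.2 hx) (fun _ => 1 / N.A)).trans ?_
  rw [Real.exp_le_exp, neg_le_neg_iff]
  simp only [Finset.sum_singleton, Net.en]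
  have hA := N.A_pos
  have h1 : 1 / N.A * (1 / N.A) * N.g x x ≤ 1 / N.A := by
    have := N.g_le_A x x
    rw [mul_assoc]
    refine mul_le_of_le_one_right (by positivity) ?_
    rw [one_div, inv_mul_le_iff₀ hA]; linarith
  have : a ^ 2 / (2 * N.A) = a ^ 2 / 2 * (1 / N.A) := by field_simp
  rw [this]
  refine mul_le_mul_of_nonneg_left (by linarith) (by positivity)

end Prob

end Perc

namespace Perc

/-- The response functions attached to a decreasing weight `F` of the explored set. -/
structure Net.Resp {V : Type} (N : Net V) (F : Finset V → ℝ) (y : V) (C : ℝ) where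
  R : Finset V → V → ℝ
  R_insert : ∀ A z, R (insert z A) z = R A z
  R_anti : ∀ A A' z, A ⊆ A' → R A' z ≤ R A z
  R_lap : ∀ A z, z ≠ y → N.lap (R A) z ≤ 0
  R_nonneg : ∀ A z, 0 ≤ R A z
  R_le : ∀ A z, R A z ≤ C * F A * N.g z y
  Λ : Finset V
  R_out : ∀ A z, z ∉ Λ → R A z = 0

section Moments

variable {M : Model} {N : Net M.V}

lemma abs_phi_le (hL : Linked M N) {s : Finset M.V} {S : FG s}
    (hμ : S.μ = M.P.map (restr M s)) (y : s) : ∫ x, |x y| ∂S.μ ≤ N.A := by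
  have := M.Pprob
  have hm : Measurable fun x : s → ℝ => |x y| :=
    continuous_abs.measurable.comp (measurable_pi_apply y)
  rw [hμ, integral_map (restr_measurable s).aemeasurable hm.aestronglyMeasurable]
  have h1 : ∀ ω, |restr M s ω y| ≤ (1 + (M.φ ω y) ^ 2) / 2 := fun ω => by
    have : restr M s ω y = M.φ ω y := rfl
    rw [this]
    nlinarith [sq_abs (M.φ ω y), sq_nonneg (|M.φ ω y| - 1)]
  have hInt : Integrable (fun ω => (M.φ ω y) ^ 2) M.P := (phi_memLp M y).integrable_sq
  have hint1 := (phi_memLp M (y : M.V)).integrable one_le_two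
  have h2 : ∫ ω, (M.φ ω y) ^ 2 ∂M.P = N.g y y := by
    have := phi_comb_sq M {(y : M.V)} (fun _ => 1)
    simp only [Finset.sum_singleton, one_mul] at this
    rw [this, ← hL.g_eq, max_eq_left (N.g_nonneg _ _)]
  calc ∫ ω, |restr M s ω y| ∂M.P ≤ ∫ ω, (1 + (M.φ ω y) ^ 2) / 2 ∂M.P :=
        integral_mono hint1.abs (((integrable_const 1).add hInt).div_const 2) h1
    _ = (1 + N.g y y) / 2 := by
        rw [integral_div, integral_add (integrable_const 1) hInt, h2]; simp
    _ ≤ N.A := by linarith [N.g_le_A y y, N.one_le_A]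

/-- Weight of the part of the cluster not yet explored. -/
def wt (N : Net M.V) {s : Finset M.V} (Λ A : Finset M.V) (a : ℝ) (K : Finset s) : ℝ :=
  if up K ⊆ Λ then N.capW a (A ∪ up K) else 0

lemma wt_anti {s : Finset M.V} (Λ A : Finset M.V) (a : ℝ) :
    Antitone (wt N Λ A a : Finset s → ℝ) := by
  intro K K' h
  unfold wt
  have h1 := up_mono h
  by_cases h2 : up K' ⊆ Λ
  · rw [if_pos h2, if_pos (h1.trans h2)]
    exact N.capW_anti a (Finset.union_subset_union_right h1)
  · rw [if_neg h2]
    split_ifs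
    exacts [N.capW_nonneg _ _, le_rfl]

lemma wt_nonneg {s : Finset M.V} (Λ A : Finset M.V) (a : ℝ) (K : Finset s) :
    0 ≤ wt N Λ A a K := by
  unfold wt; split_ifs
  exacts [N.capW_nonneg _ _, le_rfl]

lemma wt_le {s : Finset M.V} (Λ A : Finset M.V) (a : ℝ) (K : Finset s) :
    wt N Λ A a K ≤ N.capW a A := by
  unfold wt; split_ifs
  exacts [N.capW_anti a Finset.subset_union_left, N.capW_nonneg _ _]

/-- Response function of a weighted cluster. -/
def respR (N : Net M.V) {s : Finset M.V} (S : FG s) (y : s) (Λ : Finset M.V) (a : ℝ)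
    (A : Finset M.V) (z : M.V) : ℝ :=
  if h : z ∈ s then S.R y (wt N Λ A a) ⟨z, h⟩ else 0

lemma respR_nonneg {s : Finset M.V} (S : FG s) (y : s) (Λ : Finset M.V) (a : ℝ)
    (A : Finset M.V) (z : M.V) : 0 ≤ respR N S y Λ a A z := by
  unfold respR; split_ifs
  exacts [S.R_nonneg (wt_nonneg Λ A a) _, le_rfl]

lemma respR_out {s : Finset M.V} (S : FG s) (y : s) (Λ : Finset M.V) (a : ℝ)
    (A : Finset M.V) {z : M.V} (hz : z ∉ Λ) : respR N S y Λ a A z = 0 := by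
  unfold respR; split_ifs with h
  · refine Finset.sum_eq_zero fun K _ => ?_
    by_cases hK : (⟨z, h⟩ : s) ∈ K
    · rw [wt, if_neg (fun hs => hz (hs (coe_mem_up (v := ⟨z, h⟩) |>.2 hK))), zero_mul]
    · rw [S.T_of_notMem hK, mul_zero]
  · rfl

lemma respR_insert {s : Finset M.V} (S : FG s) (y : s) (Λ : Finset M.V) (a : ℝ)
    (A : Finset M.V) (z : M.V) : respR N S y Λ a (insert z A) z = respR N S y Λ a A z := by
  unfold respR; split_ifs with h
  · refine S.R_congr _ fun K hK => ?_
    unfold wt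
    have : insert z A ∪ up K = A ∪ up K := by
      rw [Finset.insert_union, Finset.insert_eq_of_mem]
      exact Finset.mem_union_right _ (coe_mem_up (v := ⟨z, h⟩) |>.2 hK)
    rw [this]
  · rfl

lemma respR_anti {s : Finset M.V} (S : FG s) (y : s) (Λ : Finset M.V) (a : ℝ)
    (A A' : Finset M.V) (z : M.V) (h : A ⊆ A') :
    respR N S y Λ a A' z ≤ respR N S y Λ a A z := by
  unfold respR; split_ifs with hz
  · refine S.R_mono _ fun K _ => ?_
    unfold wt; split_ifs
    exacts [N.capW_anti a (Finset.union_subset_union_left h), le_rfl]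
  · rfl

lemma sum_prec_row {s : Finset M.V} (z : s) (hz : N.nb z ⊆ s) (f : M.V → ℝ) :
    ∑ v : s, N.prec s z v * f v = N.lap f z := by
  simp only [N.prec_apply_of_interior s z hz, sub_mul, ite_mul, zero_mul]
  rw [Finset.sum_sub_distrib, Finset.sum_ite_eq, if_pos (Finset.mem_univ _), Net.lap,
    Finset.sum_coe_sort s (fun v => N.w z v * f v)]
  congr 1
  rw [← Finset.sum_subset hz]
  intro v _ hv
  rw [N.w_eq_zero hv, zero_mul]

lemma respR_lap {s Λ : Finset M.V} (hs : hull N Λ ⊆ s) {S : FG s} (hQ : S.Q = N.prec s) (y : s)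
    (a : ℝ) (A : Finset M.V) {z : M.V} (hzy : z ≠ y) :
    N.lap (respR N S y Λ a A) z ≤ 0 := by
  by_cases hz : z ∈ Λ
  · have hzs : z ∈ s := hs (subset_hull Λ hz)
    have hne : (⟨z, hzs⟩ : s) ≠ y := fun h => hzy (congrArg Subtype.val h)
    have := S.R_superharmonic hne (wt_anti (N := N) Λ A a)
    rw [← sum_prec_row (N := N) ⟨z, hzs⟩ ((nb_subset_hull hz).trans hs), ← hQ]
    refine le_of_eq_of_le (Finset.sum_congr rfl fun v _ => ?_) this
    rw [respR, dif_pos v.2]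
  · rw [Net.lap, respR_out S y Λ a A hz, mul_zero, zero_sub]
    exact neg_nonpos.2 (Finset.sum_nonneg fun v _ =>
      mul_nonneg (N.w_nonneg _ _) (respR_nonneg _ _ _ _ _ _))

lemma respR_le (hL : Linked M N) {s Λ : Finset M.V} (hs : hull N Λ ⊆ s) {S : FG s}
    (hQ : S.Q = N.prec s) (hμ : S.μ = M.P.map (restr M s)) (y : s)
    (a : ℝ) (A : Finset M.V) (z : M.V) :
    respR N S y Λ a A z ≤ N.A ^ 2 * N.capW a A * N.g z y := by
  have hgyy : 1 ≤ N.A * N.g y y := by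
    have := N.g_ge y y
    rwa [N.d_self, rho, max_eq_right zero_le_one, Real.one_rpow] at this
  have hF := N.capW_nonneg a A
  refine N.comparison (Λ.erase y) (respR N S y Λ a A)
    (fun z => N.A ^ 2 * N.capW a A * N.g z y) (fun z hz => ?_) (fun z hz => ?_) z
  · rw [N.lap_smul, N.lap_g, if_neg (Finset.ne_of_mem_erase hz), mul_zero]
    exact respR_lap hs hQ y a A (Finset.ne_of_mem_erase hz)
  · by_cases hzy : z = y
    · subst hzy
      rw [respR, dif_pos y.2]
      refine (S.R_le (c := N.capW a A) (fun K _ => wt_le Λ A a K) hF).trans ?_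
      have h1 := abs_phi_le hL hμ y
      have h2 : N.A ^ 2 * N.capW a A * N.g y y = N.capW a A * (N.A * (N.A * N.g y y)) := by ring
      rw [h2]
      refine mul_le_mul_of_nonneg_left (h1.trans ?_) hF
      exact le_mul_of_one_le_right N.A_pos.le hgyy
    · have : z ∉ Λ := fun h => hz (Finset.mem_erase.2 ⟨hzy, h⟩)
      rw [respR_out S y Λ a A this]
      exact mul_nonneg (mul_nonneg (sq_nonneg _) hF) (N.g_nonneg _ _)

/-- The response functions of a finite-volume model. -/
def resp (hL : Linked M N) {s Λ : Finset M.V} (hs : hull N Λ ⊆ s) {S : FG s}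
    (hQ : S.Q = N.prec s) (hμ : S.μ = M.P.map (restr M s)) (y : s) (a : ℝ) :
    N.Resp (N.capW a) y (N.A ^ 2) where
  R := respR N S y Λ a
  R_insert := respR_insert S y Λ a
  R_anti := respR_anti S y Λ a
  R_lap _ _ h := respR_lap hs hQ y a _ h
  R_nonneg := respR_nonneg S y Λ a
  R_le := respR_le hL hs hQ hμ y a
  Λ := Λ
  R_out _ _ h := respR_out S y Λ a _ h

lemma tau_le_of_resp (hL : Linked M N) (a : ℝ) {x y : M.V} (hxy : x ≠ y) {c : ℝ} (hc : 0 ≤ c)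
    (h : ∀ I : N.Resp (N.capW a) y (N.A ^ 2), ∑ v ∈ N.nb x, I.R {x} v ≤ c) :
    M.tau a x y ≤ 2 * N.A ^ 2 * c := by
  have hA := N.one_le_A
  refine tau_le_of a x y fun Λ => ?_
  by_cases hy : y ∈ Λ
  swap
  · rw [PL_of_notMem a x hy]; positivity
  obtain ⟨S, hQ, hμ⟩ := exists_fg hL (hull N Λ)
  set y' : hull N Λ := ⟨y, subset_hull Λ hy⟩
  have h1 := PL_le hL (Finset.Subset.refl _) hQ hμ a y' hxy
  refine h1.trans ?_
  by_cases hx : x ∈ Λ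
  swap
  · refine (Finset.sum_nonpos fun K _ => ?_).trans (by positivity : (0:ℝ) ≤ 2 * N.A ^ 2 * c)
    rw [if_neg (fun hK => hx (hK.2 hK.1))]
  have hxs : x ∈ hull N Λ := subset_hull Λ hx
  set x' : hull N Λ := ⟨x, hxs⟩
  have hne : x' ≠ y' := fun h => hxy (congrArg Subtype.val h)
  have h2 := S.sum_D_le hne (wt_anti (N := N) Λ {x} a) (wt_nonneg Λ {x} a)
  have e1 : ∀ K : Finset (hull N Λ), (if x ∈ up K ∧ up K ⊆ Λ then
      N.capW a (up K) * S.D y' K else 0) =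
      wt N Λ {x} a K * (if x' ∈ K then S.D y' K else 0) := by
    intro K
    have e0 : x' ∈ K ↔ x ∈ up K := (coe_mem_up (v := x')).symm
    by_cases hK : x ∈ up K
    · have : {x} ∪ up K = up K := by
        rw [Finset.singleton_union, Finset.insert_eq_of_mem hK]
      rw [wt, this, if_pos (e0.2 hK)]
      by_cases hK2 : up K ⊆ Λ <;> simp [hK, hK2]
    · rw [if_neg (fun h => hK (e0.1 h)), if_neg (fun h => hK h.1), mul_zero]
  rw [Finset.sum_congr rfl fun K _ => e1 K]
  refine (le_of_eq (by congr!)).trans (h2.trans ?_)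
  have hnb : N.nb x' ⊆ hull N Λ := nb_subset_hull hx
  have hQd : S.Q x' x' ≤ N.A := by
    rw [hQ, N.prec_apply_of_interior _ _ hnb, if_pos rfl]
    linarith [N.W_le x', N.w_nonneg x' x']
  have hsq : √(S.Q x' x') ≤ N.A := by
    refine (Real.sqrt_le_sqrt hQd).trans ?_
    rw [Real.sqrt_le_left (by linarith)]
    nlinarith
  have hWge := N.W_ge x
  have hrow : ∑ v ∈ Finset.univ.erase x', -S.Q x' v / S.Q x' x' * S.R y' (wt N Λ {x} a) v ≤
      N.A * ∑ v ∈ N.nb x, (resp hL (Finset.Subset.refl _) hQ hμ y' a).R {x} v := by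
    have hterm : ∀ v ∈ Finset.univ.erase x', -S.Q x' v / S.Q x' x' * S.R y' (wt N Λ {x} a) v ≤
        N.A * (if (v : M.V) ∈ N.nb x then respR N S y' Λ a {x} v else 0) := by
      intro v hv
      have hvx : x' ≠ v := (Finset.ne_of_mem_erase hv).symm
      have hR : respR N S y' Λ a {x} v = S.R y' (wt N Λ {x} a) v := by
        rw [respR, dif_pos v.2]
      have hR0 := S.R_nonneg (y := y') (wt_nonneg (N := N) Λ {x} a) v
      rw [hR]
      have hQv : S.Q x' v = -N.w x v := by
        rw [hQ, N.prec_apply_of_interior _ _ hnb, if_neg hvx]; ring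
      have hQx : S.Q x' x' = N.W x := by
        rw [hQ, N.prec_apply_of_interior _ _ hnb, if_pos rfl, N.w_self]; ring
      rw [hQv, hQx, neg_neg]
      split_ifs with hvn
      · refine mul_le_mul_of_nonneg_right ?_ hR0
        have hW := N.W_pos x
        rw [div_le_iff₀ hW]
        have : N.w x v ≤ N.W x := by
          rw [N.W_eq]
          exact Finset.single_le_sum (f := fun z => N.w x z) (fun z _ => N.w_nonneg _ _) hvn
        nlinarith
      · rw [N.w_eq_zero hvn]; simp
    refine (Finset.sum_le_sum hterm).trans ?_
    rw [← Finset.mul_sum]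
    refine mul_le_mul_of_nonneg_left ?_ (by linarith)
    refine (Finset.sum_le_sum_of_subset_of_nonneg (Finset.subset_univ _) fun v _ _ => ?_).trans
      (le_of_eq ?_)
    · split_ifs
      exacts [respR_nonneg _ _ _ _ _ _, le_rfl]
    · rw [Finset.sum_coe_sort (hull N Λ)
        (fun v => if v ∈ N.nb x then respR N S y' Λ a {x} v else 0), ← Finset.sum_filter]
      refine Finset.sum_congr ?_ fun _ _ => rfl
      ext v
      rw [Finset.mem_filter]
      exact ⟨fun h => h.2, fun h => ⟨hnb h, h⟩⟩
  have hI := h (resp hL (Finset.Subset.refl _) hQ hμ y' a)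
  calc _ ≤ 2 * √(S.Q x' x') * (N.A * c) := by
        refine mul_le_mul_of_nonneg_left ((le_of_eq (by congr!)).trans (hrow.trans ?_))
          (by positivity)
        exact mul_le_mul_of_nonneg_left hI (by linarith)
    _ ≤ 2 * N.A * (N.A * c) := by gcongr
    _ = _ := by ring

end Moments

end Perc

namespace Perc

namespace Net

variable {V : Type} (N : Net V)

lemma comparison_of_nb (B : Finset V) (f F : V → ℝ) (hB : ∀ z ∈ B, N.lap f z ≤ N.lap F z)
    (hout : ∀ u ∈ B, ∀ z ∈ N.nb u, z ∉ B → f z ≤ F z) {z : V} (hz : z ∈ B) : f z ≤ F z := by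
  have key := N.comparison B (fun z => if z ∈ B ∨ ∃ u ∈ B, z ∈ N.nb u then f z else F z) F
    (fun z hz => ?_) (fun z hz => ?_) z
  · rwa [if_pos (Or.inl hz)] at key
  · refine le_trans (le_of_eq ?_) (hB z hz)
    simp only [lap, if_pos (Or.inl hz : z ∈ B ∨ ∃ u ∈ B, z ∈ N.nb u)]
    congr 1
    refine Finset.sum_congr rfl fun v hv => ?_
    rw [if_pos (Or.inr ⟨z, hz, hv⟩)]
  · split_ifs with h
    · rcases h with h | ⟨u, hu, hv⟩
      exacts [absurd h hz, hout u hu z hv hz]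
    · exact le_rfl

/-- Data of a block: the occupation window, the interaction kernel, the normalisation. -/
structure Blk (V : Type) where
  B : Finset V
  k : V → V → ℝ
  k_symm : ∀ u v, k u v = k v u
  k_ge : ∀ u v, 1 / 4 ≤ k u v
  κ : ℝ
  η : ℝ
  κ_nonneg : 0 ≤ κ
  η_pos : 0 < η

namespace Blk

variable (b : Blk V)

/-- Total mass of an occupation profile. -/
def tot (l : V → ℝ) : ℝ := ∑ u ∈ b.B, l u

/-- Interaction of an occupation profile with a point. -/
def row (l : V → ℝ) (z : V) : ℝ := ∑ u ∈ b.B, l u * b.k u z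

/-- Self-interaction of an occupation profile. -/
def self (l : V → ℝ) : ℝ := ∑ v ∈ b.B, l v * b.row l v

/-- Add a visit at `z`. -/
def add (l : V → ℝ) (z : V) : V → ℝ := fun u => l u + if u = z then 1 else 0

/-- Charge whose potential is the expected interaction among future visits. -/
def fut (u : V) : ℝ := N.W u * ∑ v ∈ b.B, b.k u v * (N.W v * N.g u v)

/-- Expected gain when the walk stands at `z` with profile `l`. -/
def val (l : V → ℝ) (z : V) : ℝ :=
  b.η * (b.tot l + N.pot b.B N.W z - b.κ) -
    b.η ^ 2 * (b.self l + 2 * N.pot b.B (fun v => N.W v * b.row l v) z + 2 * N.pot b.B (b.fut N) z)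

lemma tot_add {l : V → ℝ} {z : V} (hz : z ∈ b.B) : b.tot (add l z) = b.tot l + 1 := by
  simp [tot, add, Finset.sum_add_distrib, hz]

lemma row_add {l : V → ℝ} {z : V} (hz : z ∈ b.B) (v : V) :
    b.row (add l z) v = b.row l v + b.k z v := by
  simp [row, add, Finset.sum_add_distrib, add_mul, hz]

lemma self_add {l : V → ℝ} {z : V} (hz : z ∈ b.B) :
    b.self (add l z) = b.self l + 2 * b.row l z + b.k z z := by
  have h1 : b.self (add l z) = ∑ v ∈ b.B, (l v * b.row l v + l v * b.k v z +
      (if v = z then b.row l v + b.k z v else 0)) := by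
    refine Finset.sum_congr rfl fun v _ => ?_
    rw [b.row_add hz, add, b.k_symm v z]
    split_ifs <;> ring
  rw [h1, Finset.sum_add_distrib, Finset.sum_add_distrib, Finset.sum_ite_eq', if_pos hz]
  change b.self l + b.row l z + _ = _
  ring

lemma lap_val (l : V → ℝ) (z : V) :
    N.lap (b.val N l) z = if z ∈ b.B then
      b.η * N.W z - b.η ^ 2 * (2 * (N.W z * b.row l z) + 2 * b.fut N z) else 0 := by
  have h : b.val N l = fun z => (b.η * (b.tot l - b.κ) - b.η ^ 2 * b.self l) +
      (b.η * N.pot b.B N.W z + (-(2 * b.η ^ 2) * N.pot b.B (fun v => N.W v * b.row l v) z +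
        -(2 * b.η ^ 2) * N.pot b.B (b.fut N) z)) := by
    funext z; rw [val]; ring
  rw [h, lap_add, lap_const, lap_add, lap_smul, lap_add, lap_smul, lap_smul, lap_pot, lap_pot,
    lap_pot]
  split_ifs <;> ring

lemma val_add {l : V → ℝ} {z : V} (hz : z ∈ b.B) :
    b.val N (add l z) z = b.val N l z + b.η -
      b.η ^ 2 * (2 * b.row l z + b.k z z + 2 * ∑ v ∈ b.B, b.k z v * (N.W v * N.g z v)) := by
  have h : N.pot b.B (fun v => N.W v * b.row (add l z) v) z =
      N.pot b.B (fun v => N.W v * b.row l v) z + ∑ v ∈ b.B, b.k z v * (N.W v * N.g z v) := by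
    simp only [pot, ← Finset.sum_add_distrib]
    refine Finset.sum_congr rfl fun v _ => ?_
    rw [b.row_add hz]; ring
  rw [val, val, b.tot_add hz, b.self_add hz, h]
  ring

lemma le_sum_val {l : V → ℝ} {z : V} (hz : z ∈ b.B) :
    N.W z * b.val N l z ≤ ∑ v ∈ N.nb z, N.w z v * b.val N (add l z) v := by
  have h1 := b.lap_val N (add l z) z
  rw [if_pos hz, lap, b.row_add hz, b.val_add N hz, fut] at h1
  have h2 : 0 ≤ N.W z * (b.η ^ 2 * b.k z z) :=
    mul_nonneg (N.W_pos z).le (mul_nonneg (sq_nonneg _) (by linarith [b.k_ge z z]))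
  linarith

lemma tot_nonneg {l : V → ℝ} (hl : ∀ v, 0 ≤ l v) : 0 ≤ b.tot l :=
  Finset.sum_nonneg fun v _ => hl v

lemma row_ge {l : V → ℝ} (hl : ∀ v, 0 ≤ l v) (z : V) : 1 / 4 * b.tot l ≤ b.row l z := by
  rw [tot, Finset.mul_sum]
  exact Finset.sum_le_sum fun v _ => by
    rw [mul_comm]; exact mul_le_mul_of_nonneg_left (b.k_ge _ _) (hl v)

lemma self_ge {l : V → ℝ} (hl : ∀ v, 0 ≤ l v) : 1 / 4 * b.tot l ^ 2 ≤ b.self l := by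
  have : b.self l ≥ ∑ v ∈ b.B, l v * (1 / 4 * b.tot l) :=
    Finset.sum_le_sum fun v _ => mul_le_mul_of_nonneg_left (b.row_ge hl v) (hl v)
  rw [← Finset.sum_mul] at this
  change _ ≥ b.tot l * (1 / 4 * b.tot l) at this
  nlinarith

lemma val_le {l : V → ℝ} (hl : ∀ v, 0 ≤ l v) (z : V) :
    b.val N l z ≤ b.η * (b.tot l + N.pot b.B N.W z - b.κ) - b.η ^ 2 * b.self l := by
  have hg := fun v => N.g_nonneg z v
  have hW := fun v => (N.W_pos v).le
  have hk : ∀ u v, 0 ≤ b.k u v := fun u v => by linarith [b.k_ge u v]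
  have h1 : 0 ≤ N.pot b.B (fun v => N.W v * b.row l v) z :=
    Finset.sum_nonneg fun v _ => mul_nonneg (mul_nonneg (hW v)
      (Finset.sum_nonneg fun u _ => mul_nonneg (hl u) (hk u v))) (hg v)
  have h2 : 0 ≤ N.pot b.B (b.fut N) z :=
    Finset.sum_nonneg fun u _ => mul_nonneg (mul_nonneg (hW u)
      (Finset.sum_nonneg fun v _ => mul_nonneg (hk u v) (mul_nonneg (hW v) (N.g_nonneg u v))))
      (hg u)
  rw [val]
  have : 0 ≤ b.η ^ 2 * (2 * N.pot b.B (fun v => N.W v * b.row l v) z +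
    2 * N.pot b.B (b.fut N) z) := mul_nonneg (sq_nonneg _) (by linarith)
  linarith

/-- The gain estimate for one block. -/
lemma step {F : Finset V → ℝ} {y : V} {C : ℝ} (I : N.Resp F y C) (D : Finset V)
    (hBD : b.B ⊆ D) (hy : y ∉ D) (A₀ : Finset V) {P γ : ℝ} (hP : 0 ≤ P) (hγ : 0 ≤ γ)
    (hbig : ∀ A, A₀ ⊆ A → ∀ z ∈ D, I.R A z ≤ P)
    (hκ : ∀ z, z ∉ D → N.pot b.B N.W z ≤ b.κ)
    (hexit : ∀ A, A₀ ⊆ A → ∀ l : V → ℝ, (∀ v, 0 ≤ l v) → (∀ v, l v ≠ 0 → v ∈ A ∧ v ∈ b.B) →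
      ∀ u ∈ D, ∀ z ∈ N.nb u, z ∉ D →
        I.R A z ≤ P * (1 - γ * (b.η * b.tot l - b.η ^ 2 * b.self l)))
    {z : V} (hz : z ∈ D) : I.R A₀ z ≤ P * (1 - γ * b.val N (fun _ => 0) z) := by
  have hη := b.η_pos
  set T : ℝ := ∑ v ∈ b.B, N.W v * N.A with hT
  have hpot : ∀ z, N.pot b.B N.W z ≤ T := fun z =>
    Finset.sum_le_sum fun v _ => mul_le_mul_of_nonneg_left (N.g_le_A _ _) (N.W_pos v).le
  have hT0 : 0 ≤ T := Finset.sum_nonneg fun v _ => mul_nonneg (N.W_pos v).le N.A_pos.le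
  obtain ⟨m, hm⟩ := exists_nat_ge (8 / b.η + T + 1)
  have hexit' : ∀ A, A₀ ⊆ A → ∀ l : V → ℝ, (∀ v, 0 ≤ l v) →
      (∀ v, l v ≠ 0 → v ∈ A ∧ v ∈ b.B) → ∀ u ∈ D, ∀ z ∈ N.nb u, z ∉ D →
        I.R A z ≤ P * (1 - γ * b.val N l z) := by
    intro A hA l hl hs u hu z hz hzD
    refine (hexit A hA l hl hs u hu z hz hzD).trans (mul_le_mul_of_nonneg_left ?_ hP)
    have h1 := b.val_le N hl z
    have h2 := mul_le_mul_of_nonneg_left (hκ z hzD) hη.le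
    have := mul_le_mul_of_nonneg_left (show b.val N l z ≤
      b.η * b.tot l - b.η ^ 2 * b.self l by linarith) hγ
    linarith
  have main : ∀ j : ℕ, ∀ A, A₀ ⊆ A → ∀ l : V → ℝ, (∀ v, 0 ≤ l v) →
      (∀ v, l v ≠ 0 → v ∈ A ∧ v ∈ b.B) → (m : ℝ) ≤ b.tot l + j → ∀ z ∈ D,
        I.R A z ≤ P * (1 - γ * b.val N l z) := by
    intro j
    induction j with
    | zero =>
      intro A hA l hl _ hj z hz
      refine (hbig A hA z hz).trans (le_mul_of_one_le_right hP ?_)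
      have h1 := b.val_le N hl z
      have h2 := b.self_ge hl
      have h3 := mul_le_mul_of_nonneg_left (hpot z) hη.le
      set t := b.tot l
      have ht : 8 / b.η + T + 1 ≤ t := by simpa using hm.trans hj
      have h8 : 8 ≤ b.η * t := by
        have : 8 / b.η ≤ t := by linarith
        rw [div_le_iff₀ hη] at this; linarith
      have hTt : T ≤ t := by
        have : 0 < 8 / b.η := by positivity
        linarith
      have h4 : b.η ^ 2 * (1 / 4 * t ^ 2) ≤ b.η ^ 2 * b.self l :=
        mul_le_mul_of_nonneg_left h2 (sq_nonneg _)
      have h5 : b.η * T ≤ b.η * t := mul_le_mul_of_nonneg_left hTt hη.le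
      have h6 : 0 ≤ b.η * b.κ := mul_nonneg hη.le b.κ_nonneg
      have h7 : 0 ≤ b.η * t * (b.η * t - 8) := mul_nonneg (by linarith) (by linarith)
      have : b.val N l z ≤ 0 := by nlinarith
      have := mul_nonneg hγ (neg_nonneg.2 this)
      linarith
    | succ j ih =>
      intro A hA l hl hs hj
      have hin : ∀ z ∈ b.B, I.R A z ≤ P * (1 - γ * b.val N l z) := by
        intro z hz
        have hzy : z ≠ y := by rintro rfl; exact hy (hBD hz)
        have hla : ∀ v, 0 ≤ add l z v := fun v => by
          unfold add; split_ifs <;> linarith [hl v]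
        have hsa : ∀ v, add l z v ≠ 0 → v ∈ insert z A ∧ v ∈ b.B := by
          intro v hv
          by_cases hvz : v = z
          · subst hvz; exact ⟨Finset.mem_insert_self _ _, hz⟩
          · rw [add, if_neg hvz, add_zero] at hv
            exact ⟨Finset.mem_insert_of_mem (hs v hv).1, (hs v hv).2⟩
        have hAi : A₀ ⊆ insert z A := hA.trans (Finset.subset_insert _ _)
        have h1 := I.R_lap (insert z A) z hzy
        rw [lap, I.R_insert] at h1
        have h2 : ∀ v ∈ N.nb z, N.w z v * I.R (insert z A) v ≤
            N.w z v * (P * (1 - γ * b.val N (add l z) v)) := by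
          intro v hv
          refine mul_le_mul_of_nonneg_left ?_ (N.w_nonneg _ _)
          by_cases hvD : v ∈ D
          · refine ih (insert z A) hAi _ hla hsa ?_ v hvD
            rw [b.tot_add hz]; push_cast at hj; linarith
          · exact hexit' _ hAi _ hla hsa z (hBD hz) v hv hvD
        have h3 := Finset.sum_le_sum h2
        have h4 : ∑ v ∈ N.nb z, N.w z v * (P * (1 - γ * b.val N (add l z) v)) =
            P * N.W z - P * γ * ∑ v ∈ N.nb z, N.w z v * b.val N (add l z) v := by
          rw [N.W_eq, Finset.mul_sum, Finset.mul_sum, ← Finset.sum_sub_distrib]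
          exact Finset.sum_congr rfl fun v _ => by ring
        have h5 := mul_le_mul_of_nonneg_left (b.le_sum_val N (l := l) hz) (mul_nonneg hP hγ)
        refine le_of_mul_le_mul_left ?_ (N.W_pos z)
        linarith
      intro z hz
      by_cases hzB : z ∈ b.B
      · exact hin z hzB
      refine N.comparison_of_nb (D \ b.B) (I.R A) (fun z => P * (1 - γ * b.val N l z))
        (fun v hv => ?_) (fun u hu v hv hvD => ?_) (Finset.mem_sdiff.2 ⟨hz, hzB⟩)
      · rw [Finset.mem_sdiff] at hv
        have e : (fun z => P * (1 - γ * b.val N l z)) =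
            fun z => P + (-(P * γ)) * b.val N l z := by funext z; ring
        rw [e, lap_add, lap_const, lap_smul, lap_val, if_neg hv.2, mul_zero, add_zero]
        exact I.R_lap A v (by rintro rfl; exact hy hv.1)
      · by_cases hvB : v ∈ b.B
        · exact hin v hvB
        · exact hexit' A hA l hl hs u (Finset.mem_sdiff.1 hu).1 v hv
            (fun h => hvD (Finset.mem_sdiff.2 ⟨h, hvB⟩))
  exact main m A₀ (Finset.Subset.refl _) _ (fun _ => le_rfl) (fun v hv => absurd rfl hv)
    (by simp [tot]) z hz

end Blk

end Net

end Perc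

namespace Perc

namespace Net

variable {V : Type} (N : Net V)

/-- A block whose expected gain is bounded below uniformly in the scale. -/
lemma exists_blk : ∃ δ L₁ : ℝ, 0 < δ ∧ 1 ≤ L₁ ∧ ∀ L, L₁ ≤ L → ∀ Θ, N.lgc L ≤ Θ → ∀ z₀ : V,
    ∃ b : Blk V, b.B ⊆ N.bal z₀ L ∧ (∀ u v, b.k u v = 1 / 4 + L ^ N.ν * N.g u v / (4 * Θ)) ∧
      (∀ z, z ∉ N.bal z₀ L → N.pot b.B N.W z ≤ b.κ) ∧ δ ≤ b.val N (fun _ => 0) z₀ := by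
  have hν := N.one_le_ν
  have hα := N.two_ν_le
  have hA := N.one_le_A
  have hA0 := N.A_pos
  obtain ⟨C₁, hC₁, hg1⟩ := N.g_sum_le
  obtain ⟨C₂, hC₂, hg2⟩ := N.g_sq_sum_le
  set X : ℝ := 2 ^ (N.ν + 1) * N.A ^ 6 with hX
  have hX0 : 0 < X := by positivity
  set ε : ℝ := X ^ (-(1 / N.ν)) with hε
  have hε0 : 0 < ε := Real.rpow_pos_of_pos hX0 _
  have hεν : ε ^ N.ν * X = 1 := by
    rw [hε, ← Real.rpow_mul hX0.le, show -(1 / N.ν) * N.ν = -1 by field_simp,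
      Real.rpow_neg_one, inv_mul_cancel₀ hX0.ne']
  have hε2 : ε ≤ 1 / 2 := by
    by_contra hcon
    push Not at hcon
    have h1 : (1 / 2 : ℝ) ^ N.ν ≤ ε ^ N.ν := Real.rpow_le_rpow (by norm_num) hcon.le (by linarith)
    have h2 : (1 / 2 : ℝ) ^ N.ν * 2 ^ N.ν = 1 := by
      rw [← Real.mul_rpow (by norm_num) (by norm_num)]; norm_num
    have h3 : X = 2 ^ N.ν * 2 * N.A ^ 6 := by
      rw [hX, Real.rpow_add two_pos, Real.rpow_one]
    have h4 : (1:ℝ) ≤ N.A ^ 6 := one_le_pow₀ hA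
    have h5 : (1 / 2 : ℝ) ^ N.ν * X ≤ ε ^ N.ν * X := mul_le_mul_of_nonneg_right h1 hX0.le
    rw [hεν, h3, show (1 / 2 : ℝ) ^ N.ν * (2 ^ N.ν * 2 * N.A ^ 6) =
      ((1 / 2 : ℝ) ^ N.ν * 2 ^ N.ν) * (2 * N.A ^ 6) by ring, h2] at h5
    linarith
  set c₁ : ℝ := 1 / 2 * (N.A ^ 3)⁻¹ * ε ^ (N.α - N.ν) with hc₁
  have hc₁0 : 0 < c₁ := by positivity
  set C₃ : ℝ := N.A ^ 2 * (C₁ + C₂) * C₁ with hC₃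
  have hC₃0 : 0 < C₃ := by positivity
  refine ⟨c₁ ^ 2 / (8 * C₃), max 2 (1 / ε), by positivity, le_max_of_le_left one_le_two,
    fun L hL Θ hΘ z₀ => ?_⟩
  have hL2 : 2 ≤ L := (le_max_left _ _).trans hL
  have hLε : 1 ≤ ε * L := by
    have := (le_max_right _ _).trans hL
    rw [div_le_iff₀ hε0] at this; linarith
  have hL0 : 0 < L := by linarith
  have hΘ1 : 1 ≤ Θ := (N.one_le_lgc (by linarith)).trans hΘ
  have hΘ0 : 0 < Θ := by linarith
  set p : ℝ := L ^ (N.α - N.ν) with hp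
  have hp0 : 0 < p := Real.rpow_pos_of_pos hL0 _
  have hLν : 0 < L ^ N.ν := Real.rpow_pos_of_pos hL0 _
  have hk0 : ∀ u v, 0 ≤ L ^ N.ν * N.g u v / (4 * Θ) := fun u v =>
    div_nonneg (mul_nonneg hLν.le (N.g_nonneg _ _)) (by positivity)
  have hsub : N.bal z₀ (ε * L) ⊆ N.bal z₀ L := fun u hu => by
    rw [mem_bal] at hu ⊢; nlinarith
  set b : Blk V :=
    { B := N.bal z₀ (ε * L)
      k := fun u v => 1 / 4 + L ^ N.ν * N.g u v / (4 * Θ)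
      k_symm := fun u v => by rw [N.g_symm]
      k_ge := fun u v => by linarith [hk0 u v]
      κ := c₁ * p
      η := c₁ / (4 * C₃) / p
      κ_nonneg := by positivity
      η_pos := by positivity } with hb
  refine ⟨b, hsub, fun _ _ => rfl, fun z hz => ?_, ?_⟩
  · rw [mem_bal, not_le] at hz
    have h1 : ∀ u ∈ N.bal z₀ (ε * L), N.W u * N.g z u ≤ N.A * (N.A * (L / 2) ^ (-N.ν)) := by
      intro u hu
      rw [mem_bal] at hu
      refine mul_le_mul (N.W_le u) ((N.g_le z u).trans ?_) (N.g_nonneg _ _) hA0.le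
      refine mul_le_mul_of_nonneg_left ?_ hA0.le
      refine Real.rpow_le_rpow_of_nonpos (by linarith) ?_ (by linarith)
      have := N.d_triangle z₀ u z
      have h3 := le_rho (N.d z u)
      rw [N.d_symm u z] at this
      nlinarith
    have h2 := N.card_le z₀ (ε * L) hLε
    calc N.pot (N.bal z₀ (ε * L)) N.W z
        ≤ ∑ u ∈ N.bal z₀ (ε * L), N.A * (N.A * (L / 2) ^ (-N.ν)) := Finset.sum_le_sum h1
      _ = ((N.bal z₀ (ε * L)).card : ℝ) * (N.A * (N.A * (L / 2) ^ (-N.ν))) := by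
          rw [Finset.sum_const, nsmul_eq_mul]
      _ ≤ (N.A * (ε * L) ^ N.α) * (N.A * (N.A * (L / 2) ^ (-N.ν))) := by gcongr
      _ = c₁ * p := by
          have e1 : (ε * L) ^ N.α = ε ^ (N.α - N.ν) * ε ^ N.ν * (p * L ^ N.ν) := by
            rw [Real.mul_rpow hε0.le hL0.le, hp, ← Real.rpow_add hε0, ← Real.rpow_add hL0]
            simp
          have e2 : (L / 2) ^ (-N.ν) = 2 ^ N.ν / L ^ N.ν := by
            rw [Real.rpow_neg (by positivity), Real.div_rpow hL0.le two_pos.le, inv_div]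
          have e3 : ε ^ N.ν = (2 ^ N.ν * 2 * N.A ^ 6)⁻¹ := by
            refine eq_inv_of_mul_eq_one_left ?_
            rwa [← Real.rpow_add_one two_ne_zero]
          rw [e1, e2, e3, hc₁]
          have : (2:ℝ) ^ N.ν ≠ 0 := by positivity
          field_simp
  · have hfut : ∀ u ∈ b.B, b.fut N u ≤ N.A ^ 2 * (C₁ + C₂) * p := by
      intro u hu
      have hbu : b.B ⊆ N.bal u L := fun v hv => by
        have hu' := (N.mem_bal _ _ _).1 hu
        have hv' := (N.mem_bal _ _ _).1 hv
        rw [mem_bal]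
        have := N.d_triangle u z₀ v
        rw [N.d_symm u z₀] at this
        nlinarith
      have t1 : ∀ v ∈ b.B, b.k u v * (N.W v * N.g u v) ≤
          N.A * (N.g u v + L ^ N.ν / Θ * N.g u v ^ 2) := by
        intro v _
        have hg := N.g_nonneg u v
        have : b.k u v * (N.W v * N.g u v) ≤ b.k u v * (N.A * N.g u v) := by
          refine mul_le_mul_of_nonneg_left (mul_le_mul_of_nonneg_right (N.W_le v) hg) ?_
          linarith [b.k_ge u v]
        refine this.trans ?_
        have e : b.k u v = 1 / 4 + L ^ N.ν * N.g u v / (4 * Θ) := rfl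
        rw [e, show (1 / 4 + L ^ N.ν * N.g u v / (4 * Θ)) * (N.A * N.g u v) =
          N.A * (1 / 4 * N.g u v + 1 / 4 * (L ^ N.ν / Θ * N.g u v ^ 2)) by field_simp]
        have : 0 ≤ L ^ N.ν / Θ * N.g u v ^ 2 := by positivity
        exact mul_le_mul_of_nonneg_left (by linarith) hA0.le
      have t2 : ∑ v ∈ b.B, b.k u v * (N.W v * N.g u v) ≤ N.A * ((C₁ + C₂) * p) := by
        refine (Finset.sum_le_sum t1).trans ?_
        rw [← Finset.mul_sum, Finset.sum_add_distrib, ← Finset.mul_sum]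
        refine mul_le_mul_of_nonneg_left ?_ hA0.le
        have s1 : ∑ v ∈ b.B, N.g u v ≤ C₁ * p :=
          (Finset.sum_le_sum_of_subset_of_nonneg hbu fun v _ _ => N.g_nonneg _ _).trans
            (hg1 u L (by linarith))
        have s2 : ∑ v ∈ b.B, N.g u v ^ 2 ≤ C₂ * L ^ (N.α - 2 * N.ν) * Θ :=
          ((Finset.sum_le_sum_of_subset_of_nonneg hbu fun v _ _ => sq_nonneg _).trans
            (hg2 u L (by linarith))).trans (mul_le_mul_of_nonneg_left hΘ (by positivity))
        have s3 : L ^ N.ν / Θ * (C₂ * L ^ (N.α - 2 * N.ν) * Θ) = C₂ * p := by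
          rw [hp, show N.α - N.ν = N.ν + (N.α - 2 * N.ν) by ring, Real.rpow_add hL0]
          field_simp
        have s4 := mul_le_mul_of_nonneg_left s2 (by positivity : 0 ≤ L ^ N.ν / Θ)
        rw [s3] at s4
        linarith
      have h0 : 0 ≤ N.A * ((C₁ + C₂) * p) := by positivity
      calc b.fut N u ≤ N.W u * (N.A * ((C₁ + C₂) * p)) :=
            mul_le_mul_of_nonneg_left t2 (N.W_pos u).le
        _ ≤ N.A * (N.A * ((C₁ + C₂) * p)) := mul_le_mul_of_nonneg_right (N.W_le u) h0
        _ = _ := by ring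
    have hpf : N.pot b.B (b.fut N) z₀ ≤ C₃ * p ^ 2 := by
      have h0 : 0 ≤ N.A ^ 2 * (C₁ + C₂) * p := by positivity
      calc N.pot b.B (b.fut N) z₀ ≤ ∑ u ∈ b.B, N.A ^ 2 * (C₁ + C₂) * p * N.g z₀ u :=
            Finset.sum_le_sum fun u hu => mul_le_mul_of_nonneg_right (hfut u hu) (N.g_nonneg _ _)
        _ ≤ N.A ^ 2 * (C₁ + C₂) * p * (C₁ * p) := by
            rw [← Finset.mul_sum]
            refine mul_le_mul_of_nonneg_left ?_ h0
            exact (Finset.sum_le_sum_of_subset_of_nonneg hsub fun v _ _ => N.g_nonneg _ _).trans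
              (hg1 z₀ L (by linarith))
        _ = _ := by rw [hC₃]; ring
    have hpW : 2 * c₁ * p ≤ N.pot b.B N.W z₀ := by
      have t1 : ∀ u ∈ b.B, N.A⁻¹ * (N.A⁻¹ * (ε * L) ^ (-N.ν)) ≤ N.W u * N.g z₀ u := by
        intro u hu
        have hu' := (N.mem_bal _ _ _).1 hu
        refine mul_le_mul ?_ ?_ (by positivity) (N.W_pos u).le
        · rw [inv_le_iff_one_le_mul₀' hA0]; exact N.W_ge u
        · rw [inv_mul_le_iff₀ hA0]
          refine le_trans ?_ (N.g_ge z₀ u)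
          exact Real.rpow_le_rpow_of_nonpos (rho_pos _) (max_le hu' hLε) (by linarith)
      have h2 := N.card_ge z₀ (ε * L) hLε
      have h2' : N.A⁻¹ * (ε * L) ^ N.α ≤ (b.B.card : ℝ) := by
        rw [inv_mul_le_iff₀ hA0]; exact h2
      have h3 := Finset.sum_le_sum t1
      rw [Finset.sum_const, nsmul_eq_mul] at h3
      refine le_trans ?_ h3
      refine le_trans (le_of_eq ?_) (mul_le_mul_of_nonneg_right h2' (by positivity))
      have e1 : (ε * L) ^ N.α = ε ^ (N.α - N.ν) * p * (ε * L) ^ N.ν := by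
        rw [hp, ← Real.mul_rpow hε0.le hL0.le, ← Real.rpow_add (by positivity)]
        simp
      have e2 : (ε * L) ^ N.ν ≠ 0 := by positivity
      rw [e1, Real.rpow_neg (by positivity), hc₁]
      field_simp
    have htot : b.tot (fun _ => 0) = 0 := by simp [Blk.tot]
    have hself : b.self (fun _ => 0) = 0 := by simp [Blk.self]
    have hrow : N.pot b.B (fun v => N.W v * b.row (fun _ => 0) v) z₀ = 0 := by
      simp [Net.pot, Blk.row]
    rw [Blk.val, htot, hself, hrow]
    have e1 : b.η = c₁ / (4 * C₃) / p := rfl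
    have e2 : b.κ = c₁ * p := rfl
    have h1 : b.η * (c₁ * p) ≤ b.η * (0 + N.pot b.B N.W z₀ - b.κ) :=
      mul_le_mul_of_nonneg_left (by rw [e2]; linarith) b.η_pos.le
    have h2 := mul_le_mul_of_nonneg_left hpf (sq_nonneg b.η)
    have h3 : b.η * (c₁ * p) - 2 * (b.η ^ 2 * (C₃ * p ^ 2)) = c₁ ^ 2 / (8 * C₃) := by
      rw [e1]; field_simp; norm_num
    linarith

/-- Extract from an occupation profile a measure of mass at most one and small energy. -/
lemma Blk.exists_scale (b : Blk V) {L Θ : ℝ} (hL : 0 < L) (hΘ : 0 < Θ)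
    (hk : ∀ u v, b.k u v = 1 / 4 + L ^ N.ν * N.g u v / (4 * Θ)) {l : V → ℝ} (hl : ∀ v, 0 ≤ l v) :
    ∃ s : ℝ, 0 ≤ s ∧ s * b.tot l ≤ 1 ∧
      s ^ 2 * N.en b.B l l ≤ s * b.tot l * (Θ * L ^ (-N.ν)) ∧
      b.η * b.tot l - b.η ^ 2 * b.self l ≤ s * b.tot l := by
  have hLν : 0 < L ^ N.ν := Real.rpow_pos_of_pos hL _
  have hself : b.self l = 1 / 4 * b.tot l ^ 2 + L ^ N.ν / (4 * Θ) * N.en b.B l l := by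
    have : ∀ v ∈ b.B, l v * b.row l v = l v * (1 / 4 * b.tot l) +
        L ^ N.ν / (4 * Θ) * ∑ y ∈ b.B, l v * l y * N.g v y := by
      intro v _
      rw [row, tot, Finset.mul_sum, Finset.mul_sum, Finset.mul_sum, Finset.mul_sum,
        ← Finset.sum_add_distrib]
      refine Finset.sum_congr rfl fun u _ => ?_
      rw [hk, N.g_symm u v]; ring
    rw [self, Finset.sum_congr rfl this, Finset.sum_add_distrib, ← Finset.sum_mul,
      ← Finset.mul_sum]
    change b.tot l * (1 / 4 * b.tot l) + L ^ N.ν / (4 * Θ) * N.en b.B l l = _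
    ring
  have ht := b.tot_nonneg hl
  have he : 0 ≤ N.en b.B l l := N.en_self_nonneg _ _
  have hη := b.η_pos
  rcases ht.eq_or_lt with h0 | hpos
  · refine ⟨0, le_rfl, by simp, by simp, ?_⟩
    rw [hself, ← h0]
    have : 0 ≤ b.η ^ 2 * (L ^ N.ν / (4 * Θ) * N.en b.B l l) := by positivity
    linarith
  have hepos : 0 < N.en b.B l l := by
    obtain ⟨v, hv, hlv⟩ : ∃ v ∈ b.B, 0 < l v := by
      by_contra hcon
      push Not at hcon
      exact absurd hpos (not_lt.2 (Finset.sum_nonpos hcon))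
    have h1 : l v * l v * N.g v v ≤ ∑ y ∈ b.B, l v * l y * N.g v y :=
      Finset.single_le_sum (f := fun y => l v * l y * N.g v y)
        (fun y _ => mul_nonneg (mul_nonneg (hl _) (hl _)) (N.g_nonneg _ _)) hv
    have h2 : ∑ y ∈ b.B, l v * l y * N.g v y ≤ N.en b.B l l :=
      Finset.single_le_sum (f := fun x => ∑ y ∈ b.B, l x * l y * N.g x y)
        (fun x _ => Finset.sum_nonneg fun y _ =>
          mul_nonneg (mul_nonneg (hl _) (hl _)) (N.g_nonneg _ _)) hv
    have h3 : 0 < l v * l v * N.g v v := mul_pos (mul_pos hlv hlv) (N.g_pos _ _)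
    linarith
  set t := b.tot l
  set e := N.en b.B l l
  set q : ℝ := Θ * L ^ (-N.ν) with hq
  have hq0 : 0 < q := mul_pos hΘ (Real.rpow_pos_of_pos hL _)
  set m : ℝ := min 1 (q * t ^ 2 / e) with hm
  have hm0 : 0 ≤ m := le_min zero_le_one (by positivity)
  have hst : m / t * t = m := div_mul_cancel₀ _ hpos.ne'
  refine ⟨m / t, by positivity, by rw [hst]; exact min_le_left _ _, ?_, ?_⟩
  · rw [hst]
    have h1 : m * e ≤ q * t ^ 2 := by
      have := min_le_right 1 (q * t ^ 2 / e)
      rwa [← hm, le_div_iff₀ hepos] at this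
    have : (m / t) ^ 2 * e = m * (m * e) / t ^ 2 := by field_simp
    rw [this, div_le_iff₀ (by positivity)]
    nlinarith
  · rw [hst, hself]
    have hLq : L ^ N.ν / (4 * Θ) = 1 / (4 * q) := by
      rw [hq, Real.rpow_neg hL.le]; field_simp
    rw [hLq]
    have h3 : 0 ≤ b.η ^ 2 * (1 / (4 * q) * e) := by positivity
    refine le_min ?_ ?_
    · nlinarith [sq_nonneg (b.η * t / 2 - 1)]
    · rw [le_div_iff₀ hepos]
      have h4 : (b.η * t - b.η ^ 2 * (1 / (4 * q) * e)) * e ≤ q * t ^ 2 := by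
        have : q * t ^ 2 - (b.η * t - b.η ^ 2 * (1 / (4 * q) * e)) * e =
            (2 * q * t - b.η * e) ^ 2 / (4 * q) := by field_simp; ring
        have h5 : 0 ≤ (2 * q * t - b.η * e) ^ 2 / (4 * q) := by positivity
        linarith
      have h5 : 0 ≤ b.η ^ 2 * (1 / 4 * t ^ 2) * e := by positivity
      nlinarith

end Net

end Perc

namespace Perc

lemma exp_neg_mul_le (c : ℝ) {m : ℝ} (h0 : 0 ≤ m) (h1 : m ≤ 1) :
    Real.exp (-(c * m)) ≤ 1 - (1 - Real.exp (-c)) * m := by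
  have := convexOn_exp.2 (Set.mem_univ 0) (Set.mem_univ (-c)) (sub_nonneg.2 h1) h0 (by ring)
  simp only [smul_eq_mul, mul_zero, zero_add, Real.exp_zero, mul_one] at this
  rw [show m * -c = -(c * m) by ring] at this
  linarith

lemma half_le_one_sub_exp {c : ℝ} (h0 : 0 ≤ c) (h1 : c ≤ 1) : c / 2 ≤ 1 - Real.exp (-c) := by
  have h := exp_neg_mul_le 1 h0 h1
  rw [one_mul] at h
  have h2 := Real.add_one_le_exp (1:ℝ)
  have h3 : Real.exp (-1) ≤ 1 / 2 := by
    rw [Real.exp_neg, inv_le_comm₀ (Real.exp_pos _) (by norm_num)]; linarith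
  nlinarith

namespace Net

variable {V : Type} (N : Net V)

lemma pot_add_mul (s : Finset V) (c e : V → ℝ) (t : ℝ) (z : V) :
    N.pot s (fun v => c v + t * e v) z = N.pot s c z + t * N.pot s e z := by
  rw [pot, pot, pot, Finset.mul_sum, ← Finset.sum_add_distrib]
  exact Finset.sum_congr rfl fun v _ => by ring

lemma sum_eq_of_supp {s t : Finset V} {c : V → ℝ} (hs : ∀ v, c v ≠ 0 → v ∈ s)
    (ht : ∀ v, c v ≠ 0 → v ∈ t) (h : V → ℝ) : ∑ v ∈ s, c v * h v = ∑ v ∈ t, c v * h v := by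
  have : ∀ r : Finset V, (∀ v, c v ≠ 0 → v ∈ r) →
      ∑ v ∈ r ∩ (s ∩ t), c v * h v = ∑ v ∈ r, c v * h v := fun r _ =>
    Finset.sum_subset Finset.inter_subset_left fun v hv hv' => by
      by_contra hne
      have hc : c v ≠ 0 := fun h0 => hne (by rw [h0, zero_mul])
      exact hv' (Finset.mem_inter.2 ⟨hv, Finset.mem_inter.2 ⟨hs v hc, ht v hc⟩⟩)
  rw [← this s hs, ← this t ht]
  congr 1
  ext v; simp only [Finset.mem_inter]; tauto

lemma pot_eq_of_supp {s t : Finset V} {c : V → ℝ} (hs : ∀ v, c v ≠ 0 → v ∈ s)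
    (ht : ∀ v, c v ≠ 0 → v ∈ t) (z : V) : N.pot s c z = N.pot t c z :=
  sum_eq_of_supp hs ht _

lemma en_eq_pot (s : Finset V) (c e : V → ℝ) : N.en s c e = ∑ y ∈ s, e y * N.pot s c y := by
  rw [en, Finset.sum_comm]
  refine Finset.sum_congr rfl fun y _ => ?_
  rw [pot, Finset.mul_sum]
  exact Finset.sum_congr rfl fun x _ => by rw [N.g_symm]; ring

lemma en_eq_of_supp {s t : Finset V} {c : V → ℝ} (hs : ∀ v, c v ≠ 0 → v ∈ s)
    (ht : ∀ v, c v ≠ 0 → v ∈ t) : N.en s c c = N.en t c c := by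
  rw [en_eq_pot, en_eq_pot, sum_eq_of_supp hs ht]
  exact Finset.sum_congr rfl fun v _ => by rw [N.pot_eq_of_supp hs ht]

/-- A measure of small energy on `A`, built from the first `i` blocks around `x`. -/
structure Charge (x : V) (L Θ : ℝ) (n i : ℕ) (A : Finset V) (μ : V → ℝ) : Prop where
  nonneg : ∀ v, 0 ≤ μ v
  supp : ∀ v, μ v ≠ 0 → v ∈ A
  energy : N.en A μ μ ≤ 3 * Θ * L ^ (-N.ν) * ∑ v ∈ A, μ v
  far : ∀ j, i ≤ j → j ≤ n → ∀ u, 4 * j * L ≤ N.d x u →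
    N.pot A μ u ≤ N.A * L ^ (-N.ν) * ∑ k ∈ Finset.range i, ((j - k : ℕ) : ℝ) ^ (-N.ν)

variable {N}

lemma Charge.total_eq {x : V} {L Θ : ℝ} {n i : ℕ} {A : Finset V} {μ : V → ℝ}
    (h : N.Charge x L Θ n i A μ) {A' : Finset V} (hA : A ⊆ A') :
    ∑ v ∈ A', μ v = ∑ v ∈ A, μ v := by
  have := sum_eq_of_supp (fun v hv => hA (h.supp v hv)) h.supp (fun _ => 1)
  simpa using this

lemma Charge.mono {x : V} {L Θ : ℝ} {n i : ℕ} {A : Finset V} {μ : V → ℝ}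
    (h : N.Charge x L Θ n i A μ) {A' : Finset V} (hA : A ⊆ A') : N.Charge x L Θ n i A' μ where
  nonneg := h.nonneg
  supp v hv := hA (h.supp v hv)
  energy := by
    rw [N.en_eq_of_supp (fun v hv => hA (h.supp v hv)) h.supp, h.total_eq hA]
    exact h.energy
  far j hj hjn u hu := by
    rw [N.pot_eq_of_supp (fun v hv => hA (h.supp v hv)) h.supp]
    exact h.far j hj hjn u hu

lemma Charge.succ {x : V} {L Θ : ℝ} (hL : 0 < L) {n i : ℕ} {A : Finset V} {μ : V → ℝ}
    (h : N.Charge x L Θ n i A μ) : N.Charge x L Θ n (i + 1) A μ where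
  nonneg := h.nonneg
  supp := h.supp
  energy := h.energy
  far j hj hjn u hu := by
    refine (h.far j (by omega) hjn u hu).trans ?_
    rw [Finset.sum_range_succ]
    have h1 : 0 < L ^ (-N.ν) := Real.rpow_pos_of_pos hL _
    have h2 : 0 ≤ ((j - i : ℕ) : ℝ) ^ (-N.ν) := Real.rpow_nonneg (Nat.cast_nonneg _) _
    exact mul_le_mul_of_nonneg_left (by linarith) (mul_nonneg N.A_pos.le h1.le)

/-- Add the contribution of a new block. -/
lemma Charge.add {x : V} {L Θ : ℝ} (hL : 0 < L) {n i : ℕ} (hi : i ≤ n) {A : Finset V}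
    {μ : V → ℝ} (h : N.Charge x L Θ n i A μ)
    (hΘ : N.A * ∑ k ∈ Finset.range i, ((i - k : ℕ) : ℝ) ^ (-N.ν) ≤ Θ)
    {B : Finset V} {l : V → ℝ} (hl : ∀ v, 0 ≤ l v) (hlA : ∀ v, l v ≠ 0 → v ∈ A ∧ v ∈ B)
    (hB : ∀ v ∈ B, 4 * i * L ≤ N.d x v ∧ N.d x v ≤ 4 * i * L + 3 * L) {s : ℝ} (hs : 0 ≤ s)
    (hm : s * ∑ v ∈ B, l v ≤ 1)
    (hen : s ^ 2 * N.en B l l ≤ s * (∑ v ∈ B, l v) * (Θ * L ^ (-N.ν))) :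
    N.Charge x L Θ n (i + 1) A (fun v => μ v + s * l v) ∧
      ∑ v ∈ A, (μ v + s * l v) = ∑ v ∈ A, μ v + s * ∑ v ∈ B, l v := by
  have hLν : 0 < L ^ (-N.ν) := Real.rpow_pos_of_pos hL _
  have hlA1 : ∀ v, l v ≠ 0 → v ∈ A := fun v hv => (hlA v hv).1
  have hlB1 : ∀ v, l v ≠ 0 → v ∈ B := fun v hv => (hlA v hv).2
  have hsum : ∑ v ∈ A, l v = ∑ v ∈ B, l v := by
    simpa using sum_eq_of_supp hlA1 hlB1 (fun _ => 1)
  have htot : ∑ v ∈ A, (μ v + s * l v) = ∑ v ∈ A, μ v + s * ∑ v ∈ B, l v := by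
    rw [Finset.sum_add_distrib, ← Finset.mul_sum, hsum]
  refine ⟨⟨fun v => add_nonneg (h.nonneg v) (mul_nonneg hs (hl v)), fun v hv => ?_, ?_, ?_⟩, htot⟩
  · by_cases hlv : l v = 0
    · rw [hlv, mul_zero, add_zero] at hv; exact h.supp v hv
    · exact hlA1 v hlv
  · rw [en_quad, htot, N.en_eq_of_supp hlA1 hlB1]
    have hcross : N.en A μ l ≤ Θ * L ^ (-N.ν) * ∑ v ∈ B, l v := by
      rw [en_eq_pot, ← hsum, Finset.mul_sum]
      refine Finset.sum_le_sum fun v _ => ?_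
      by_cases hlv : l v = 0
      · simp [hlv]
      rw [mul_comm]
      refine mul_le_mul_of_nonneg_right ?_ (hl v)
      refine (h.far i le_rfl hi v (hB v (hlB1 v hlv)).1).trans ?_
      rw [mul_right_comm]
      exact mul_le_mul_of_nonneg_right hΘ hLν.le
    have := mul_le_mul_of_nonneg_left hcross hs
    have := h.energy
    linarith
  · intro j hj hjn u hu
    rw [pot_add_mul, Finset.sum_range_succ, mul_add]
    refine add_le_add (h.far j (by omega) hjn u hu) ?_
    have hk : (1:ℝ) ≤ ((j - i : ℕ) : ℝ) := by exact_mod_cast (by omega : 1 ≤ j - i)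
    have hji : ((j - i : ℕ) : ℝ) = j - i := by rw [Nat.cast_sub (by omega)]
    set κ : ℝ := ((j - i : ℕ) : ℝ)
    have hg : ∀ v ∈ A, l v * N.g u v ≤ l v * (N.A * (L ^ (-N.ν) * κ ^ (-N.ν))) := by
      intro v _
      by_cases hlv : l v = 0
      · simp [hlv]
      refine mul_le_mul_of_nonneg_left ((N.g_le u v).trans ?_) (hl v)
      refine mul_le_mul_of_nonneg_left ?_ N.A_pos.le
      rw [← Real.mul_rpow hL.le (by linarith)]
      refine Real.rpow_le_rpow_of_nonpos (by positivity) ?_ (by linarith [N.one_le_ν])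
      have h1 := (hB v (hlB1 v hlv)).2
      have h2 := N.d_triangle x v u
      rw [N.d_symm v u] at h2
      have h3 := le_rho (N.d u v)
      have h4 : L * κ = j * L - i * L := by rw [hji]; ring
      have h5 : 3 * L ≤ 3 * (L * κ) := by nlinarith
      linarith
    have h1 : N.pot A l u ≤ (∑ v ∈ B, l v) * (N.A * (L ^ (-N.ν) * κ ^ (-N.ν))) := by
      rw [← hsum, Finset.sum_mul]
      exact Finset.sum_le_sum hg
    have hpos : 0 ≤ N.A * (L ^ (-N.ν) * κ ^ (-N.ν)) :=
      mul_nonneg N.A_pos.le (mul_nonneg hLν.le (Real.rpow_nonneg (by linarith) _))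
    calc s * N.pot A l u ≤ s * ((∑ v ∈ B, l v) * (N.A * (L ^ (-N.ν) * κ ^ (-N.ν)))) :=
          mul_le_mul_of_nonneg_left h1 hs
      _ = s * (∑ v ∈ B, l v) * (N.A * (L ^ (-N.ν) * κ ^ (-N.ν))) := by ring
      _ ≤ 1 * (N.A * (L ^ (-N.ν) * κ ^ (-N.ν))) := mul_le_mul_of_nonneg_right hm hpos
      _ = _ := by ring

/-- A charge of total mass `S` makes the capacity weight at most `exp (-c S)`. -/
lemma Charge.capW_le {x : V} {L Θ : ℝ} (hL : 0 < L) (hΘ : 0 < Θ) {n i : ℕ} {A : Finset V}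
    {μ : V → ℝ} (h : N.Charge x L Θ n i A μ) (a : ℝ) :
    N.capW a A ≤ Real.exp (-(a ^ 2 * L ^ N.ν / (6 * Θ) * ∑ v ∈ A, μ v)) := by
  have hLν : 0 < L ^ N.ν := Real.rpow_pos_of_pos hL _
  refine (N.capW_le a A (fun v => L ^ N.ν / (3 * Θ) * μ v)).trans ?_
  rw [Real.exp_le_exp, neg_le_neg_iff, ← Finset.mul_sum]
  have hen : N.en A (fun v => L ^ N.ν / (3 * Θ) * μ v) (fun v => L ^ N.ν / (3 * Θ) * μ v) =
      (L ^ N.ν / (3 * Θ)) ^ 2 * N.en A μ μ := by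
    simp only [en, Finset.mul_sum]
    exact Finset.sum_congr rfl fun u _ => Finset.sum_congr rfl fun v _ => by ring
  rw [hen]
  set S := ∑ v ∈ A, μ v
  have h1 := mul_le_mul_of_nonneg_left h.energy (sq_nonneg (L ^ N.ν / (3 * Θ)))
  have h2 : (L ^ N.ν / (3 * Θ)) ^ 2 * (3 * Θ * L ^ (-N.ν) * S) = L ^ N.ν / (3 * Θ) * S := by
    rw [Real.rpow_neg hL.le]; field_simp
  rw [h2] at h1
  have h3 : a ^ 2 * L ^ N.ν / (6 * Θ) * S = a ^ 2 / 2 * (L ^ N.ν / (3 * Θ) * S) := by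
    field_simp; ring
  rw [h3]
  exact mul_le_mul_of_nonneg_left (by linarith) (by positivity)

variable (N)

/-- Exponential decay of response functions in the number of blocks. -/
lemma exists_resp_le : ∃ δ L₁ : ℝ, 0 < δ ∧ 1 ≤ L₁ ∧ ∀ (a L Θ C : ℝ) (n : ℕ) (x y : V)
    (I : N.Resp (N.capW a) y C), 0 ≤ C → L₁ ≤ L → N.lgc L ≤ Θ →
    (∀ i ≤ n, N.A * ∑ k ∈ Finset.range i, ((i - k : ℕ) : ℝ) ^ (-N.ν) ≤ Θ) →
    a ^ 2 * L ^ N.ν ≤ 6 * Θ → 2 * (4 * n * L + L) ≤ N.d x y →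
    ∑ v ∈ N.nb x, I.R {x} v ≤ N.A * N.A ^ N.α * (C * (N.A * (N.d x y / 2) ^ (-N.ν))) *
      Real.exp (-(n * (δ * (a ^ 2 * L ^ N.ν / Θ)))) := by
  obtain ⟨δ₀, L₀, hδ₀, hL₀, hblk⟩ := N.exists_blk
  set δ := min δ₀ 1 with hδ
  have hδ0 : 0 < δ := lt_min hδ₀ one_pos
  refine ⟨δ / 12, max L₀ N.A, by positivity, le_max_of_le_left hL₀, ?_⟩
  intro a L Θ C n x y I hC hL hΘL hΘ haL hd
  have hA := N.one_le_A
  have hν := N.one_le_ν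
  have hLA : N.A ≤ L := (le_max_right _ _).trans hL
  have hL0 : 0 < L := by linarith
  have hL1 : 1 ≤ L := hA.trans hLA
  have hΘ0 : 0 < Θ := by linarith [N.one_le_lgc hL1]
  have hLν : 0 < L ^ N.ν := Real.rpow_pos_of_pos hL0 _
  set c : ℝ := a ^ 2 * L ^ N.ν / (6 * Θ) with hc
  have hc0 : 0 ≤ c := by positivity
  have hc1 : c ≤ 1 := by rw [hc, div_le_one (by positivity)]; exact haL
  set γ : ℝ := 1 - Real.exp (-c) with hγ
  have hγc := half_le_one_sub_exp hc0 hc1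
  have hγ0 : 0 ≤ γ := by linarith
  have hγ1 : γ ≤ 1 := by linarith [Real.exp_pos (-c)]
  set q : ℝ := 1 - γ * δ with hq
  have hδ1 : δ ≤ 1 := min_le_right _ _
  have hq0 : 0 ≤ q := by nlinarith
  have hnL : 0 ≤ (n : ℝ) * L := by positivity
  have hd0 : 0 < N.d x y := by linarith
  set M₀ : ℝ := C * (N.A * (N.d x y / 2) ^ (-N.ν)) with hM₀
  have hM0 : 0 ≤ M₀ := by positivity
  have hout : ∀ (i : ℕ) (z : V), i ≤ n → N.d x z ≤ 4 * i * L + L → z ≠ y := by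
    rintro i z hi hz rfl
    have : (i : ℝ) * L ≤ n * L := by gcongr
    linarith
  have main : ∀ k i : ℕ, i + k = n → ∀ A μ, N.Charge x L Θ n i A μ → ∀ z,
      N.d x z ≤ 4 * i * L + L → I.R A z ≤ M₀ * q ^ k * Real.exp (-(c * ∑ v ∈ A, μ v)) := by
    intro k
    induction k with
    | zero =>
      intro i hi A μ h z hz
      obtain rfl : i = n := by omega
      have h1 := h.capW_le hL0 hΘ0 a
      have h2 : N.g z y ≤ N.A * (N.d x y / 2) ^ (-N.ν) := by
        refine (N.g_le z y).trans (mul_le_mul_of_nonneg_left ?_ N.A_pos.le)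
        refine Real.rpow_le_rpow_of_nonpos (by positivity) ?_ (by linarith)
        have := N.d_triangle x z y
        linarith [le_rho (N.d z y)]
      refine (I.R_le A z).trans ?_
      rw [pow_zero, mul_one, hM₀, mul_right_comm]
      exact mul_le_mul (mul_le_mul_of_nonneg_left h2 hC) h1 (N.capW_nonneg _ _)
        (mul_nonneg hC ((N.g_nonneg z y).trans h2)) |>.trans' (le_of_eq (by ring))
    | succ k ih =>
      intro i hi A₀ μ h z hz
      set P : ℝ := M₀ * q ^ k * Real.exp (-(c * ∑ v ∈ A₀, μ v)) with hP
      have hP0 : 0 ≤ P := by positivity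
      have hgoal : M₀ * q ^ (k + 1) * Real.exp (-(c * ∑ v ∈ A₀, μ v)) = P * q := by
        rw [hP, pow_succ]; ring
      rw [hgoal]
      have hi1 : ((i + 1 : ℕ) : ℝ) = i + 1 := by push_cast; ring
      refine N.comparison_of_nb (N.bal x (4 * i * L + L)) (I.R A₀) (fun _ => P * q)
        (fun v hv => ?_) (fun u hu z₀ hz₀ hz₀' => ?_) ((N.mem_bal _ _ _).2 hz)
      · rw [lap_const]
        exact I.R_lap A₀ v (hout i v (by omega) ((N.mem_bal _ _ _).1 hv))
      rw [mem_bal, not_le] at hz₀'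
      rw [mem_bal] at hu
      have hz₀u : N.d x z₀ ≤ 4 * i * L + 2 * L := by
        have := N.d_triangle x u z₀
        have := N.w_d u z₀ ((N.mem_nb _ _).1 hz₀)
        linarith
      have hD : ∀ v ∈ N.bal z₀ L, 4 * i * L ≤ N.d x v ∧ N.d x v ≤ 4 * i * L + 3 * L := by
        intro v hv
        rw [mem_bal] at hv
        have h1 := N.d_triangle x z₀ v
        have h2 := N.d_triangle x v z₀
        rw [N.d_symm v z₀] at h2
        exact ⟨by linarith, by linarith⟩
      obtain ⟨b, hbB, hbk, hbκ, hbv⟩ := hblk L ((le_max_left _ _).trans hL) Θ hΘL z₀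
      have hstep := b.step N I (N.bal z₀ L) hbB
        (fun hy => hout (i + 1) y (by omega) (by rw [hi1]; linarith [(hD y hy).2]) rfl) A₀ hP0 hγ0
        (fun A hA z hz => ?_) hbκ (fun A hA l hl hls u hu z hz _ => ?_)
        (N.self_mem_bal z₀ hL0.le)
      · refine hstep.trans (mul_le_mul_of_nonneg_left ?_ hP0)
        have : δ ≤ b.val N (fun _ => 0) z₀ := (min_le_left _ _).trans hbv
        rw [hq]
        have := mul_le_mul_of_nonneg_left this hγ0
        linarith
      · have := ih (i + 1) (by omega) A μ ((h.mono hA).succ hL0) z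
          (by rw [hi1]; linarith [(hD z hz).2])
        rwa [h.total_eq hA] at this
      · obtain ⟨s, hs0, hs1, hse, hsv⟩ := b.exists_scale N hL0 hΘ0 hbk hl
        obtain ⟨hch, htot⟩ := (h.mono hA).add hL0 (by omega) (hΘ i (by omega)) hl hls
          (fun v hv => hD v (hbB hv)) hs0 hs1 hse
        have h1 := ih (i + 1) (by omega) A _ hch z (by
          rw [hi1]
          have := N.d_triangle x u z
          have := N.w_d u z ((N.mem_nb _ _).1 hz)
          linarith [(hD u hu).2])
        have ht0 := b.tot_nonneg hl
        rw [htot, h.total_eq hA] at h1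
        change I.R A z ≤ M₀ * q ^ k * Real.exp (-(c * (∑ v ∈ A₀, μ v + s * b.tot l))) at h1
        refine h1.trans ?_
        rw [show -(c * (∑ v ∈ A₀, μ v + s * b.tot l)) =
          -(c * ∑ v ∈ A₀, μ v) + -(c * (s * b.tot l)) by ring, Real.exp_add, ← mul_assoc, ← hP]
        refine mul_le_mul_of_nonneg_left ?_ hP0
        have h2 := exp_neg_mul_le c (mul_nonneg hs0 ht0) hs1
        have h3 := mul_le_mul_of_nonneg_left hsv hγ0
        linarith
  have hch : N.Charge x L Θ n 0 {x} (fun _ => 0) :=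
    ⟨fun _ => le_rfl, fun v hv => absurd rfl hv, by simp [en], fun j _ _ u _ => by simp [pot]⟩
  have hterm : ∀ v ∈ N.nb x, I.R {x} v ≤ M₀ * q ^ n := fun v hv => by
    have := main n 0 (by omega) {x} _ hch v (by
      have := N.w_d x v ((N.mem_nb _ _).1 hv)
      simp only [Nat.cast_zero]; linarith)
    simpa using this
  have hqn : q ^ n ≤ Real.exp (-(n * (δ / 12 * (a ^ 2 * L ^ N.ν / Θ)))) := by
    have h1 : q ≤ Real.exp (-(γ * δ)) := by
      have := Real.add_one_le_exp (-(γ * δ)); linarith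
    refine (pow_le_pow_left₀ hq0 h1 n).trans ?_
    rw [← Real.exp_nat_mul, Real.exp_le_exp]
    have h2 : δ / 12 * (a ^ 2 * L ^ N.ν / Θ) = c / 2 * δ := by rw [hc]; field_simp; ring
    rw [h2, mul_neg, neg_le_neg_iff]
    gcongr
  have hcard : ((N.nb x).card : ℝ) ≤ N.A * N.A ^ N.α := by
    refine le_trans ?_ (N.card_le x N.A hA)
    exact_mod_cast Finset.card_le_card fun v hv =>
      (N.mem_bal _ _ _).2 (N.w_d x v ((N.mem_nb _ _).1 hv))
  calc ∑ v ∈ N.nb x, I.R {x} v ≤ (N.nb x).card * (M₀ * q ^ n) := by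
        rw [← nsmul_eq_mul]; exact Finset.sum_le_card_nsmul _ _ _ hterm
    _ ≤ N.A * N.A ^ N.α * (M₀ * Real.exp (-(n * (δ / 12 * (a ^ 2 * L ^ N.ν / Θ))))) := by gcongr
    _ = _ := by ring

end Net

end Perc

namespace Perc

/-- Partial sums of the series with general term `(k + 1) ^ (-ν)`. -/
def hsum (ν : ℝ) (n : ℕ) : ℝ := ∑ k ∈ Finset.range n, ((k : ℝ) + 1) ^ (-ν)

lemma hsum_nonneg (ν : ℝ) (n : ℕ) : 0 ≤ hsum ν n :=
  Finset.sum_nonneg fun _ _ => Real.rpow_nonneg (by positivity) _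

lemma hsum_le_log {ν : ℝ} (hν : 1 ≤ ν) (n : ℕ) : hsum ν n ≤ 1 + Real.log n := by
  refine le_trans ?_ (harmonic_le_one_add_log n)
  rw [harmonic, hsum]
  push_cast
  refine Finset.sum_le_sum fun k _ => ?_
  rw [← Real.rpow_neg_one]
  exact Real.rpow_le_rpow_of_exponent_le (by linarith [(Nat.cast_nonneg k : (0:ℝ) ≤ k)])
    (by linarith)

lemma exists_hsum_le {ν : ℝ} (hν : 1 < ν) : ∃ Z : ℝ, 1 ≤ Z ∧ ∀ n, hsum ν n ≤ Z := by
  have h : Summable fun k : ℕ => ((k : ℝ) + 1) ^ (-ν) := by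
    have := (summable_nat_add_iff 1).2 (Real.summable_nat_rpow.2 (show -ν < -1 by linarith))
    simpa using this
  refine ⟨max 1 (∑' k : ℕ, ((k : ℝ) + 1) ^ (-ν)), le_max_left _ _, fun n => ?_⟩
  exact (h.sum_le_tsum _ fun _ _ => Real.rpow_nonneg (by positivity) _).trans (le_max_right _ _)

lemma sum_filter_hsum_le (ν : ℝ) (n : ℕ) (p : ℕ → Prop) (f : ℕ → ℕ)
    (hf : ∀ j < n, p j → f j < n)
    (hinj : ∀ i < n, ∀ j < n, p i → p j → f i = f j → i = j) :
    ∑ j ∈ (Finset.range n).filter p, ((f j : ℝ) + 1) ^ (-ν) ≤ hsum ν n := by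
  rw [← Finset.sum_image (f := fun k : ℕ => ((k : ℝ) + 1) ^ (-ν)) (g := f)]
  · refine Finset.sum_le_sum_of_subset_of_nonneg ?_ fun _ _ _ =>
      Real.rpow_nonneg (by positivity) _
    intro k hk
    obtain ⟨j, hj, rfl⟩ := Finset.mem_image.1 hk
    simp only [Finset.mem_filter, Finset.mem_range] at hj ⊢
    exact hf j hj.1 hj.2
  · intro i hi j hj h
    simp only [Finset.coe_filter, Finset.mem_range] at hi hj
    exact hinj i hi.1 j hj.1 hi.2 hj.2 h

lemma sum_rho_le {ν : ℝ} (hν : 0 ≤ ν) (n i : ℕ) (hi : i < n) (D : ℕ → ℝ)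
    (hD : ∀ j < n, |(i : ℝ) - j| ≤ D j) :
    ∑ j ∈ Finset.range n, rho (D j) ^ (-ν) ≤ 1 + 2 * hsum ν n := by
  have h1 : ∑ j ∈ Finset.range n, rho (D j) ^ (-ν) ≤ ∑ j ∈ Finset.range n,
      ((if j = i then 1 else 0) + (if j < i then (((i - j - 1 : ℕ) : ℝ) + 1) ^ (-ν) else 0) +
        (if i < j then (((j - i - 1 : ℕ) : ℝ) + 1) ^ (-ν) else 0)) := by
    refine Finset.sum_le_sum fun j hj => ?_
    have hd := hD j (Finset.mem_range.1 hj)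
    rcases lt_trichotomy j i with h | h | h
    · rw [if_neg h.ne, if_pos h, if_neg h.not_gt, zero_add, add_zero]
      refine Real.rpow_le_rpow_of_nonpos (by positivity) (le_trans ?_ (le_rho _)) (by linarith)
      refine le_trans ?_ (hd.trans' (le_abs_self _))
      have : ((i - j - 1 : ℕ) : ℝ) + 1 = ((i - j - 1 + 1 + j : ℕ) : ℝ) - j := by push_cast; ring
      rw [this, show i - j - 1 + 1 + j = i by omega]
    · rw [if_pos h, if_neg h.not_lt, if_neg h.not_gt, add_zero, add_zero]
      exact Real.rpow_le_one_of_one_le_of_nonpos (one_le_rho _) (by linarith)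
    · rw [if_neg h.ne', if_pos h, if_neg h.not_gt, zero_add, zero_add]
      refine Real.rpow_le_rpow_of_nonpos (by positivity) (le_trans ?_ (le_rho _)) (by linarith)
      refine le_trans ?_ (hd.trans' (neg_le_abs _))
      have : ((j - i - 1 : ℕ) : ℝ) + 1 = ((j - i - 1 + 1 + i : ℕ) : ℝ) - i := by push_cast; ring
      rw [this, show j - i - 1 + 1 + i = j by omega]
      linarith
  refine h1.trans ?_
  rw [Finset.sum_add_distrib, Finset.sum_add_distrib, Finset.sum_ite_eq',
    if_pos (Finset.mem_range.2 hi), ← Finset.sum_filter, ← Finset.sum_filter]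
  have h2 := sum_filter_hsum_le ν n (fun j => j < i) (fun j => i - j - 1)
    (fun j _ hp => by omega) (fun a _ b _ ha hb h => by omega)
  have h3 := sum_filter_hsum_le ν n (fun j => i < j) (fun j => j - i - 1)
    (fun j _ hp => by omega) (fun a _ b _ ha hb h => by omega)
  rw [show 1 + 2 * hsum ν n = 1 + hsum ν n + hsum ν n by ring]
  exact add_le_add (add_le_add le_rfl ((le_of_eq (by congr!)).trans h2))
    ((le_of_eq (by congr!)).trans h3)

namespace Net
variable {V : Type} (N : Net V)

/-- A set which crosses every sphere of radius at most `R` around `y`. -/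
def Crosses (K : Finset V) (y : V) (R : ℝ) : Prop :=
  ∀ r, 0 < r → r ≤ R → ∃ u ∈ K, ∃ w ∈ K, N.d y u < r ∧ r ≤ N.d y w ∧ 0 < N.w u w

lemma Crosses.exists_charge {K : Finset V} {y : V} {R : ℝ} (h : N.Crosses K y R) (n : ℕ)
    (hn : 2 * N.A * n ≤ R) :
    ∃ μ : V → ℝ, n / (N.A * (1 + 2 * hsum N.ν n)) ≤ 2 * ∑ x ∈ K, μ x - N.en K μ μ := by
  have hA := N.A_pos
  have hA1 := N.one_le_A
  have hw : ∀ j : ℕ, ∃ v, j < n → v ∈ K ∧ 2 * N.A * (j + 1) ≤ N.d y v ∧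
      N.d y v ≤ 2 * N.A * (j + 1) + N.A := by
    intro j
    by_cases hj : j < n
    · have hj' : (j : ℝ) + 1 ≤ n := by exact_mod_cast hj
      obtain ⟨u, _, v, hv, h1, h2, h3⟩ := h (2 * N.A * (j + 1)) (by positivity)
        (le_trans (by gcongr) hn)
      exact ⟨v, fun _ => ⟨hv, h2, by linarith [N.d_triangle y u v, N.w_d u v h3]⟩⟩
    · exact ⟨y, fun h => absurd h hj⟩
  choose v hv using hw
  have hdist : ∀ i < n, ∀ j < n, |(i : ℝ) - j| ≤ N.d (v i) (v j) := by
    have key : ∀ i < n, ∀ j < n, i < j → (j : ℝ) - i ≤ N.d (v i) (v j) := by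
      intro i hi j hj hij
      have h1 := (hv i hi).2.2
      have h2 := (hv j hj).2.1
      have h3 := N.d_triangle y (v i) (v j)
      have h4 : (i : ℝ) + 1 ≤ j := by exact_mod_cast hij
      nlinarith
    intro i hi j hj
    rcases lt_trichotomy i j with h | h | h
    · have h' : (i : ℝ) < j := by exact_mod_cast h
      rw [abs_of_neg (by linarith), neg_sub]
      exact key i hi j hj h
    · subst h; rw [sub_self, abs_zero]; exact N.d_nonneg _ _
    · have h' : (j : ℝ) < i := by exact_mod_cast h
      rw [abs_of_pos (by linarith), N.d_symm]
      exact key j hj i hi h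
  have hinj : Set.InjOn v (Finset.range n) := by
    intro i hi j hj hij
    have h1 := hdist i (Finset.mem_range.1 hi) j (Finset.mem_range.1 hj)
    rw [hij, N.d_self] at h1
    have h2 := abs_nonpos_iff.1 h1
    exact_mod_cast sub_eq_zero.1 h2
  set T := (Finset.range n).image v with hT
  have hTK : T ⊆ K := by
    intro x hx
    obtain ⟨j, hj, rfl⟩ := Finset.mem_image.1 hx
    exact (hv j (Finset.mem_range.1 hj)).1
  have hs := hsum_nonneg N.ν n
  set q := N.A * (1 + 2 * hsum N.ν n) with hq
  have hq0 : 0 < q := by positivity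
  refine ⟨fun x => if x ∈ T then 1 / q else 0, ?_⟩
  rw [N.en_restrict hTK (fun _ => 1 / q), sum_restrict hTK (fun _ => 1 / q)]
  have h1 : ∑ _x ∈ T, 1 / q = n / q := by
    rw [Finset.sum_const, hT, Finset.card_image_of_injOn hinj, Finset.card_range, nsmul_eq_mul]
    ring
  have h2 : N.en T (fun _ => 1 / q) (fun _ => 1 / q) ≤ n / q := by
    rw [en, hT, Finset.sum_image hinj]
    have h3 : ∀ i ∈ Finset.range n, ∑ z ∈ (Finset.range n).image v, 1 / q * (1 / q) * N.g (v i) z ≤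
        1 / q := by
      intro i hi
      rw [Finset.sum_image hinj, ← Finset.mul_sum]
      have h4 : ∑ j ∈ Finset.range n, N.g (v i) (v j) ≤ q := by
        rw [hq]
        refine (Finset.sum_le_sum fun j _ => N.g_le (v i) (v j)).trans ?_
        rw [← Finset.mul_sum]
        refine mul_le_mul_of_nonneg_left ?_ hA.le
        exact sum_rho_le (by linarith [N.one_le_ν]) n i (Finset.mem_range.1 hi) _
          fun j hj => hdist i (Finset.mem_range.1 hi) j hj
      calc 1 / q * (1 / q) * ∑ j ∈ Finset.range n, N.g (v i) (v j) ≤ 1 / q * (1 / q) * q := by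
            gcongr
        _ = 1 / q := by field_simp
    refine (Finset.sum_le_sum h3).trans (le_of_eq ?_)
    rw [Finset.sum_const, Finset.card_range, nsmul_eq_mul]
    ring
  rw [h1]
  linarith

end Net
end Perc

namespace Perc

/-- A uniform lower bound for the Gaussian density on `[0, 2]`. -/
def dens (A : ℝ) : ℝ := (√(2 * π * A))⁻¹ * Real.exp (-(2 * A))

lemma dens_pos {A : ℝ} (hA : 0 < A) : 0 < dens A := by unfold dens; positivity

lemma gaussian_Ioo_ge {v : ℝ≥0} {A l u : ℝ} (hA : 0 < A) (hv1 : 1 ≤ A * v) (hv2 : (v:ℝ) ≤ A)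
    (hl : 0 ≤ l) (hlu : l ≤ u) (hu : u ≤ 2) :
    dens A * (u - l) ≤ (gaussianReal 0 v).real (Set.Ioo l u) := by
  have hv0 : (0:ℝ) < v := by
    by_contra h
    have : (v : ℝ) = 0 := le_antisymm (not_lt.1 h) v.2
    rw [this] at hv1; linarith
  have hv : v ≠ 0 := fun h => by rw [h] at hv0; simp at hv0
  rw [measureReal_def, gaussianReal_apply 0 hv, ← ENNReal.ofReal_le_iff_le_toReal]
  · calc ENNReal.ofReal (dens A * (u - l)) = ∫⁻ _ in Set.Ioo l u, ENNReal.ofReal (dens A) := by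
          rw [setLIntegral_const, Real.volume_Ioo, ENNReal.ofReal_mul (dens_pos hA).le]
      _ ≤ ∫⁻ t in Set.Ioo l u, gaussianPDF 0 v t := by
          refine setLIntegral_mono (measurable_gaussianPDF 0 v) fun t ht =>
            ENNReal.ofReal_le_ofReal ?_
          rw [gaussianPDFReal, dens]
          refine mul_le_mul ?_ (Real.exp_le_exp.2 ?_) (Real.exp_nonneg _) (by positivity)
          · exact inv_anti₀ (by positivity) (Real.sqrt_le_sqrt (by gcongr))
          · rw [sub_zero, neg_div, neg_le_neg_iff, div_le_iff₀ (by positivity)]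
            have h1 : t ^ 2 ≤ 4 := by nlinarith [ht.1, ht.2]
            nlinarith
  · rw [← gaussianReal_apply 0 hv]; exact measure_ne_top _ _

lemma theta_ge {v : ℝ≥0} {A m : ℝ} (hA : 0 < A) (hv1 : 1 ≤ A * v) (hv2 : (v:ℝ) ≤ A)
    (hm : 0 ≤ m) (hm2 : m ≤ 2) : dens A * m ≤ theta v m := by
  have h1 := gaussian_Ioo_ge hA hv1 hv2 le_rfl hm hm2
  rw [sub_zero] at h1
  refine h1.trans ?_
  have hflip : theta v m = ∫ t, sg (m - t) ∂(gaussianReal 0 v) := by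
    have := theta_neg v m
    rw [← neg_eq_iff_eq_neg] at this
    rw [← this, theta, ← integral_neg]
    refine integral_congr_ae (Eventually.of_forall fun t => ?_)
    dsimp only
    rw [← sg_neg]; congr 1; ring
  have hi2 : Integrable (fun t => sg (m - t)) (gaussianReal 0 v) :=
    Integrable.of_bound (sg_measurable.comp (measurable_const.sub measurable_id)).aestronglyMeasurable
      1 (Eventually.of_forall fun _ => abs_sg_le _)
  have h2 : 2 * theta v m = ∫ t, (sg (m + t) + sg (m - t)) ∂(gaussianReal 0 v) := by
    rw [integral_add (sg_integrable v m) hi2, ← hflip, theta]; ring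
  have h3 : ∫ t, (Set.Ioo 0 m).indicator (fun _ => (2:ℝ)) t ∂(gaussianReal 0 v) ≤
      2 * theta v m := by
    rw [h2]
    refine integral_mono ((integrable_const 2).indicator measurableSet_Ioo)
      ((sg_integrable v m).add hi2) fun t => ?_
    dsimp only
    by_cases ht : t ∈ Set.Ioo 0 m
    · rw [Set.indicator_of_mem ht, sg_of_pos (by linarith [ht.1] : 0 < m + t),
        sg_of_pos (by linarith [ht.2] : 0 < m - t)]
      norm_num
    · rw [Set.indicator_of_notMem ht]
      have : sg (-(m - t)) ≤ sg (m + t) := sg_mono (by linarith)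
      rw [sg_neg] at this
      linarith
  rw [integral_indicator measurableSet_Ioo, setIntegral_const, smul_eq_mul] at h3
  linarith

/-- Expectation of the sign of one field value on the event that another one is positive. -/
def sgCorr (M : Model) (x y : M.V) : ℝ :=
  ∫ ω, sg (M.φ ω x) * (if 0 < M.φ ω y then 1 else 0) ∂M.P

variable {M : Model} {N : Net M.V}

lemma map_phi (hL : Linked M N) (y : M.V) :
    M.P.map (fun ω => M.φ ω y) = gaussianReal 0 (Real.toNNReal (N.g y y)) := by
  have h := M.φ_gauss {y} (fun _ => 1)
  simpa [hL.g_eq] using h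

lemma one_le_A_mul_g (N : Net M.V) (y : M.V) : 1 ≤ N.A * N.g y y := by
  have := N.g_ge y y
  rwa [N.d_self, rho, max_eq_right zero_le_one, Real.one_rpow] at this

lemma measurable_phi (M : Model) (y : M.V) : Measurable fun ω => M.φ ω y := M.φ_meas y

lemma dens_le_phi_gt_one (hL : Linked M N) (y : M.V) :
    dens N.A ≤ M.P.real {ω | 1 < M.φ ω y} := by
  have := M.Pprob
  have h := gaussian_Ioo_ge (v := Real.toNNReal (N.g y y)) (l := 1) (u := 2) N.A_pos
    (by rw [Real.coe_toNNReal _ (N.g_nonneg _ _)]; exact one_le_A_mul_g N y)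
    (by rw [Real.coe_toNNReal _ (N.g_nonneg _ _)]; exact N.g_le_A y y)
    zero_le_one one_le_two le_rfl
  rw [← map_phi hL y, map_measureReal_apply (measurable_phi M y) measurableSet_Ioo] at h
  refine le_trans (by linarith) (h.trans (measureReal_mono fun ω hω => hω.1))

lemma phi_pos_le_half (hL : Linked M N) (y : M.V) :
    M.P.real {ω | 0 < M.φ ω y} ≤ 1 / 2 := by
  have := M.Pprob
  have hpos : MeasurableSet {ω | 0 < M.φ ω y} :=
    measurableSet_lt measurable_const (measurable_phi M y)
  have hneg : MeasurableSet {ω | M.φ ω y < 0} :=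
    measurableSet_lt (measurable_phi M y) measurable_const
  have e1 : M.P.real {ω | 0 < M.φ ω y} =
      (gaussianReal 0 (Real.toNNReal (N.g y y))).real (Set.Ioi 0) := by
    rw [← map_phi hL y, map_measureReal_apply (measurable_phi M y) measurableSet_Ioi]; rfl
  have e2 : M.P.real {ω | M.φ ω y < 0} =
      (gaussianReal 0 (Real.toNNReal (N.g y y))).real (Set.Iio 0) := by
    rw [← map_phi hL y, map_measureReal_apply (measurable_phi M y) measurableSet_Iio]; rfl
  have e3 : (gaussianReal 0 (Real.toNNReal (N.g y y))).real (Set.Ioi 0) =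
      (gaussianReal 0 (Real.toNNReal (N.g y y))).real (Set.Iio 0) := by
    have h : (gaussianReal 0 (Real.toNNReal (N.g y y))).map (fun t => -t) =
      gaussianReal 0 (Real.toNNReal (N.g y y)) := by rw [gaussianReal_map_neg, neg_zero]
    conv_lhs => rw [← h]
    rw [map_measureReal_apply measurable_neg measurableSet_Ioi]
    congr 1; ext t; simp
  have h4 : M.P.real ({ω | 0 < M.φ ω y} ∪ {ω | M.φ ω y < 0}) ≤ 1 := measureReal_le_one
  rw [measureReal_union _ hneg] at h4
  · rw [e2, ← e3, ← e1] at h4; linarith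
  · rw [Set.disjoint_left]
    intro ω h1 h2
    exact absurd (show (0:ℝ) < M.φ ω y from h1) (not_lt.2 (le_of_lt h2))

lemma Net.prec_diag_le (N : Net M.V) (s : Finset M.V) (u : s) : N.prec s u u ≤ N.A := by
  have h1 : N.prec s u u = (N.prec s).mulVec (Pi.single u 1) u := by
    rw [Matrix.mulVec_single_one]; rfl
  rw [h1, prec_mulVec_eq_lap]
  set f := N.pot s (ext0 ((N.prec s).mulVec (Pi.single u 1))) with hf
  have h2 : ∀ z, 0 ≤ f z := N.pot_nonneg s _ fun z hz => by
    rw [N.pot_prec s _ ⟨z, hz⟩, Pi.single_apply]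
    split_ifs <;> norm_num
  have h3 : f u = 1 := by rw [hf, N.pot_prec, Pi.single_eq_same]
  rw [lap_eq_sum_sub]
  refine le_trans ?_ (N.W_le u)
  rw [N.W_eq]
  refine Finset.sum_le_sum fun z _ => mul_le_of_le_one_right (N.w_nonneg _ _) ?_
  rw [h3]; linarith [h2 z]

lemma Net.one_le_A_mul_prec (N : Net M.V) (s : Finset M.V) (u : s) :
    1 ≤ N.A * N.prec s u u := by
  have h := N.qf_prec_ge s {u} (Pi.single u 1) (fun v hv => by
    rw [Finset.mem_singleton.1 hv, Pi.single_eq_same]) (fun _ => 1 / N.A)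
  have hA := N.A_pos
  have hup : up ({u} : Finset s) = {(u : M.V)} := by simp [up]
  have hq : qf (N.prec s) (Pi.single u 1) = N.prec s u u := by
    rw [qf, Matrix.mulVec_single_one, single_one_dotProduct]; rfl
  rw [hup, hq, Finset.sum_singleton, en, Finset.sum_singleton, Finset.sum_singleton] at h
  have h2 := N.g_le_A u u
  have h3 : 1 / N.A * (1 / N.A) * N.g u u ≤ 1 / N.A := by
    calc 1 / N.A * (1 / N.A) * N.g u u ≤ 1 / N.A * (1 / N.A) * N.A := by gcongr
      _ = 1 / N.A := by field_simp
  have h4 : 1 / N.A ≤ N.prec s u u := by linarith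
  rwa [div_le_iff₀' hA] at h4

lemma FG.integral_theta_le {ι : Type*} [Fintype ι] (S : FG ι) (z : ι) {y : ι} (hzy : z ≠ y) :
    ∫ x, theta (S.var z) (S.cm z x) * (if 0 < x y then 1 else 0) ∂S.μ ≤
      ∫ x, sg (x z) * (if 0 < x y then 1 else 0) ∂S.μ := by
  have h := S.sg_correlation z hzy (F := fun _ => -1) fun _ _ _ => le_rfl
  have e : ∀ x, S.G y (fun _ => -1) x = -(if 0 < x y then 1 else 0) := fun x => by
    rw [← S.G_one y x, FG.G, FG.G, ← Finset.sum_neg_distrib]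
    exact Finset.sum_congr rfl fun _ _ => by ring
  simp only [e, mul_neg, integral_neg] at h
  linarith

lemma sgCorr_eq {s : Finset M.V} {S : FG s} (hμ : S.μ = M.P.map (restr M s)) (x y : s) :
    sgCorr M x y = ∫ z, sg (z x) * (if 0 < z y then 1 else 0) ∂S.μ := by
  have h1 := sg_measurable
  have h2 : Measurable fun z : s → ℝ => z x := measurable_pi_apply x
  have h3 : Measurable fun z : s → ℝ => if 0 < z y then (1:ℝ) else 0 :=
    Measurable.ite (measurableSet_lt measurable_const (measurable_pi_apply y))
      measurable_const measurable_const
  rw [hμ, integral_map (restr_measurable s).aemeasurable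
    (by fun_prop : Measurable fun z : s → ℝ =>
      sg (z x) * (if 0 < z y then (1:ℝ) else 0)).aestronglyMeasurable]
  rfl

lemma sgCorr_ge (hL : Linked M N) {x y : M.V} (hxy : x ≠ y) :
    dens N.A ^ 2 / N.A * N.g x y ≤ sgCorr M x y := by
  have := M.Pprob
  have hA := N.A_pos
  set s : Finset M.V := {x, y} with hs
  obtain ⟨S, hQ, hμ⟩ := exists_fg hL s
  set X : s := ⟨x, by simp [hs]⟩ with hX
  set Y : s := ⟨y, by simp [hs]⟩ with hY
  have hXY : X ≠ Y := fun h => hxy (congrArg Subtype.val h)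
  have huniv : (Finset.univ : Finset s).erase X = {Y} := by
    ext ⟨v, hv⟩
    simp only [hs, Finset.mem_insert, Finset.mem_singleton] at hv
    simp only [Finset.mem_erase, Finset.mem_univ, and_true, Finset.mem_singleton, ne_eq, hX, hY,
      Subtype.mk.injEq]
    constructor
    · intro h; tauto
    · rintro rfl h; exact hxy h.symm
  have hXX := S.diag_pos X
  have hβ : -S.Q X Y / S.Q X X = N.g x y / N.g y y := by
    have h := congrFun (congrFun (N.prec_mul_gmat s) X) Y
    rw [Matrix.mul_apply, ← Finset.add_sum_erase _ _ (Finset.mem_univ X), huniv,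
      Finset.sum_singleton, Matrix.one_apply_ne hXY, ← hQ] at h
    have h2 : S.Q X X * N.g x y + S.Q X Y * N.g y y = 0 := h
    rw [div_eq_div_iff hXX.ne' (N.g_pos y y).ne']
    linarith
  have hcm : ∀ z, S.cm X z = N.g x y / N.g y y * z Y := fun z => by
    rw [S.cm_eq_sum, ← hβ, ← Finset.sum_singleton (fun v => -S.Q X v / S.Q X X * z v) Y]
    exact Finset.sum_congr (by convert huniv) fun _ _ => rfl
  have hv1 : 1 ≤ N.A * (S.var X : ℝ) := by
    rw [S.coe_var, ← div_eq_mul_inv, one_le_div hXX, hQ]; exact N.prec_diag_le s X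
  have hv2 : (S.var X : ℝ) ≤ N.A := by
    rw [S.coe_var, inv_le_iff_one_le_mul₀ hXX, hQ]; exact N.one_le_A_mul_prec s X
  have hgA : N.g x y / N.A ≤ 1 := (div_le_one hA).2 (N.g_le_A x y)
  have hg0 : 0 ≤ N.g x y / N.A := div_nonneg (N.g_nonneg x y) hA.le
  have hθ := theta_ge hA hv1 hv2 hg0 (by linarith)
  have hset : MeasurableSet {z : s → ℝ | 1 < z Y} :=
    measurableSet_lt measurable_const (measurable_pi_apply Y)
  have hP : dens N.A ≤ S.μ.real {z : s → ℝ | 1 < z Y} := by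
    rw [hμ, map_measureReal_apply (restr_measurable s) hset]
    exact dens_le_phi_gt_one hL y
  have hprob : IsProbabilityMeasure S.μ := S.prob
  rw [show sgCorr M x y = sgCorr M X Y from rfl, sgCorr_eq hμ]
  refine le_trans ?_ (S.integral_theta_le X hXY)
  have hmeas : Measurable fun z : s → ℝ =>
      theta (S.var X) (S.cm X z) * (if 0 < z Y then (1:ℝ) else 0) :=
    ((theta_mono _).measurable.comp (S.cm_measurable X)).mul
      (Measurable.ite (measurableSet_lt measurable_const (measurable_pi_apply Y))
        measurable_const measurable_const)
  have hInt : Integrable (fun z : s → ℝ =>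
      theta (S.var X) (S.cm X z) * (if 0 < z Y then (1:ℝ) else 0)) S.μ := by
    refine Integrable.of_bound hmeas.aestronglyMeasurable 1 (Eventually.of_forall fun z => ?_)
    rw [norm_mul, Real.norm_eq_abs, Real.norm_eq_abs]
    have := abs_theta_le (S.var X) (S.cm X z)
    split_ifs <;> simp [this]
  have hd := (dens_pos hA).le
  calc dens N.A ^ 2 / N.A * N.g x y = dens N.A * (dens N.A * (N.g x y / N.A)) := by ring
    _ ≤ S.μ.real {z : s → ℝ | 1 < z Y} * (dens N.A * (N.g x y / N.A)) := by gcongr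
    _ = ∫ z, {z : s → ℝ | 1 < z Y}.indicator (fun _ => dens N.A * (N.g x y / N.A)) z ∂S.μ := by
        rw [integral_indicator hset, setIntegral_const, smul_eq_mul]
    _ ≤ _ := by
        refine integral_mono ((integrable_const _).indicator hset) hInt fun z => ?_
        have hβ1 : N.g x y / N.A ≤ N.g x y / N.g y y :=
          div_le_div_of_nonneg_left (N.g_nonneg x y) (N.g_pos y y) (N.g_le_A y y)
        by_cases hz : 1 < z Y
        · rw [Set.indicator_of_mem (show z ∈ {z : s → ℝ | 1 < z Y} from hz)]
          dsimp only
          rw [if_pos (by linarith), mul_one]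
          refine hθ.trans (theta_mono _ ?_)
          rw [hcm]
          nlinarith
        · rw [Set.indicator_of_notMem (show z ∉ {z : s → ℝ | 1 < z Y} from hz)]
          dsimp only
          split_ifs with h0
          · rw [mul_one]
            have h5 : theta (S.var X) 0 ≤ theta (S.var X) (S.cm X z) :=
              theta_mono _ (by rw [hcm]; exact mul_nonneg (hg0.trans hβ1) h0.le)
            have h6 := theta_neg (S.var X) 0
            rw [neg_zero] at h6
            linarith
          · rw [mul_zero]

end Perc

namespace Perc

/-- Lower bound for the capacity of a set crossing `n` well separated spheres. -/
def chainCap {V : Type} (N : Net V) (n : ℕ) : ℝ := n / (N.A * (1 + 2 * hsum N.ν n))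

lemma chainCap_ge {V : Type} (N : Net V) {n : ℕ} (hn : 1 ≤ n) :
    √n / (7 * N.A) ≤ chainCap N n := by
  have hA := N.A_pos
  have hn' : (1:ℝ) ≤ n := by exact_mod_cast hn
  have hs1 : 1 ≤ √(n:ℝ) := Real.one_le_sqrt.2 hn'
  have hs2 : √(n:ℝ) * √n = n := Real.mul_self_sqrt (by linarith)
  have h0 := hsum_nonneg N.ν n
  have h1 : hsum N.ν n ≤ 1 + 2 * √n := by
    refine (hsum_le_log N.one_le_ν n).trans ?_
    have h2 : Real.log (√n) ≤ √n := (Real.log_le_sub_one_of_pos (by linarith)).trans (by linarith)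
    rw [Real.log_sqrt (by linarith)] at h2
    linarith
  rw [chainCap, div_le_div_iff₀ (by positivity) (by positivity)]
  have h3 : √(n:ℝ) * (1 + 2 * hsum N.ν n) ≤ n * 7 := by nlinarith
  nlinarith

lemma tendsto_chainCap {V : Type} (N : Net V) : Tendsto (chainCap N) atTop atTop := by
  have hA := N.A_pos
  have h : Tendsto (fun n : ℕ => √(n:ℝ) / (7 * N.A)) atTop atTop :=
    (Real.tendsto_sqrt_atTop.comp tendsto_natCast_atTop_atTop).atTop_div_const (by positivity)
  refine tendsto_atTop_mono' atTop ?_ h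
  filter_upwards [eventually_ge_atTop 1] with n hn
  exact chainCap_ge N hn

variable {M : Model} {N : Net M.V}

lemma crosses_of_D {s : Finset M.V} {S : FG s} (hQ : S.Q = N.prec s) {y : s} {R : ℝ}
    (hs : hull N (N.bal y R) ⊆ s) {K : Finset s} (hD : S.D y K ≠ 0)
    (hK : ¬ up K ⊆ N.bal y R) : N.Crosses (up K) y R := by
  intro r hr0 hrR
  obtain ⟨v, hv, hvR⟩ := Finset.not_subset.1 hK
  rw [N.mem_bal, not_le] at hvR
  obtain ⟨hvs, hvK⟩ := mem_up.1 hv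
  obtain ⟨a, ha, b, hb, h1, h2, h3⟩ := S.D_cross hD (fun u : s => N.d y u < r)
    (by rw [N.d_self]; exact hr0) hvK (by dsimp only; linarith)
  have ha' : N.nb a ⊆ s :=
    (nb_subset_hull ((N.mem_bal _ _ _).2 (h1.le.trans hrR))).trans hs
  have hab : a ≠ b := by rintro rfl; exact h2 h1
  refine ⟨a, coe_mem_up.2 ha, b, coe_mem_up.2 hb, h1, not_lt.1 h2, ?_⟩
  rw [hQ, N.prec_apply_of_interior s a ha', if_neg hab, zero_sub, neg_ne_zero] at h3
  exact lt_of_le_of_ne (N.w_nonneg _ _) h3.symm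

lemma FG.integral_nK_shift_eq {ι : Type*} [Fintype ι] (S : FG ι) (y : ι) (ε : ℝ) :
    S.μ.real {z | ε < z y} = ∑ K, ∫ z, nK S.Q y K (z - ε • 1) ∂S.μ := by
  have hprob : IsProbabilityMeasure S.μ := S.prob
  have hm : MeasurableSet {z : ι → ℝ | ε < z y} :=
    measurableSet_lt measurable_const (measurable_pi_apply y)
  have hi : ∀ K, Integrable (fun z => nK S.Q y K (z - ε • 1)) S.μ := fun K =>
    Integrable.of_bound ((nK_measurable S.Q y K).comp
      (measurable_id.sub_const (ε • 1))).aestronglyMeasurable 1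
      (Eventually.of_forall fun z => by
        rw [Real.norm_eq_abs, abs_of_nonneg (nK_nonneg _ _ _ _)]; exact nK_le_one _ _ _ _)
  rw [← integral_finsetSum _ fun K _ => hi K]
  have h : ∀ z, ∑ K, nK S.Q y K (z - ε • 1) =
      {z : ι → ℝ | ε < z y}.indicator (fun _ => (1:ℝ)) z := fun z => by
    have h1 := S.G_one y (z - ε • 1)
    simp only [FG.G, one_mul] at h1
    rw [h1]
    by_cases hz : ε < z y
    · rw [Set.indicator_of_mem (show z ∈ {z : ι → ℝ | ε < z y} from hz), if_pos]
      simpa using hz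
    · rw [Set.indicator_of_notMem (show z ∉ {z : ι → ℝ | ε < z y} from hz), if_neg]
      simpa using hz
  simp only [h]
  rw [integral_indicator hm, setIntegral_const, smul_eq_mul, mul_one]

lemma sum_D_large_le {s : Finset M.V} {S : FG s} (hQ : S.Q = N.prec s) {y : s} {R : ℝ}
    (hs : hull N (N.bal y R) ⊆ s) (n : ℕ) (hn : 2 * N.A * n ≤ R) {ε : ℝ} (hε : 0 < ε) :
    ∑ K : Finset s, (if up K ⊆ N.bal y R then 0 else S.D y K) ≤
      S.μ.real {z | 0 < z y} - S.μ.real {z | ε < z y} +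
        Real.exp (-(ε ^ 2 * chainCap N n / 2)) := by
  have hprob : IsProbabilityMeasure S.μ := S.prob
  set e := Real.exp (-(ε ^ 2 * chainCap N n / 2)) with he
  have hterm : ∀ K : Finset s, ∫ z, nK S.Q y K (z - ε • 1) ∂S.μ ≤
      (S.D y K - (if up K ⊆ N.bal y R then 0 else S.D y K)) + e * S.D y K := by
    intro K
    have h1 : ∀ u ∈ K, 0 ≤ ε * S.Q.mulVec 1 u := fun u _ => by
      rw [hQ]; exact mul_nonneg hε.le (N.prec_mulVec_one_nonneg s u)
    have hD0 := S.D_nonneg y K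
    have hc0 : ∫ z, nK S.Q y K (z - ε • 1) ∂S.μ ≤ S.D y K := by
      have := S.shift_D_le y K ε 0 h1 fun h _ => qf_nonneg S.pd h
      simpa using this
    split_ifs with hK
    · have := mul_nonneg (Real.exp_nonneg (-(ε ^ 2 * chainCap N n / 2))) hD0
      linarith
    · by_cases hD : S.D y K = 0
      · rw [hD] at hc0 ⊢; linarith
      · obtain ⟨μ, hμ⟩ := (crosses_of_D hQ hs hD hK).exists_charge N n hn
        have := S.shift_D_le y K ε (chainCap N n) h1 fun h hh => by
          rw [hQ]; exact hμ.trans (N.qf_prec_ge s K h hh μ)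
        linarith
  have h2 := Finset.sum_le_sum fun K (_ : K ∈ Finset.univ) => hterm K
  rw [← S.integral_nK_shift_eq, Finset.sum_add_distrib, Finset.sum_sub_distrib, ← Finset.mul_sum,
    S.sum_D] at h2
  have h3 : e * S.μ.real {z | 0 < z y} ≤ e :=
    mul_le_of_le_one_right (Real.exp_nonneg _) measureReal_le_one
  linarith

lemma sgCorr_le_aux (hL : Linked M N) {x y : M.V} (hxy : x ≠ y) (n : ℕ)
    (hn : N.d y x ≤ 2 * N.A * n) {ε : ℝ} (hε : 0 < ε) :
    sgCorr M x y ≤ M.tau 0 x y + (M.P.real {ω | 0 < M.φ ω y} - M.P.real {ω | ε < M.φ ω y} +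
        Real.exp (-(ε ^ 2 * chainCap N n / 2))) := by
  have hA := N.A_pos
  set R := 2 * N.A * n with hR
  set s := hull N (N.bal y R) with hs
  have hy : y ∈ s := subset_hull _ ((N.mem_bal _ _ _).2 (by rw [N.d_self]; positivity))
  have hx : x ∈ s := subset_hull _ ((N.mem_bal _ _ _).2 hn)
  obtain ⟨S, hQ, hμ⟩ := exists_fg hL s
  have hprob : IsProbabilityMeasure S.μ := S.prob
  have h1 := sum_D_large_le hQ (y := ⟨y, hy⟩) (le_of_eq hs.symm) n le_rfl hε
  have hreal : ∀ t : ℝ, S.μ.real {z | t < z ⟨y, hy⟩} = M.P.real {ω | t < M.φ ω y} := fun t => by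
    rw [hμ, map_measureReal_apply (restr_measurable s)
      (measurableSet_lt measurable_const (measurable_pi_apply _))]
    rfl
  rw [hreal, hreal] at h1
  have h2 := PL_le_tau 0 x y (N.bal y R)
  rw [show y = ((⟨y, hy⟩ : s) : M.V) from rfl,
    PL_zero hL (le_of_eq hs.symm) hQ hμ ⟨y, hy⟩ hxy] at h2
  have h3 : sgCorr M x y = ∑ K, if (⟨x, hx⟩ : s) ∈ K then S.D ⟨y, hy⟩ K else 0 := by
    have h4 := S.integral_mul_G ⟨y, hy⟩ (fun _ => 1) (h := fun z => sg (z ⟨x, hx⟩))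
      (Integrable.of_bound (sg_measurable.comp (measurable_pi_apply _)).aestronglyMeasurable 1
        (Eventually.of_forall fun _ => abs_sg_le _))
    simp only [one_mul, S.G_one, S.sg_mul_nK] at h4
    refine ((sgCorr_eq hμ ⟨x, hx⟩ ⟨y, hy⟩).trans h4).trans ?_
    congr!
  rw [h3]
  refine le_trans ?_ (add_le_add h2 h1)
  rw [← Finset.sum_add_distrib]
  refine Finset.sum_le_sum fun K _ => ?_
  have hD := S.D_nonneg ⟨y, hy⟩ K
  have hm : x ∈ up K ↔ (⟨x, hx⟩ : s) ∈ K := coe_mem_up (v := ⟨x, hx⟩)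
  simp only [hm]
  by_cases h4 : (⟨x, hx⟩ : s) ∈ K <;> by_cases h5 : up K ⊆ N.bal y R <;> simp [h4, h5, hD]

lemma sgCorr_le_tau (hL : Linked M N) {x y : M.V} (hxy : x ≠ y) : sgCorr M x y ≤ M.tau 0 x y := by
  have := M.Pprob
  have hA := N.A_pos
  have h1 : ∀ ε : ℝ, 0 < ε → sgCorr M x y ≤
      M.tau 0 x y + (M.P.real {ω | 0 < M.φ ω y} - M.P.real {ω | ε < M.φ ω y}) := by
    intro ε hε
    have ht : Tendsto (fun n : ℕ => M.tau 0 x y + (M.P.real {ω | 0 < M.φ ω y} -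
        M.P.real {ω | ε < M.φ ω y} + Real.exp (-(ε ^ 2 * chainCap N n / 2)))) atTop
        (𝓝 (M.tau 0 x y + (M.P.real {ω | 0 < M.φ ω y} - M.P.real {ω | ε < M.φ ω y} + 0))) := by
      refine tendsto_const_nhds.add (tendsto_const_nhds.add ?_)
      refine Real.tendsto_exp_neg_atTop_nhds_zero.comp ?_
      exact ((tendsto_chainCap N).const_mul_atTop (by positivity)).atTop_div_const two_pos
    rw [add_zero] at ht
    refine ge_of_tendsto ht ?_
    obtain ⟨n₀, hn₀⟩ := exists_nat_ge (N.d y x / (2 * N.A))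
    rw [div_le_iff₀ (by positivity)] at hn₀
    filter_upwards [eventually_ge_atTop n₀] with n hn
    have hn' : (n₀ : ℝ) ≤ n := by exact_mod_cast hn
    exact sgCorr_le_aux hL hxy n (by nlinarith) hε
  have hlim : Tendsto (fun k : ℕ => M.P.real {ω | 1 / ((k:ℝ) + 1) < M.φ ω y}) atTop
      (𝓝 (M.P.real {ω | 0 < M.φ ω y})) := by
    have hU : (⋃ k : ℕ, {ω | 1 / ((k:ℝ) + 1) < M.φ ω y}) = {ω | 0 < M.φ ω y} := by
      ext ω
      rw [Set.mem_iUnion]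
      constructor
      · rintro ⟨k, hk⟩
        exact lt_trans (by positivity : (0:ℝ) < 1 / ((k:ℝ) + 1)) hk
      · intro h
        exact exists_nat_one_div_lt (show (0:ℝ) < M.φ ω y from h)
    rw [← hU]
    refine (ENNReal.tendsto_toReal (measure_ne_top _ _)).comp
      (tendsto_measure_iUnion_atTop fun i j hij ω hω => ?_)
    refine lt_of_le_of_lt ?_ (show 1 / ((i:ℝ) + 1) < M.φ ω y from hω)
    exact one_div_le_one_div_of_le (by positivity) (by
      have : (i:ℝ) ≤ j := by exact_mod_cast hij
      linarith)
  have ht := (tendsto_const_nhds (x := M.tau 0 x y)).add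
    ((tendsto_const_nhds (x := M.P.real {ω | 0 < M.φ ω y})).sub hlim)
  rw [sub_self, add_zero] at ht
  exact ge_of_tendsto' ht fun k => h1 _ (by positivity)

/-- Lower bound on the critical two-point function. -/
lemma rho_le_tau (hL : Linked M N) {x y : M.V} (hxy : x ≠ y) :
    dens N.A ^ 2 / N.A ^ 2 * rho (N.d x y) ^ (-N.ν) ≤ M.tau 0 x y := by
  have hA := N.A_pos
  refine le_trans ?_ ((sgCorr_ge hL hxy).trans (sgCorr_le_tau hL hxy))
  have h := N.g_ge x y
  calc dens N.A ^ 2 / N.A ^ 2 * rho (N.d x y) ^ (-N.ν) ≤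
        dens N.A ^ 2 / N.A ^ 2 * (N.A * N.g x y) := by gcongr
    _ = dens N.A ^ 2 / N.A * N.g x y := by field_simp

lemma half_le_tau_self (hL : Linked M N) (y : M.V) : 1 / 2 ≤ M.tau 0 y y := by
  have := M.Pprob
  set s := hull N {y} with hs
  have hy : y ∈ s := subset_hull _ (Finset.mem_singleton_self y)
  obtain ⟨S, hQ, hμ⟩ := exists_fg hL s
  have hprob : IsProbabilityMeasure S.μ := S.prob
  set Y : s := ⟨y, hy⟩ with hY
  have hup : up ({Y} : Finset s) = {y} := by simp [up, hY]
  have h1 := prob_cluster hL hQ hμ 0 Y {Y} (fun u hu => by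
    rw [Finset.mem_singleton.1 hu]
    exact nb_subset_hull (Finset.mem_singleton_self y)) (Finset.mem_singleton_self Y)
  simp only [zero_smul, sub_zero, hup] at h1
  have hm : MeasurableSet {z : s → ℝ | 0 < z Y} :=
    measurableSet_lt measurable_const (measurable_pi_apply Y)
  have h2 : S.μ.real {z : s → ℝ | 0 < z Y}ᶜ ≤ ∫ z, wK (pe S.Q z) Y {Y} ∂S.μ := by
    have e : S.μ.real {z : s → ℝ | 0 < z Y}ᶜ =
        ∫ z, {z : s → ℝ | 0 < z Y}ᶜ.indicator (fun _ => (1:ℝ)) z ∂S.μ := by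
      rw [integral_indicator hm.compl, setIntegral_const, smul_eq_mul, mul_one]
    rw [e]
    refine integral_mono ((integrable_const _).indicator hm.compl)
      (Integrable.of_bound (wK_measurable S.Q Y {Y}).aestronglyMeasurable 1
        (Eventually.of_forall fun z => by
          rw [Real.norm_eq_abs, abs_of_nonneg (wK_nonneg (pe_mem S.Q z) _ _)]
          exact wK_le_one (pe_mem S.Q z) _ _)) fun z => ?_
    by_cases hz : z ∈ {z : s → ℝ | 0 < z Y}ᶜ
    · rw [Set.indicator_of_mem hz]
      have h3 := sum_wK (pe S.Q z) Y
      rw [Finset.sum_eq_single {Y}] at h3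
      · exact h3.ge
      · intro K _ hK
        rw [wK_eq_nK S.Q hK, nK, if_neg (show ¬ 0 < z Y from hz)]
      · intro h; exact absurd (Finset.mem_univ _) h
    · rw [Set.indicator_of_notMem hz]
      exact wK_nonneg (pe_mem S.Q z) _ _
  have h3 : M.P.real {ω | M.cluster 0 ω y = ↑({y} : Finset M.V)} ≤ M.tau 0 y y :=
    measureReal_mono fun ω hω =>
      ⟨Relation.ReflTransGen.refl, by
        rw [show M.cluster 0 ω y = ↑({y} : Finset M.V) from hω]; exact Finset.finite_toSet _⟩
  rw [measureReal_compl hm] at h2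
  have h4 : S.μ.real {z : s → ℝ | 0 < z Y} ≤ 1 / 2 := by
    rw [hμ, map_measureReal_apply (restr_measurable s) hm]
    exact phi_pos_le_half hL y
  have h5 : S.μ.real Set.univ = 1 := probReal_univ
  have h6 : M.P.real {ω | M.cluster 0 ω y = ↑({y} : Finset M.V)} =
    ∫ z, wK (pe S.Q z) Y {Y} ∂S.μ := h1
  linarith

end Perc

namespace Perc

variable {M : Model} {N : Net M.V}

lemma hsum_mono (ν : ℝ) {m n : ℕ} (h : m ≤ n) : hsum ν m ≤ hsum ν n :=
  Finset.sum_le_sum_of_subset_of_nonneg (Finset.range_mono h) fun _ _ _ =>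
    Real.rpow_nonneg (by positivity) _

lemma sum_sub_rpow_eq_hsum (ν : ℝ) (i : ℕ) :
    ∑ k ∈ Finset.range i, ((i - k : ℕ) : ℝ) ^ (-ν) = hsum ν i := by
  rw [hsum, ← Finset.sum_range_reflect]
  refine Finset.sum_congr rfl fun k hk => ?_
  have hk' := Finset.mem_range.1 hk
  rw [show i - (i - 1 - k) = k + 1 by omega]
  push_cast
  rfl

/-- Exponential decay from the capacity of chains crossing from `y` to `x`. -/
lemma tau_le_exp_chain (hL : Linked M N) (a : ℝ) {x y : M.V} (hxy : x ≠ y) :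
    M.tau a x y ≤ M.tau 0 x y * Real.exp (-(a ^ 2 * N.d x y /
      (8 * N.A ^ 2 * (1 + 2 * hsum N.ν ⌊N.d x y / (2 * N.A)⌋₊)))) := by
  have hA := N.A_pos
  have hd := N.d_nonneg x y
  set n := ⌊N.d x y / (2 * N.A)⌋₊ with hn
  have hs := hsum_nonneg N.ν n
  have hn1 : 2 * N.A * n ≤ N.d x y := by
    have := Nat.floor_le (show 0 ≤ N.d x y / (2 * N.A) by positivity)
    rwa [le_div_iff₀' (by positivity)] at this
  have hn2 : N.d x y < (n + 1) * (2 * N.A) := by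
    have := Nat.lt_floor_add_one (N.d x y / (2 * N.A))
    rwa [div_lt_iff₀ (by positivity)] at this
  have hτ := tau_nonneg (M := M) 0 x y
  rcases Nat.eq_zero_or_pos n with h0 | h0
  · refine (tau_le_tau_zero hL a hxy).trans ?_
    rw [mul_comm]
    refine mul_le_mul_of_nonneg_left (Real.exp_le_exp.2 (neg_le_neg ?_)) hτ
    rw [h0, Nat.cast_zero, zero_add, one_mul] at hn2
    rw [div_le_div_iff₀ (by positivity) (by positivity)]
    calc a ^ 2 * N.d x y * (2 * N.A) ≤ a ^ 2 * (2 * N.A) * (2 * N.A) * 1 := by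
          rw [mul_one]; gcongr
      _ ≤ a ^ 2 * (2 * N.A) * (2 * N.A) * (2 * (1 + 2 * hsum N.ν n)) := by
          gcongr; linarith
      _ = _ := by ring
  · have hn3 : (1:ℝ) ≤ n := by exact_mod_cast h0
    have h1 := tau_le_of_capW hL a hxy (f := Real.exp (-(a ^ 2 / 2 * chainCap N n)))
      (fun K hx hy hP => by
        have hc : N.Crosses K y (N.d x y) := by
          intro r hr0 hr
          obtain ⟨u, hu, w, hw, h1, h2, h3⟩ := hP (fun v => N.d y v < r)
            (by rw [N.d_self]; exact hr0) x hx (by rw [N.d_symm y x]; exact not_lt.2 hr)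
          exact ⟨u, hu, w, hw, h1, not_lt.1 h2, h3⟩
        obtain ⟨μ, hμ⟩ := hc.exists_charge N n hn1
        refine (N.capW_le a K μ).trans (Real.exp_le_exp.2 (neg_le_neg ?_))
        exact mul_le_mul_of_nonneg_left hμ (by positivity)) (Real.exp_nonneg _)
    refine h1.trans ?_
    rw [mul_comm]
    refine mul_le_mul_of_nonneg_left (Real.exp_le_exp.2 (neg_le_neg ?_)) hτ
    have h2 : N.d x y ≤ 4 * N.A * n := by nlinarith
    rw [chainCap, div_mul_div_comm, div_le_div_iff₀ (by positivity) (by positivity)]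
    calc a ^ 2 * N.d x y * (2 * (N.A * (1 + 2 * hsum N.ν n))) ≤
          a ^ 2 * (4 * N.A * n) * (2 * (N.A * (1 + 2 * hsum N.ν n))) := by gcongr
      _ = _ := by ring

/-- Exponential decay for small levels. -/
lemma exists_tau_le_exp (hL : Linked M N) : ∃ δ B L₁ : ℝ, 0 < δ ∧ 1 ≤ B ∧ 1 ≤ L₁ ∧
    ∀ (a Θ : ℝ) (x y : M.V), x ≠ y → a ≠ 0 → |a| ≤ 1 → N.lgc (L₁ * |a| ^ (-(2 / N.ν))) ≤ Θ →
      L₁ ^ N.ν ≤ 6 * Θ → N.A * hsum N.ν ⌊|a| ^ (2 / N.ν) * N.d x y⌋₊ ≤ Θ →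
      M.tau a x y ≤ B * M.tau 0 x y * Real.exp (-(δ * (|a| ^ (2 / N.ν) * N.d x y) / Θ)) := by
  obtain ⟨δ, L₁, hδ, hL₁, hmain⟩ := Net.exists_resp_le (N := N)
  have hA := N.A_pos
  have hA1 := N.one_le_A
  have hν := N.one_le_ν
  have hν0 : 0 < N.ν := by linarith
  have hdens := dens_pos hA
  set B₀ : ℝ := 2 * N.A ^ 2 * (N.A * N.A ^ N.α * (N.A ^ 2 * (N.A * 2 ^ N.ν))) *
    (N.A ^ 2 / dens N.A ^ 2) with hB₀
  have hB₀0 : 0 ≤ B₀ := by positivity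
  refine ⟨δ * L₁ ^ N.ν / (8 * L₁), (B₀ + 1) * Real.exp (8 * δ), L₁, by positivity, ?_, hL₁, ?_⟩
  · have := Real.one_le_exp (show 0 ≤ 8 * δ by positivity)
    nlinarith
  intro a Θ x y hxy ha0 ha1 hΘ1 hΘ2 hΘ3
  have ha : 0 < |a| := abs_pos.2 ha0
  set q := |a| ^ (2 / N.ν) with hq
  have hq0 : 0 < q := Real.rpow_pos_of_pos ha _
  have hq1 : q ≤ 1 := Real.rpow_le_one ha.le ha1 (by positivity)
  set L := L₁ * |a| ^ (-(2 / N.ν)) with hLdef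
  have hLq : L = L₁ / q := by rw [hLdef, Real.rpow_neg ha.le]; rfl
  have hLL₁ : L₁ ≤ L := by rw [hLq, le_div_iff₀ hq0]; nlinarith
  have hL0 : 0 < L := by linarith
  have haL : a ^ 2 * L ^ N.ν = L₁ ^ N.ν := by
    rw [hLq, Real.div_rpow (by linarith) hq0.le, hq, ← Real.rpow_mul ha.le,
      div_mul_cancel₀ _ hν0.ne', Real.rpow_two, sq_abs]
    field_simp
  have hP0 : 0 < L₁ ^ N.ν := Real.rpow_pos_of_pos (by linarith) _
  have hΘ0 : 0 < Θ := by linarith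
  have hd := N.d_nonneg x y
  have hτ := tau_nonneg (M := M) 0 x y
  set κ := δ * (L₁ ^ N.ν / Θ) with hκ
  have hκ0 : 0 ≤ κ := by positivity
  have hκ6 : κ ≤ 6 * δ := by
    have : L₁ ^ N.ν / Θ ≤ 6 := (div_le_iff₀ hΘ0).2 hΘ2
    nlinarith
  have hexp : δ * L₁ ^ N.ν / (8 * L₁) * (q * N.d x y) / Θ = κ * (N.d x y / (8 * L)) := by
    rw [hLq, hκ]; field_simp
  rw [hexp]
  rcases lt_or_ge (N.d x y) (2 * L) with hdL | hdL
  · have h1 : M.tau a x y ≤ 1 * M.tau 0 x y := by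
      refine (tau_le_tau_zero hL a hxy).trans (mul_le_mul_of_nonneg_right ?_ hτ)
      have : 0 ≤ a ^ 2 / (2 * N.A) := by positivity
      exact Real.exp_le_one_iff.2 (by linarith)
    refine h1.trans ?_
    have h2 : κ * (N.d x y / (8 * L)) ≤ 8 * δ := by
      have : N.d x y / (8 * L) ≤ 1 := (div_le_one (by positivity)).2 (by linarith)
      nlinarith
    have h3 : 1 ≤ Real.exp (8 * δ) * Real.exp (-(κ * (N.d x y / (8 * L)))) := by
      rw [← Real.exp_add]; exact Real.one_le_exp (by linarith)
    calc 1 * M.tau 0 x y ≤ (Real.exp (8 * δ) * Real.exp (-(κ * (N.d x y / (8 * L))))) *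
          M.tau 0 x y := by gcongr
      _ ≤ ((B₀ + 1) * (Real.exp (8 * δ) * Real.exp (-(κ * (N.d x y / (8 * L)))))) *
          M.tau 0 x y := by
          refine mul_le_mul_of_nonneg_right ?_ hτ
          exact le_mul_of_one_le_left (by positivity) (by linarith)
      _ = _ := by ring
  · set n := ⌊N.d x y / (8 * L) - 1 / 4⌋₊ with hn
    have h14 : 1 / 4 ≤ N.d x y / (8 * L) := by
      rw [le_div_iff₀ (by positivity)]; linarith
    have hn1 : (n : ℝ) ≤ N.d x y / (8 * L) - 1 / 4 := Nat.floor_le (by linarith)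
    have hn2 : N.d x y / (8 * L) - 1 / 4 < n + 1 := Nat.lt_floor_add_one _
    have hdist : 2 * (4 * n * L + L) ≤ N.d x y := by
      have : (n + 1 / 4 : ℝ) ≤ N.d x y / (8 * L) := by linarith
      rw [le_div_iff₀ (by positivity)] at this
      linarith
    have hnm : n ≤ ⌊q * N.d x y⌋₊ := by
      refine Nat.floor_le_floor ?_
      have : N.d x y / (8 * L) ≤ q * N.d x y := by
        rw [div_le_iff₀ (by positivity), hLq]
        have : q * N.d x y * (8 * (L₁ / q)) = 8 * L₁ * N.d x y := by field_simp
        rw [this]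
        nlinarith
      linarith
    have hsum' : ∀ i ≤ n, N.A * ∑ k ∈ Finset.range i, ((i - k : ℕ) : ℝ) ^ (-N.ν) ≤ Θ := by
      intro i hi
      rw [sum_sub_rpow_eq_hsum]
      refine le_trans ?_ hΘ3
      exact mul_le_mul_of_nonneg_left (hsum_mono _ (hi.trans hnm)) hA.le
    have hd2 : 2 ≤ N.d x y := by linarith only [hL₁, hLL₁, hdL]
    have h1 := tau_le_of_resp hL a hxy (c := N.A * N.A ^ N.α *
        (N.A ^ 2 * (N.A * (N.d x y / 2) ^ (-N.ν))) *
        Real.exp (-(n * (δ * (a ^ 2 * L ^ N.ν / Θ))))) (by positivity)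
      (fun I => hmain a L Θ (N.A ^ 2) n x y I (by positivity) hLL₁ hΘ1 hsum'
        (by rw [haL]; exact hΘ2) hdist)
    rw [haL, ← hκ] at h1
    have hρ : (N.d x y / 2) ^ (-N.ν) ≤ 2 ^ N.ν * (N.A ^ 2 / dens N.A ^ 2 * M.tau 0 x y) := by
      have h2 := rho_le_tau hL hxy
      rw [rho, max_eq_left (by linarith)] at h2
      have h3 : (N.d x y / 2) ^ (-N.ν) = 2 ^ N.ν * N.d x y ^ (-N.ν) := by
        rw [Real.div_rpow hd (by norm_num), Real.rpow_neg (by norm_num : (0:ℝ) ≤ 2), div_inv_eq_mul,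
          mul_comm]
      rw [h3]
      refine mul_le_mul_of_nonneg_left ?_ (by positivity)
      calc N.d x y ^ (-N.ν) = N.A ^ 2 / dens N.A ^ 2 *
            (dens N.A ^ 2 / N.A ^ 2 * N.d x y ^ (-N.ν)) := by field_simp
        _ ≤ _ := by gcongr
    have he : Real.exp (-(n * κ)) ≤ Real.exp (8 * δ) * Real.exp (-(κ * (N.d x y / (8 * L)))) := by
      rw [← Real.exp_add, Real.exp_le_exp]
      have h5 : κ * (N.d x y / (8 * L)) ≤ κ * (n + 5 / 4) :=
        mul_le_mul_of_nonneg_left (by linarith only [hn2]) hκ0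
      linarith only [h5, hκ6, hδ]
    calc M.tau a x y ≤ 2 * N.A ^ 2 * (N.A * N.A ^ N.α *
          (N.A ^ 2 * (N.A * (N.d x y / 2) ^ (-N.ν))) * Real.exp (-(n * κ))) := h1
      _ ≤ 2 * N.A ^ 2 * (N.A * N.A ^ N.α *
          (N.A ^ 2 * (N.A * (2 ^ N.ν * (N.A ^ 2 / dens N.A ^ 2 * M.tau 0 x y)))) *
          (Real.exp (8 * δ) * Real.exp (-(κ * (N.d x y / (8 * L)))))) := by gcongr
      _ = B₀ * (Real.exp (8 * δ) * Real.exp (-(κ * (N.d x y / (8 * L)))) * M.tau 0 x y) := by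
          rw [hB₀]; ring
      _ ≤ (B₀ + 1) * (Real.exp (8 * δ) * Real.exp (-(κ * (N.d x y / (8 * L)))) *
          M.tau 0 x y) := by gcongr; linarith
      _ = _ := by ring

/-- The bound on the truncated two-point function for a general logarithmic correction `D`. -/
lemma exists_tau_le (hL : Linked M N) (D : ℝ → ℝ → ℝ) (hD : ∀ a d, 1 ≤ D a d)
    (h : ∀ L₁ : ℝ, 1 ≤ L₁ → ∃ K : ℝ, 1 ≤ K ∧ ∀ a d : ℝ, 0 ≤ d →
      (1 ≤ |a| → 1 + 2 * hsum N.ν ⌊d / (2 * N.A)⌋₊ ≤ K * D a d) ∧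
      (a ≠ 0 → |a| ≤ 1 → N.lgc (L₁ * |a| ^ (-(2 / N.ν))) ≤ K * D a d ∧
        N.A * hsum N.ν ⌊|a| ^ (2 / N.ν) * d⌋₊ ≤ K * D a d)) :
    ∃ c > (0:ℝ), ∃ C > (0:ℝ), ∀ (a : ℝ) (x y : M.V),
      M.tau a x y ≤ C * M.tau 0 x y *
        Real.exp (-(c * |a| ^ (2 / N.ν) * N.d x y / D a (N.d x y))) := by
  obtain ⟨δ, B, L₁, hδ, hB, hL₁, hsmall⟩ := exists_tau_le_exp hL
  obtain ⟨K, hK, hKD⟩ := h L₁ hL₁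
  have hA := N.A_pos
  have hν := N.one_le_ν
  have hν0 : 0 < N.ν := by linarith
  have hP0 : 0 < L₁ ^ N.ν := Real.rpow_pos_of_pos (by linarith) _
  set K' := K + L₁ ^ N.ν with hK'
  have hK'0 : 0 < K' := by linarith
  set c := min (1 / (8 * N.A ^ 2 * K)) (δ / K') with hc
  have hc0 : 0 < c := by
    rw [hc]; exact lt_min (by positivity) (by positivity)
  refine ⟨c, hc0, B + 1, by linarith, fun a x y => ?_⟩
  have hτ := tau_nonneg (M := M) 0 x y
  have hd := N.d_nonneg x y
  have hDp : 0 < D a (N.d x y) := zero_lt_one.trans_le (hD _ _)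
  have weaken : ∀ E F : ℝ, F ≤ E → M.tau a x y ≤ B * M.tau 0 x y * Real.exp (-E) →
      M.tau a x y ≤ (B + 1) * M.tau 0 x y * Real.exp (-F) := fun E F hEF h1 => by
    refine h1.trans ?_
    have : 0 ≤ B * M.tau 0 x y := by positivity
    calc B * M.tau 0 x y * Real.exp (-E) ≤ B * M.tau 0 x y * Real.exp (-F) := by gcongr
      _ ≤ _ := by gcongr; linarith
  by_cases hxy : x = y
  · subst hxy
    rw [N.d_self, mul_zero, zero_div, neg_zero, Real.exp_zero, mul_one]
    have h1 := half_le_tau_self hL x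
    have h2 : M.tau a x x ≤ 1 := by
      have := M.Pprob
      exact measureReal_le_one (μ := M.P)
    nlinarith
  by_cases ha : a = 0
  · subst ha
    rw [abs_zero, Real.zero_rpow (by positivity), mul_zero, zero_mul, zero_div, neg_zero,
      Real.exp_zero, mul_one]
    nlinarith
  have ha0 : 0 < |a| := abs_pos.2 ha
  obtain ⟨h1, h2⟩ := hKD a (N.d x y) hd
  rcases le_total 1 |a| with ha1 | ha1
  · refine weaken (a ^ 2 * N.d x y /
      (8 * N.A ^ 2 * (1 + 2 * hsum N.ν ⌊N.d x y / (2 * N.A)⌋₊))) _ ?_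
      ((tau_le_exp_chain hL a hxy).trans ?_)
    · have h3 := h1 ha1
      have hs := hsum_nonneg N.ν ⌊N.d x y / (2 * N.A)⌋₊
      have h4 : |a| ^ (2 / N.ν) ≤ a ^ 2 := by
        rw [← sq_abs, ← Real.rpow_two]
        refine Real.rpow_le_rpow_of_exponent_le ha1 ?_
        rw [div_le_iff₀ hν0]; linarith
      calc c * |a| ^ (2 / N.ν) * N.d x y / D a (N.d x y) ≤
            1 / (8 * N.A ^ 2 * K) * a ^ 2 * N.d x y / D a (N.d x y) := by
            gcongr; exact min_le_left _ _
        _ = a ^ 2 * N.d x y / (8 * N.A ^ 2 * (K * D a (N.d x y))) := by field_simp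
        _ ≤ _ := by gcongr
    · refine mul_le_mul_of_nonneg_right ?_ (Real.exp_nonneg _)
      exact le_mul_of_one_le_left hτ hB
  · obtain ⟨h3, h4⟩ := h2 ha ha1
    have hKK : K * D a (N.d x y) ≤ K' * D a (N.d x y) := by gcongr; linarith
    refine weaken _ _ ?_ (hsmall a (K' * D a (N.d x y)) x y hxy ha ha1 (h3.trans hKK) ?_
      (h4.trans hKK))
    · have hq : 0 ≤ |a| ^ (2 / N.ν) := Real.rpow_nonneg ha0.le _
      calc c * |a| ^ (2 / N.ν) * N.d x y / D a (N.d x y) ≤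
            δ / K' * |a| ^ (2 / N.ν) * N.d x y / D a (N.d x y) := by
            gcongr; exact min_le_right _ _
        _ = δ * (|a| ^ (2 / N.ν) * N.d x y) / (K' * D a (N.d x y)) := by field_simp
        _ ≤ _ := le_rfl
    · have : L₁ ^ N.ν * 1 ≤ K' * D a (N.d x y) := by
        refine mul_le_mul (by linarith) (hD _ _) zero_le_one hK'0.le
      linarith

lemma log_floor_le {t u : ℝ} (htu : t ≤ u) (hu : 0 ≤ u) :
    Real.log (⌊t⌋₊ : ℝ) ≤ max (Real.log u) 1 := by
  rcases Nat.eq_zero_or_pos ⌊t⌋₊ with h | h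
  · rw [h, Nat.cast_zero, Real.log_zero]
    exact le_max_of_le_right zero_le_one
  · refine le_max_of_le_left (Real.log_le_log (by exact_mod_cast h) ?_)
    have := Nat.floor_le (show 0 ≤ t from by
      by_contra h'
      rw [Nat.floor_of_nonpos (by linarith)] at h
      exact absurd h (lt_irrefl 0))
    linarith

lemma exists_tau_le_of_nu_eq_one (hL : Linked M N) (h1 : N.ν = 1) (hα : 2 * N.ν ≠ N.α) :
    ∃ c > (0:ℝ), ∃ C > (0:ℝ), ∀ (a : ℝ) (x y : M.V),
      M.tau a x y ≤ C * M.tau 0 x y *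
        Real.exp (-(c * a ^ 2 * N.d x y / max (Real.log (a ^ 2 * N.d x y)) 1)) := by
  have hA := N.A_pos
  have hA1 := N.one_le_A
  have hq : ∀ a : ℝ, |a| ^ (2 / N.ν) = a ^ 2 := fun a => by
    rw [h1, div_one, Real.rpow_two, sq_abs]
  have h := exists_tau_le hL (fun a d => max (Real.log (a ^ 2 * d)) 1)
    (fun _ _ => le_max_right _ _) fun L₁ _ => ⟨5 + 2 * N.A, by linarith, fun a d hd => by
      have hm : 1 ≤ max (Real.log (a ^ 2 * d)) 1 := le_max_right _ _
      set m := max (Real.log (a ^ 2 * d)) 1 with hmdef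
      refine ⟨fun ha => ?_, fun _ _ => ⟨?_, ?_⟩⟩
      · have h2 := hsum_le_log N.one_le_ν ⌊d / (2 * N.A)⌋₊
        have h3 : Real.log (⌊d / (2 * N.A)⌋₊ : ℝ) ≤ m := by
          refine log_floor_le ?_ (by positivity)
          have : 1 ≤ a ^ 2 := by rw [← sq_abs]; nlinarith
          rw [div_le_iff₀ (by positivity)]
          nlinarith [mul_nonneg (mul_nonneg (sq_nonneg a) hd) hA.le, mul_le_mul_of_nonneg_right this hd]
        nlinarith
      · rw [Net.lgc, if_neg hα]
        nlinarith
      · rw [hq]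
        have h2 := hsum_le_log N.one_le_ν ⌊a ^ 2 * d⌋₊
        have h3 : Real.log (⌊a ^ 2 * d⌋₊ : ℝ) ≤ m := log_floor_le le_rfl (by positivity)
        nlinarith⟩
  simpa only [hq] using h

lemma exists_tau_le_of_one_lt_nu (hL : Linked M N) (h1 : 1 < N.ν) (hα : 2 * N.ν ≠ N.α) :
    ∃ c > (0:ℝ), ∃ C > (0:ℝ), ∀ (a : ℝ) (x y : M.V),
      M.tau a x y ≤ C * M.tau 0 x y * Real.exp (-(c * |a| ^ (2 / N.ν) * N.d x y)) := by
  have hA := N.A_pos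
  have hA1 := N.one_le_A
  obtain ⟨Z, hZ, hZs⟩ := exists_hsum_le h1
  have h := exists_tau_le hL (fun _ _ => 1) (fun _ _ => le_rfl) fun L₁ _ =>
    ⟨1 + 2 * Z + N.A * Z, by nlinarith, fun a d hd => by
      refine ⟨fun ha => ?_, fun _ _ => ⟨?_, ?_⟩⟩
      · have := hZs ⌊d / (2 * N.A)⌋₊
        nlinarith
      · rw [Net.lgc, if_neg hα]
        nlinarith
      · have := mul_le_mul_of_nonneg_left (hZs ⌊|a| ^ (2 / N.ν) * d⌋₊) hA.le
        linarith⟩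
  simpa only [div_one] using h

lemma exists_tau_le_of_nu_eq_half (hL : Linked M N) (h1 : 1 < N.ν) (hα : 2 * N.ν = N.α) :
    ∃ c > (0:ℝ), ∃ C > (0:ℝ), ∀ (a : ℝ) (x y : M.V),
      M.tau a x y ≤ C * M.tau 0 x y *
        Real.exp (-(c * |a| ^ (2 / N.ν) * N.d x y / max (Real.log |a|⁻¹) 1)) := by
  have hA := N.A_pos
  have hA1 := N.one_le_A
  obtain ⟨Z, hZ, hZs⟩ := exists_hsum_le h1
  refine exists_tau_le hL (fun a _ => max (Real.log |a|⁻¹) 1) (fun _ _ => le_max_right _ _)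
    fun L₁ hL₁ => ?_
  have hlog := Real.log_nonneg hL₁
  have hAZ : 0 ≤ N.A * Z := by positivity
  refine ⟨3 + 2 * Z + N.A * Z + Real.log L₁, by nlinarith, fun a d hd => ?_⟩
  have hm : 1 ≤ max (Real.log |a|⁻¹) 1 := le_max_right _ _
  have hm2 : Real.log |a|⁻¹ ≤ max (Real.log |a|⁻¹) 1 := le_max_left _ _
  set m := max (Real.log |a|⁻¹) 1
  refine ⟨fun ha => ?_, fun ha0 ha1 => ⟨?_, ?_⟩⟩
  · have := hZs ⌊d / (2 * N.A)⌋₊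
    nlinarith
  · have ha : 0 < |a| := abs_pos.2 ha0
    have hl : 0 ≤ Real.log |a|⁻¹ := Real.log_nonneg ((one_le_inv₀ ha).2 ha1)
    have h2 : 2 / N.ν ≤ 2 := by rw [div_le_iff₀ (by linarith)]; linarith
    rw [Net.lgc, if_pos hα, Real.log_mul (by linarith) (Real.rpow_pos_of_pos ha _).ne',
      Real.log_rpow ha, neg_mul, ← mul_neg, ← Real.log_inv]
    nlinarith
  · have := mul_le_mul_of_nonneg_left (hZs ⌊|a| ^ (2 / N.ν) * d⌋₊) hA.le
    nlinarith

end Perc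

/-- **Theorem 1.2 (upper bound on the truncated two-point function).** -/
theorem truncated_two_point_upper_bound (M : Model)
    (hS : M.toWGraph.Standing) (hν1 : 1 ≤ M.ν) (hνα : M.ν ≤ M.α / 2) :
    ∃ c > (0:ℝ), ∃ C > (0:ℝ), ∀ (a : ℝ) (x y : M.V),
      (M.ν = 1 →
        M.tau a x y ≤ C * M.tau 0 x y *
          Real.exp (-(c * a ^ 2 * M.d x y / max (Real.log (a ^ 2 * M.d x y)) 1))) ∧
      (1 < M.ν → M.ν < M.α / 2 →
        M.tau a x y ≤ C * M.tau 0 x y * Real.exp (-(c * |a| ^ (2 / M.ν) * M.d x y))) ∧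
      (M.ν = M.α / 2 →
        M.tau a x y ≤ C * M.tau 0 x y *
          Real.exp (-(c * |a| ^ (2 / M.ν) * M.d x y / max (Real.log |a|⁻¹) 1))) := by
  rcases isEmpty_or_nonempty M.V with hV | ⟨⟨o⟩⟩
  · exact ⟨1, one_pos, 1, one_pos, fun _ x => hV.elim x⟩
  obtain ⟨N, hw, hg, hd, hα, hν⟩ := Perc.exists_net M hS hν1 hνα
  have hL : Perc.Linked M N := ⟨hw, hg⟩
  have hgap := Perc.Net.nu_add_two_le (N := N) o
  simp only [← hd, ← hα, ← hν] at hν1 hνα ⊢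
  rcases hν1.eq_or_lt with h1 | h1
  · obtain ⟨c, hc, C, hC, h⟩ := Perc.exists_tau_le_of_nu_eq_one hL h1.symm (by intro h2; linarith)
    refine ⟨c, hc, C, hC, fun a x y => ⟨fun _ => h a x y, fun h2 => ?_, fun h2 => ?_⟩⟩ <;> linarith
  by_cases h2 : 2 * N.ν = N.α
  · obtain ⟨c, hc, C, hC, h⟩ := Perc.exists_tau_le_of_nu_eq_half hL h1 h2
    refine ⟨c, hc, C, hC, fun a x y => ⟨fun h3 => ?_, fun _ h3 => ?_, fun _ => h a x y⟩⟩ <;> linarith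
  · obtain ⟨c, hc, C, hC, h⟩ := Perc.exists_tau_le_of_one_lt_nu hL h1 h2
    refine ⟨c, hc, C, hC, fun a x y => ⟨fun h3 => ?_, fun _ _ => h a x y, fun h3 => ?_⟩⟩
    · linarith
    · exact absurd (by linarith) h2
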